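/- For every ε > 0 there is a constant K(ε) with the following property. Let F be a normalized holomorphic Hecke eigenform of even weight k ≥ 12 for SL(2, ℤ) with normalized Hecke eigenvalues λ. Let M₁, M₂, X, Z ≥ 1, let f be a nonzero integer and σ ∈ {+1, −1}. Let (α_m), (β_n) be complex sequences with |α_m|, |β_n| ≤ 1, where α_m = 0 unless m is squarefree. Let g : ℝ → ℂ be smooth, supported in [X, 2X], with |g^{(ν)}| ≤ K_ν (X/Z)^{−ν} for all ν ∈ ℕ₀, and suppose there is a real Ξ with X/(100Z) ≤ Ξ ≤ 100(X + |f|) such that g(x) = 0 unless σx + f ∈ [Ξ, 2Ξ]. Then | Σ_{M₁ ≤ m ≤ M₂} Σ_{n ∈ ℕ} α_m β_n g(mn) λ(σmn + f) | ≤ K(ε) (kX|f|)^{ε} k^{10} Z^{5} (1 + |f|/X)^{5} ( M₁^{−1/2} X + M₂^{3/8} X^{7/8} ). -/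

import Mathlib

set_option linter.all false

/-- Normalized Hecke eigenvalues: `λ(n) = a(n) n^{−(k−1)/2}` for `n ≥ 1`, `λ(m) = 0` for
`m ≤ 0`. -/
noncomputable def heckeLambda (k : ℕ) (a : ℕ → ℂ) (m : ℤ) : ℂ :=
  if 0 < m then a m.toNat * ((m.toNat : ℝ) ^ (-(((k : ℝ) - 1) / 2)) : ℝ) else 0

/-- `a : ℕ → ℂ` is the sequence of Fourier coefficients of a normalized holomorphic Hecke
eigenform of even weight `k ≥ 12` for `SL(2, ℤ)`. -/
def IsNormalizedHeckeEigenform (k : ℕ) (a : ℕ → ℂ) : Prop :=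
  Even k ∧ 12 ≤ k ∧
  (∃ F : CuspForm (CongruenceSubgroup.Gamma 1) k, F ≠ 0 ∧
    ∀ z : UpperHalfPlane, F z = ∑' n : ℕ,
      a (n + 1) * Complex.exp (2 * Real.pi * Complex.I * (n + 1) * (z : ℂ))) ∧
  a 1 = 1 ∧
  ∀ m n : ℕ, 1 ≤ m → 1 ≤ n →
    a m * a n = ∑ d ∈ (Nat.gcd m n).divisors, (d : ℂ) ^ (k - 1) * a (m * n / d ^ 2)

open Polynomial in
theorem st_hd {K : Type*} [Field K] (f : K[X]) (hf : f ≠ 0) (m : ℕ) (hm : f.natDegree ≤ m)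
    (e a : ℕ) (h : a ≤ e) :
    ∃ U : K[X], hasseDeriv a (f ^ e) = f ^ (e - a) * U ∧ U.natDegree ≤ a * m := by
  have key : ∀ e a : ℕ, f ^ (e - a) ∣ hasseDeriv a (f ^ e) := by
    intro e
    induction e with
    | zero => intro a; simp
    | succ e ih =>
      intro a
      rw [pow_succ', hasseDeriv_mul]
      refine Finset.dvd_sum fun ij hij => ?_
      rw [Finset.HasAntidiagonal.mem_antidiagonal] at hij
      rcases Nat.eq_zero_or_pos ij.1 with h0 | h0
      · rw [h0, hasseDeriv_zero']
        refine dvd_trans (pow_dvd_pow f (?_ : e + 1 - a ≤ (e - ij.2) + 1)) ?_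
        · omega
        · rw [pow_succ']; exact mul_dvd_mul_left _ (ih _)
      · exact Dvd.dvd.mul_left (dvd_trans (pow_dvd_pow f (by omega)) (ih ij.2)) _
  obtain ⟨U, hU⟩ := key e a
  refine ⟨U, hU, ?_⟩
  rcases eq_or_ne U 0 with rfl | hU0
  · simp
  have h1 : (f ^ (e - a) * U).natDegree ≤ e * f.natDegree := by
    rw [← hU]; refine (natDegree_hasseDeriv_le _ _).trans ((Nat.sub_le _ _).trans ?_)
    rw [natDegree_pow]
  rw [natDegree_mul (pow_ne_zero _ hf) hU0, natDegree_pow] at h1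
  obtain ⟨b, rfl⟩ := Nat.exists_eq_add_of_le h
  simp only [Nat.add_sub_cancel_left] at h1
  nlinarith

open Polynomial in
theorem st_sq {K : Type*} [Field K] (f : K[X]) (hsq : Squarefree f) (hu : ¬ IsUnit f) (c : K)
    (hc : c ≠ 0) : ∀ N : ℕ, ∀ r s : K[X], r.natDegree < N → r ^ 2 * f = C c * s ^ 2 →
      r = 0 := by
  intro N
  have hf0 : f ≠ 0 := hsq.ne_zero
  have hfd : 0 < f.natDegree := by
    rw [Nat.pos_iff_ne_zero]; intro h
    rw [natDegree_eq_zero] at h; obtain ⟨x, rfl⟩ := h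
    exact hu (isUnit_C.2 (isUnit_iff_ne_zero.2 (by rintro rfl; simp at hf0)))
  induction N with
  | zero => intro r s h; omega
  | succ N ih =>
    intro r s hr h
    by_contra hr0
    have h1 : f ∣ s := by
      have : f ∣ C c⁻¹ * (C c * s ^ 2) := by rw [← h]; exact ⟨C c⁻¹ * r ^ 2, by ring⟩
      rw [← mul_assoc, ← C_mul, inv_mul_cancel₀ hc, C_1, one_mul] at this
      exact hsq.isRadical 2 s this
    obtain ⟨s1, rfl⟩ := h1
    have h2 : r ^ 2 = f * (C c * s1 ^ 2) := by
      apply mul_right_cancel₀ hf0; rw [h]; ring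
    have h3 : f ∣ r := hsq.isRadical 2 r ⟨_, h2⟩
    obtain ⟨r1, rfl⟩ := h3
    have hr1 : r1 ≠ 0 := by rintro rfl; simp at hr0
    rw [natDegree_mul hf0 hr1] at hr
    refine hr1 (ih r1 s1 (by omega) ?_)
    apply mul_left_cancel₀ hf0
    rw [← h2]; ring

open Polynomial in
/-- one-sided Stepanov bound -/
theorem stepanov {K : Type*} [Field K] [Fintype K] [DecidableEq K] (f : K[X]) (m c l J d : ℕ) (a : K)
    (hm : f.natDegree ≤ m) (hsq : Squarefree f) (hu : ¬ IsUnit f) (hf0 : f.eval 0 ≠ 0)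
    (hq : Fintype.card K = 2 * c + 1) (hl : l ≤ Fintype.card K) (hd : 2 * d + m ≤ Fintype.card K)
    (hd1 : 1 ≤ d)
    (hdim : l * (d + l * m + J) < 2 * (J * d)) :
    l * (Finset.univ.filter fun x : K => (f.eval x) ^ c = a).card ≤
      l * m + d + c * m + J * Fintype.card K := by
  classical
  set q := Fintype.card K with hqd
  have hfn : f ≠ 0 := hsq.ne_zero
  choose! U hU hUd using fun e a => st_hd f hfn m hm e a
  let L : ℕ → ℕ → K[X] →ₗ[K] K[X] := fun e i => ∑ ab ∈ Finset.HasAntidiagonal.antidiagonal i,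
    (LinearMap.mulLeft K (f ^ ab.2 * U e ab.1)).comp (hasseDeriv ab.2)
  have hL : ∀ e i r, i ≤ e → hasseDeriv i (f ^ e * r) = f ^ (e - i) * L e i r := by
    intro e i r hi
    rw [hasseDeriv_mul]
    simp only [L, LinearMap.sum_apply, LinearMap.comp_apply, LinearMap.mulLeft_apply, Finset.mul_sum]
    refine Finset.sum_congr rfl fun ab hab => ?_
    rw [Finset.HasAntidiagonal.mem_antidiagonal] at hab
    rw [hU e ab.1 (by omega), show e - ab.1 = (e - i) + ab.2 by omega, pow_add]; ring
  have hLd : ∀ e i r, i ≤ e → i ≤ l → r.natDegree < d → (L e i r).natDegree < d + l * m := by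
    intro e i r hi hil hr
    have : (L e i r).natDegree ≤ (d - 1) + l * m := by
      simp only [L, LinearMap.sum_apply, LinearMap.comp_apply, LinearMap.mulLeft_apply]
      refine natDegree_sum_le_of_forall_le _ _ fun ab hab => ?_
      rw [Finset.HasAntidiagonal.mem_antidiagonal] at hab
      refine natDegree_mul_le.trans ?_
      have h1 : (f ^ ab.2 * U e ab.1).natDegree ≤ l * m := by
        refine natDegree_mul_le.trans ?_
        rw [natDegree_pow]
        have := hUd e ab.1 (by omega)
        have h2 : ab.2 * f.natDegree ≤ ab.2 * m := Nat.mul_le_mul_left _ hm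
        have h3 : (ab.1 + ab.2) * m ≤ l * m := Nat.mul_le_mul_right _ (by omega)
        nlinarith only [this, h2, h3]
      have h2 := natDegree_hasseDeriv_le r ab.2
      omega
    omega
  -- linear algebra
  let V := (Fin J → degreeLT K d) × (Fin J → degreeLT K d)
  let σ : ℕ → V →ₗ[K] K[X] := fun i => ∑ j : Fin J,
    (LinearMap.mulLeft K (X ^ (j : ℕ))).comp
      ((L l i).comp ((degreeLT K d).subtype.comp ((LinearMap.proj j).comp (LinearMap.fst K _ _)))
        + a • (L (l + c) i).comp
          ((degreeLT K d).subtype.comp ((LinearMap.proj j).comp (LinearMap.snd K _ _))))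
  have hσ : ∀ i v, σ i v = ∑ j : Fin J, X ^ (j : ℕ) * (L l i (v.1 j) + a • L (l + c) i (v.2 j)) := by
    intro i v; simp [σ, LinearMap.sum_apply]; rfl
  have hdeg : ∀ r : degreeLT K d, (r : K[X]).natDegree < d := by
    intro r
    have := mem_degreeLT.1 r.2
    rcases eq_or_ne (r : K[X]) 0 with h | h
    · rw [h]; simp; omega
    · exact (natDegree_lt_iff_degree_lt h).2 this
  let Φ : V →ₗ[K] (Fin l → Fin (d + l * m + J) → K) :=
    LinearMap.pi fun i => LinearMap.pi fun t => (lcoeff K (t : ℕ)).comp (σ i)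
  have hker : LinearMap.ker Φ ≠ ⊥ := by
    apply LinearMap.ker_ne_bot_of_finrank_lt
    have hfr : Module.finrank K (degreeLT K d) = d := by
      rw [(degreeLTEquiv K d).finrank_eq]; simp
    have : Module.Finite K (degreeLT K d) := Module.Finite.equiv (degreeLTEquiv K d).symm
    have e : Module.finrank K V = J * d + J * d := by
      change Module.finrank K ((Fin J → degreeLT K d) × (Fin J → degreeLT K d)) = _
      rw [Module.finrank_prod, Module.finrank_pi_fintype]; simp [hfr]
    rw [e]
    simp only [Module.finrank_pi_fintype, Finset.sum_const,
      Finset.card_univ, Fintype.card_fin, smul_eq_mul, Module.finrank_self, mul_one]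
    omega
  obtain ⟨v, hv, hv0⟩ := (Submodule.ne_bot_iff _).1 hker
  have hσ0 : ∀ i, i < l → σ i v = 0 := by
    intro i hi
    have hn : (σ i v).natDegree < d + l * m + J := by
      rw [hσ]
      rcases Nat.eq_zero_or_pos J with hJ | hJ
      · subst hJ; simp at hdim
      have : (∑ j : Fin J, X ^ (j : ℕ) * (L l i (v.1 j) + a • L (l + c) i (v.2 j))).natDegree
          ≤ (J - 1) + (d + l * m - 1) := by
        refine natDegree_sum_le_of_forall_le _ _ fun j _ => ?_
        refine natDegree_mul_le.trans ?_
        rw [natDegree_X_pow]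
        refine add_le_add (by omega) ?_
        refine (natDegree_add_le _ _).trans (max_le ?_ ?_)
        · have := hLd l i _ (by omega) (by omega) (hdeg (v.1 j)); omega
        · refine (natDegree_smul_le _ _).trans ?_
          have := hLd (l + c) i _ (by omega) (by omega) (hdeg (v.2 j)); omega
      omega
    ext t
    by_cases ht : t < d + l * m + J
    · have := congrFun (congrFun (LinearMap.mem_ker.1 hv) ⟨i, hi⟩) ⟨t, ht⟩
      simpa [Φ] using this
    · rw [coeff_eq_zero_of_natDegree_lt (by omega)]; simp
  let h : K[X] := ∑ j : Fin J, (f ^ l * (v.1 j : K[X]) + f ^ (l + c) * (v.2 j : K[X])) * X ^ ((j : ℕ) * q)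
  have hqpos : 0 < q := Fintype.card_pos
  -- nonvanishing
  have hne : h ≠ 0 := by
    intro h0
    have hex : ∃ j : Fin J, ¬ (v.1 j = 0 ∧ v.2 j = 0) := by
      by_contra hcon
      push Not at hcon
      exact hv0 (Prod.ext (funext fun j => (hcon j).1) (funext fun j => (hcon j).2))
    obtain ⟨j0, hj0, hmin⟩ : ∃ j : Fin J, ¬ (v.1 j = 0 ∧ v.2 j = 0) ∧
        ∀ i < j, (v.1 i = 0 ∧ v.2 i = 0) := by
      obtain ⟨j, hj⟩ := WellFounded.has_min (wellFounded_lt (α := Fin J))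
        {j : Fin J | ¬ (v.1 j = 0 ∧ v.2 j = 0)} hex
      exact ⟨j, hj.1, fun i hi => by_contra fun h => hj.2 i h hi⟩
    set r : K[X] := (v.1 j0).1
    set s : K[X] := (v.2 j0).1
    have hd1' : X ^ q ∣ r + s * f ^ c := by
      have h1 : X ^ (((j0 : ℕ) + 1) * q) ∣
          (f ^ l * r + f ^ (l + c) * s) * X ^ ((j0 : ℕ) * q) := by
        have : (f ^ l * r + f ^ (l + c) * s) * X ^ ((j0 : ℕ) * q) = - ∑ j ∈ Finset.univ.erase j0,
            (f ^ l * (v.1 j : K[X]) + f ^ (l + c) * (v.2 j : K[X])) * X ^ ((j : ℕ) * q) := by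
          rw [eq_neg_iff_add_eq_zero]
          rw [← h0]; exact Finset.add_sum_erase _ (fun j : Fin J => (f ^ l * (v.1 j : K[X]) + f ^ (l + c) * (v.2 j : K[X])) * X ^ ((j : ℕ) * q)) (Finset.mem_univ j0)
        rw [this, dvd_neg]
        refine Finset.dvd_sum fun j hj => ?_
        rcases lt_trichotomy j j0 with hlt | heq | hgt
        · rw [(hmin j hlt).1, (hmin j hlt).2]; simp
        · simp [heq] at hj
        · exact Dvd.dvd.mul_left (pow_dvd_pow _ (Nat.mul_le_mul_right _ hgt)) _
      rw [add_mul, one_mul, pow_add, mul_comm (X ^ ((j0 : ℕ) * q)),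
        mul_dvd_mul_iff_right (pow_ne_zero _ X_ne_zero)] at h1
      have h2 : X ^ q ∣ f ^ l * (r + s * f ^ c) := by
        convert h1 using 1; rw [pow_add]; ring
      have hcop : IsCoprime (X ^ q : K[X]) (f ^ l) := by
        apply IsCoprime.pow
        rw [(irreducible_X).coprime_iff_not_dvd, X_dvd_iff, coeff_zero_eq_eval_zero]
        exact hf0
      exact hcop.dvd_of_dvd_mul_left h2
    have hd2 : X ^ q ∣ r ^ 2 * f - C (f.eval 0) * s ^ 2 := by
      have e1 : X ^ q ∣ r ^ 2 * f - s ^ 2 * f ^ q := by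
        have : r ^ 2 * f - s ^ 2 * f ^ q = (r + s * f ^ c) * ((r - s * f ^ c) * f) := by
          rw [hq]; ring
        rw [this]; exact Dvd.dvd.mul_right hd1' _
      have e2 : X ^ q ∣ f ^ q - C (f.eval 0) := by
        have : X ∣ f - C (f.eval 0) := by
          rw [X_dvd_iff]; simp [coeff_zero_eq_eval_zero]
        obtain ⟨w, hw⟩ := this
        have h3 := congrArg (expand K q) hw
        rw [map_sub, map_mul, expand_X, expand_C] at h3
        rw [← FiniteField.expand_card f, h3]; exact Dvd.intro _ rfl
      have : r ^ 2 * f - C (f.eval 0) * s ^ 2 = (r ^ 2 * f - s ^ 2 * f ^ q) +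
          s ^ 2 * (f ^ q - C (f.eval 0)) := by ring
      rw [this]; exact dvd_add e1 (Dvd.dvd.mul_left e2 _)
    have hz : r ^ 2 * f - C (f.eval 0) * s ^ 2 = 0 := by
      apply eq_zero_of_dvd_of_natDegree_lt hd2
      rw [natDegree_X_pow]
      have hr : r.natDegree < d := hdeg (v.1 j0)
      have hs : s.natDegree < d := hdeg (v.2 j0)
      have : (r ^ 2 * f - C (f.eval 0) * s ^ 2).natDegree ≤ 2 * (d - 1) + m := by
        refine (natDegree_sub_le _ _).trans (max_le ?_ ?_)
        · refine natDegree_mul_le.trans (add_le_add ?_ hm)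
          rw [natDegree_pow]; exact Nat.mul_le_mul_left _ (by omega)
        · refine (natDegree_C_mul_le _ _).trans ?_
          rw [natDegree_pow]; have : s.natDegree ≤ d - 1 := by omega
          omega
      omega
    have hr0 : r = 0 := st_sq f hsq hu _ hf0 _ r s (Nat.lt_succ_self _) (sub_eq_zero.1 hz)
    have hs0 : s = 0 := by
      rw [hr0] at hz
      simpa [hf0] using hz
    exact hj0 ⟨Subtype.ext hr0, Subtype.ext hs0⟩
  -- degree
  have hdegh : h.natDegree ≤ l * m + d + c * m + J * q := by
    refine natDegree_sum_le_of_forall_le _ _ fun j _ => ?_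
    refine natDegree_mul_le.trans (add_le_add ?_ ?_)
    · have h1 := hdeg (v.1 j)
      have h2 := hdeg (v.2 j)
      have h3 : l * f.natDegree ≤ l * m := Nat.mul_le_mul_left _ hm
      have h4 : c * f.natDegree ≤ c * m := Nat.mul_le_mul_left _ hm
      refine (natDegree_add_le _ _).trans (max_le ?_ ?_)
      · refine natDegree_mul_le.trans ?_
        rw [natDegree_pow]; omega
      · refine natDegree_mul_le.trans ?_
        rw [natDegree_pow, add_mul]; omega
    · rw [natDegree_X_pow]; exact Nat.mul_le_mul_right _ (by omega)
  -- vanishing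
  have hroot : ∀ x : K, (f.eval x) ^ c = a → (X - C x) ^ l ∣ h := by
    intro x hx
    have hc0 : ∀ i < l, (taylor x h).coeff i = 0 := by
      intro i hi
      have hterm : ∀ (P : K[X]) (j : ℕ), (taylor x (P * X ^ (j * q))).coeff i =
          x ^ j * (hasseDeriv i P).eval x := by
        intro P j
        have e1 : taylor x (X ^ (j * q) : K[X]) = (X ^ q + C x) ^ j := by
          rw [taylor_X_pow, mul_comm j q, pow_mul]
          congr 1
          obtain ⟨p, hp⟩ := CharP.exists K
          obtain ⟨n, hpp, hn⟩ := FiniteField.card K p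
          have := Fact.mk hpp
          rw [hqd, hn, add_pow_char_pow, ← C_pow, ← hn, FiniteField.pow_card]
        obtain ⟨w, hw⟩ : ∃ w, (X ^ q + C x) ^ j = C (x ^ j) + X ^ q * w := by
          have : X ^ q ∣ (X ^ q + C x) ^ j - C x ^ j := by
            refine dvd_trans ?_ (sub_dvd_pow_sub_pow _ _ j); simp
          obtain ⟨w, hw⟩ := this
          exact ⟨w, by rw [← hw, C_pow]; ring⟩
        rw [taylor_mul, e1, hw, mul_add, coeff_add, coeff_mul_C, taylor_coeff]
        rw [show taylor x P * (X ^ q * w) = X ^ q * (taylor x P * w) by ring, coeff_X_pow_mul',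
          if_neg (by omega)]
        ring
      have : (taylor x h).coeff i = (f.eval x) ^ (l - i) * (σ i v).eval x := by
        simp only [h, map_sum, finsetSum_coeff, hterm]
        rw [hσ, eval_finsetSum, Finset.mul_sum]
        refine Finset.sum_congr rfl fun j _ => ?_
        rw [map_add, hL l i _ (by omega), hL (l + c) i _ (by omega)]
        simp only [eval_add, eval_mul, eval_pow, eval_X, eval_smul, smul_eq_mul]
        rw [show l + c - i = (l - i) + c by omega, pow_add, hx]; ring
      rw [this, hσ0 i hi]; simp
    have h1 : X ^ l ∣ taylor x h := X_pow_dvd_iff.2 hc0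
    obtain ⟨w, hw⟩ := h1
    refine ⟨taylor (-x) w, ?_⟩
    have := congrArg (taylor (-x)) hw
    rw [taylor_taylor, neg_add_cancel, taylor_zero, taylor_mul, taylor_X_pow] at this
    rw [this]; simp [sub_eq_add_neg]
  have hprod : (∏ x ∈ Finset.univ.filter (fun x : K => (f.eval x) ^ c = a), (X - C x) ^ l) ∣ h := by
    refine Finset.prod_dvd_of_coprime ?_ fun x hx => hroot x (Finset.mem_filter.1 hx).2
    intro x _ y _ hxy
    exact (pairwise_coprime_X_sub_C (Function.injective_id) hxy).pow
  have := natDegree_le_of_dvd hprod hne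
  rw [Finset.prod_pow, natDegree_pow, natDegree_prod_of_monic _ _ (fun x _ => monic_X_sub_C x)] at this
  simp only [natDegree_X_sub_C, Finset.sum_const, smul_eq_mul, mul_one] at this
  exact this.trans hdegh

theorem kl_quad {K L : Type*} [Field K] [Field L] [Fintype K] [Fintype L]
    [DecidableEq K] [DecidableEq L] [Algebra K L] (h2 : Module.finrank K L = 2) (χ : AddChar K ℂ) (hχ : χ ≠ 0) :
    ∑ x : Lˣ, χ (Algebra.trace K L ((x : L) + (x : L)⁻¹)) =
      2 * (Fintype.card K : ℂ) - (∑ x : Kˣ, χ ((x : K) + (x : K)⁻¹)) ^ 2 := by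
  classical
  set q := Fintype.card K with hq
  have hi : Function.Injective (algebraMap K L) := (algebraMap K L).injective
  have htr : ∀ x : L, algebraMap K L (Algebra.trace K L x) = x + x ^ q := by
    intro x; rw [FiniteField.algebraMap_trace_eq_sum_pow, h2]; simp [Finset.sum_range_succ, hq]
  have hnm : ∀ x : L, algebraMap K L (Algebra.norm K x) = x * x ^ q := by
    intro x; rw [FiniteField.algebraMap_norm_eq_prod_pow, h2]; simp [Finset.prod_range_succ, hq]
  let F : (Kˣ × Kˣ) ⊕ Lˣ → K × Kˣ := fun e => match e with
    | .inl xy => ((xy.1 : K) + xy.2, xy.1 * xy.2)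
    | .inr x => (Algebra.trace K L x, Units.map (Algebra.norm K) x)
  have hfib : ∀ b, (Finset.univ.filter fun e => F e = b).card ≤ 2 := by
    rintro ⟨s, π⟩
    have hL : ∀ x x' : Lˣ, F (.inr x) = (s, π) → F (.inr x') = (s, π) →
        (x' : L) = x ∨ (x' : L) = (x : L) ^ q := by
      intro x x' h h'
      have h1 := congrArg Prod.fst (h.trans h'.symm)
      have h3 := congrArg (fun z => ((Prod.snd z : Kˣ) : K)) (h.trans h'.symm)
      simp only [F, Units.coe_map] at h1 h3
      have h1 := (congrArg (algebraMap K L) h1); rw [htr, htr] at h1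
      have h3 := (congrArg (algebraMap K L) h3); erw [hnm, hnm] at h3
      have : ((x' : L) - x) * ((x' : L) - (x : L) ^ q) = 0 := by
        linear_combination (-(x' : L)) * h1 + h3
      rcases mul_eq_zero.1 this with h | h
      · left; exact sub_eq_zero.1 h
      · right; exact sub_eq_zero.1 h
    have hK : ∀ x y x' y' : Kˣ, F (.inl (x, y)) = (s, π) → F (.inl (x', y')) = (s, π) →
        (x' = x ∧ y' = y) ∨ (x' = y ∧ y' = x) := by
      intro x y x' y' h h'
      have h1 := congrArg Prod.fst (h.trans h'.symm)
      have h3 := congrArg (fun z => ((Prod.snd z : Kˣ) : K)) (h.trans h'.symm)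
      simp only [F, Units.val_mul] at h1 h3
      have : ((x' : K) - x) * ((x' : K) - y) = 0 := by
        linear_combination (-(x' : K)) * h1 + h3
      rcases mul_eq_zero.1 this with h | h
      · left; have h := sub_eq_zero.1 h
        exact ⟨Units.ext h, Units.ext (by linear_combination -h1 - h)⟩
      · right; have h := sub_eq_zero.1 h
        exact ⟨Units.ext h, Units.ext (by linear_combination -h1 - h)⟩
    have hKL : ∀ x y : Kˣ, ∀ z : Lˣ, F (.inl (x, y)) = (s, π) → F (.inr z) = (s, π) →
        x = y ∧ (z : L) = algebraMap K L x := by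
      intro x y z h h'
      have h1' := congrArg Prod.fst (h.trans h'.symm)
      have h3 := congrArg (fun z => ((Prod.snd z : Kˣ) : K)) (h.trans h'.symm)
      simp only [F, Units.val_mul, Units.coe_map] at h1' h3
      have h1 := (congrArg (algebraMap K L) h1'); rw [htr, map_add] at h1
      have h3 := (congrArg (algebraMap K L) h3); erw [hnm] at h3; rw [map_mul] at h3
      have : ((z : L) - algebraMap K L x) * ((z : L) - algebraMap K L y) = 0 := by
        linear_combination (-(z : L)) * h1 + h3
      have key : ∀ w : K, (z : L) = algebraMap K L w → (x : K) + y = 2 * w := by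
        intro w hw; rw [h1', hw, Algebra.trace_algebraMap, h2]; simp
      rcases mul_eq_zero.1 this with h | h
      · have h := sub_eq_zero.1 h
        have := key _ h
        exact ⟨Units.ext (by linear_combination -this), h⟩
      · have h := sub_eq_zero.1 h
        have := key _ h
        have hxy : (x : K) = y := by linear_combination this
        exact ⟨Units.ext hxy, by rw [h, hxy]⟩
    by_cases hex : ∃ x y : Kˣ, F (.inl (x, y)) = (s, π)
    · obtain ⟨x, y, hxy⟩ := hex
      by_cases hne : x = y
      · subst hne
        refine (Finset.card_le_card (t := {.inl (x, x), .inr (Units.map (algebraMap K L).toMonoidHom x)})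
          ?_).trans Finset.card_le_two
        intro e he
        have he := (Finset.mem_filter.1 he).2
        rcases e with ⟨a, b⟩ | z
        · have := hK _ _ _ _ hxy he; simp_all
        · have := hKL _ _ _ hxy he
          simp only [Finset.mem_insert, reduceCtorEq, Finset.mem_singleton, Sum.inr.injEq, false_or]
          exact Units.ext this.2
      · refine (Finset.card_le_card (t := {.inl (x, y), .inl (y, x)})
          ?_).trans Finset.card_le_two
        intro e he
        have he := (Finset.mem_filter.1 he).2
        rcases e with ⟨a, b⟩ | z
        · have := hK _ _ _ _ hxy he
          simpa using this
        · exact absurd (hKL _ _ _ hxy he).1 hne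
    · by_cases hex2 : ∃ z, F (.inr z) = (s, π)
      · obtain ⟨z, hz⟩ := hex2
        refine (Finset.card_le_card (t := {.inr z, .inr (z ^ q)}) ?_).trans Finset.card_le_two
        intro e he
        have he := (Finset.mem_filter.1 he).2
        rcases e with ⟨a, b⟩ | z'
        · exact absurd ⟨a, b, he⟩ hex
        · have := hL _ _ hz he
          simpa [Units.ext_iff] using this
      · rw [Finset.filter_false_of_mem]; · simp
        rintro (⟨a, b⟩ | z) _ he
        · exact hex ⟨a, b, he⟩
        · exact hex2 ⟨z, he⟩
  have hcardL : Fintype.card L = q ^ 2 := by rw [Module.card_eq_pow_finrank (K := K), h2]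
  have hq1 : 1 ≤ q := Fintype.card_pos
  have hcard : ∑ b : K × Kˣ, (Finset.univ.filter fun e => F e = b).card = ∑ b : K × Kˣ, 2 := by
    rw [← Finset.card_eq_sum_card_fiberwise (fun _ _ => Finset.mem_coe.2 (Finset.mem_univ _))]
    simp only [Finset.card_univ, Fintype.card_sum, Fintype.card_prod, Fintype.card_units, hcardL,
      Finset.sum_const, smul_eq_mul, ← hq]
    obtain ⟨t, ht⟩ := Nat.exists_eq_add_of_le hq1
    rw [ht]; simp only [Nat.add_sub_cancel_left]
    have : (1 + t) ^ 2 - 1 = t ^ 2 + 2 * t := by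
      rw [Nat.sub_eq_iff_eq_add (by nlinarith)]; ring
    rw [this]; ring
  have heq := (Finset.sum_eq_sum_iff_of_le (fun b _ => hfib b)).1 hcard
  let G : K × Kˣ → ℂ := fun b => χ (b.1 * (1 + (b.2 : K)⁻¹))
  have hsum : ∑ e, G (F e) = 2 * ∑ b, G b := by
    rw [← Finset.sum_fiberwise_of_maps_to (g := F) (t := Finset.univ) (fun _ _ => Finset.mem_univ _), Finset.mul_sum]
    refine Finset.sum_congr rfl fun b hb => ?_
    rw [Finset.sum_congr rfl (fun e he => by rw [(Finset.mem_filter.1 he).2]), Finset.sum_const, heq b hb]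
    simp
  have hG : ∑ b, G b = q := by
    rw [Fintype.sum_prod_type_right]
    have : ∀ y : Kˣ, ∑ x : K, G (x, y) = if y = -1 then (q : ℂ) else 0 := by
      intro y
      have := AddChar.sum_mulShift (ψ := χ) (1 + (y : K)⁻¹) (AddChar.IsPrimitive.of_ne_one hχ)
      simp only [G]
      rw [this]
      have hiff : (1 + (y : K)⁻¹ = 0) ↔ y = -1 := by
        rw [Units.ext_iff]; simp only [Units.val_neg, Units.val_one]
        have := y.ne_zero
        constructor
        · intro h; field_simp at h; linear_combination h
        · intro h; rw [h]; simp [inv_neg]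
      simp [hiff, hq]
    simp [this]
  rw [hG, Fintype.sum_sum_type, Fintype.sum_prod_type] at hsum
  have e1 : ∑ x : Lˣ, G (F (.inr x)) = ∑ x : Lˣ, χ (Algebra.trace K L ((x : L) + (x : L)⁻¹)) := by
    refine Finset.sum_congr rfl fun x _ => ?_
    simp only [G, F, Units.coe_map]
    congr 1
    apply hi
    have hx := x.ne_zero
    have e := hnm x
    rw [map_add (Algebra.trace K L), map_mul, map_add, htr, map_add, htr, htr, map_one, inv_pow, map_inv₀]
    erw [hnm]
    field_simp
    try ring
  have e2 : ∑ x : Kˣ, ∑ y : Kˣ, G (F (.inl (x, y))) = (∑ x : Kˣ, χ ((x : K) + (x : K)⁻¹)) ^ 2 := by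
    rw [sq, Finset.sum_mul_sum]
    refine Finset.sum_congr rfl fun x _ => Finset.sum_congr rfl fun y _ => ?_
    simp only [G, F, ← AddChar.map_add_eq_mul, Units.val_mul]
    congr 1
    have := x.ne_zero; have := y.ne_zero
    field_simp; ring
  rw [e1, e2] at hsum
  linear_combination hsum

open Polynomial in
theorem kl_lower (p : ℕ) [Fact p.Prime] (hp : p ≠ 2) {K : Type*} [Field K] [Fintype K] [DecidableEq K]
    [Algebra (ZMod p) K] (l : ℕ) (hq : Fintype.card K = l ^ 2) (hl : 100 * p ≤ l) :
    (l : ℤ) ^ 2 - l * (10 * p + 10) ≤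
      p * (Finset.univ.filter fun x : Kˣ => Algebra.trace (ZMod p) K ((x : K) + (x : K)⁻¹) = 0).card := by
  have hpp : p.Prime := Fact.out
  have hp2 := hpp.two_le
  have hchar : CharP K p := charP_of_injective_algebraMap (algebraMap (ZMod p) K).injective p
  have h2 : (2 : K) ≠ 0 := by
    intro h
    have : p ∣ 2 := (CharP.cast_eq_zero_iff K p 2).1 (by exact_mod_cast h)
    exact hp ((Nat.prime_dvd_prime_iff_eq hpp Nat.prime_two).1 this)
  have hrc : ringChar K ≠ 2 := by rw [ringChar.eq K p]; exact hp
  obtain ⟨c, hc⟩ : Odd (Fintype.card K) :=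
    Nat.odd_iff.2 (FiniteField.odd_card_of_char_ne_two hrc)
  have hlo : Odd l := by
    have : Odd (l ^ 2) := hq ▸ ⟨c, hc⟩
    exact (Nat.odd_pow_iff two_ne_zero).1 this
  set f : K[X] := (X ^ p - X) ^ 2 - C 4 with hf
  have hdeg : f.natDegree = 2 * p := by
    have h1 : (X ^ p - X : K[X]).natDegree = p := FiniteField.X_pow_card_sub_X_natDegree_eq K hpp.one_lt
    rw [hf, natDegree_sub_C, natDegree_pow, h1]
  have hev : ∀ y, f.eval y = (y ^ p - y) ^ 2 - 4 := by intro y; simp [hf]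
  have h4 : (4 : K) ≠ 0 := by rw [show (4 : K) = 2 * 2 by norm_num]; exact mul_ne_zero h2 h2
  have hsep : f.Separable := by
    rw [separable_def']
    refine ⟨C (-4⁻¹), C (-8⁻¹) * (X ^ p - X), ?_⟩
    have : derivative f = - C 2 * (X ^ p - X) := by
      simp [hf, derivative_pow, CharP.cast_eq_zero]
    rw [this]
    have h8 : (8 : K) ≠ 0 := by rw [show (8 : K) = 2 * 4 by norm_num]; exact mul_ne_zero h2 h4
    have e1 : (C (-4⁻¹ : K) * C 4 : K[X]) = -1 := by rw [← C_mul]; simp [h4]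
    have e2 : (C (-8⁻¹ : K) * C 2 : K[X]) = C (-4⁻¹) := by
      rw [← C_mul]; congr 1; field_simp; norm_num
    linear_combination (-e1 + (- (X ^ p - X) ^ 2) * e2)
  have hu : ¬ IsUnit f := by
    intro h; have := natDegree_eq_zero_of_isUnit h; rw [hdeg] at this; omega
  obtain ⟨b, hb⟩ := hlo
  have hle : 100 * p * l ≤ l ^ 2 := by rw [pow_two]; exact Nat.mul_le_mul_right l hl
  have hpl : p * 1 ≤ p * l := Nat.mul_le_mul_left p (by omega)
  have hpc : p ≤ c := by nlinarith only [hle, hq, hc, hpl, hp2]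
  obtain ⟨d, hd⟩ : ∃ d, 2 * d + 2 * p + 1 = l ^ 2 := by
    refine ⟨c - p, ?_⟩
    omega
  have hst := stepanov f (2 * p) c l (b + 4 * p + 3) d (-1) hdeg.le hsep.squarefree hu
    (by rw [hev]; simp [hpp.ne_zero, h4]) hc (by rw [hq]; nlinarith only [hle, hpl, hp2, hl, hb, hd]) (by omega) (by nlinarith only [hle, hpl, hp2, hl, hb, hd])
    (by
      have h1 : (l : ℤ) ≥ 100 * p := by exact_mod_cast hl
      have h3 : (2 * d + 2 * p + 1 : ℤ) = l ^ 2 := by exact_mod_cast hd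
      have h4 : (l : ℤ) = 2 * b + 1 := by exact_mod_cast hb
      have h5 : (2 : ℤ) ≤ p := by exact_mod_cast hp2
      zify
      have e1 : (d : ℤ) = (l ^ 2 - 2 * p - 1) / 2 := by omega
      have : (l : ℤ) * (2 * d + 2 * (l * (2 * p)) + (2 * b + 8 * p + 6)) < (2 * b + 8 * p + 6) * (2 * d) := by
        have e1 : (2 * d : ℤ) = l ^ 2 - 2 * p - 1 := by omega
        rw [e1, show (2 * b + 8 * p + 6 : ℤ) = l + 8 * p + 5 by omega]
        nlinarith only [h1, h5, mul_nonneg (sub_nonneg.2 h1) (sub_nonneg.2 h1), mul_nonneg (sub_nonneg.2 h1) (sub_nonneg.2 h5)]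
      linarith)
  set Nm := (Finset.univ.filter fun x : K => f.eval x ^ c = -1)
  set Np := (Finset.univ.filter fun x : K => f.eval x ^ c = 1)
  set N0 := (Finset.univ.filter fun x : K => f.eval x = 0)
  have hf0 : f ≠ 0 := hsep.ne_zero
  have hN0 : N0.card ≤ 2 * p := by
    rw [← hdeg]
    refine le_trans (Finset.card_le_card (t := f.roots.toFinset) ?_) (f.roots.toFinset_card_le.trans f.card_roots')
    intro x hx; simp [N0] at hx; simp [hf0, hx]
  have hc2 : Fintype.card K / 2 = c := by omega
  have hall : Fintype.card K ≤ Nm.card + Np.card + N0.card := by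
    rw [← Finset.card_univ]
    refine (Finset.card_le_card (t := Nm ∪ Np ∪ N0) ?_).trans
      ((Finset.card_union_le _ _).trans (Nat.add_le_add_right (Finset.card_union_le _ _) _))
    intro x _
    by_cases h : f.eval x = 0
    · simp [N0, h]
    · rcases FiniteField.pow_dichotomy hrc h with h | h
      · simp [Np, ← hc2, h]
      · simp [Nm, ← hc2, h]
  -- pairs
  set T := (Finset.univ.filter fun x : Kˣ => Algebra.trace (ZMod p) K ((x : K) + (x : K)⁻¹) = 0)
  set Pr := (Finset.univ.filter fun yx : K × Kˣ => ((yx.2 : K) + (yx.2 : K)⁻¹) = yx.1 ^ p - yx.1)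
  have hPT : Pr.card ≤ p * T.card := by
    refine Finset.card_le_mul_card_image_of_maps_to (f := Prod.snd) ?_ p ?_
    · rintro ⟨y, x⟩ h
      simp only [Pr, Finset.mem_filter, Finset.mem_univ, true_and] at h
      show x ∈ T
      simp only [T, Finset.mem_filter, Finset.mem_univ, true_and]
      rw [h, map_sub]
      have := Algebra.trace_eq_of_algEquiv (FiniteField.frobeniusAlgEquivOfAlgebraic (ZMod p) K) y
      simp only [FiniteField.coe_frobeniusAlgEquivOfAlgebraic, ZMod.card] at this
      rw [this, sub_self]
    · intro x _
      have hne : (X ^ p - X - C ((x : K) + (x : K)⁻¹) : K[X]).natDegree = p := by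
        rw [natDegree_sub_C]; exact FiniteField.X_pow_card_sub_X_natDegree_eq K hpp.one_lt
      have hne0 : (X ^ p - X - C ((x : K) + (x : K)⁻¹) : K[X]) ≠ 0 := by
        intro h; rw [h] at hne; simp at hne; omega
      conv_rhs => rw [← hne]
      refine le_trans ?_ ((Multiset.toFinset_card_le _).trans (card_roots' _))
      refine Finset.card_le_card_of_injOn Prod.fst ?_ ?_
      · rintro ⟨y, x'⟩ h
        simp only [Pr, Finset.coe_filter, Finset.mem_filter, Finset.mem_univ, true_and, Set.mem_ofPred_eq] at h
        obtain ⟨h, rfl⟩ := h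
        rw [Finset.mem_coe, Multiset.mem_toFinset, mem_roots hne0]
        simp [h]
      · rintro ⟨y, x'⟩ h ⟨y2, x2⟩ h2 hy
        simp only [Finset.coe_filter, Finset.mem_filter, Set.mem_ofPred_eq] at h h2
        exact Prod.ext hy (h.2.trans h2.2.symm)
  have hNP : 2 * Np.card ≤ Pr.card := by
    rw [mul_comm]
    have hmaps : ∀ y ∈ Np, 2 ≤ (Pr.filter fun yx => yx.1 = y).card := by
      intro y hy
      simp only [Np, Finset.mem_filter, Finset.mem_univ, true_and] at hy
      have hn : f.eval y ≠ 0 := by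
        intro h; rw [h] at hy
        have : c ≠ 0 := by omega
        simp [this] at hy
      obtain ⟨r, hr⟩ := (FiniteField.isSquare_iff hrc hn).2 (hc2 ▸ hy)
      rw [hev] at hr
      have hr0 : r ≠ 0 := by
        rintro rfl; rw [hev] at hn; exact hn (by rw [hr]; ring)
      set u := y ^ p - y with hu
      have hprod : ((u + r) / 2) * ((u - r) / 2) = 1 := by
        field_simp; linear_combination hr
      let x1 : Kˣ := ⟨(u + r) / 2, (u - r) / 2, hprod, by rw [mul_comm]; exact hprod⟩
      have hx1i : ((x1 : K))⁻¹ = (u - r) / 2 := inv_eq_of_mul_eq_one_right hprod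
      have hx2i : (((x1⁻¹ : Kˣ) : K))⁻¹ = (u + r) / 2 := inv_eq_of_mul_eq_one_left hprod
      have hsum : (u + r) / 2 + (u - r) / 2 = u := by field_simp; ring
      refine le_trans ?_ (Finset.card_le_card (s := {(y, x1), (y, x1⁻¹)}) ?_)
      · rw [Finset.card_pair]
        intro h
        have := congrArg (fun z => ((Prod.snd z : Kˣ) : K)) h
        have h3 : (u + r) / 2 = (u - r) / 2 := this
        field_simp at h3
        apply hr0
        have : 2 * r = 0 := by linear_combination h3
        exact (mul_eq_zero.1 this).resolve_left h2
      · intro e he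
        simp only [Finset.mem_insert, Finset.mem_singleton] at he
        rcases he with rfl | rfl
        · simp only [Pr, Finset.mem_filter, Finset.mem_univ, true_and, and_true]
          rw [hx1i]; exact hsum
        · simp only [Pr, Finset.mem_filter, Finset.mem_univ, true_and, and_true]
          rw [hx2i]; show (u - r) / 2 + _ = _; rw [add_comm]; exact hsum
    refine (Finset.card_nsmul_le_sum _ _ _ hmaps).trans ?_
    rw [← Finset.card_biUnion]
    · exact Finset.card_le_card (Finset.biUnion_subset.2 fun _ _ => Finset.filter_subset _ _)
    · intro a _ b _ hab
      simp only [Function.onFun]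
      rw [Finset.disjoint_filter]; intro e _ h1 h2; exact hab (h1.symm.trans h2)
  -- conclude
  have hfin : (l : ℤ) * (2 * Nm.card) ≤ l * (4 * p + l + 2 * l * p + (l + 8 * p + 5) * l) := by
    have h1 : (l * Nm.card : ℤ) ≤ l * (2 * p) + d + c * (2 * p) + (b + 4 * p + 3) * (l ^ 2) := by
      rw [hq] at hst; exact_mod_cast hst
    have h3 : (2 * d + 2 * p + 1 : ℤ) = l ^ 2 := by exact_mod_cast hd
    have h4 : (l : ℤ) = 2 * b + 1 := by exact_mod_cast hb
    have h5 : (l ^ 2 : ℤ) = 2 * c + 1 := by rw [hq] at hc; exact_mod_cast hc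
    have e1 : (2 * d : ℤ) = l ^ 2 - 2 * p - 1 := by omega
    have e2 : (2 * b : ℤ) = l - 1 := by omega
    have e3 : (2 * c : ℤ) = l ^ 2 - 1 := by omega
    calc (l : ℤ) * (2 * Nm.card) = 2 * (l * Nm.card) := by ring
      _ ≤ 2 * (l * (2 * p) + d + c * (2 * p) + (b + 4 * p + 3) * (l ^ 2)) := by linarith
      _ = 4 * p * l + 2 * d + (2 * c) * (2 * p) + (2 * b + 8 * p + 6) * l ^ 2 := by ring
      _ ≤ _ := by rw [e1, e2, e3]; nlinarith only [Int.natCast_nonneg p]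
  have hl0 : (0 : ℤ) < l := by exact_mod_cast (by omega : 0 < l)
  have hfin' := le_of_mul_le_mul_left hfin hl0
  have hallz : (l : ℤ) ^ 2 ≤ Nm.card + Np.card + N0.card := by rw [hq] at hall; exact_mod_cast hall
  have hN0z : (N0.card : ℤ) ≤ 2 * p := by exact_mod_cast hN0
  have hA : (2 * Np.card : ℤ) ≤ p * T.card := by exact_mod_cast hNP.trans hPT
  have hlz : (100 * p : ℤ) ≤ l := by exact_mod_cast hl
  have hpz : (2 : ℤ) ≤ p := by exact_mod_cast hp2
  have hpl' : (2 : ℤ) * l ≤ p * l := mul_le_mul_of_nonneg_right hpz hl0.le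
  nlinarith only [hfin', hallz, hN0z, hA, hlz, hpz, hpl']

/-- sequence of Kloosterman sums in the tower -/
noncomputable def klS (p : ℕ) (s : ℝ) : ℕ → ℝ
  | 0 => s
  | n + 1 => 2 * (p : ℝ) ^ (2 ^ n) - klS p s n ^ 2

open Classical in
theorem kl_real {K : Type*} [Field K] [Fintype K] [Fintype Kˣ] (χ : AddChar K ℂ) :
    ∑ x : Kˣ, χ ((x : K) + (x : K)⁻¹) = ((∑ x : Kˣ, χ ((x : K) + (x : K)⁻¹)).re : ℂ) := by
  symm
  rw [← Complex.conj_eq_iff_re, map_sum]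
  refine Fintype.sum_equiv (Equiv.neg _) _ _ fun x => ?_
  rw [← AddChar.map_neg_eq_conj]
  congr 1
  simp only [Equiv.neg_apply, Units.val_neg, inv_neg]; ring

open Classical in
theorem kl_tower (p : ℕ) [Fact p.Prime] (n : ℕ) :
    ∃ (K : Type) (_ : Field K) (_ : Fintype K) (_ : Algebra (ZMod p) K), Fintype.card K = p ^ (2 ^ n) ∧
      ∀ χ : AddChar (ZMod p) ℂ, χ ≠ 0 →
        ∑ x : Kˣ, χ (Algebra.trace (ZMod p) K ((x : K) + (x : K)⁻¹)) =
          (klS p (∑ x : (ZMod p)ˣ, χ ((x : ZMod p) + (x : ZMod p)⁻¹)).re n : ℂ) := by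
  induction n with
  | zero =>
    refine ⟨ZMod p, inferInstance, inferInstance, inferInstance, by simp [ZMod.card], fun χ _ => ?_⟩
    rw [klS, ← kl_real]
    refine Finset.sum_congr (by ext; simp) fun x _ => ?_
    have : ∀ y : ZMod p, Algebra.trace (ZMod p) (ZMod p) y = y := fun y => by
      rw [Algebra.trace_self_apply]
    rw [this]
  | succ n ih =>
    obtain ⟨K, i1, i2, i3, hc, hS⟩ := ih
    have : CharP K p := charP_of_injective_algebraMap (algebraMap (ZMod p) K).injective p
    have hf : Fintype (FiniteField.Extension K p 2) := Fintype.ofFinite _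
    refine ⟨FiniteField.Extension K p 2, inferInstance, hf, inferInstance, ?_, fun χ hχ => ?_⟩
    · have := FiniteField.natCard_extension K p 2
      rw [Nat.card_eq_fintype_card, Nat.card_eq_fintype_card, hc] at this
      rw [this, ← pow_mul, pow_succ]
    · set χ' : AddChar K ℂ := χ.compAddMonoidHom (Algebra.trace (ZMod p) K).toAddMonoidHom with hχ'
      have hne : χ' ≠ 0 := by
        obtain ⟨b, hb⟩ := (AddChar.ne_zero_iff).1 hχ
        obtain ⟨x, hx⟩ := Algebra.trace_surjective (ZMod p) K b
        rw [AddChar.ne_zero_iff]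
        exact ⟨x, by simpa [hχ', hx] using hb⟩
      have hq := kl_quad (L := FiniteField.Extension K p 2) (FiniteField.finrank_extension K p 2) χ' hne
      have e1 : ∀ x : K, χ' x = χ (Algebra.trace (ZMod p) K x) := fun x => rfl
      simp only [e1] at hq
      rw [hS χ hχ, hc] at hq
      rw [klS]
      push_cast at hq ⊢
      rw [← hq]
      refine Finset.sum_congr rfl fun x _ => ?_
      rw [Algebra.trace_trace]

theorem kl_T_grow (t : ℕ → ℝ) (h : ∀ n, t (n + 1) = 2 - t n ^ 2) (h0 : 2 < |t 0|) (C : ℝ) (n0 : ℕ) :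
    ∃ n ≥ n0, t n < -C := by
  have h1 : t 1 < -2 := by
    rw [h 0]; have := sq_abs (t 0); nlinarith
  obtain ⟨η, hη, hη1⟩ : ∃ η > 0, t 1 = -(2 + η) := ⟨-2 - t 1, by linarith, by ring⟩
  have h2 : ∀ n, t (n + 1) ≤ -(2 + (n + 1) * η) := by
    intro n
    induction n with
    | zero => rw [hη1]; simp
    | succ n ih => rw [h (n + 1)]; push_cast; nlinarith [mul_nonneg (Nat.cast_nonneg (α := ℝ) n) hη.le]
  obtain ⟨N, hN⟩ := exists_nat_gt (C / η)
  refine ⟨N + n0 + 1, by omega, ?_⟩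
  have := h2 (N + n0)
  rw [div_lt_iff₀ hη] at hN
  push_cast at this
  nlinarith [mul_nonneg (Nat.cast_nonneg (α := ℝ) n0) hη.le]

open Classical in
theorem weil_prime (p : ℕ) [Fact p.Prime] (hp : p ≠ 2) (ψ : AddChar (ZMod p) ℂ) (hψ : ψ ≠ 0) :
    ‖∑ x : (ZMod p)ˣ, ψ ((x : ZMod p) + (x : ZMod p)⁻¹)‖ ≤ 2 * Real.sqrt p := by
  set s : AddChar (ZMod p) ℂ → ℝ := fun χ => (∑ x : (ZMod p)ˣ, χ ((x : ZMod p) + (x : ZMod p)⁻¹)).re with hs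
  have hpp : p.Prime := Fact.out
  have hp0 : (0 : ℝ) < p := by exact_mod_cast hpp.pos
  rw [kl_real, Complex.norm_real, Real.norm_eq_abs]
  by_contra! hcon
  have hsq : ∀ n, Real.sqrt p ^ (2 ^ (n + 1)) = (p : ℝ) ^ (2 ^ n) := by
    intro n; rw [pow_succ', pow_mul, Real.sq_sqrt hp0.le]
  have hs0 : 0 < Real.sqrt p := Real.sqrt_pos.2 hp0
  obtain ⟨n, hn, hlt⟩ := kl_T_grow (fun n => klS p (s ψ) n / Real.sqrt p ^ (2 ^ n)) (by
      intro n
      simp only [klS]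
      rw [hsq, div_pow, ← pow_mul, ← pow_succ, hsq]
      have : (p : ℝ) ^ (2 ^ n) ≠ 0 := by positivity
      field_simp) (by
      simp only [klS, pow_zero, pow_one]
      rw [abs_div, abs_of_pos hs0, lt_div_iff₀ hs0]; exact hcon) (12 * p + 10) (p + 100)
  obtain ⟨n, rfl⟩ : ∃ m, n = m + 1 := ⟨n - 1, by omega⟩
  simp only [hsq] at hlt
  set l := p ^ (2 ^ n) with hl
  obtain ⟨K, i1, i2, i3, hc, hS⟩ := kl_tower p (n + 1)
  have hlow := kl_lower p hp (K := K) l (by rw [hc, hl, ← pow_mul, pow_succ]) (by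
    have h1 : n < 2 ^ n := Nat.lt_two_pow_self
    have h2 : 2 ^ n < p ^ (2 ^ n) :=
      lt_of_lt_of_le Nat.lt_two_pow_self (Nat.pow_le_pow_left hpp.two_le _)
    have h3 : 100 * p ≤ 2 ^ n := by
      obtain ⟨m, rfl⟩ : ∃ m, n = 7 + m := ⟨n - 7, by omega⟩
      have : m < 2 ^ m := Nat.lt_two_pow_self
      rw [pow_add]; omega
    rw [hl]; omega)
  set T := (Finset.univ.filter fun x : Kˣ => Algebra.trace (ZMod p) K ((x : K) + (x : K)⁻¹) = 0)
  have hsum : ∑ χ : AddChar (ZMod p) ℂ, ∑ x : Kˣ, χ (Algebra.trace (ZMod p) K ((x : K) + (x : K)⁻¹)) = (p * T.card : ℝ) := by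
    rw [Finset.sum_comm]
    simp only [AddChar.sum_apply_eq_ite, ZMod.card]
    rw [← Finset.sum_filter, Finset.sum_const]
    push_cast; rw [nsmul_eq_mul, mul_comm]
  have hre := congrArg Complex.re hsum
  rw [Complex.ofReal_re, Complex.re_sum, ← Finset.add_sum_erase _ _ (Finset.mem_univ 0),
    ← Finset.add_sum_erase _ _ (Finset.mem_erase.2 ⟨hψ, Finset.mem_univ ψ⟩), hS ψ hψ] at hre
  have h0 : (∑ x : Kˣ, (0 : AddChar (ZMod p) ℂ) (Algebra.trace (ZMod p) K ((x : K) + (x : K)⁻¹))).re ≤ (l : ℝ) ^ 2 := by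
    simp only [AddChar.zero_apply, Finset.sum_const, Finset.card_univ, Fintype.card_units, hc, nsmul_eq_mul, mul_one]
    rw [Complex.natCast_re, hl]
    calc ((p ^ 2 ^ (n + 1) - 1 : ℕ) : ℝ) ≤ ((p ^ 2 ^ (n + 1) : ℕ) : ℝ) := by
          exact_mod_cast Nat.sub_le _ _
      _ = _ := by push_cast; rw [← pow_mul, pow_succ]
  have hother : ∑ χ ∈ (Finset.univ.erase 0).erase ψ, (∑ x : Kˣ, χ (Algebra.trace (ZMod p) K ((x : K) + (x : K)⁻¹))).re
      ≤ ∑ χ ∈ (Finset.univ.erase (0 : AddChar (ZMod p) ℂ)).erase ψ, (2 * l : ℝ) := by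
    refine Finset.sum_le_sum fun χ hχ => ?_
    rw [hS χ (Finset.mem_erase.1 (Finset.mem_erase.1 hχ).2).1, Complex.ofReal_re, klS, hl]
    push_cast; nlinarith [sq_nonneg (klS p (s χ) n)]
  have hcardle : (((Finset.univ.erase (0 : AddChar (ZMod p) ℂ)).erase ψ).card : ℝ) ≤ p := by
    have : ((Finset.univ.erase (0 : AddChar (ZMod p) ℂ)).erase ψ).card ≤ p := by
      refine (Finset.card_le_univ _).trans ?_
      rw [AddChar.card_eq, ZMod.card]
    exact_mod_cast this
  rw [Finset.sum_const, nsmul_eq_mul] at hother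
  rw [Complex.ofReal_re] at hre
  have hlowR : (l : ℝ) ^ 2 - l * (10 * p + 10) ≤ p * T.card := by exact_mod_cast hlow
  have hlpos : (0 : ℝ) < l := by rw [hl]; push_cast; positivity
  rw [div_lt_iff₀ (by positivity)] at hlt
  have e : ((p : ℝ) ^ (2 ^ n)) = l := by rw [hl]; push_cast; rfl
  rw [e] at hlt
  change klS p (s ψ) (n + 1) < _ at hlt
  have : klS p (s ψ) (n + 1) = klS p (∑ x : (ZMod p)ˣ, ψ ((x : ZMod p) + (x : ZMod p)⁻¹)).re (n + 1) := rfl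
  rw [← this] at hre
  nlinarith

/-- restricted Kloosterman sum -/
noncomputable def Kl (d : ℕ) (h : ℤ) (c : ℕ) [NeZero c] : ℂ :=
  ∑ u : (ZMod c)ˣ, if (ZMod.cast (u : ZMod c) : ZMod d) = 1 then
    ZMod.stdAddChar ((h : ZMod c) * ((u : ZMod c) + ((u⁻¹ : (ZMod c)ˣ) : ZMod c))) else 0

theorem Kl_mul (d m n : ℕ) [NeZero m] [NeZero n] (hmn : m.Coprime n) (hd : d ∣ n) (h a b : ℤ)
    (hab : a * n + b * m = 1) : Kl d h (m * n) = Kl 1 (h * a) m * Kl d (h * b) n := by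
  unfold Kl
  rw [Finset.sum_mul_sum, ← Fintype.sum_prod_type']
  let e := (Units.mapEquiv (ZMod.chineseRemainder hmn).toMulEquiv).trans MulEquiv.prodUnits
  refine Fintype.sum_equiv e.toEquiv _ _ fun u => ?_
  obtain ⟨x, hx⟩ := ZMod.intCast_surjective (u : ZMod (m * n))
  obtain ⟨y, hy⟩ := ZMod.intCast_surjective ((u⁻¹ : (ZMod (m * n))ˣ) : ZMod (m * n))
  have f1 : ((e u).1 : ZMod m) = (x : ZMod m) := by
    show (ZMod.chineseRemainder hmn (u : ZMod (m * n))).1 = _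
    rw [← hx, map_intCast]; simp
  have f2 : ((e u).2 : ZMod n) = (x : ZMod n) := by
    show (ZMod.chineseRemainder hmn (u : ZMod (m * n))).2 = _
    rw [← hx, map_intCast]; simp
  have f3 : (((e u).1⁻¹ : (ZMod m)ˣ) : ZMod m) = (y : ZMod m) := by
    show (ZMod.chineseRemainder hmn ((u⁻¹ : (ZMod (m * n))ˣ) : ZMod (m * n))).1 = _
    rw [← hy, map_intCast]; simp
  have f4 : (((e u).2⁻¹ : (ZMod n)ˣ) : ZMod n) = (y : ZMod n) := by
    show (ZMod.chineseRemainder hmn ((u⁻¹ : (ZMod (m * n))ˣ) : ZMod (m * n))).2 = _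
    rw [← hy, map_intCast]; simp
  have hc1 : (ZMod.cast (u : ZMod (m * n)) : ZMod d) = x := by
    rw [← hx, ZMod.cast_intCast (hd.trans (dvd_mul_left n m))]
  have hc2 : (ZMod.cast ((e u).2 : ZMod n) : ZMod d) = x := by
    rw [f2, ZMod.cast_intCast hd]
  have hc3 : (ZMod.cast ((e u).1 : ZMod m) : ZMod 1) = 1 := Subsingleton.elim _ _
  show _ = (if (ZMod.cast ((e u).1 : ZMod m) : ZMod 1) = 1 then _ else _) * (if (ZMod.cast ((e u).2 : ZMod n) : ZMod d) = 1 then _ else _)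
  rw [hc1, hc2, if_pos hc3, mul_ite, mul_zero]
  refine if_congr Iff.rfl ?_ rfl
  show _ = ZMod.stdAddChar (((h * a : ℤ) : ZMod m) * (((e u).1 : ZMod m) + (((e u).1⁻¹ : (ZMod m)ˣ) : ZMod m))) *
    ZMod.stdAddChar (((h * b : ℤ) : ZMod n) * (((e u).2 : ZMod n) + (((e u).2⁻¹ : (ZMod n)ˣ) : ZMod n)))
  rw [f1, f2, f3, f4, ← hx, ← hy]
  simp only [← Int.cast_add, ← Int.cast_mul]
  rw [ZMod.stdAddChar_coe, ZMod.stdAddChar_coe, ZMod.stdAddChar_coe, ← Complex.exp_add]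
  congr 1
  have hm : (m : ℂ) ≠ 0 := NeZero.ne _
  have hn : (n : ℂ) ≠ 0 := NeZero.ne _
  have hab' : (a : ℂ) * n + b * m = 1 := by exact_mod_cast hab
  push_cast
  field_simp
  linear_combination (-(h * (x + y) : ℂ)) * hab'

theorem norm_stdAddChar {c : ℕ} [NeZero c] (x : ZMod c) : ‖ZMod.stdAddChar x‖ = 1 := by
  rw [ZMod.stdAddChar_apply]; exact Circle.norm_coe _

theorem Kl_triv (d : ℕ) (h : ℤ) (c : ℕ) [NeZero c] (hdc : d ∣ c) : ‖Kl d h c‖ ≤ (c : ℝ) / d := by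
  have hc0 : 0 < c := Nat.pos_of_ne_zero (NeZero.ne c)
  have hd0 : 0 < d := Nat.pos_of_dvd_of_pos hdc hc0
  obtain ⟨t, ht⟩ := hdc
  have h1 : ‖Kl d h c‖ ≤ ∑ u : (ZMod c)ˣ, if (ZMod.cast (u : ZMod c) : ZMod d) = 1 then (1 : ℝ) else 0 := by
    refine (norm_sum_le _ _).trans (Finset.sum_le_sum fun u _ => ?_)
    split_ifs
    · rw [norm_stdAddChar]
    · simp
  refine h1.trans ?_
  rw [Finset.sum_boole]
  have h2 : (Finset.univ.filter fun u : (ZMod c)ˣ => (ZMod.cast (u : ZMod c) : ZMod d) = 1).card ≤ (Finset.range t).card := by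
    refine Finset.card_le_card_of_injOn (fun u => (u : ZMod c).val / d) ?_ ?_
    · intro u _
      simp only [Finset.coe_range, Set.mem_Iio]
      rw [Nat.div_lt_iff_lt_mul hd0, mul_comm, ← ht]; exact ZMod.val_lt _
    · intro u hu v hv huv
      simp only [Finset.coe_filter, Finset.mem_univ, true_and, Set.mem_ofPred_eq] at hu hv
      rw [ZMod.cast_eq_val] at hu hv
      have hmod : (u : ZMod c).val % d = (v : ZMod c).val % d := (ZMod.natCast_eq_natCast_iff' _ _ _).1 (hu.trans hv.symm)
      simp only at huv
      have : (u : ZMod c).val = (v : ZMod c).val := by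
        rw [← Nat.div_add_mod (u : ZMod c).val d, ← Nat.div_add_mod (v : ZMod c).val d, hmod, huv]
      exact Units.ext (ZMod.val_injective c this)
  rw [Finset.card_range] at h2
  have hcr : (c : ℝ) = d * t := by exact_mod_cast ht
  have : (d : ℝ) ≠ 0 := by exact_mod_cast hd0.ne'
  rw [hcr, mul_div_cancel_left₀ _ this]; exact_mod_cast h2

theorem Kl_prime (h : ℤ) (p : ℕ) [Fact p.Prime] :
    ‖Kl 1 h p‖ ≤ 2 * Real.sqrt p * Real.sqrt (Int.gcd h p) := by
  have hpp : p.Prime := Fact.out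
  have hp1 : (1 : ℝ) ≤ p := by exact_mod_cast hpp.one_le
  have hg : 1 ≤ (Int.gcd h p : ℝ) := by
    have : 0 < Int.gcd h p := Int.gcd_pos_of_ne_zero_right _ (by exact_mod_cast hpp.ne_zero)
    exact_mod_cast this
  have htriv := Kl_triv 1 h p (one_dvd _)
  simp only [Nat.cast_one, div_one] at htriv
  by_cases hph : (p : ℤ) ∣ h
  · have : Int.gcd h p = p := by
      rw [Int.gcd_eq_right_iff_dvd (by positivity) |>.2 hph |> fun e => (by exact_mod_cast e : Int.gcd h p = p)]
    rw [this, mul_assoc, Real.mul_self_sqrt (by positivity)]; linarith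
  by_cases hp2 : p = 2
  · subst hp2
    refine htriv.trans ?_
    have : (2 : ℝ) = Real.sqrt 2 * Real.sqrt 2 := (Real.mul_self_sqrt (by norm_num)).symm
    have h1 : 1 ≤ Real.sqrt (Int.gcd h (2 : ℕ)) := Real.one_le_sqrt.2 hg
    have h2 : Real.sqrt 2 ≤ 2 := by rw [Real.sqrt_le_left] <;> norm_num
    push_cast at *
    nlinarith [Real.sqrt_nonneg 2]
  · have hh : (h : ZMod p) ≠ 0 := by rwa [Ne, ZMod.intCast_zmod_eq_zero_iff_dvd]
    have hψ : (ZMod.stdAddChar (N := p)).mulShift (h : ZMod p) ≠ 0 := by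
      have := (ZMod.isPrimitive_stdAddChar p) hh
      exact this
    have hw := weil_prime p hp2 _ hψ
    have e : Kl 1 h p = ∑ x : (ZMod p)ˣ, (ZMod.stdAddChar (N := p)).mulShift (h : ZMod p) ((x : ZMod p) + (x : ZMod p)⁻¹) := by
      unfold Kl
      refine Finset.sum_congr (by ext; simp) fun u _ => ?_
      rw [if_pos (Subsingleton.elim _ _), AddChar.mulShift_apply, Units.val_inv_eq_inv_val]
    rw [← e] at hw
    have h1 : 1 ≤ Real.sqrt (Int.gcd h p) := Real.one_le_sqrt.2 hg
    refine hw.trans ?_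
    nlinarith [Real.sqrt_nonneg p]

theorem Kl_bound (d c2 : ℕ) [NeZero c2] (hd : d ∣ c2) (c1 : ℕ) : ∀ [NeZero c1] (h : ℤ), Squarefree c1 → c1.Coprime c2 →
    ‖Kl d h (c1 * c2)‖ ≤ c1.divisors.card * Real.sqrt c1 * Real.sqrt (Int.gcd h c1) * (c2 / d) := by
  induction c1 using Nat.strong_induction_on with
  | _ c1 ih =>
    intro _ h hsq hcop
    rcases eq_or_ne c1 1 with rfl | h1
    · have e : Kl d h (1 * c2) = Kl d h c2 := by congr 1 <;> simp
      rw [e]; simpa using Kl_triv d h c2 hd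
    obtain ⟨p, hp, hpc⟩ := Nat.exists_prime_and_dvd h1
    obtain ⟨c, rfl⟩ := hpc
    have : NeZero c := ⟨by rintro rfl; simp at hsq⟩
    have hf : Fact p.Prime := ⟨hp⟩
    have hpc : p.Coprime c := Nat.coprime_of_squarefree_mul hsq
    have hsqc : Squarefree c := hsq.of_mul_right
    have hpc2 : p.Coprime c2 := hcop.coprime_dvd_left (dvd_mul_right _ _)
    have hcc2 : c.Coprime c2 := hcop.coprime_dvd_left (dvd_mul_left _ _)
    have hlt : c < p * c := by
      have := hp.two_le; have := Nat.pos_of_ne_zero (NeZero.ne c); nlinarith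
    have hcopn : p.Coprime (c * c2) := Nat.Coprime.mul_right hpc hpc2
    have hb : ∃ a b : ℤ, a * ((c * c2 : ℕ) : ℤ) + b * p = 1 := by
      have := Int.isCoprime_iff_gcd_eq_one.2 (by rw [Int.gcd_natCast_natCast]; exact hcopn.symm : Int.gcd ((c * c2 : ℕ) : ℤ) p = 1)
      obtain ⟨a, b, h⟩ := this; exact ⟨a, b, h⟩
    obtain ⟨a, b, hab⟩ := hb
    have e : Kl d h (p * c * c2) = Kl d h (p * (c * c2)) := by congr 1 <;> ring
    rw [e, Kl_mul d p (c * c2) hcopn (hd.trans (dvd_mul_left _ _)) h a b hab, norm_mul]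
    have hA := Kl_prime (h * a) p
    have hB := ih c hlt (h * b) hsqc hcc2
    have ga : Int.gcd (h * a) p = Int.gcd h p := by
      rw [mul_comm]; apply Int.gcd_mul_right_left_of_gcd_eq_one
      rw [← Int.isCoprime_iff_gcd_eq_one]
      exact ⟨((c * c2 : ℕ) : ℤ), b, by linarith⟩
    have gb : Int.gcd (h * b) c = Int.gcd h c := by
      rw [mul_comm]; apply Int.gcd_mul_right_left_of_gcd_eq_one
      rw [← Int.isCoprime_iff_gcd_eq_one]
      exact ⟨p, a * c2, by push_cast at hab; linarith⟩
    rw [ga] at hA; rw [gb] at hB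
    have gm : Int.gcd h (p * c : ℕ) = Int.gcd h p * Int.gcd h c := by
      rw [Int.gcd_def, Int.gcd_def, Int.gcd_def, Int.natAbs_natCast, Int.natAbs_natCast, Int.natAbs_natCast]
      exact hpc.gcd_mul _
    have dm : (p * c).divisors.card = 2 * c.divisors.card := by
      rw [hpc.card_divisors_mul, hp.divisors, Finset.card_pair hp.one_lt.ne]
    rw [gm, dm]
    push_cast
    rw [Real.sqrt_mul (by positivity), Real.sqrt_mul (by positivity)]
    calc _ ≤ (2 * Real.sqrt p * Real.sqrt (Int.gcd h p)) * (c.divisors.card * Real.sqrt c * Real.sqrt (Int.gcd h c) * (c2 / d)) :=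
        mul_le_mul hA hB (norm_nonneg _) (by positivity)
      _ = _ := by ring

theorem tau_bound (ε : ℝ) (hε : 0 < ε) : ∃ C : ℝ, 1 ≤ C ∧ ∀ n : ℕ, n ≠ 0 →
    (n.divisors.card : ℝ) ≤ C * (n : ℝ) ^ ε := by
  set D : ℝ := 1 + 1 / (ε * Real.log 2) with hD
  have hl2 : 0 < Real.log 2 := Real.log_pos (by norm_num)
  have hεl : 0 < ε * Real.log 2 := by positivity
  have hD1 : 1 ≤ D := by rw [hD]; have : 0 < 1 / (ε * Real.log 2) := by positivity
                         linarith
  obtain ⟨P, hP⟩ := exists_nat_gt ((2 : ℝ) ^ (1 / ε))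
  refine ⟨D ^ P, one_le_pow₀ hD1, fun n hn => ?_⟩
  have hsmall : ∀ p a : ℕ, 2 ≤ p → ((a : ℝ) + 1) ≤ (if p < P then D else 1) * ((p : ℝ) ^ a) ^ ε := by
    intro p a hp
    have hp' : (2 : ℝ) ≤ p := by exact_mod_cast hp
    rw [← Real.rpow_natCast, ← Real.rpow_mul (by positivity)]
    split_ifs with h
    · have h1 : (2 : ℝ) ^ ((a : ℝ) * ε) ≤ (p : ℝ) ^ ((a : ℝ) * ε) :=
        Real.rpow_le_rpow (by norm_num) hp' (by positivity)
      have h2 : Real.log 2 * (a * ε) + 1 ≤ (2 : ℝ) ^ ((a : ℝ) * ε) := by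
        rw [Real.rpow_def_of_pos (by norm_num)]; exact Real.add_one_le_exp _
      have h3 : (a : ℝ) = 1 / (ε * Real.log 2) * (Real.log 2 * (a * ε)) := by field_simp
      have ha : (0 : ℝ) ≤ a := Nat.cast_nonneg a
      have h4 : (a : ℝ) + 1 ≤ D * (Real.log 2 * (a * ε) + 1) := by
        have : 0 ≤ Real.log 2 * (a * ε) := by positivity
        have h5 : 0 < 1 / (ε * Real.log 2) := by positivity
        rw [hD]
        calc (a : ℝ) + 1 = 1 / (ε * Real.log 2) * (Real.log 2 * (a * ε)) + 1 := by rw [← h3]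
          _ ≤ _ := by nlinarith
      exact h4.trans (mul_le_mul_of_nonneg_left (h2.trans h1) (by linarith))
    · push Not at h
      have hp2 : (2 : ℝ) ^ (1 / ε) ≤ p := hP.le.trans (by exact_mod_cast h)
      have h1 : ((2 : ℝ) ^ (1 / ε)) ^ ((a : ℝ) * ε) ≤ (p : ℝ) ^ ((a : ℝ) * ε) :=
        Real.rpow_le_rpow (by positivity) hp2 (by positivity)
      rw [← Real.rpow_mul (by norm_num), show 1 / ε * (a * ε) = a by field_simp, Real.rpow_natCast] at h1
      have h2 : a + 1 ≤ 2 ^ a := Nat.lt_two_pow_self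
      have h3 : (a : ℝ) + 1 ≤ 2 ^ a := by exact_mod_cast h2
      linarith
  rw [Nat.card_divisors hn]
  push_cast
  have hn' : (n : ℝ) = ∏ p ∈ n.primeFactors, (p : ℝ) ^ n.factorization p := by
    conv_lhs => rw [← Nat.prod_factorization_pow_eq_self hn]
    rw [Finsupp.prod, Nat.support_factorization]; push_cast; rfl
  calc ∏ p ∈ n.primeFactors, ((n.factorization p : ℝ) + 1)
      ≤ ∏ p ∈ n.primeFactors, ((if p < P then D else 1) * ((p : ℝ) ^ n.factorization p) ^ ε) :=
        Finset.prod_le_prod (fun _ _ => by positivity) fun p hp =>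
          hsmall p _ (Nat.prime_of_mem_primeFactors hp).two_le
    _ = (∏ p ∈ n.primeFactors, (if p < P then D else 1)) * (n : ℝ) ^ ε := by
        rw [Finset.prod_mul_distrib]; congr 1
        conv_rhs => rw [hn']
        rw [Real.finsetProd_rpow _ _ (fun _ _ => by positivity)]
    _ ≤ _ := by
        gcongr
        rw [← Finset.prod_filter]
        rw [Finset.prod_const]
        refine pow_le_pow_right₀ hD1 ?_
        calc _ ≤ (Finset.range P).card := Finset.card_le_card (fun p hp => by
                simp only [Finset.mem_filter] at hp; simpa using hp.2)
          _ = P := Finset.card_range P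

theorem sum_inv_sqrt (n : ℕ) : ∑ s ∈ Finset.Icc 1 n, 1 / Real.sqrt s ≤ 2 * Real.sqrt n := by
  induction n with
  | zero => simp
  | succ n ih =>
    rw [Finset.sum_Icc_succ_top (by omega)]
    have h1 : (Real.sqrt (n + 1)) ^ 2 = n + 1 := Real.sq_sqrt (by positivity)
    have h2 : (Real.sqrt n) ^ 2 = n := Real.sq_sqrt (by positivity)
    have h3 : 0 < Real.sqrt (n + 1) := Real.sqrt_pos.2 (by positivity)
    have h4 : 0 ≤ Real.sqrt n := Real.sqrt_nonneg _
    have : 1 / Real.sqrt (n + 1) ≤ 2 * Real.sqrt (n + 1) - 2 * Real.sqrt n := by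
      rw [div_le_iff₀ h3]
      nlinarith [sq_nonneg (Real.sqrt (n + 1) - Real.sqrt n)]
    push_cast
    linarith

theorem sum_inv_le (n : ℕ) : ∑ s ∈ Finset.Icc 1 n, 1 / (s : ℝ) ≤ 1 + Real.log n := by
  have := harmonic_le_one_add_log n
  rw [harmonic_eq_sum_Icc] at this
  push_cast at this
  simpa using this

theorem sum_gcd (q n : ℕ) (hq : q ≠ 0) (φ : ℕ → ℝ) (hφ : ∀ n, 0 ≤ φ n) :
    ∑ s ∈ Finset.Icc 1 n, (Nat.gcd q s : ℝ) * φ s ≤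
      ∑ e ∈ q.divisors, (e : ℝ) * ∑ s ∈ Finset.Icc 1 (n / e), φ (e * s) := by
  have h1 : ∀ s ∈ Finset.Icc 1 n, (Nat.gcd q s : ℝ) * φ s ≤ ∑ e ∈ q.divisors, if e ∣ s then (e : ℝ) * φ s else 0 := by
    intro s hs
    have hm : Nat.gcd q s ∈ q.divisors := Nat.mem_divisors.2 ⟨Nat.gcd_dvd_left _ _, hq⟩
    refine le_trans ?_ (Finset.single_le_sum (f := fun e => if e ∣ s then (e : ℝ) * φ s else 0) (fun e _ => ?_) hm)
    · rw [if_pos (Nat.gcd_dvd_right q s)]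
    · split_ifs
      · exact mul_nonneg (by positivity) (hφ s)
      · exact le_rfl
  refine (Finset.sum_le_sum h1).trans ?_
  rw [Finset.sum_comm]
  refine Finset.sum_le_sum fun e he => ?_
  have he0 : 0 < e := Nat.pos_of_mem_divisors he
  rw [← Finset.sum_filter, ← Finset.mul_sum]
  refine mul_le_mul_of_nonneg_left (le_of_eq ?_) (by positivity)
  refine Finset.sum_bij' (fun s _ => s / e) (fun s _ => e * s) ?_ ?_ ?_ ?_ ?_
  · intro s hs
    simp only [Finset.mem_filter, Finset.mem_Icc] at hs ⊢
    exact ⟨Nat.div_pos (Nat.le_of_dvd (by omega) hs.2) he0, Nat.div_le_div_right hs.1.2⟩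
  · intro s hs
    simp only [Finset.mem_filter, Finset.mem_Icc] at hs ⊢
    refine ⟨⟨Nat.mul_pos he0 (by omega), ?_⟩, dvd_mul_right _ _⟩
    rw [mul_comm]; exact (Nat.le_div_iff_mul_le he0).1 hs.2
  · intro s hs
    simp only [Finset.mem_filter] at hs
    exact Nat.mul_div_cancel' hs.2
  · intro s hs
    exact Nat.mul_div_cancel_left s he0
  · intro s hs
    simp only [Finset.mem_filter] at hs
    rw [Nat.mul_div_cancel' hs.2]

theorem sum_gcd_sqrt (q n : ℕ) (hq : q ≠ 0) :
    ∑ s ∈ Finset.Icc 1 n, (Nat.gcd q s : ℝ) * (1 / Real.sqrt s) ≤ 2 * q.divisors.card * Real.sqrt n := by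
  refine (sum_gcd q n hq (fun s => 1 / Real.sqrt s) (fun _ => by positivity)).trans ?_
  calc _ ≤ ∑ e ∈ q.divisors, 2 * Real.sqrt n := by
        refine Finset.sum_le_sum fun e he => ?_
        have he0 : 0 < e := Nat.pos_of_mem_divisors he
        have he' : (0 : ℝ) < e := by exact_mod_cast he0
        have : ∀ s : ℕ, 1 / Real.sqrt ((e * s : ℕ) : ℝ) = 1 / Real.sqrt e * (1 / Real.sqrt s) := by
          intro s; push_cast; rw [Real.sqrt_mul he'.le]; field_simp
        simp only [this]
        rw [← Finset.mul_sum, ← mul_assoc]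
        have h1 : (e : ℝ) * (1 / Real.sqrt e) = Real.sqrt e := by
          have : Real.sqrt e ≠ 0 := (Real.sqrt_pos.2 he').ne'
          field_simp; exact (Real.sq_sqrt he'.le).symm
        rw [h1]
        calc _ ≤ Real.sqrt e * (2 * Real.sqrt ((n / e : ℕ) : ℝ)) := by gcongr; exact sum_inv_sqrt _
          _ ≤ Real.sqrt e * (2 * Real.sqrt ((n : ℝ) / e)) := by gcongr; exact Nat.cast_div_le
          _ = _ := by
            rw [Real.sqrt_div (by positivity)]
            have : Real.sqrt e ≠ 0 := (Real.sqrt_pos.2 he').ne'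
            field_simp
    _ = _ := by rw [Finset.sum_const, nsmul_eq_mul]; ring

theorem sum_gcd_inv (q n : ℕ) (hq : q ≠ 0) :
    ∑ s ∈ Finset.Icc 1 n, (Nat.gcd q s : ℝ) * (1 / s) ≤ q.divisors.card * (1 + Real.log n) := by
  refine (sum_gcd q n hq (fun s => 1 / s) (fun _ => by positivity)).trans ?_
  calc _ ≤ ∑ e ∈ q.divisors, (1 + Real.log n) := by
        refine Finset.sum_le_sum fun e he => ?_
        have he0 : 0 < e := Nat.pos_of_mem_divisors he
        have he' : (e : ℝ) ≠ 0 := by exact_mod_cast he0.ne'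
        have : ∀ s : ℕ, 1 / ((e * s : ℕ) : ℝ) = 1 / e * (1 / (s : ℝ)) := by
          intro s; push_cast; field_simp
        simp only [this]
        rw [← Finset.mul_sum, ← mul_assoc, mul_one_div_cancel he', one_mul]
        refine le_trans ?_ (sum_inv_le n)
        exact Finset.sum_le_sum_of_subset_of_nonneg
          (Finset.Icc_subset_Icc le_rfl (Nat.div_le_self _ _)) (fun _ _ _ => by positivity)
    _ = _ := by rw [Finset.sum_const, nsmul_eq_mul]

theorem kl_decomp (d q c : ℕ) (hc : c ≠ 0) (hd : Squarefree d) (hq : Squarefree q) (hdc : d ^ 2 ∣ c) (hqc : q ∣ c) :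
    ∃ c1 x y : ℕ, c = c1 * (x ^ 2 * y) ∧ y ∣ x ∧ d ∣ x ∧ q ∣ c1 * x ∧ Squarefree c1 ∧ c1.Coprime (x ^ 2 * y) := by
  obtain ⟨a, b, hab, ha⟩ := Nat.sq_mul_squarefree c
  obtain ⟨c1, hc1⟩ := Nat.gcd_dvd_left a b
  set y := Nat.gcd a b with hy
  have hb0 : b ≠ 0 := by rintro rfl; simp at hab; exact hc hab.symm
  have hsq : Squarefree (y * c1) := hc1 ▸ ha
  have hcy : c1.Coprime y := (Nat.coprime_of_squarefree_mul hsq).symm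
  have hcb : c1.Coprime b := by
    rw [Nat.coprime_iff_gcd_eq_one]
    have h1 : Nat.gcd c1 b ∣ y := Nat.dvd_gcd ((Nat.gcd_dvd_left _ _).trans ⟨y, by rw [hc1]; ring⟩) (Nat.gcd_dvd_right _ _)
    exact Nat.eq_one_of_dvd_coprimes hcy (Nat.gcd_dvd_left _ _) h1
  refine ⟨c1, b, y, ?_, Nat.gcd_dvd_right _ _, ?_, ?_, hsq.of_mul_right, ?_⟩
  · rw [← hab, hc1]; ring
  · rw [← hab] at hdc
    obtain ⟨g, d', b', hg, hcop, hdg, hbg⟩ := Nat.exists_coprime' (Nat.gcd_pos_of_pos_right d (Nat.pos_of_ne_zero hb0))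
    have h2 : d' ^ 2 ∣ b' ^ 2 * a := by
      have : g ^ 2 * d' ^ 2 ∣ g ^ 2 * (b' ^ 2 * a) := by
        convert hdc using 1
        · rw [hdg]; ring
        · rw [hbg]; ring
      exact Nat.dvd_of_mul_dvd_mul_left (by positivity) this
    have h3 : d' ^ 2 ∣ a := (Nat.Coprime.pow 2 2 hcop).dvd_of_dvd_mul_left h2
    have h4 : d' = 1 := by
      have := ha d' (by rw [← sq]; exact h3)
      exact Nat.isUnit_iff.1 this
    rw [hdg, h4, one_mul, hbg]; exact dvd_mul_left _ _
  · rw [← (hq.dvd_pow_iff_dvd three_ne_zero)]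
    refine hqc.trans ?_
    obtain ⟨w, hw⟩ : y ∣ b := Nat.gcd_dvd_right _ _
    rw [← hab, hc1]
    refine ⟨c1 ^ 2 * w, ?_⟩
    calc (c1 * b) ^ 3 = c1 ^ 3 * b ^ 2 * b := by ring
      _ = c1 ^ 3 * b ^ 2 * (y * w) := by rw [← hw]
      _ = _ := by ring
  · exact Nat.Coprime.mul_right (Nat.Coprime.pow_right 2 hcb) hcy

/-- norm of Kloosterman sum, zero at modulus zero -/
noncomputable def klN (d : ℕ) (h : ℤ) (c : ℕ) : ℝ :=
  if hc : c ≠ 0 then ‖@Kl d h c ⟨hc⟩‖ else 0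

theorem klN_bound (d c1 c2 : ℕ) (h1 : c1 ≠ 0) (h2 : c2 ≠ 0) (hd : d ∣ c2) (h : ℤ) (hs : Squarefree c1)
    (hc : c1.Coprime c2) :
    klN d h (c1 * c2) ≤ c1.divisors.card * Real.sqrt c1 * Real.sqrt (Int.gcd h c1) * (c2 / d) := by
  have i1 : NeZero c1 := ⟨h1⟩
  have i2 : NeZero c2 := ⟨h2⟩
  rw [klN, dif_pos (mul_ne_zero h1 h2)]
  exact Kl_bound d c2 hd c1 h hs hc

theorem kl_alg (T d g τ C x ρ γ s : ℝ) (hd : d ≠ 0) (hx : x ≠ 0) (hs : s ≠ 0) (hγ : γ ≠ 0) (h : s * s = ρ) :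
    T / d * g * (1 / s) * (2 * τ * (C / (d * x * s))) = (2 * T * τ * g * C / (d ^ 2 * (ρ * γ))) * (γ * (1 / x)) := by
  subst h; field_simp

set_option maxHeartbeats 1000000 in
theorem kl_sum_aux (T : ℝ) (hT0 : 0 ≤ T) (d q C0 : ℕ) (h : ℤ) (hT : ∀ n, 1 ≤ n → n ≤ C0 → (n.divisors.card : ℝ) ≤ T)
    (hd : Squarefree d) (hq : Squarefree q) (hdq : d.Coprime q) (hh : h ≠ 0) :
    ∑ c ∈ (Finset.Icc 1 C0).filter (fun c => d ^ 2 * q ∣ c), klN d h c / c ≤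
      2 * T ^ 2 * q.divisors.card * h.natAbs.divisors.card * (1 + Real.log C0) *
        Real.sqrt (Int.gcd h q) * Real.sqrt C0 / (d ^ 2 * q) := by
  have hd0 : 0 < d := Nat.pos_of_ne_zero hd.ne_zero
  have hq0 : 0 < q := Nat.pos_of_ne_zero hq.ne_zero
  have hha : h.natAbs ≠ 0 := Int.natAbs_ne_zero.2 hh
  set S := (Finset.Icc 1 C0).filter (fun c => d ^ 2 * q ∣ c) with hS
  have hdec : ∀ c : ℕ, ∃ t : ℕ × ℕ × ℕ, c ∈ S → (c = t.1 * (t.2.1 ^ 2 * t.2.2) ∧ t.2.2 ∣ t.2.1 ∧ d ∣ t.2.1 ∧ q ∣ t.1 * t.2.1 ∧ Squarefree t.1 ∧ t.1.Coprime (t.2.1 ^ 2 * t.2.2)) := by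
    intro c
    by_cases hc : c ∈ S
    · simp only [hS, Finset.mem_filter, Finset.mem_Icc] at hc
      obtain ⟨c1, x, y, H⟩ := kl_decomp d q c (by omega) hd hq ((dvd_mul_right _ _).trans hc.2) ((dvd_mul_left _ _).trans hc.2)
      exact ⟨(c1, x, y), fun _ => H⟩
    · exact ⟨0, fun h => absurd h hc⟩
  choose t ht using hdec
  let r : ℕ → ℕ := fun x => q / Nat.gcd q x
  have hgp : ∀ x, 0 < Nat.gcd q x := fun x => Nat.gcd_pos_of_pos_left _ hq0
  have hr0 : ∀ x, 0 < r x := fun x => Nat.div_pos (Nat.gcd_le_left _ hq0) (hgp x)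
  have hrq : ∀ x, r x ∣ q := fun x => Nat.div_dvd_of_dvd (Nat.gcd_dvd_left _ _)
  let Box : Finset (Σ _ : ℕ, Σ _ : ℕ, ℕ) := (Finset.Icc 1 (C0 / d)).sigma fun x =>
    (d * x).divisors.sigma fun y => Finset.Icc 1 (C0 / ((d * x) ^ 2 * y * r x))
  let G : (Σ _ : ℕ, Σ _ : ℕ, ℕ) → ℝ := fun e =>
    T / d * Real.sqrt (Int.gcd h q) * (1 / Real.sqrt (r e.1)) * ((Nat.gcd h.natAbs e.2.2 : ℝ) * (1 / Real.sqrt e.2.2))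
  let φ : ℕ → (Σ _ : ℕ, Σ _ : ℕ, ℕ) := fun c => ⟨(t c).2.1 / d, (t c).2.2, (t c).1 / r ((t c).2.1 / d)⟩
  have hprop : ∀ c ∈ S, 0 < (t c).1 ∧ 0 < (t c).2.1 ∧ 0 < (t c).2.2 ∧ d * ((t c).2.1 / d) = (t c).2.1 ∧
      r ((t c).2.1 / d) * ((t c).1 / r ((t c).2.1 / d)) = (t c).1 ∧ 1 ≤ c ∧ c ≤ C0 := by
    intro c hc
    obtain ⟨e1, e2, e3, e4, e5, e6⟩ := ht c hc
    simp only [hS, Finset.mem_filter, Finset.mem_Icc] at hc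
    have p1 : 0 < (t c).1 := Nat.pos_of_ne_zero fun h => by rw [h] at e1; simp at e1; omega
    have p2 : 0 < (t c).2.1 := Nat.pos_of_ne_zero fun h => by rw [h] at e1; simp at e1; omega
    have p3 : 0 < (t c).2.2 := Nat.pos_of_ne_zero fun h => by rw [h] at e1; simp at e1; omega
    have p4 := Nat.mul_div_cancel' e3
    refine ⟨p1, p2, p3, p4, Nat.mul_div_cancel' ?_, hc.1⟩
    set x := (t c).2.1 / d with hx
    rw [← p4] at e4
    have e7 : q ∣ (t c).1 * x := by
      have : q ∣ d * ((t c).1 * x) := by convert e4 using 1; ring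
      exact hdq.symm.dvd_of_dvd_mul_left this
    have hcop : (r x).Coprime (x / Nat.gcd q x) := Nat.coprime_div_gcd_div_gcd (hgp x)
    refine hcop.dvd_of_dvd_mul_right ?_
    have : Nat.gcd q x * r x ∣ Nat.gcd q x * ((t c).1 * (x / Nat.gcd q x)) := by
      have a1 : Nat.gcd q x * r x = q := Nat.mul_div_cancel' (Nat.gcd_dvd_left _ _)
      have a2 : Nat.gcd q x * (x / Nat.gcd q x) = x := Nat.mul_div_cancel' (Nat.gcd_dvd_right _ _)
      rw [a1, mul_left_comm, a2]; exact e7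
    exact Nat.dvd_of_mul_dvd_mul_left (hgp x) this
  have hinj : Set.InjOn φ S := by
    intro c hc c' hc' hcc
    have hc := Finset.mem_coe.1 hc; have hc' := Finset.mem_coe.1 hc'
    simp only [φ, Sigma.mk.injEq, heq_eq_eq] at hcc
    obtain ⟨g1, g2, g3⟩ := hcc
    obtain ⟨-, -, -, a4, a5, -⟩ := hprop c hc
    obtain ⟨-, -, -, b4, b5, -⟩ := hprop c' hc'
    rw [(ht c hc).1, (ht c' hc').1, ← a5, ← b5, ← a4, ← b4, g2, Nat.mul_div_cancel_left _ hd0, Nat.mul_div_cancel_left _ hd0, g1]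
    rw [g1] at g3
    rw [g3]
  have hmaps : ∀ c ∈ S, φ c ∈ Box := by
    intro c hc
    obtain ⟨a1, a2, a3, a4, a5, a6, a7⟩ := hprop c hc
    obtain ⟨e1, e2, e3, e4, e5, e6⟩ := ht c hc
    have hxle : (t c).2.1 ≤ C0 := by
      refine le_trans ?_ (e1 ▸ a7 : (t c).1 * ((t c).2.1 ^ 2 * (t c).2.2) ≤ C0)
      calc (t c).2.1 ≤ 1 * ((t c).2.1 ^ 2 * 1) := by nlinarith
        _ ≤ _ := by gcongr <;> omega
    simp only [Box, φ, Finset.mem_sigma, Finset.mem_Icc, Nat.mem_divisors]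
    refine ⟨⟨Nat.div_pos (Nat.le_of_dvd a2 e3) hd0, Nat.div_le_div_right hxle⟩, ⟨a4.symm ▸ e2, by rw [a4]; omega⟩,
      Nat.div_pos (Nat.le_of_dvd a1 ⟨_, a5.symm⟩) (hr0 _), ?_⟩
    rw [Nat.le_div_iff_mul_le (by rw [a4]; have := hr0 ((t c).2.1 / d); positivity)]
    refine le_trans (le_of_eq ?_) a7
    rw [a4]
    conv_rhs => rw [e1, ← a5]
    ring
  have hterm : ∀ c ∈ S, klN d h c / c ≤ G (φ c) := by
    intro c hc
    obtain ⟨a1, a2, a3, a4, a5, a6, a7⟩ := hprop c hc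
    obtain ⟨e1, e2, e3, e4, e5, e6⟩ := ht c hc
    have hb := klN_bound d (t c).1 ((t c).2.1 ^ 2 * (t c).2.2) a1.ne' (by positivity) (e3.trans ((dvd_pow_self _ two_ne_zero).trans (dvd_mul_right _ _))) h e5 e6
    rw [← e1] at hb
    have hc0 : (0 : ℝ) < c := by exact_mod_cast a6
    have hc1le : (t c).1 ≤ C0 := by
      refine le_trans ?_ a7
      conv_rhs => rw [e1]
      exact Nat.le_mul_of_pos_right _ (by positivity)
    rw [div_le_iff₀ hc0]
    refine hb.trans ?_
    set c1 := (t c).1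
    set s := c1 / r ((t c).2.1 / d) with hs
    set ρ := r ((t c).2.1 / d)
    have hc1r : (c1 : ℝ) = ρ * s := by exact_mod_cast a5.symm
    have hρ0 : (0 : ℝ) < ρ := by exact_mod_cast hr0 _
    have hs0 : (0 : ℝ) < s := by
      exact_mod_cast Nat.div_pos (Nat.le_of_dvd a1 ⟨_, a5.symm⟩) (hr0 _)
    have hgcd : (Int.gcd h c1 : ℝ) ≤ Int.gcd h q * Nat.gcd h.natAbs s := by
      have : Int.gcd h c1 ≤ Int.gcd h q * Nat.gcd h.natAbs s := by
        rw [Int.gcd_def, Int.gcd_def, Int.natAbs_natCast, Int.natAbs_natCast, ← a5]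
        refine Nat.le_of_dvd (Nat.mul_pos (Nat.gcd_pos_of_pos_right _ hq0) (Nat.gcd_pos_of_pos_left _ (by omega))) ?_
        exact (Nat.gcd_mul_right_dvd_mul_gcd _ _ _).trans (mul_dvd_mul (Nat.gcd_dvd_gcd_of_dvd_right _ (hrq _)) dvd_rfl)
      exact_mod_cast this
    have hgs : (1 : ℝ) ≤ Nat.gcd h.natAbs s := by
      exact_mod_cast Nat.gcd_pos_of_pos_left _ (by omega)
    have hsq : Real.sqrt (Int.gcd h c1) ≤ Real.sqrt (Int.gcd h q) * Nat.gcd h.natAbs s := by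
      refine (Real.sqrt_le_sqrt hgcd).trans ?_
      rw [Real.sqrt_mul (by positivity)]
      gcongr
      rw [Real.sqrt_le_left (by positivity)]
      nlinarith
    have hcr : (c : ℝ) = c1 * ((t c).2.1 ^ 2 * (t c).2.2) := by exact_mod_cast e1
    show _ ≤ T / d * Real.sqrt (Int.gcd h q) * (1 / Real.sqrt ρ) * ((Nat.gcd h.natAbs s : ℝ) * (1 / Real.sqrt s)) * c
    have hdR : (0 : ℝ) < d := by exact_mod_cast hd0
    calc _ ≤ T * Real.sqrt c1 * (Real.sqrt (Int.gcd h q) * Nat.gcd h.natAbs s) * ((((t c).2.1 ^ 2 * (t c).2.2 : ℕ) : ℝ) / d) := by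
          gcongr
          exact hT c1 a1 hc1le
      _ = _ := by
          rw [hcr]
          have hc1p : 0 < (c1 : ℝ) := by exact_mod_cast a1
          have : (c1 : ℝ) = Real.sqrt c1 * Real.sqrt c1 := (Real.mul_self_sqrt hc1p.le).symm
          have e : (1 / Real.sqrt ρ) * (1 / Real.sqrt s) = 1 / Real.sqrt c1 := by
            rw [hc1r, Real.sqrt_mul hρ0.le]; field_simp
          have hsp : Real.sqrt c1 ≠ 0 := (Real.sqrt_pos.2 hc1p).ne'
          calc _ = T / d * Real.sqrt (Int.gcd h q) * Nat.gcd h.natAbs s * (1 / Real.sqrt c1) * (Real.sqrt c1 * Real.sqrt c1 * ((t c).2.1 ^ 2 * (t c).2.2)) := by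
                push_cast; field_simp
            _ = T / d * Real.sqrt (Int.gcd h q) * Nat.gcd h.natAbs s * ((1 / Real.sqrt ρ) * (1 / Real.sqrt s)) * (c1 * ((t c).2.1 ^ 2 * (t c).2.2)) := by rw [← this, e]
            _ = _ := by ring
  have hG0 : ∀ e, 0 ≤ G e := fun e => by simp only [G]; positivity
  generalize hτ : h.natAbs.divisors.card = τ
  calc ∑ c ∈ S, klN d h c / c ≤ ∑ c ∈ S, G (φ c) := Finset.sum_le_sum hterm
    _ = ∑ e ∈ S.image φ, G e := (Finset.sum_image hinj).symm
    _ ≤ ∑ e ∈ Box, G e := Finset.sum_le_sum_of_subset_of_nonneg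
        (Finset.image_subset_iff.2 hmaps) (fun e _ _ => hG0 e)
    _ = ∑ x ∈ Finset.Icc 1 (C0 / d), ∑ y ∈ (d * x).divisors, ∑ s ∈ Finset.Icc 1 (C0 / ((d * x) ^ 2 * y * r x)), G ⟨x, y, s⟩ := by
        rw [Finset.sum_sigma]; simp_rw [Finset.sum_sigma]
    _ ≤ ∑ x ∈ Finset.Icc 1 (C0 / d), (2 * T ^ 2 * τ * Real.sqrt (Int.gcd h q) * Real.sqrt C0 / (d ^ 2 * q)) * ((Nat.gcd q x : ℝ) * (1 / x)) := by
        refine Finset.sum_le_sum fun x hx => ?_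
        rw [Finset.mem_Icc] at hx
        have hx0 : (0 : ℝ) < x := by exact_mod_cast hx.1
        have hdR : (0 : ℝ) < d := by exact_mod_cast hd0
        have hrR : (0 : ℝ) < r x := by exact_mod_cast hr0 x
        have hqR : (0 : ℝ) < q := by exact_mod_cast hq0
        have hrg : (q : ℝ) = r x * Nat.gcd q x := by
          exact_mod_cast (Nat.div_mul_cancel (Nat.gcd_dvd_left q x)).symm
        have hgR : (0 : ℝ) < Nat.gcd q x := by exact_mod_cast hgp x
        calc _ ≤ ∑ y ∈ (d * x).divisors, (2 * T * τ * Real.sqrt (Int.gcd h q) * Real.sqrt C0 / (d ^ 2 * q)) * ((Nat.gcd q x : ℝ) * (1 / x)) := by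
              refine Finset.sum_le_sum fun y hy => ?_
              have hy0 : 1 ≤ y := Nat.pos_of_mem_divisors hy
              have hyR : (1 : ℝ) ≤ y := by exact_mod_cast hy0
              simp only [G]
              rw [← Finset.mul_sum]
              calc _ ≤ T / d * Real.sqrt (Int.gcd h q) * (1 / Real.sqrt (r x)) * (2 * τ * Real.sqrt ((C0 / ((d * x) ^ 2 * y * r x) : ℕ) : ℝ)) := by
                    gcongr; exact hτ ▸ sum_gcd_sqrt _ _ hha
                _ ≤ T / d * Real.sqrt (Int.gcd h q) * (1 / Real.sqrt (r x)) * (2 * τ * (Real.sqrt C0 / (d * x * Real.sqrt (r x)))) := by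
                    gcongr
                    rw [← Real.sqrt_sq (by positivity : 0 ≤ (d * x * Real.sqrt (r x) : ℝ)), ← Real.sqrt_div (by positivity)]
                    refine Real.sqrt_le_sqrt (Nat.cast_div_le.trans ?_)
                    push_cast
                    rw [mul_pow _ (Real.sqrt _), Real.sq_sqrt hrR.le]
                    gcongr
                    nlinarith [sq_nonneg ((d : ℝ) * x)]
                _ = _ := by
                    rw [hrg]; exact kl_alg _ _ _ _ _ _ _ _ _ hdR.ne' hx0.ne' (Real.sqrt_pos.2 hrR).ne' hgR.ne' (Real.mul_self_sqrt hrR.le)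
          _ ≤ _ := by
              rw [Finset.sum_const, nsmul_eq_mul]
              have h1 : ((d * x).divisors.card : ℝ) ≤ T := hT _ (Nat.mul_pos hd0 hx.1) (by
                rw [mul_comm]; exact (Nat.le_div_iff_mul_le hd0).1 hx.2)
              calc _ ≤ T * _ := mul_le_mul_of_nonneg_right h1 (by positivity)
                _ = _ := by ring
    _ = (2 * T ^ 2 * τ * Real.sqrt (Int.gcd h q) * Real.sqrt C0 / (d ^ 2 * q)) * ∑ x ∈ Finset.Icc 1 (C0 / d), ((Nat.gcd q x : ℝ) * (1 / x)) := by
        rw [Finset.mul_sum]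
    _ ≤ (2 * T ^ 2 * τ * Real.sqrt (Int.gcd h q) * Real.sqrt C0 / (d ^ 2 * q)) * (q.divisors.card * (1 + Real.log C0)) := by
        gcongr
        refine le_trans ?_ (sum_gcd_inv q C0 hq0.ne')
        exact Finset.sum_le_sum_of_subset_of_nonneg
          (Finset.Icc_subset_Icc le_rfl (Nat.div_le_self _ _)) (fun _ _ _ => by positivity)
    _ = _ := by ring

open UpperHalfPlane in
/-- analytic data of an eigenform of weight `2 j`. -/
structure ED (j : ℕ) (a : ℕ → ℂ) (F : ℍ → ℂ) (B : ℝ) : Prop where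
  hj : 6 ≤ j
  cont : Continuous F
  modu : ∀ (γ : Matrix.SpecialLinearGroup (Fin 2) ℤ) (z : ℍ), F (γ • z) = denom γ z ^ (2 * j) * F z
  bd : ∀ z : ℍ, ‖F z‖ * z.im ^ j ≤ B
  Bpos : 0 < B
  sm : ∀ z : ℍ, Summable fun n : ℕ => ‖a (n + 1) * Complex.exp (2 * Real.pi * Complex.I * (n + 1) * (z : ℂ))‖
  eq : ∀ z : ℍ, F z = ∑' n : ℕ, a (n + 1) * Complex.exp (2 * Real.pi * Complex.I * (n + 1) * (z : ℂ))
  near : ∃ z : ℍ, B / 2 ≤ ‖F z‖ * z.im ^ j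
  a1 : a 1 = 1
  hecke : ∀ m n : ℕ, 1 ≤ m → 1 ≤ n →
    a m * a n = ∑ d ∈ (Nat.gcd m n).divisors, (d : ℂ) ^ (2 * j - 1) * a (m * n / d ^ 2)

open UpperHalfPlane in
lemma norm_term (a : ℂ) (n : ℕ) (z : ℍ) :
    ‖a * Complex.exp (2 * Real.pi * Complex.I * (n + 1) * (z : ℂ))‖ = ‖a‖ * Real.exp (-(2 * Real.pi * (n+1) * z.im)) := by
  rw [norm_mul, Complex.norm_exp]
  congr 2
  have : (2 * Real.pi * Complex.I * (n + 1) * (z : ℂ)) = Complex.I * ((2 * Real.pi * (n+1) : ℝ) * (z:ℂ)) := by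
    push_cast; ring
  rw [this]
  simp only [Complex.I_mul_re, Complex.mul_im, Complex.ofReal_re, Complex.ofReal_im, zero_mul, add_zero]
  rfl

open UpperHalfPlane in
lemma low_im (z : ℍ) (t : ℝ) (ht : 0 < t) : ∃ γ : Matrix.SpecialLinearGroup (Fin 2) ℤ, (γ • z).im < t := by
  obtain ⟨n, hn⟩ := exists_nat_gt (|z.re| + 1 + z.im / t)
  refine ⟨ModularGroup.S * ModularGroup.T ^ (n:ℤ), ?_⟩
  rw [mul_smul]
  have him : ((ModularGroup.S • (ModularGroup.T ^ (n:ℤ) • z)) : ℍ).im = z.im / Complex.normSq ((z:ℂ) + n) := by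
    rw [UpperHalfPlane.modular_S_smul]
    simp only [UpperHalfPlane.im, UpperHalfPlane.coe_mk, ModularGroup.coe_T_zpow_smul_eq]
    rw [Complex.inv_im]
    rw [Complex.normSq_neg]; simp
  rw [him]
  have h1 : z.im / t < n := by have := abs_nonneg z.re; linarith
  have h0 : 0 ≤ z.im / t := div_nonneg z.im_pos.le ht.le
  have h2 : 1 + z.im/t < z.re + n := by have := neg_abs_le z.re; linarith
  have h3 : z.im / t < Complex.normSq ((z:ℂ) + n) := by
    rw [Complex.normSq_apply]
    simp only [Complex.add_re, Complex.add_im, Complex.natCast_re, Complex.natCast_im, UpperHalfPlane.coe_re, UpperHalfPlane.coe_im]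
    nlinarith [mul_self_nonneg (z.im+0)]
  rw [div_lt_iff₀ (lt_of_le_of_lt h0 h3)]
  rw [div_lt_iff₀ ht] at h3
  linarith

open UpperHalfPlane in
lemma ed_exists (k : ℕ) (a : ℕ → ℂ) (h : IsNormalizedHeckeEigenform k a) :
    ∃ (j : ℕ) (F : ℍ → ℂ) (B : ℝ), k = 2 * j ∧ ED j a F B := by
  obtain ⟨⟨j, hkj⟩, hk, ⟨F, hF0, hF⟩, ha1, hH⟩ := h
  have hk2 : k = 2 * j := by omega
  subst hk2
  have hmod : ∀ (γ : Matrix.SpecialLinearGroup (Fin 2) ℤ) (z : ℍ), F (γ • z) = denom γ z ^ (2 * j) * F z := by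
    intro γ z
    have h1 := SlashInvariantForm.slash_action_eqn'' F (γ := (γ : GL (Fin 2) ℝ)) (by
      refine ⟨γ, ?_, rfl⟩
      rw [CongruenceSubgroup.Gamma_one_top]; exact Subgroup.mem_top γ) z
    rw [zpow_natCast] at h1
    exact h1
  have hcont : Continuous F := (CuspFormClass.holo F).continuous
  obtain ⟨C, hC⟩ := CuspFormClass.exists_bound (Γ := (CongruenceSubgroup.Gamma 1 : Subgroup (GL (Fin 2) ℝ))) F
  have hC' : ∀ z : ℍ, ‖F z‖ * z.im ^ j ≤ C := by
    intro z
    have := hC z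
    have e : z.im ^ ((((2 * j : ℕ) : ℤ) : ℝ) / 2) = z.im ^ j := by
      rw [show ((((2 * j : ℕ) : ℤ) : ℝ) / 2) = (j:ℝ) by push_cast; ring, Real.rpow_natCast]
    rw [e, le_div_iff₀ (pow_pos z.im_pos _)] at this
    exact this
  have hbdd : BddAbove (Set.range fun z : ℍ => ‖F z‖ * z.im ^ j) := ⟨C, by rintro _ ⟨z, rfl⟩; exact hC' z⟩
  have hz0 : ∃ z, F z ≠ 0 := by
    by_contra hcon
    push Not at hcon
    exact hF0 (DFunLike.ext _ _ hcon)
  obtain ⟨z0, hz0⟩ := hz0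
  set B := sSup (Set.range fun z : ℍ => ‖F z‖ * z.im ^ j) with hB
  have hle : ∀ z : ℍ, ‖F z‖ * z.im ^ j ≤ B := fun z => le_csSup hbdd ⟨z, rfl⟩
  have hBpos : 0 < B := lt_of_lt_of_le (mul_pos (norm_pos_iff.mpr hz0) (pow_pos z0.im_pos _)) (hle z0)
  have hsm : ∀ z : ℍ, Summable fun n : ℕ => ‖a (n + 1) * Complex.exp (2 * Real.pi * Complex.I * (n + 1) * (z : ℂ))‖ := by
    intro z
    by_contra hns
    obtain ⟨γ, hγ⟩ := low_im z0 z.im z.im_pos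
    have h0 : F (γ • z0) ≠ 0 := by
      rw [hmod]; exact mul_ne_zero (pow_ne_zero _ (denom_ne_zero _ _)) hz0
    apply h0
    rw [hF]
    apply tsum_eq_zero_of_not_summable
    intro hs
    apply hns
    refine Summable.of_nonneg_of_le (fun _ => norm_nonneg _) (fun n => ?_) hs.norm
    rw [norm_term, norm_term]
    have := Real.pi_pos
    gcongr
  refine ⟨j, F, B, rfl, ⟨by omega, hcont, hmod, hle, hBpos, hsm, hF, ?_, ha1, hH⟩⟩
  obtain ⟨_, ⟨z, rfl⟩, hz⟩ := exists_lt_of_lt_csSup (Set.range_nonempty _) (show B / 2 < sSup (Set.range fun z : ℍ => ‖F z‖ * z.im ^ j) by rw [← hB]; linarith)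
  exact ⟨z, hz.le⟩

open MeasureTheory

lemma int_trig {ι : Type*} [Countable ι] (c : ι → ℂ) (ν : ι → ℤ) (hc : Summable fun i => ‖c i‖) :
    ∫ x in (0:ℝ)..1, ∑' i, c i * Complex.exp (2 * Real.pi * Complex.I * (ν i : ℂ) * x)
      = ∑' i, if ν i = 0 then c i else 0 := by
  have hn : ∀ i (x:ℝ), ‖c i * Complex.exp (2 * Real.pi * Complex.I * (ν i : ℂ) * x)‖ = ‖c i‖ := by
    intro i x
    rw [norm_mul, show (2 * Real.pi * Complex.I * (ν i : ℂ) * x : ℂ) = ((2 * Real.pi * ν i * x : ℝ) : ℂ) * Complex.I by push_cast; ring,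
      Complex.norm_exp_ofReal_mul_I, mul_one]
  have key := intervalIntegral.hasSum_integral_of_dominated_convergence (μ := volume) (a := 0) (b := 1)
    (F := fun i (x:ℝ) => c i * Complex.exp (2 * Real.pi * Complex.I * (ν i : ℂ) * x))
    (f := fun x => ∑' i, c i * Complex.exp (2 * Real.pi * Complex.I * (ν i : ℂ) * x))
    (fun i _ => ‖c i‖) (fun i => (Continuous.aestronglyMeasurable (by fun_prop)))
    (fun i => Filter.Eventually.of_forall fun x _ => (hn i x).le)
    (Filter.Eventually.of_forall fun x _ => hc)
    (by simp)
    (Filter.Eventually.of_forall fun x _ => (Summable.of_norm (by simpa only [hn] using hc)).hasSum)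
  rw [← key.tsum_eq]
  congr 1; ext i
  rw [intervalIntegral.integral_const_mul]
  split_ifs with h
  · simp [h]
  · have h2 : (2 * Real.pi * Complex.I * (ν i : ℂ)) ≠ 0 := by
      have : (ν i : ℂ) ≠ 0 := by exact_mod_cast h
      have hp : (Real.pi : ℂ) ≠ 0 := by exact_mod_cast Real.pi_ne_zero
      simp [this, hp]
    rw [integral_exp_mul_complex h2]
    have : Complex.exp (2 * Real.pi * Complex.I * (ν i : ℂ) * (1:ℝ)) = 1 := by
      rw [Complex.exp_eq_one_iff]; exact ⟨ν i, by push_cast; ring⟩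
    rw [this]; simp

open UpperHalfPlane in
lemma ed_ofc {j a F B} (E : ED j a F B) (w : ℂ) (hw : 0 < w.im) :
    (F (ofComplex w) = ∑' n : ℕ, a (n + 1) * Complex.exp (2 * Real.pi * Complex.I * (n + 1) * w)) ∧
    (Summable fun n : ℕ => ‖a (n + 1) * Complex.exp (2 * Real.pi * Complex.I * (n + 1) * w)‖) ∧
    ‖F (ofComplex w)‖ * w.im ^ j ≤ B := by
  have h1 := E.eq (ofComplex w)
  have h2 := E.sm (ofComplex w)
  have h3 := E.bd (ofComplex w)
  rw [ofComplex_apply_of_im_pos hw] at h1 h2 h3 ⊢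
  exact ⟨h1, h2, h3⟩

open UpperHalfPlane ComplexConjugate in
lemma ed_mix {j a F B} (E : ED j a F B) (p q : ℕ) (hp : 1 ≤ p) (hq : 1 ≤ q) (s t : ℝ) (h : ℤ) (y : ℝ) (hy : 0 < y) :
    (Summable fun i : ℕ × ℕ => ‖a (i.1+1)‖ * ‖a (i.2+1)‖ * Real.exp (-(2*Real.pi*y*(p*(i.1+1) + q*(i.2+1))))) ∧
    ∫ x in (0:ℝ)..1, F (ofComplex (p * (x + y * Complex.I) + s)) * conj (F (ofComplex (q * (x + y * Complex.I) + t)))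
        * Complex.exp (-(2 * Real.pi * Complex.I * h * x))
      = ∑' i : ℕ × ℕ, if (p:ℤ) * (i.1+1) - q * (i.2+1) - h = 0 then
          a (i.1+1) * conj (a (i.2+1)) * Complex.exp (2 * Real.pi * Complex.I * ((i.1+1) * s - (i.2+1)*t))
            * Real.exp (-(2*Real.pi*y*(p*(i.1+1) + q*(i.2+1)))) else 0 := by
  have hpos : ∀ (p : ℕ) (s x : ℝ), 1 ≤ p → 0 < ((p * (x + y * Complex.I) + s : ℂ)).im := by
    intro p s x hp
    have : (0:ℝ) < p := by exact_mod_cast hp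
    simp; positivity
  have hnt : ∀ (p : ℕ) (s x : ℝ) (n : ℕ), ‖a (n + 1) * Complex.exp (2 * Real.pi * Complex.I * (n + 1) * (p * (x + y * Complex.I) + s))‖
      = ‖a (n+1)‖ * Real.exp (-(2*Real.pi*y*(p*(n+1)))) := by
    intro p s x n
    rw [norm_mul, Complex.norm_exp]
    congr 2
    rw [show (2 * Real.pi * Complex.I * (n + 1) * (p * (x + y * Complex.I) + s) : ℂ) =
      Complex.I * ((2 * Real.pi * (n+1) : ℝ) * ((p * x + s : ℝ) + (p * y : ℝ) * Complex.I)) by push_cast; ring]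
    simp only [Complex.I_mul_re, Complex.mul_im, Complex.ofReal_re, Complex.ofReal_im, zero_mul, add_zero, Complex.add_im, Complex.I_im, Complex.I_re, mul_zero, mul_one, zero_add]
    ring
  have hs1 : Summable fun n : ℕ => ‖a (n+1)‖ * Real.exp (-(2*Real.pi*y*(p*(n+1)))) := by
    have := (ed_ofc E _ (hpos p s 0 hp)).2.1
    simpa only [hnt] using this
  have hs2 : Summable fun n : ℕ => ‖a (n+1)‖ * Real.exp (-(2*Real.pi*y*(q*(n+1)))) := by
    have := (ed_ofc E _ (hpos q t 0 hq)).2.1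
    simpa only [hnt] using this
  have hS : Summable fun i : ℕ × ℕ => ‖a (i.1+1)‖ * ‖a (i.2+1)‖ * Real.exp (-(2*Real.pi*y*(p*(i.1+1) + q*(i.2+1)))) := by
    have := hs1.mul_of_nonneg hs2 (fun _ => by positivity) (fun _ => by positivity)
    refine this.congr fun i => ?_
    rw [show -(2*Real.pi*y*(p*((i.1:ℝ)+1) + q*(i.2+1))) = -(2*Real.pi*y*(p*(i.1+1))) + -(2*Real.pi*y*(q*(i.2+1))) by ring, Real.exp_add]
    ring
  refine ⟨hS, ?_⟩
  rw [← int_trig (fun i : ℕ × ℕ => a (i.1+1) * conj (a (i.2+1)) * Complex.exp (2 * Real.pi * Complex.I * ((i.1+1) * s - (i.2+1)*t))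
            * Real.exp (-(2*Real.pi*y*(p*(i.1+1) + q*(i.2+1))))) (fun i => (p:ℤ) * (i.1+1) - q * (i.2+1) - h)]
  · congr 1; ext x
    rw [(ed_ofc E _ (hpos p s x hp)).1, (ed_ofc E _ (hpos q t x hq)).1, Complex.conj_tsum,
      tsum_mul_tsum_of_summable_norm (ed_ofc E _ (hpos p s x hp)).2.1 (by simpa using (ed_ofc E _ (hpos q t x hq)).2.1), ← tsum_mul_right]
    congr 1; ext i
    simp only [map_mul, ← Complex.exp_conj, Complex.conj_I, map_add, map_one, map_natCast, Complex.conj_ofReal, map_ofNat, Complex.ofReal_exp]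
    have h1 : ∀ A B C D E : ℂ, A * Complex.exp C * (B * Complex.exp D) * Complex.exp E = A * B * Complex.exp (C + D + E) := by
      intros; rw [Complex.exp_add, Complex.exp_add]; ring
    have h2 : ∀ A B C D E : ℂ, A * B * Complex.exp C * Complex.exp D * Complex.exp E = A * B * Complex.exp (C + D + E) := by
      intros; rw [Complex.exp_add, Complex.exp_add]; ring
    rw [h1, h2]
    congr 2
    push_cast
    linear_combination (2 * (Real.pi:ℂ) * y * (p * (i.1 + 1)+ q * (i.2+1))) * Complex.I_sq
  · refine hS.congr fun i => ?_
    rw [norm_mul, norm_mul, norm_mul, Complex.norm_conj, Complex.norm_real, Real.norm_of_nonneg (Real.exp_pos _).le,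
      show (2 * Real.pi * Complex.I * ((i.1+1) * s - (i.2+1)*t) : ℂ) = ((2 * Real.pi * ((i.1+1) * s - (i.2+1)*t) : ℝ) : ℂ) * Complex.I by push_cast; ring,
      Complex.norm_exp_ofReal_mul_I, mul_one]

open UpperHalfPlane ComplexConjugate in
lemma ed_parseval {j a F B} (E : ED j a F B) (y : ℝ) (hy : 0 < y) :
    (Summable fun n : ℕ => ‖a (n+1)‖^2 * Real.exp (-(4*Real.pi*y*(n+1)))) ∧
    ∑' n : ℕ, ‖a (n+1)‖^2 * Real.exp (-(4*Real.pi*y*(n+1))) ≤ B^2 / y^(2*j) := by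
  obtain ⟨hS, hI⟩ := ed_mix E 1 1 le_rfl le_rfl 0 0 0 y hy
  have hinj : Function.Injective (fun n : ℕ => (n, n)) := fun a b h => by simpa using h
  have hs' : Summable fun n : ℕ => ‖a (n+1)‖^2 * Real.exp (-(4*Real.pi*y*(n+1))) := by
    refine (hS.comp_injective hinj).congr fun n => ?_
    simp only [Function.comp]
    rw [sq]; congr 2; push_cast; ring
  refine ⟨hs', ?_⟩
  have e1 : (∑' i : ℕ × ℕ, if ((1:ℕ):ℤ) * (i.1+1) - ((1:ℕ):ℤ) * (i.2+1) - 0 = 0 then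
          a (i.1+1) * conj (a (i.2+1)) * Complex.exp (2 * Real.pi * Complex.I * ((i.1+1) * (0:ℝ) - (i.2+1)*(0:ℝ)))
            * Real.exp (-(2*Real.pi*y*((1:ℕ)*(i.1+1) + (1:ℕ)*(i.2+1)))) else 0)
      = ((∑' n : ℕ, ‖a (n+1)‖^2 * Real.exp (-(4*Real.pi*y*(n+1))) : ℝ) : ℂ) := by
    rw [Complex.ofReal_tsum]
    rw [← hinj.tsum_eq]
    · congr 1; ext n
      rw [if_pos (by ring)]
      rw [Complex.mul_conj, Complex.normSq_eq_norm_sq]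
      simp only [Complex.ofReal_zero, mul_zero, sub_zero, Complex.exp_zero, mul_one]
      push_cast
      congr 2; ring
    · intro i hi
      simp only [Function.mem_support, ne_eq, ite_eq_right_iff, not_forall] at hi
      obtain ⟨h1, _⟩ := hi
      refine ⟨i.1, ?_⟩
      ext <;> simp
      push_cast at h1
      omega
  rw [e1] at hI
  have hb : ‖((∑' n : ℕ, ‖a (n+1)‖^2 * Real.exp (-(4*Real.pi*y*(n+1))) : ℝ) : ℂ)‖ ≤ (B^2 / y^(2*j)) * |(1:ℝ) - 0| := by
    rw [← hI]
    apply intervalIntegral.norm_integral_le_of_norm_le_const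
    intro x _
    rw [norm_mul, norm_mul, Complex.norm_conj,
      show (-(2 * Real.pi * Complex.I * (0:ℤ) * x) : ℂ) = 0 by simp, Complex.exp_zero, norm_one, mul_one]
    have := (ed_ofc E ((1:ℕ) * (x + y * Complex.I) + (0:ℝ)) (by simpa using hy)).2.2
    have him : ((1:ℕ) * (x + y * Complex.I) + (0:ℝ) : ℂ).im = y := by simp
    rw [him] at this
    rw [le_div_iff₀ (by positivity), show y^(2*j) = y^j*y^j by ring]
    have h0 := norm_nonneg (F (ofComplex ((1:ℕ) * (x + y * Complex.I) + (0:ℝ))))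
    nlinarith [mul_le_mul this this (by positivity) E.Bpos.le]
  rw [Complex.norm_real] at hb
  exact (le_abs_self _).trans (by simpa using hb)

open MeasureTheory

/-- peak value of `t ^ j * exp (- 2 π t)`. -/
noncomputable def Om (j : ℕ) : ℝ := (j / (2 * Real.pi * Real.exp 1)) ^ j

lemma Om_pos {j : ℕ} (hj : 1 ≤ j) : 0 < Om j := by
  have : (0:ℝ) < j := by exact_mod_cast hj
  have := Real.pi_pos
  unfold Om; positivity

lemma Om_peak {j : ℕ} (hj : 1 ≤ j) (t : ℝ) (ht : 0 ≤ t) : t ^ j * Real.exp (-(2*Real.pi*t)) ≤ Om j := by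
  have hj0 : (0:ℝ) < j := by exact_mod_cast hj
  have hp := Real.pi_pos
  have h1 : 2 * Real.pi * t / j ≤ Real.exp (2*Real.pi*t/j - 1) := by
    have := Real.add_one_le_exp (2*Real.pi*t/j - 1); linarith
  have h2 := pow_le_pow_left₀ (by positivity) h1 j
  rw [← Real.exp_nat_mul] at h2
  have e : (j:ℝ) * (2*Real.pi*t/j - 1) = 2*Real.pi*t - j := by field_simp
  rw [e] at h2
  have e2 : Om j = (j/(2*Real.pi))^j * Real.exp (-j) := by
    unfold Om
    rw [← div_div, div_pow, ← Real.exp_nat_mul, mul_one, Real.exp_neg]; rfl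
  rw [e2]
  have e3 : t ^ j = (j/(2*Real.pi))^j * (2 * Real.pi * t / j)^j := by
    rw [← mul_pow]; congr 1; field_simp
  rw [e3, mul_assoc]
  apply mul_le_mul_of_nonneg_left _ (by positivity)
  calc _ ≤ Real.exp (2*Real.pi*t - j) * Real.exp (-(2*Real.pi*t)) := by gcongr
    _ = _ := by rw [← Real.exp_add]; congr 1; ring

lemma ed_coef {j a F B} (E : ED j a F B) (n : ℕ) (hn : 1 ≤ n) : ‖a n‖ ≤ B / Om j * n ^ j := by
  obtain ⟨n, rfl⟩ : ∃ m, n = m + 1 := ⟨n-1, by omega⟩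
  have hj := E.hj
  have hj0 : (0:ℝ) < j := by exact_mod_cast (by omega : 0 < j)
  have hp := Real.pi_pos
  have hn0 : (0:ℝ) < n+1 := by positivity
  obtain ⟨h1, h2⟩ := ed_parseval E (j / (2*Real.pi*(n+1))) (by positivity)
  have h3 := (h1.le_tsum n (fun _ _ => by positivity)).trans h2
  have e1 : -(4 * Real.pi * (j / (2 * Real.pi * (n+1))) * (n+1)) = -(2*j:ℝ) := by field_simp; ring
  rw [e1] at h3
  have hO := Om_pos (j := j) (by omega)
  have hsq : ‖a (n+1)‖^2 ≤ (B / Om j * ((n+1:ℕ):ℝ)^j)^2 := by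
    have e2 : (B / Om j * ((n+1:ℕ):ℝ)^j)^2 = B ^ 2 / (j / (2 * Real.pi * (n + 1))) ^ (2 * j) * Real.exp (2*j) := by
      unfold Om
      rw [show Real.exp (2*j:ℝ) = (Real.exp 1 ^ j)^2 by rw [← Real.exp_nat_mul, ← Real.exp_nat_mul]; congr 1; push_cast; ring]
      rw [pow_mul']
      simp only [div_pow, mul_pow]
      push_cast
      field_simp
    rw [e2]
    rw [Real.exp_neg] at h3
    rwa [mul_inv_le_iff₀ (Real.exp_pos _)] at h3
  exact abs_le_of_sq_le_sq' hsq (mul_nonneg (div_nonneg E.Bpos.le hO.le) (by positivity)) |>.2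

open UpperHalfPlane in
lemma ed_near {j a F B} (E : ED j a F B) : ∃ z : ℍ, (2:ℝ)/3 ≤ z.im ∧ B / 2 ≤ ‖F z‖ * z.im ^ j := by
  obtain ⟨z, hz⟩ := E.near
  obtain ⟨γ, hγ⟩ := ModularGroup.exists_smul_mem_fd z
  refine ⟨γ • z, ?_, ?_⟩
  · have := ModularGroup.three_le_four_mul_im_sq_of_mem_fd hγ
    nlinarith [(γ • z).im_pos]
  · rw [E.modu, ModularGroup.im_smul_eq_div_normSq, norm_mul, norm_pow, div_pow, Complex.normSq_eq_norm_sq, ← pow_mul]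
    have : ‖denom γ z‖ ≠ 0 := norm_ne_zero_iff.mpr (denom_ne_zero _ _)
    calc B/2 ≤ _ := hz
      _ = _ := by field_simp

open UpperHalfPlane in
lemma ed_sup {j a F B} (E : ED j a F B) : B / Om j ≤ 128 * (j:ℝ)^3 := by
  have hj := E.hj
  have hO := Om_pos (j := j) (by omega)
  have hp := Real.pi_pos
  set w := B / Om j with hw
  have hw0 : 0 < w := div_pos E.Bpos hO
  have hBw : B = w * Om j := by rw [hw]; field_simp
  set N := 2 * j with hN
  set A := ∑ n ∈ Finset.range N, ‖a (n+1)‖ / ((n+1:ℕ):ℝ)^j with hA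
  have hA0 : 0 ≤ A := Finset.sum_nonneg fun _ _ => by positivity
  -- first inequality
  have h1 : w ≤ 4 * A := by
    obtain ⟨z, hz, hB⟩ := ed_near E
    have hzp := z.im_pos
    have hterm : ∀ n : ℕ, ‖a (n + 1) * Complex.exp (2 * Real.pi * Complex.I * (n + 1) * (z : ℂ))‖ * z.im ^ j ≤
        (if n < N then Om j * (‖a (n+1)‖ / ((n+1:ℕ):ℝ)^j) else 0) + B/64 * ((1/2)^n) := by
      intro n
      rw [norm_term]
      have hn0 : (0:ℝ) < ((n+1:ℕ):ℝ) := by positivity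
      split_ifs with h
      · have := Om_peak (j := j) (by omega) (((n+1:ℕ):ℝ) * z.im) (by positivity)
        have e : ‖a (n+1)‖ * Real.exp (-(2 * Real.pi * (n+1) * z.im)) * z.im ^ j
          = (((n+1:ℕ):ℝ) * z.im)^j * Real.exp (-(2*Real.pi*(((n+1:ℕ):ℝ) * z.im))) * (‖a (n+1)‖ / ((n+1:ℕ):ℝ)^j) := by
          rw [mul_pow]; push_cast; rw [← mul_assoc (2*Real.pi)]
          have : ((n:ℝ)+1)^j ≠ 0 := by positivity
          field_simp
        rw [e]
        have h5 := mul_le_mul_of_nonneg_right this (show 0 ≤ ‖a (n+1)‖ / ((n+1:ℕ):ℝ)^j by positivity)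
        have := E.Bpos
        have : 0 ≤ B/64 * ((1/2)^n) := by positivity
        linarith
      · have h6 := Om_peak (j := j) (by omega) (((n+1:ℕ):ℝ) * z.im / 2) (by positivity)
        have h7 := ed_coef E (n+1) (by omega)
        have h8 : ‖a (n+1)‖ * Real.exp (-(2 * Real.pi * (n+1) * z.im)) * z.im ^ j ≤
          w * (2^j * Om j) * Real.exp (-(Real.pi * (n+1) * z.im)) := by
          calc _ ≤ (w * ((n+1:ℕ):ℝ)^j) * Real.exp (-(2 * Real.pi * (n+1) * z.im)) * z.im ^ j := by gcongr
            _ = w * (2^j * ((((n+1:ℕ):ℝ) * z.im / 2)^j * Real.exp (-(2*Real.pi*(((n+1:ℕ):ℝ) * z.im/2))))) * Real.exp (-(Real.pi * (n+1) * z.im)) := by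
              rw [show -(2 * Real.pi * ((n:ℝ)+1) * z.im) = -(2*Real.pi*(((n+1:ℕ):ℝ) * z.im/2)) + -(Real.pi * (n+1) * z.im) by push_cast; ring, Real.exp_add, div_pow, mul_pow]
              field_simp
            _ ≤ _ := by gcongr
        refine h8.trans ?_
        have h9 : (2:ℝ)^j ≤ Real.exp ((n+1)/2) := by
          calc (2:ℝ)^j ≤ (Real.exp 1)^j := pow_le_pow_left₀ (by norm_num) (by linarith [Real.add_one_le_exp (1:ℝ)]) _
            _ = Real.exp j := by rw [← Real.exp_nat_mul, mul_one]
            _ ≤ _ := by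
              apply Real.exp_le_exp.mpr
              have : (2 * j : ℝ) ≤ n := by exact_mod_cast (by omega : 2 * j ≤ n)
              linarith
        have h10 : Real.exp (-(Real.pi * (n+1) * z.im)) ≤ Real.exp (-(2*(n+1))) := by
          apply Real.exp_le_exp.mpr
          have : 2 ≤ Real.pi * z.im := by nlinarith [Real.pi_gt_three]
          nlinarith
        have h11 : (2:ℝ)^j * Real.exp (-(Real.pi * (n+1) * z.im)) ≤ 1/64 * (1/2)^n := by
          calc _ ≤ Real.exp ((n+1)/2) * Real.exp (-(2*(n+1))) := by gcongr
            _ = Real.exp (-(3*(n+1)/2)) := by rw [← Real.exp_add]; congr 1; ring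
            _ ≤ Real.exp (-((6 + n : ℕ):ℝ)) := by
              apply Real.exp_le_exp.mpr
              have : (12 : ℝ) ≤ n := by exact_mod_cast (by omega : 12 ≤ n)
              push_cast; linarith
            _ = (Real.exp (-1))^(6+n) := by rw [← Real.exp_nat_mul]; congr 1; ring
            _ ≤ (1/2)^(6+n) := by
              apply pow_le_pow_left₀ (Real.exp_pos _).le
              rw [Real.exp_neg, one_div]
              apply inv_anti₀ (by norm_num)
              linarith [Real.add_one_le_exp (1:ℝ)]
            _ = _ := by rw [pow_add]; norm_num
        rw [hBw, zero_add]
        have h12 := mul_le_mul_of_nonneg_left h11 (mul_pos hw0 hO).le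
        calc _ = w * Om j * (2 ^ j * Real.exp (-(Real.pi * (↑n + 1) * z.im))) := by ring
          _ ≤ _ := h12
          _ = _ := by ring
    have hs2 : Summable fun n : ℕ => (if n < N then Om j * (‖a (n+1)‖ / ((n+1:ℕ):ℝ)^j) else 0) :=
      summable_of_finite_support ((Finset.finite_toSet (Finset.range N)).subset (by
        intro n hn; simp only [Function.mem_support] at hn
        simp only [Finset.coe_range, Set.mem_Iio]; by_contra hc; simp [hc] at hn))
    have hs3 : Summable fun n : ℕ => B/64 * ((1/2:ℝ)^n) := (summable_geometric_of_lt_one (by norm_num) (by norm_num)).mul_left _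
    have h2 : ‖F z‖ * z.im ^ j ≤ Om j * A + B/32 := by
      calc ‖F z‖ * z.im^j ≤ (∑' n : ℕ, ‖a (n + 1) * Complex.exp (2 * Real.pi * Complex.I * (n + 1) * (z : ℂ))‖) * z.im^j := by
            gcongr; rw [E.eq z]; exact norm_tsum_le_tsum_norm (E.sm z)
        _ = ∑' n : ℕ, ‖a (n + 1) * Complex.exp (2 * Real.pi * Complex.I * (n + 1) * (z : ℂ))‖ * z.im^j := tsum_mul_right.symm
        _ ≤ _ := ((E.sm z).mul_right _).tsum_le_tsum hterm (hs2.add hs3)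
        _ = (∑' n : ℕ, (if n < N then Om j * (‖a (n+1)‖ / ((n+1:ℕ):ℝ)^j) else 0)) + ∑' n : ℕ, B/64 * ((1/2:ℝ)^n) := hs2.tsum_add hs3
        _ = Om j * A + B/32 := by
          congr 1
          · rw [tsum_eq_sum (s := Finset.range N) (fun n hn => by simp at hn; simp [hn]), hA, Finset.mul_sum]
            exact Finset.sum_congr rfl fun n hn => by simp at hn; simp [hn]
          · rw [tsum_mul_left, tsum_geometric_two]; ring
    have h3 : w * Om j / 4 ≤ Om j * A := by rw [← hBw]; linarith [E.Bpos]
    nlinarith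
  have h2 : A^2 ≤ w * (N:ℝ)^3 := by
    rw [sq, hA, Finset.sum_mul_sum]
    have hterm : ∀ m ∈ Finset.range N, ∀ n ∈ Finset.range N, ‖a (m+1)‖ / ((m+1:ℕ):ℝ)^j * (‖a (n+1)‖ / ((n+1:ℕ):ℝ)^j) ≤ w * N := by
      intro m hm n hn
      have hm' : m < N := by simpa using hm
      have e : ‖a (m+1)‖ * ‖a (n+1)‖ ≤ (((m+1:ℕ):ℝ)^j * ((n+1:ℕ):ℝ)^j) * (w * N) := by
        rw [← norm_mul, E.hecke _ _ (by omega) (by omega)]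
        have hcard : ((Nat.gcd (m+1) (n+1)).divisors.card : ℝ) ≤ N := by
          have h1 := Nat.card_divisors_le_self (Nat.gcd (m+1) (n+1))
          have h2 := Nat.gcd_le_left (n+1) (show 0 < m+1 by omega)
          exact_mod_cast (by omega)
        calc _ ≤ ∑ d ∈ (Nat.gcd (m+1) (n+1)).divisors, ‖(d : ℂ) ^ (2 * j - 1) * a ((m+1) * (n+1) / d ^ 2)‖ := norm_sum_le _ _
          _ ≤ ∑ d ∈ (Nat.gcd (m+1) (n+1)).divisors, (((m+1:ℕ):ℝ)^j * ((n+1:ℕ):ℝ)^j) * w := by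
            apply Finset.sum_le_sum
            intro d hd
            have hd' := Nat.dvd_of_mem_divisors hd
            have hd1 : d ∣ m+1 := hd'.trans (Nat.gcd_dvd_left _ _)
            have hd2 : d ∣ n+1 := hd'.trans (Nat.gcd_dvd_right _ _)
            obtain ⟨u, hu⟩ := hd1
            obtain ⟨v, hv⟩ := hd2
            have hdp : 0 < d := Nat.pos_of_mem_divisors hd
            have hup : 0 < u := by rcases Nat.eq_zero_or_pos u with h | h; · simp [h] at hu
                                   · exact h
            have hvp : 0 < v := by rcases Nat.eq_zero_or_pos v with h | h; · simp [h] at hv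
                                   · exact h
            rw [hu, hv, show d * u * (d * v) = u * v * d^2 by ring, Nat.mul_div_cancel _ (by positivity)]
            rw [norm_mul, norm_pow, Complex.norm_natCast]
            have hd1 : (1:ℝ) ≤ d := by exact_mod_cast hdp
            calc (d:ℝ)^(2*j-1) * ‖a (u*v)‖ ≤ (d:ℝ)^(2*j) * (w * ((u*v:ℕ):ℝ)^j) := 
                  mul_le_mul (pow_le_pow_right₀ hd1 (by omega)) (ed_coef E (u*v) (Nat.mul_pos hup hvp)) (norm_nonneg _) (by positivity)
              _ = _ := by push_cast; rw [pow_mul]; simp only [mul_pow]; ring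
          _ = ((Nat.gcd (m+1) (n+1)).divisors.card : ℝ) * ((((m+1:ℕ):ℝ)^j * ((n+1:ℕ):ℝ)^j) * w) := by rw [Finset.sum_const, nsmul_eq_mul]
          _ ≤ N * ((((m+1:ℕ):ℝ)^j * ((n+1:ℕ):ℝ)^j) * w) := by gcongr
          _ = _ := by ring
      rw [div_mul_div_comm, div_le_iff₀ (by positivity)]
      linarith
    calc _ ≤ ∑ m ∈ Finset.range N, ∑ n ∈ Finset.range N, w * (N:ℝ) := Finset.sum_le_sum fun m hm => Finset.sum_le_sum fun n hn => hterm m hm n hn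
      _ = _ := by simp; ring
  have h3 : w * w ≤ w * (128 * (j:ℝ)^3) := by
    have : w * w ≤ 16 * A^2 := by nlinarith
    have e : (N:ℝ)^3 = 8 * j^3 := by rw [hN]; push_cast; ring
    rw [e] at h2
    nlinarith
  exact le_of_mul_le_mul_left h3 hw0

open MeasureTheory ComplexConjugate

section unf
variable {G α : Type*} [Group G] [Countable G] [MeasurableSpace α] [MulAction G α]

lemma meas_tsum {ι : Type*} [Countable ι] (f : ι → α → ℂ) (hf : ∀ i, Measurable (f i)) (hs : ∀ z, Summable fun i => f i z) :
    Measurable fun z => ∑' i, f i z := by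
  refine measurable_of_tendsto_metrizable' (Filter.atTop : Filter (Finset ι)) (f := fun s z => ∑ i ∈ s, f i z) (fun s => ?_) ?_
  · exact Finset.measurable_sum _ (fun i _ => hf i)
  · rw [tendsto_pi_nhds]; intro z; exact (hs z).hasSum

lemma unf (μ : Measure α) [MeasurableConstSMul G α] [SMulInvariantMeasure G α μ]
    (w : α → ℝ) (hw : Measurable w) (hw0 : ∀ z, 0 ≤ w z) (hs : ∀ z, HasSum (fun g : G => w (g • z)) 1)
    (φ : α → ℂ) (hφm : Measurable φ) (hφ : Integrable φ μ) :
    ∫ z, φ z ∂μ = ∫ z, ∑' g : G, (w z : ℂ) * φ (g • z) ∂μ := by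
  have hwg : ∀ g : G, Measurable fun z => w (g • z) := fun g => hw.comp (measurable_const_smul g)
  have hle : ∀ (g : G) z, w (g • z) ≤ 1 := fun g z => le_hasSum (hs z) g (fun _ _ => hw0 _)
  have inv : ∀ (g : G) {E : Type} [NormedAddCommGroup E] [NormedSpace ℝ E] (f : α → E), ∫ z, f (g • z) ∂μ = ∫ z, f z ∂μ := by
    intro g E _ _ f
    exact integral_smul_eq_self f
  have h1 : HasSum (fun g : G => ∫ z, (w (g • z) : ℂ) * φ z ∂μ) (∫ z, φ z ∂μ) := by
    refine hasSum_integral_of_dominated_convergence (fun g z => w (g • z) * ‖φ z‖) (fun g => ?_) (fun g => ?_) ?_ ?_ ?_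
    · exact ((Complex.measurable_ofReal.comp (hwg g)).mul hφm).aestronglyMeasurable
    · refine Filter.Eventually.of_forall fun z => ?_
      rw [norm_mul, Complex.norm_real, Real.norm_of_nonneg (hw0 _)]
    · exact Filter.Eventually.of_forall fun z => (hs z).summable.mul_right _
    · refine hφ.norm.congr (Filter.Eventually.of_forall fun z => ?_)
      simp only [tsum_mul_right, (hs z).tsum_eq, one_mul]
    · refine Filter.Eventually.of_forall fun z => ?_
      have := (Complex.hasSum_ofReal.mpr (hs z)).mul_right (φ z)
      simpa using this
  have h2 : HasSum (fun g : G => ∫ z, w (g • z) * ‖φ z‖ ∂μ) (∫ z, ‖φ z‖ ∂μ) := by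
    refine hasSum_integral_of_dominated_convergence (fun g z => w (g • z) * ‖φ z‖) (fun g => ?_) (fun g => ?_) ?_ ?_ ?_
    · exact ((hwg g).mul hφm.norm).aestronglyMeasurable
    · refine Filter.Eventually.of_forall fun z => ?_
      rw [Real.norm_of_nonneg (mul_nonneg (hw0 _) (norm_nonneg _))]
    · exact Filter.Eventually.of_forall fun z => (hs z).summable.mul_right _
    · refine hφ.norm.congr (Filter.Eventually.of_forall fun z => ?_)
      simp only [tsum_mul_right, (hs z).tsum_eq, one_mul]
    · refine Filter.Eventually.of_forall fun z => ?_
      have := (hs z).mul_right (‖φ z‖)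
      simpa using this
  have e1 : ∀ g : G, ∫ z, (w z : ℂ) * φ (g • z) ∂μ = ∫ z, (w (g⁻¹ • z) : ℂ) * φ z ∂μ := by
    intro g
    rw [← inv g (fun z => (w (g⁻¹ • z) : ℂ) * φ z)]
    simp
  have e2 : ∀ g : G, ∫ z, w z * ‖φ (g • z)‖ ∂μ = ∫ z, w (g⁻¹ • z) * ‖φ z‖ ∂μ := by
    intro g
    rw [← inv g (fun z => w (g⁻¹ • z) * ‖φ z‖)]
    simp
  have hint : ∀ g : G, Integrable (fun z => (w z : ℂ) * φ (g • z)) μ := by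
    intro g
    have hφg : Integrable (fun z => φ (g • z)) μ := (measurePreserving_smul g μ).integrable_comp_of_integrable hφ
    refine Integrable.mono hφg ((Complex.measurable_ofReal.comp hw).mul (hφm.comp (measurable_const_smul g))).aestronglyMeasurable ?_
    refine Filter.Eventually.of_forall fun z => ?_
    rw [norm_mul, Complex.norm_real, Real.norm_of_nonneg (hw0 _)]
    have := hle 1 z
    rw [one_smul] at this
    exact mul_le_of_le_one_left (norm_nonneg _) this
  have h3 := hasSum_integral_of_summable_integral_norm hint (by
    have : (fun g : G => ∫ z, ‖(w z : ℂ) * φ (g • z)‖ ∂μ) = fun g => ∫ z, w (g⁻¹ • z) * ‖φ z‖ ∂μ := by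
      ext g
      rw [← e2]
      congr 1; ext z
      rw [norm_mul, Complex.norm_real, Real.norm_of_nonneg (hw0 _)]
    rw [this]
    exact ((Equiv.inv G).summable_iff (f := fun g : G => ∫ z, w (g • z) * ‖φ z‖ ∂μ)).mpr h2.summable)
  rw [← h3.tsum_eq, ← h1.tsum_eq, ← (Equiv.inv G).tsum_eq]
  congr 1; ext g
  rw [e1]; rfl

lemma unf_CS (μ : Measure α) [MeasurableConstSMul G α] [SMulInvariantMeasure G α μ]
    (w : α → ℝ) (hw : Measurable w) (hw0 : ∀ z, 0 ≤ w z) (hs : ∀ z, HasSum (fun g : G => w (g • z)) 1)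
    (hwI : Integrable w μ) (V : α → ℂ) (hVm : Measurable V) (hV : ∀ (g : G) z, V (g • z) = V z) (B : ℝ) (hB0 : 0 ≤ B) (hB : ∀ z, ‖V z‖ ≤ B)
    (Φ : α → ℂ) (hΦm : Measurable Φ) (hΦ : Integrable Φ μ) (hΦ1 : ∀ z, ‖Φ z‖ ≤ 1)
    (S : Finset G) (hS : ∀ (g : G) z, Φ z ≠ 0 → Φ (g • z) ≠ 0 → g ∈ S) :
    ‖∫ z, V z * Φ z ∂μ‖ ^ 2 ≤ B ^ 2 * (∫ z, w z ∂μ) * ‖∑ g ∈ S, ∫ z, conj (Φ z) * Φ (g • z) ∂μ‖ := by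
  classical
  have hle : ∀ z, w z ≤ 1 := fun z => by
    have := le_hasSum (hs z) 1 (fun _ _ => hw0 _); rwa [one_smul] at this
  -- finiteness
  have hfin : ∀ z, ∃ T : Finset G, T.card ≤ S.card ∧ ∀ g ∉ T, Φ (g • z) = 0 := by
    intro z
    by_cases h : ∃ g0 : G, Φ (g0 • z) ≠ 0
    · obtain ⟨g0, hg0⟩ := h
      refine ⟨S.image (· * g0), Finset.card_image_le, fun g hg => ?_⟩
      by_contra hne
      apply hg
      rw [Finset.mem_image]
      refine ⟨g * g0⁻¹, hS _ (g0 • z) hg0 ?_, by group⟩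
      rwa [smul_smul, inv_mul_cancel_right]
    · push Not at h
      exact ⟨∅, by simp, fun g _ => h g⟩
  have hsumm : ∀ z, Summable fun g : G => Φ (g • z) := by
    intro z
    obtain ⟨T, _, hT⟩ := hfin z
    exact summable_of_ne_finset_zero (s := T) hT
  set P : α → ℂ := fun z => ∑' g : G, Φ (g • z) with hP
  have hPm : Measurable P := meas_tsum _ (fun g => hΦm.comp (measurable_const_smul g)) hsumm
  have hPinv : ∀ (g : G) z, P (g • z) = P z := by
    intro g z
    simp only [hP, smul_smul]
    exact (Equiv.mulRight g).tsum_eq (fun h => Φ (h • z))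
  have hPb : ∀ z, ‖P z‖ ≤ S.card := by
    intro z
    obtain ⟨T, hTc, hT⟩ := hfin z
    simp only [hP]
    rw [tsum_eq_sum (s := T) hT]
    calc _ ≤ ∑ g ∈ T, ‖Φ (g • z)‖ := norm_sum_le _ _
      _ ≤ ∑ g ∈ T, (1:ℝ) := Finset.sum_le_sum fun g _ => hΦ1 _
      _ = T.card := by simp
      _ ≤ _ := by exact_mod_cast hTc
  have i1 : Integrable (fun z => w z * ‖P z‖) μ := by
    refine hwI.mul_bdd (c := S.card) hPm.norm.aestronglyMeasurable ?_
    exact Filter.Eventually.of_forall fun z => by rw [norm_norm]; exact hPb z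
  have i2 : Integrable (fun z => w z * ‖P z‖^2) μ := by
    refine hwI.mul_bdd (c := (S.card:ℝ)^2) (hPm.norm.pow_const 2).aestronglyMeasurable ?_
    exact Filter.Eventually.of_forall fun z => by rw [norm_pow, norm_norm]; exact pow_le_pow_left₀ (norm_nonneg _) (hPb z) 2
  -- first
  have h1 : ‖∫ z, V z * Φ z ∂μ‖ ≤ B * ∫ z, w z * ‖P z‖ ∂μ := by
    rw [unf (G := G) μ w hw hw0 hs (fun z => V z * Φ z) (hVm.mul hΦm)
      (hΦ.bdd_mul hVm.aestronglyMeasurable (Filter.Eventually.of_forall hB)), ← integral_const_mul]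
    refine norm_integral_le_of_norm_le (i1.const_mul B) (Filter.Eventually.of_forall fun z => ?_)
    have : ∑' g : G, (w z : ℂ) * (V (g • z) * Φ (g • z)) = w z * V z * P z := by
      simp only [hV, hP, ← mul_assoc, tsum_mul_left]
    rw [this, norm_mul, norm_mul, Complex.norm_real, Real.norm_of_nonneg (hw0 z)]
    have := hB z
    have h0 := hw0 z
    calc w z * ‖V z‖ * ‖P z‖ ≤ w z * B * ‖P z‖ := by gcongr
      _ = _ := by ring
  have h2 : ((∫ z, w z * ‖P z‖^2 ∂μ : ℝ) : ℂ) = ∑ g ∈ S, ∫ z, conj (Φ z) * Φ (g • z) ∂μ := by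
    have hci : Integrable (fun z => conj (Φ z)) μ := by
      refine hΦ.mono (Complex.continuous_conj.measurable.comp hΦm).aestronglyMeasurable (Filter.Eventually.of_forall fun z => by simp)
    have hφ : Integrable (fun z => conj (Φ z) * P z) μ :=
      hci.mul_bdd (c := S.card) hPm.aestronglyMeasurable (Filter.Eventually.of_forall hPb)
    have u := unf (G := G) μ w hw hw0 hs (fun z => conj (Φ z) * P z) ((Complex.continuous_conj.measurable.comp hΦm).mul hPm) hφ
    have e : ∀ z, ∑' g : G, (w z : ℂ) * (conj (Φ (g • z)) * P (g • z)) = ((w z * ‖P z‖^2 : ℝ) : ℂ) := by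
      intro z
      simp only [hPinv, ← mul_assoc]
      rw [tsum_mul_right, tsum_mul_left, ← Complex.conj_tsum, mul_assoc, ← Complex.normSq_eq_conj_mul_self, Complex.normSq_eq_norm_sq]
      push_cast; rfl
    simp only [e] at u
    rw [integral_complex_ofReal] at u
    rw [← u, ← integral_finsetSum]
    · congr 1; ext z
      by_cases hz : Φ z = 0
      · simp [hz]
      · simp only [hP]
        rw [tsum_eq_sum (s := S) (fun g hg => by by_contra hne; exact hg (hS g z hz hne)), Finset.mul_sum]
    · intro g _
      exact hci.mul_bdd (c := 1) (hΦm.comp (measurable_const_smul g)).aestronglyMeasurable (Filter.Eventually.of_forall fun z => hΦ1 _)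
  have h3 : (∫ z, w z * ‖P z‖ ∂μ)^2 ≤ (∫ z, w z ∂μ) * ∫ z, w z * ‖P z‖^2 ∂μ := by
    have hq : ∀ s : ℝ, 0 ≤ (∫ z, w z ∂μ) * (s * s) + (-2 * ∫ z, w z * ‖P z‖ ∂μ) * s + ∫ z, w z * ‖P z‖^2 ∂μ := by
      intro s
      have : (∫ z, w z ∂μ) * (s * s) + (-2 * ∫ z, w z * ‖P z‖ ∂μ) * s + ∫ z, w z * ‖P z‖^2 ∂μ = ∫ z, w z * (s - ‖P z‖)^2 ∂μ := by
        have : (fun z => w z * (s - ‖P z‖)^2) = fun z => ((s*s) * w z + (-2*s) * (w z * ‖P z‖)) + w z * ‖P z‖^2 := by ext z; ring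
        have i3 : Integrable (fun z => (s*s) * w z + (-2*s) * (w z * ‖P z‖)) μ := (hwI.const_mul _).add (i1.const_mul _)
        rw [this, integral_add i3 i2, integral_add (hwI.const_mul _) (i1.const_mul _), integral_const_mul, integral_const_mul]
        ring
      rw [this]
      exact integral_nonneg fun z => mul_nonneg (hw0 z) (sq_nonneg _)
    have := discrim_le_zero hq
    unfold discrim at this
    nlinarith
  rw [← h2, Complex.norm_real, Real.norm_of_nonneg (integral_nonneg fun z => mul_nonneg (hw0 z) (sq_nonneg _))]
  calc _ ≤ (B * ∫ z, w z * ‖P z‖ ∂μ)^2 := pow_le_pow_left₀ (norm_nonneg _) h1 2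
    _ = B^2 * (∫ z, w z * ‖P z‖ ∂μ)^2 := by ring
    _ ≤ B^2 * ((∫ z, w z ∂μ) * ∫ z, w z * ‖P z‖^2 ∂μ) := by gcongr
    _ = _ := by ring
end unf

open MeasureTheory UpperHalfPlane
open scoped MatrixGroups

lemma sl_coe (γ : SL(2, ℤ)) (z : ℍ) : ((γ • z : ℍ) : ℂ) = ((γ 0 0 : ℂ) * z + γ 0 1) / ((γ 1 0 : ℂ) * z + γ 1 1) := by
  rw [UpperHalfPlane.specialLinearGroup_apply]; simp

lemma sl_im (γ : SL(2, ℤ)) (z : ℍ) : (γ • z : ℍ).im = z.im / (((γ 1 0 : ℝ) * z.re + γ 1 1)^2 + ((γ 1 0:ℝ) * z.im)^2) := by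
  rw [ModularGroup.im_smul_eq_div_normSq]
  congr 1
  rw [ModularGroup.denom_apply, Complex.normSq_apply]
  simp; ring

lemma fin_entries (N : ℤ) : Set.Finite {γ : SL(2, ℤ) | ∀ i j, |γ i j| ≤ N} := by
  have : Set.Finite {m : Fin 2 → Fin 2 → ℤ | ∀ i j, m i j ∈ Set.Icc (-N) N} := by
    have h := Set.Finite.pi' (fun _ : Fin 2 => Set.Finite.pi' (fun _ : Fin 2 => Set.finite_Icc (-N) N))
    exact h
  refine Set.Finite.of_finite_image (f := fun γ : SL(2, ℤ) => fun i j => γ i j) (this.subset ?_) ?_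
  · rintro _ ⟨γ, hγ, rfl⟩ i j
    exact Set.mem_Icc.mpr (abs_le.mp (hγ i j))
  · intro γ _ γ' _ h
    ext i j
    exact congrFun (congrFun h i) j

lemma low_bd (y1 R : ℝ) (hy1 : 0 < y1) (γ : SL(2, ℤ)) (z : ℍ) (h1 : |z.re| ≤ R) (h2 : y1 ≤ z.im) (h3 : y1 ≤ (γ • z).im) (hc : γ 1 0 ≠ 0) :
    |(γ 1 1 : ℝ)| ≤ (1 + R) / y1 ∧ |(γ 1 0 : ℝ)| ≤ 1 / y1 := by
  have hy := z.im_pos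
  rw [sl_im] at h3
  have hC1 : (1:ℝ) ≤ |(γ 1 0 : ℝ)| := by
    have : (1:ℤ) ≤ |γ 1 0| := Int.one_le_abs hc
    exact_mod_cast this
  generalize (γ 1 0 : ℝ) = C at *
  generalize (γ 1 1 : ℝ) = D at *
  have hpos : 0 < (C * z.re + D)^2 + (C * z.im)^2 := by
    have : C ≠ 0 := by rintro rfl; simp at hC1; linarith
    positivity
  rw [le_div_iff₀ hpos] at h3
  have hC2 : 1 ≤ C^2 := by rw [← sq_abs]; nlinarith
  have h4 : y1 * C^2 * z.im ≤ 1 := by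
    by_contra hh; push Not at hh
    nlinarith [mul_nonneg hy1.le (sq_nonneg (C * z.re + D)), mul_lt_mul_of_pos_right hh hy]
  have h5 : |C| ≤ 1 / y1 := by
    apply abs_le_of_sq_le_sq _ (by positivity)
    rw [div_pow, le_div_iff₀ (by positivity)]
    nlinarith [mul_le_mul_of_nonneg_left h2 (mul_nonneg hy1.le (sq_nonneg C))]
  have h6 : y1 * z.im ≤ 1 := by nlinarith [mul_pos hy1 hy]
  have h7 : |C * z.re + D| ≤ 1 / y1 := by
    apply abs_le_of_sq_le_sq _ (by positivity)
    rw [div_pow, le_div_iff₀ (by positivity)]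
    nlinarith [mul_nonneg hy1.le (sq_nonneg (C * z.im))]
  refine ⟨?_, h5⟩
  calc |D| = |(C * z.re + D) - C * z.re| := by ring_nf
    _ ≤ |C * z.re + D| + |C| * |z.re| := by rw [← abs_mul]; exact abs_sub _ _
    _ ≤ 1 / y1 + 1 / y1 * R := by gcongr
    _ = _ := by ring

lemma fin_SL (y1 R : ℝ) (hy1 : 0 < y1) : Set.Finite {γ : SL(2, ℤ) | ∃ z : ℍ, |z.re| ≤ R ∧ y1 ≤ z.im ∧ |(γ • z).re| ≤ R ∧ y1 ≤ (γ • z).im} := by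
  obtain ⟨N, hN⟩ := exists_nat_gt ((1 + R) / y1)
  obtain ⟨N', hN'⟩ := exists_nat_gt (1 / y1)
  obtain ⟨N'', hN''⟩ := exists_nat_gt (2 * R)
  refine (fin_entries (N * N + 1 + N' + N'' + N)).subset ?_
  rintro γ ⟨z, h1, h2, h3, h4⟩
  have hdet := γ.det_coe
  rw [Matrix.det_fin_two] at hdet
  by_cases hc : γ 1 0 = 0
  · rw [hc] at hdet
    have h0 : 0 ≤ R := (abs_nonneg _).trans h1
    have hAD : γ 0 0 * γ 1 1 = 1 := by linarith
    have hB : |γ 0 1| ≤ N'' := by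
      have e := sl_coe γ z
      rw [hc] at e
      clear h4
      generalize γ • z = w at *
      rcases Int.mul_eq_one_iff_eq_one_or_neg_one.mp hAD with ⟨ha, hd⟩ | ⟨ha, hd⟩
      · rw [ha, hd] at e
        have e2 := congrArg Complex.re e
        simp at e2
        have : |(γ 0 1 : ℝ)| < N'' := by
          have : (γ 0 1 : ℝ) = w.re - z.re := by linarith
          rw [this]
          exact (abs_sub _ _).trans_lt (by linarith)
        exact_mod_cast this.le
      · rw [ha, hd] at e
        have e2 := congrArg Complex.re e
        simp [div_neg] at e2
        have : |(γ 0 1 : ℝ)| < N'' := by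
          have : (γ 0 1 : ℝ) = z.re - w.re := by linarith
          rw [this]
          exact (abs_sub _ _).trans_lt (by linarith)
        exact_mod_cast this.le
    have hA : |γ 0 0| = 1 ∧ |γ 1 1| = 1 := by
      rcases Int.mul_eq_one_iff_eq_one_or_neg_one.mp hAD with ⟨ha, hd⟩ | ⟨ha, hd⟩ <;> rw [ha, hd] <;> simp
    have h00 : (0:ℤ) ≤ N * N := by positivity
    intro i j
    fin_cases i <;> fin_cases j <;> simp only [Fin.mk_zero, Fin.mk_one, Fin.zero_eta, Fin.isValue]
    · rw [hA.1]; omega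
    · omega
    · rw [hc, abs_zero]; omega
    · rw [hA.2]; omega
  · obtain ⟨hD, hC⟩ := low_bd y1 R hy1 γ z h1 h2 h4 hc
    have hA := (low_bd y1 R hy1 γ⁻¹ (γ • z) h3 h4 (by rw [inv_smul_smul]; exact h2) (by
      rw [Matrix.SpecialLinearGroup.SL2_inv_expl]; simpa using hc)).1
    rw [Matrix.SpecialLinearGroup.SL2_inv_expl] at hA
    simp at hA
    have hD' : |γ 1 1| ≤ N := by exact_mod_cast (hD.trans hN.le)
    have hA' : |γ 0 0| ≤ N := by exact_mod_cast (hA.trans hN.le)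
    have hC' : |γ 1 0| ≤ N' := by exact_mod_cast (hC.trans hN'.le)
    have hB' : |γ 0 1| ≤ N * N + 1 := by
      calc |γ 0 1| ≤ |γ 0 1| * |γ 1 0| := le_mul_of_one_le_right (abs_nonneg _) (Int.one_le_abs hc)
        _ = |γ 0 0 * γ 1 1 - 1| := by rw [← abs_mul]; congr 1; linarith
        _ ≤ |γ 0 0| * |γ 1 1| + 1 := by rw [← abs_mul]; simpa using abs_sub (γ 0 0 * γ 1 1) 1
        _ ≤ _ := by gcongr
    have h00 : (0:ℤ) ≤ N * N := by positivity
    intro i j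
    fin_cases i <;> fin_cases j <;> simp only [Fin.mk_zero, Fin.mk_one, Fin.zero_eta, Fin.isValue] <;> omega

instance : SMulInvariantMeasure SL(2, ℤ) ℍ volume := ⟨fun c s hs => by
  have := SMulInvariantMeasure.measure_preimage_smul (μ := (volume : Measure ℍ)) (c : GL (Fin 2) ℝ) hs
  exact this⟩
instance : MeasurableConstSMul SL(2, ℤ) ℍ := ⟨fun c => (continuous_const_smul (c : GL (Fin 2) ℝ)).measurable⟩

instance (G : Subgroup SL(2, ℤ)) : SMulInvariantMeasure G ℍ volume := ⟨fun c s hs => 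
  SMulInvariantMeasure.measure_preimage_smul (μ := (volume : Measure ℍ)) (c : SL(2, ℤ)) hs⟩
instance (G : Subgroup SL(2, ℤ)) : MeasurableConstSMul G ℍ := ⟨fun c => measurable_const_smul (c : SL(2, ℤ))⟩
instance : Countable SL(2, ℤ) := by
  have h : Countable (Fin 2 → ℤ) := by infer_instance
  have h2 : Countable (Fin 2 → Fin 2 → ℤ) := by infer_instance
  have : Countable (Matrix (Fin 2) (Fin 2) ℤ) := h2
  exact Subtype.countable

open MeasureTheory UpperHalfPlane
open scoped MatrixGroups

lemma meas_H : Measurable (fun z : ℍ => (z.re, z.im)) :=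
  (UpperHalfPlane.continuous_re.prodMk UpperHalfPlane.continuous_im).measurable

lemma map_H : Measure.map (fun z : ℍ => (z.re, z.im)) volume =
    ((volume : Measure (ℝ × ℝ)).restrict {p | 0 < p.2}).withDensity (fun p => ENNReal.ofReal (1 / p.2 ^ 2)) := by
  have hU : MeasurableSet {p : ℝ × ℝ | 0 < p.2} := measurableSet_lt measurable_const measurable_snd
  ext s hs
  rw [Measure.map_apply meas_H hs, UpperHalfPlane.volume_eq_lintegral, withDensity_apply _ hs, Measure.restrict_restrict hs]
  have e : ((↑) : ℍ → ℂ) '' ((fun z : ℍ => (z.re, z.im)) ⁻¹' s) = Complex.measurableEquivRealProd ⁻¹' (s ∩ {p | 0 < p.2}) := by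
    ext w
    simp only [Set.mem_image, Set.mem_preimage, Set.mem_inter_iff, Set.mem_setOf_eq]
    constructor
    · rintro ⟨z, hz, rfl⟩
      exact ⟨hz, z.im_pos⟩
    · rintro ⟨h1, h2⟩
      exact ⟨⟨w, h2⟩, h1, rfl⟩
  rw [e, ← Complex.volume_preserving_equiv_real_prod.setLIntegral_comp_preimage (hs.inter hU) (by fun_prop)]
  apply lintegral_congr
  intro w
  rw [show (Complex.measurableEquivRealProd w).2 = w.im from rfl]
  rw [ENNReal.ofReal, ENNReal.coe_inj]
  ext
  rw [Real.coe_toNNReal _ (by positivity)]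
  simp

lemma int_H (f : ℝ × ℝ → ℂ) (hf : Measurable f) : ∫ z : ℍ, f (z.re, z.im) = ∫ p in {p : ℝ × ℝ | 0 < p.2}, ((1 / p.2 ^ 2 : ℝ) : ℂ) * f p := by
  rw [← integral_map (φ := fun z : ℍ => (z.re, z.im)) meas_H.aemeasurable (f := f) hf.aestronglyMeasurable, map_H]
  rw [integral_withDensity_eq_integral_toReal_smul (by fun_prop) (by simp)]
  refine integral_congr_ae (Filter.Eventually.of_forall fun p => ?_)
  simp only
  rw [ENNReal.toReal_ofReal (by positivity)]; simp

lemma vol_rect (a b s t : ℝ) (hs : 0 < s) (hst : s ≤ t) (hab : a ≤ b) :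
    (volume {z : ℍ | (a ≤ z.re ∧ z.re ≤ b) ∧ (s ≤ z.im ∧ z.im ≤ t)}) ≤ ENNReal.ofReal ((b - a) * (t - s) / s ^ 2) := by
  have hm : MeasurableSet (Set.Icc a b ×ˢ Set.Icc s t) := measurableSet_Icc.prod measurableSet_Icc
  have : {z : ℍ | (a ≤ z.re ∧ z.re ≤ b) ∧ (s ≤ z.im ∧ z.im ≤ t)} = (fun z : ℍ => (z.re, z.im)) ⁻¹' (Set.Icc a b ×ˢ Set.Icc s t) := by
    ext z; simp; tauto
  rw [this, ← Measure.map_apply meas_H hm, map_H, withDensity_apply _ hm]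
  calc _ ≤ ∫⁻ p in Set.Icc a b ×ˢ Set.Icc s t, ENNReal.ofReal (1 / s ^ 2) ∂((volume : Measure (ℝ × ℝ)).restrict {p | 0 < p.2}) := by
        refine setLIntegral_mono measurable_const fun p hp => ?_
        apply ENNReal.ofReal_le_ofReal
        have := hp.2.1
        gcongr
    _ = ENNReal.ofReal (1 / s ^ 2) * ((volume : Measure (ℝ × ℝ)).restrict {p | 0 < p.2}) (Set.Icc a b ×ˢ Set.Icc s t) := by
        rw [setLIntegral_const]
    _ ≤ ENNReal.ofReal (1 / s ^ 2) * (volume : Measure (ℝ × ℝ)) (Set.Icc a b ×ˢ Set.Icc s t) := by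
        gcongr; exact Measure.restrict_le_self
    _ = _ := by
        rw [Measure.volume_eq_prod, Measure.prod_prod, Real.volume_Icc, Real.volume_Icc, ← ENNReal.ofReal_mul (by linarith), ← ENNReal.ofReal_mul (by positivity)]
        congr 1; ring

lemma vol_siegel : volume {z : ℍ | |z.re| ≤ 1 / 2 ∧ 1 / 2 ≤ z.im} ≤ ENNReal.ofReal 4 := by
  have hsub : {z : ℍ | |z.re| ≤ 1 / 2 ∧ 1 / 2 ≤ z.im} ⊆ ⋃ n : ℕ, {z : ℍ | (-(1/2) ≤ z.re ∧ z.re ≤ 1/2) ∧ ((2:ℝ)^n / 2 ≤ z.im ∧ z.im ≤ 2^n)} := by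
    rintro z ⟨h1, h2⟩
    obtain ⟨n, hn⟩ := exists_nat_pow_near (x := 2 * z.im) (y := 2) (by linarith) (by norm_num)
    refine Set.mem_iUnion.mpr ⟨n, abs_le.mp h1, by linarith, ?_⟩
    have := hn.2; rw [pow_succ] at this; linarith
  calc _ ≤ ∑' n : ℕ, volume {z : ℍ | (-(1/2) ≤ z.re ∧ z.re ≤ 1/2) ∧ ((2:ℝ)^n / 2 ≤ z.im ∧ z.im ≤ 2^n)} := (measure_mono hsub).trans (measure_iUnion_le _)
    _ ≤ ∑' n : ℕ, ENNReal.ofReal (2 * (1/2)^n) := by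
        refine ENNReal.tsum_le_tsum fun n => (vol_rect _ _ _ _ (by positivity) (by have : (0:ℝ) < 2^n := by positivity
                                                                                   linarith) (by norm_num)).trans ?_
        apply ENNReal.ofReal_le_ofReal
        apply le_of_eq
        have : (2:ℝ)^n ≠ 0 := by positivity
        rw [one_div, inv_pow]
        field_simp
        ring
    _ = ENNReal.ofReal (∑' n : ℕ, 2 * (1/2)^n) := (ENNReal.ofReal_tsum_of_nonneg (fun n => by positivity) (summable_geometric_two.mul_left 2)).symm
    _ = ENNReal.ofReal 4 := by rw [tsum_mul_left, tsum_geometric_two]; norm_num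

lemma w0_exists : ∃ w : ℍ → ℝ, Measurable w ∧ (∀ z, 0 ≤ w z) ∧ (∀ z, HasSum (fun γ : SL(2, ℤ) => w (γ • z)) 1) ∧
    Integrable w volume ∧ ∫ z, w z ≤ 4 := by
  classical
  set D : Set ℍ := {z : ℍ | |z.re| ≤ 1 / 2 ∧ 1 / 2 ≤ z.im} with hD
  have hDm : MeasurableSet D :=
    (measurableSet_le (UpperHalfPlane.continuous_re.measurable.abs) measurable_const).inter
      (measurableSet_le measurable_const UpperHalfPlane.continuous_im.measurable)
  have hex : ∀ z : ℍ, ∃ γ : SL(2, ℤ), γ • z ∈ D := by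
    intro z
    obtain ⟨γ, hγ⟩ := ModularGroup.exists_smul_mem_fd z
    refine ⟨γ, hγ.2, ?_⟩
    have := ModularGroup.three_le_four_mul_im_sq_of_mem_fd hγ
    have h0 := (γ • z).im_pos
    nlinarith
  have hfin : ∀ z : ℍ, Set.Finite {γ : SL(2, ℤ) | γ • z ∈ D} := by
    intro z
    obtain ⟨γ0, h0⟩ := hex z
    refine ((fin_SL (1/2) (1/2) (by norm_num)).image (· * γ0)).subset ?_
    intro γ hγ
    refine ⟨γ * γ0⁻¹, ⟨γ0 • z, h0.1, h0.2, ?_⟩, by simp⟩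
    rw [smul_smul, inv_mul_cancel_right]
    exact hγ
  set χ : ℍ → ℝ := D.indicator 1 with hχ
  have hχ0 : ∀ z, 0 ≤ χ z := fun z => Set.indicator_nonneg (fun _ _ => zero_le_one) z
  have hχm : Measurable χ := measurable_one.indicator hDm
  have hsum : ∀ z, Summable fun γ : SL(2, ℤ) => χ (γ • z) := by
    intro z
    refine summable_of_ne_finset_zero (s := (hfin z).toFinset) fun γ hγ => ?_
    simp only [Set.Finite.mem_toFinset, Set.mem_setOf_eq] at hγ
    exact Set.indicator_of_notMem hγ _
  set N : ℍ → ℝ := fun z => ∑' γ : SL(2, ℤ), χ (γ • z) with hN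
  have hN1 : ∀ z, 1 ≤ N z := by
    intro z
    obtain ⟨γ0, h0⟩ := hex z
    have := (hsum z).le_tsum γ0 (fun γ _ => hχ0 _)
    rwa [show χ (γ0 • z) = 1 from Set.indicator_of_mem h0 _] at this
  have hNm : Measurable N := by
    have := meas_tsum (fun (γ : SL(2, ℤ)) (z : ℍ) => (χ (γ • z) : ℂ)) (fun γ => Complex.measurable_ofReal.comp (hχm.comp (measurable_const_smul γ)))
      (fun z => Complex.summable_ofReal.mpr (hsum z))
    have h2 : N = fun z => (∑' γ : SL(2, ℤ), (χ (γ • z) : ℂ)).re := by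
      ext z; rw [← Complex.ofReal_tsum]; rfl
    rw [h2]; exact Complex.measurable_re.comp this
  have hNinv : ∀ (γ : SL(2, ℤ)) z, N (γ • z) = N z := by
    intro γ z
    simp only [hN, smul_smul]
    exact (Equiv.mulRight γ).tsum_eq (fun h => χ (h • z))
  have hvol := vol_siegel
  have hI : Integrable χ volume := (integrable_indicator_iff hDm).mpr (integrableOn_const (hvol.trans_lt ENNReal.ofReal_lt_top).ne)
  have hle : ∀ z, χ z / N z ≤ χ z := fun z => div_le_self (hχ0 z) (hN1 z)
  have hnn : ∀ z, 0 ≤ χ z / N z := fun z => div_nonneg (hχ0 z) (by linarith [hN1 z])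
  have hI2 : Integrable (fun z => χ z / N z) volume := hI.mono (hχm.div hNm).aestronglyMeasurable
    (Filter.Eventually.of_forall fun z => by rw [Real.norm_of_nonneg (hnn z), Real.norm_of_nonneg (hχ0 z)]; exact hle z)
  refine ⟨fun z => χ z / N z, hχm.div hNm, hnn, fun z => ?_, hI2, ?_⟩
  · simp only [hNinv]
    have := (hsum z).hasSum.div_const (N z)
    rwa [show (∑' γ : SL(2, ℤ), χ (γ • z)) / N z = 1 from div_self (by linarith [hN1 z])] at this
  · calc _ ≤ ∫ z, χ z := integral_mono hI2 hI hle
      _ = (volume D).toReal := by rw [hχ, integral_indicator_one hDm]; rfl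
      _ ≤ 4 := ENNReal.toReal_le_of_le_ofReal (by norm_num) hvol

lemma w_exists (G : Subgroup SL(2, ℤ)) [G.FiniteIndex] : ∃ w : ℍ → ℝ, Measurable w ∧ (∀ z, 0 ≤ w z) ∧ (∀ z, HasSum (fun γ : G => w (γ • z)) 1) ∧
    Integrable w volume ∧ ∫ z, w z ≤ 4 * G.index := by
  obtain ⟨w, h1, h2, h3, h4, h5⟩ := w0_exists
  have : Fintype (SL(2, ℤ) ⧸ G) := Fintype.ofFinite _
  have hi : ∀ q : SL(2, ℤ) ⧸ G, Integrable (fun z => w (q.out • z)) volume := fun q =>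
    (measurePreserving_smul q.out volume).integrable_comp_of_integrable h4
  refine ⟨fun z => ∑ q : SL(2, ℤ) ⧸ G, w (q.out • z), ?_, ?_, ?_, ?_, ?_⟩
  · exact Finset.measurable_sum _ fun q _ => h1.comp (measurable_const_smul q.out)
  · exact fun z => Finset.sum_nonneg fun q _ => h2 _
  · intro z
    have hb : Function.Bijective (fun p : G × (SL(2, ℤ) ⧸ G) => p.2.out * (p.1 : SL(2, ℤ))) := by
      constructor
      · rintro ⟨g, q⟩ ⟨g', q'⟩ h
        simp only at h
        have e : ∀ (q : SL(2, ℤ) ⧸ G) (g : G), ((q.out * (g : SL(2, ℤ)) : SL(2, ℤ)) : SL(2, ℤ) ⧸ G) = q := by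
          intro q g
          rw [QuotientGroup.mk_mul_of_mem _ g.2, QuotientGroup.out_eq']
        have hq : q = q' := by rw [← e q g, ← e q' g', h]
        subst hq
        have := mul_left_cancel h
        rw [Prod.mk.injEq]; exact ⟨Subtype.ext this, rfl⟩
      · intro γ
        refine ⟨⟨⟨(QuotientGroup.mk γ : SL(2, ℤ) ⧸ G).out⁻¹ * γ, ?_⟩, QuotientGroup.mk γ⟩, by simp⟩
        rw [← QuotientGroup.eq, QuotientGroup.out_eq']
    have h := (Equiv.ofBijective _ hb).hasSum_iff.mpr (h3 z)
    refine h.prod_fiberwise (fun g => ?_)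
    have := hasSum_fintype (fun q : SL(2, ℤ) ⧸ G => w (q.out • g • z))
    convert this using 2 with q
    simp only [Function.comp, Equiv.ofBijective_apply, mul_smul]
    rfl
  · exact integrable_finset_sum _ fun q _ => hi q
  · rw [integral_finsetSum _ fun q _ => hi q]
    have : ∀ q : SL(2, ℤ) ⧸ G, ∫ z, w (q.out • z) = ∫ z, w z := fun q => integral_smul_eq_self w
    simp only [this, Finset.sum_const, Finset.card_univ, nsmul_eq_mul]
    rw [← Nat.card_eq_fintype_card, ← Subgroup.index]
    have : (0:ℝ) ≤ G.index := by positivity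
    nlinarith

open MeasureTheory UpperHalfPlane
open scoped MatrixGroups

lemma sl_det (γ : SL(2, ℤ)) : γ 0 0 * γ 1 1 - γ 0 1 * γ 1 0 = 1 := by
  have := γ.det_coe; rwa [Matrix.det_fin_two] at this

lemma sl_mul (γ δ : SL(2, ℤ)) (i j : Fin 2) : (γ * δ) i j = γ i 0 * δ 0 j + γ i 1 * δ 1 j := by
  rw [Matrix.SpecialLinearGroup.coe_mul, Matrix.mul_apply, Fin.sum_univ_two]

lemma sl_inv (γ : SL(2, ℤ)) : γ⁻¹ 0 0 = γ 1 1 ∧ γ⁻¹ 0 1 = - γ 0 1 ∧ γ⁻¹ 1 0 = - γ 1 0 ∧ γ⁻¹ 1 1 = γ 0 0 := by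
  rw [Matrix.SpecialLinearGroup.SL2_inv_expl]; simp

/-- the congruence subgroup `c ≡ 0 (Q)`, `a ≡ D ≡ 1 (d)`. -/
def GQ (d Q : ℕ) (hd : d ∣ Q) : Subgroup SL(2, ℤ) where
  carrier := {γ | (Q : ℤ) ∣ γ 1 0 ∧ (d : ℤ) ∣ γ 1 1 - 1}
  one_mem' := by simp
  mul_mem' := by
    intro γ δ h1 h2
    have hd' : (d:ℤ) ∣ Q := by exact_mod_cast hd
    simp only [Set.mem_setOf_eq, sl_mul] at *
    refine ⟨dvd_add (h1.1.mul_right _) (h2.1.mul_left _), ?_⟩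
    have : γ 1 0 * δ 0 1 + γ 1 1 * δ 1 1 - 1 = γ 1 0 * δ 0 1 + (γ 1 1 - 1) * δ 1 1 + (δ 1 1 - 1) := by ring
    rw [this]
    exact dvd_add (dvd_add ((hd'.trans h1.1).mul_right _) (h1.2.mul_right _)) h2.2
  inv_mem' := by
    intro γ h1
    have hd' : (d:ℤ) ∣ Q := by exact_mod_cast hd
    simp only [Set.mem_setOf_eq, sl_inv] at *
    refine ⟨(dvd_neg).mpr h1.1, ?_⟩
    have := sl_det γ
    have e : γ 0 0 - 1 = γ 0 1 * γ 1 0 - γ 0 0 * (γ 1 1 - 1) := by linear_combination this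
    rw [e]
    exact dvd_sub ((hd'.trans h1.1).mul_left _) (h1.2.mul_left _)

lemma GQ_mem (d Q : ℕ) (hd : d ∣ Q) (γ : SL(2, ℤ)) : γ ∈ GQ d Q hd ↔ (Q : ℤ) ∣ γ 1 0 ∧ (d : ℤ) ∣ γ 1 1 - 1 := Iff.rfl

lemma GQ_mem' (d Q : ℕ) (hd : d ∣ Q) (γ : SL(2, ℤ)) : γ ∈ GQ d Q hd ↔ (Q : ℤ) ∣ γ 1 0 ∧ (d : ℤ) ∣ γ 0 0 - 1 := by
  rw [← inv_mem_iff, GQ_mem]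
  simp [sl_inv]

lemma le_phi_tau (n : ℕ) (hn : n ≠ 0) : n ≤ n.totient * n.divisors.card := by
  conv_lhs => rw [← Nat.sum_totient n]
  rw [mul_comm, ← smul_eq_mul]
  refine Finset.sum_le_card_nsmul _ _ _ fun e he => ?_
  exact Nat.le_of_dvd (Nat.totient_pos.mpr (Nat.pos_of_ne_zero hn)) (Nat.totient_dvd_of_dvd (Nat.dvd_of_mem_divisors he))

lemma GQ_index (d Q : ℕ) (hd : d ∣ Q) (hQ : Q ≠ 0) : (GQ d Q hd).FiniteIndex ∧ (GQ d Q hd).index ≤ Q * d * Q.divisors.card := by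
  classical
  have : NeZero Q := ⟨hQ⟩
  have hd0 : d ≠ 0 := by rintro rfl; exact hQ (by simpa using hd)
  have : NeZero d := ⟨hd0⟩
  set U := (ZMod.unitsMap hd).ker with hU
  have hUd : ∀ (t : U) (x : ℤ), (x : ZMod Q) = ((t : (ZMod Q)ˣ) : ZMod Q) → (d:ℤ) ∣ x - 1 := by
    intro t x hx
    have h1 := t.2
    rw [MonoidHom.mem_ker, Units.ext_iff, ZMod.unitsMap_val, ← hx, ZMod.cast_intCast hd] at h1
    rw [← ZMod.intCast_zmod_eq_zero_iff_dvd]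
    push_cast
    rw [h1]; simp
  set φ : (SL(2, ℤ) ⧸ GQ d Q hd) × U → ZMod Q × ZMod Q := fun p =>
    (((p.2 : (ZMod Q)ˣ) : ZMod Q) * (p.1.out 0 0 : ℤ), ((p.2 : (ZMod Q)ˣ) : ZMod Q) * (p.1.out 1 0 : ℤ)) with hφ
  have hinj : Function.Injective φ := by
    rintro ⟨q, u⟩ ⟨q', u'⟩ h
    simp only [hφ, Prod.mk.injEq] at h
    set γ := q.out with hγ
    set γ' := q'.out with hγ'
    obtain ⟨h1, h2⟩ := h
    -- t = u'⁻¹ u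
    set t : U := u'⁻¹ * u with ht
    have e1 : ∀ x x' : ZMod Q, ((u : (ZMod Q)ˣ) : ZMod Q) * x = ((u' : (ZMod Q)ˣ) : ZMod Q) * x' → x' = ((t : (ZMod Q)ˣ) : ZMod Q) * x := by
      intro x x' h
      have : ((t : (ZMod Q)ˣ) : ZMod Q) = ((u'⁻¹ : (ZMod Q)ˣ) : ZMod Q) * ((u : (ZMod Q)ˣ) : ZMod Q) := by simp [ht]
      rw [this, mul_assoc, h, ← mul_assoc]; simp
    have f1 := e1 _ _ h1
    have f2 := e1 _ _ h2
    have hdet := congrArg (Int.cast : ℤ → ZMod Q) (sl_det γ)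
    push_cast at hdet
    have hmem : γ⁻¹ * γ' ∈ GQ d Q hd := by
      rw [GQ_mem', sl_mul, sl_mul, (sl_inv γ).1, (sl_inv γ).2.1, (sl_inv γ).2.2.1, (sl_inv γ).2.2.2]
      constructor
      · rw [← ZMod.intCast_zmod_eq_zero_iff_dvd]
        push_cast
        rw [f1, f2]; ring
      · apply hUd t
        push_cast
        rw [f1, f2]
        linear_combination ((t : (ZMod Q)ˣ) : ZMod Q) * hdet
    have hq : q = q' := by
      rw [← QuotientGroup.eq] at hmem
      rwa [hγ, hγ', QuotientGroup.out_eq', QuotientGroup.out_eq'] at hmem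
    subst hq
    have : ((t : (ZMod Q)ˣ) : ZMod Q) = 1 := by
      linear_combination -((t : (ZMod Q)ˣ) : ZMod Q) * hdet + hdet + (-(γ 1 1 : ZMod Q)) * f1 + (γ 0 1 : ZMod Q) * f2
    have ht1 : t = 1 := by
      apply Subtype.ext; apply Units.ext; simpa using this
    rw [ht, inv_mul_eq_one] at ht1
    rw [ht1]
  have hfin : Finite (SL(2, ℤ) ⧸ GQ d Q hd) := by
    have := Finite.of_injective φ hinj
    exact Finite.prod_left U
  have hcard : (GQ d Q hd).index * Nat.card U ≤ Q * Q := by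
    have := Nat.card_le_card_of_injective φ hinj
    rwa [Nat.card_prod, Nat.card_prod, Nat.card_zmod] at this
  have hker : Q.totient ≤ Nat.card U * d := by
    have h1 := Subgroup.card_mul_index U
    rw [hU, Subgroup.index_ker, ← hU, Nat.card_eq_fintype_card (α := (ZMod Q)ˣ), ZMod.card_units_eq_totient] at h1
    have h2 : Nat.card (ZMod.unitsMap hd).range ≤ d := by
      have := Nat.card_le_card_of_injective (fun x : (ZMod.unitsMap hd).range => ((x : (ZMod d)ˣ) : ZMod d)) (fun x y h => Subtype.ext (Units.ext h))
      rwa [Nat.card_zmod] at this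
    rw [← h1]
    exact Nat.mul_le_mul_left _ h2
  refine ⟨⟨?_⟩, ?_⟩
  · exact Subgroup.index_ne_zero_of_finite
  · have h3 := le_phi_tau Q hQ
    have : Q * (GQ d Q hd).index ≤ Q * (Q * d * Q.divisors.card) := by
      calc Q * (GQ d Q hd).index ≤ (Q.totient * Q.divisors.card) * (GQ d Q hd).index := Nat.mul_le_mul_right _ h3
        _ ≤ ((Nat.card U * d) * Q.divisors.card) * (GQ d Q hd).index := by gcongr
        _ = ((GQ d Q hd).index * Nat.card U) * (d * Q.divisors.card) := by ring
        _ ≤ (Q * Q) * (d * Q.divisors.card) := by gcongr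
        _ = _ := by ring
    exact Nat.le_of_mul_le_mul_left this (Nat.pos_of_ne_zero hQ)

open MeasureTheory UpperHalfPlane ComplexConjugate
open scoped MatrixGroups

/-- `e(-h x) ψ(y)`. -/
noncomputable def Pt (h : ℤ) (ψ : ℝ → ℝ) (z : ℍ) : ℂ := Complex.exp (-(2 * Real.pi * Complex.I * h * z.re)) * ψ z.im

/-- indicator of `[0,1)`. -/
noncomputable def ind1 (x : ℝ) : ℝ := (Set.Ico (0:ℝ) 1).indicator 1 x

/-- truncated. -/
noncomputable def Phi (h : ℤ) (ψ : ℝ → ℝ) (z : ℍ) : ℂ := ind1 z.re * Pt h ψ z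

lemma meas_re : Measurable (fun z : ℍ => z.re) := UpperHalfPlane.continuous_re.measurable
lemma meas_im : Measurable (fun z : ℍ => z.im) := UpperHalfPlane.continuous_im.measurable

lemma ind1_meas : Measurable ind1 := measurable_one.indicator measurableSet_Ico

lemma Pt_meas (h : ℤ) (ψ : ℝ → ℝ) (hψ : Measurable ψ) : Measurable (Pt h ψ) := by
  unfold Pt
  refine Measurable.mul ?_ (Complex.measurable_ofReal.comp (hψ.comp meas_im))
  exact Complex.measurable_exp.comp ((Measurable.const_mul (Complex.measurable_ofReal.comp meas_re) _).neg)

lemma Phi_meas (h : ℤ) (ψ : ℝ → ℝ) (hψ : Measurable ψ) : Measurable (Phi h ψ) :=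
  (Complex.measurable_ofReal.comp (ind1_meas.comp meas_re)).mul (Pt_meas h ψ hψ)

lemma Pt_norm (h : ℤ) (ψ : ℝ → ℝ) (z : ℍ) : ‖Pt h ψ z‖ = |ψ z.im| := by
  unfold Pt
  rw [norm_mul, Complex.norm_exp, Complex.norm_real]
  simp

lemma T_re (n : ℤ) (z : ℍ) : (ModularGroup.T ^ n • z).re = z.re + n := by
  rw [modular_T_zpow_smul, vadd_re, add_comm]
lemma T_im (n : ℤ) (z : ℍ) : (ModularGroup.T ^ n • z).im = z.im := by
  rw [modular_T_zpow_smul, vadd_im]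

lemma Pt_T (h : ℤ) (ψ : ℝ → ℝ) (n : ℤ) (z : ℍ) : Pt h ψ (ModularGroup.T ^ n • z) = Pt h ψ z := by
  unfold Pt
  rw [T_re, T_im]
  congr 1
  have : (-(2 * Real.pi * Complex.I * h * ((z.re + n : ℝ) : ℂ)) : ℂ) = -(2 * Real.pi * Complex.I * h * z.re) + ((-(h * n) : ℤ) : ℂ) * (2 * Real.pi * Complex.I) := by
    push_cast; ring
  rw [this, Complex.exp_add, Complex.exp_int_mul_two_pi_mul_I, mul_one]

lemma ind1_sum (x y : ℝ) (w : ℂ) : HasSum (fun p : ℤ × ℤ => ((ind1 (x - p.2) * ind1 (y + p.1) : ℝ) : ℂ) * w) w ∧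
    HasSum (fun p : ℤ × ℤ => (ind1 (x - p.2) * ind1 (y + p.1)) * ‖w‖) ‖w‖ := by
  have hone : ∀ (x : ℝ) (n : ℤ), ind1 (x - n) = if n = ⌊x⌋ then 1 else 0 := by
    intro x n
    unfold ind1
    rw [Set.indicator_apply]
    congr 1
    rw [eq_comm (a := n), Int.floor_eq_iff, Set.mem_Ico, eq_iff_iff]
    constructor <;> rintro ⟨h1, h2⟩ <;> constructor <;> linarith
  have key : ∀ p : ℤ × ℤ, ind1 (x - p.2) * ind1 (y + p.1) = if p = (-⌊y⌋, ⌊x⌋) then 1 else 0 := by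
    rintro ⟨l, l'⟩
    have := hone y (-l)
    push_cast at this
    rw [sub_neg_eq_add] at this
    simp only [hone, this, Prod.mk.injEq]
    have : (-l = ⌊y⌋) ↔ l = -⌊y⌋ := by omega
    simp only [this]
    split_ifs <;> simp_all
  simp only [key]
  constructor
  · convert hasSum_ite_eq ((-⌊y⌋, ⌊x⌋) : ℤ × ℤ) w using 2 with p
    split_ifs <;> simp
  · convert hasSum_ite_eq ((-⌊y⌋, ⌊x⌋) : ℤ × ℤ) ‖w‖ using 2 with p
    split_ifs <;> simp

section
variable (h : ℤ) (ψ : ℝ → ℝ) (y0 : ℝ) (hy0 : 0 < y0) (hm : Measurable ψ) (hψ1 : ∀ y, |ψ y| ≤ 1) (hsup : ∀ y, ψ y ≠ 0 → y0 ≤ y ∧ y ≤ 2 * y0)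
include hy0 hsup

lemma supp_bd (γ : SL(2, ℤ)) (z : ℍ) (h1 : ψ z.im ≠ 0) (h2 : ψ (γ • z).im ≠ 0) :
    ((γ 1 0 : ℝ) * z.re + γ 1 1)^2 + ((γ 1 0:ℝ) * z.im)^2 ≤ 2 := by
  obtain ⟨a1, a2⟩ := hsup _ h1
  obtain ⟨b1, b2⟩ := hsup _ h2
  rw [sl_im] at b1
  by_contra hh
  push Not at hh
  rw [le_div_iff₀ (by linarith)] at b1
  nlinarith

lemma supp_bd' (γ : SL(2, ℤ)) (z : ℍ) (h1 : ψ z.im ≠ 0) (h2 : ψ (γ • z).im ≠ 0) : |(γ 1 0 : ℝ)| * y0 ≤ 3 / 2 := by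
  have := supp_bd ψ y0 hy0 hsup γ z h1 h2
  obtain ⟨a1, a2⟩ := hsup _ h1
  have h3 : (|(γ 1 0 : ℝ)| * y0)^2 ≤ 2 := by
    rw [mul_pow, sq_abs]
    rw [mul_pow] at this
    have : y0^2 ≤ z.im^2 := by gcongr
    nlinarith [sq_nonneg ((γ 1 0 : ℝ) * z.re + γ 1 1), sq_nonneg (γ 1 0 : ℝ)]
  by_contra hh
  push Not at hh
  nlinarith

include hm hψ1
lemma W_int (γ : SL(2, ℤ)) (hc : γ 1 0 ≠ 0) : Integrable (fun z => conj (Pt h ψ z) * Pt h ψ (γ • z)) volume ∧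
    ‖∫ z, conj (Pt h ψ z) * Pt h ψ (γ • z)‖ ≤ 3 / (|(γ 1 0 : ℝ)| * y0) := by
  set C : ℝ := (γ 1 0 : ℝ) with hC
  have hC0 : C ≠ 0 := by rw [hC]; exact_mod_cast hc
  have hCp : 0 < |C| := abs_pos.mpr hC0
  set D : ℝ := (γ 1 1 : ℝ) with hD
  set R : Set ℍ := {z : ℍ | (-(D/C) - 3/(2*|C|) ≤ z.re ∧ z.re ≤ -(D/C) + 3/(2*|C|)) ∧ (y0 ≤ z.im ∧ z.im ≤ 2*y0)} with hR
  have hRm : MeasurableSet R :=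
    ((measurableSet_le measurable_const meas_re).inter (measurableSet_le meas_re measurable_const)).inter
      ((measurableSet_le measurable_const meas_im).inter (measurableSet_le meas_im measurable_const))
  have h0 : 0 ≤ 3/(2*|C|) := by positivity
  have hvol : volume R ≤ ENNReal.ofReal (3 / (|C| * y0)) := by
    refine (vol_rect (-(D/C) - 3/(2*|C|)) (-(D/C) + 3/(2*|C|)) y0 (2*y0) hy0 (by linarith) (by linarith)).trans (le_of_eq ?_)
    congr 1; field_simp; ring
  have hbd : ∀ z, ‖conj (Pt h ψ z) * Pt h ψ (γ • z)‖ ≤ R.indicator (1 : ℍ → ℝ) z := by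
    intro z
    rw [norm_mul, RCLike.norm_conj, Pt_norm, Pt_norm]
    by_cases h1 : ψ z.im = 0
    · rw [h1]; simp; exact Set.indicator_nonneg (fun _ _ => zero_le_one) z
    by_cases h2 : ψ (γ • z).im = 0
    · rw [h2, abs_zero, mul_zero]; exact Set.indicator_nonneg (fun _ _ => zero_le_one) z
    have hz : z ∈ R := by
      refine ⟨?_, hsup _ h1⟩
      have hb := supp_bd ψ y0 hy0 hsup γ z h1 h2
      have hb2 : |C * z.re + D| ≤ 3/2 := by
        apply abs_le_of_sq_le_sq _ (by norm_num)
        nlinarith [sq_nonneg (C * z.im)]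
      have e : C * z.re + D = C * (z.re - -(D/C)) := by field_simp; ring
      rw [e, abs_mul, ← le_div_iff₀' hCp, abs_le, div_div] at hb2
      constructor <;> linarith [hb2.1, hb2.2]
    rw [Set.indicator_of_mem hz]
    exact mul_le_one₀ (hψ1 _) (abs_nonneg _) (hψ1 _)
  have hI : Integrable (R.indicator (1 : ℍ → ℝ)) volume := (integrable_indicator_iff hRm).mpr (integrableOn_const (hvol.trans_lt ENNReal.ofReal_lt_top).ne)
  have hmm : Measurable (fun z => conj (Pt h ψ z) * Pt h ψ (γ • z)) :=
    (Complex.continuous_conj.measurable.comp (Pt_meas h ψ hm)).mul ((Pt_meas h ψ hm).comp (measurable_const_smul γ))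
  refine ⟨hI.mono' hmm.aestronglyMeasurable (Filter.Eventually.of_forall hbd), ?_⟩
  refine (norm_integral_le_of_norm_le hI (Filter.Eventually.of_forall hbd)).trans ?_
  rw [integral_indicator_one hRm]
  exact ENNReal.toReal_le_of_le_ofReal (by positivity) hvol

lemma J_fiber (γ : SL(2, ℤ)) (hc : γ 1 0 ≠ 0) :
    HasSum (fun p : ℤ × ℤ => ∫ z, conj (Phi h ψ z) * Phi h ψ ((ModularGroup.T ^ p.1 * γ * ModularGroup.T ^ p.2) • z))
      (∫ z, conj (Pt h ψ z) * Pt h ψ (γ • z)) := by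
  have hWm : Measurable (fun z => conj (Pt h ψ z) * Pt h ψ (γ • z)) :=
    (Complex.continuous_conj.measurable.comp (Pt_meas h ψ hm)).mul ((Pt_meas h ψ hm).comp (measurable_const_smul γ))
  have e : ∀ p : ℤ × ℤ, ∫ z, conj (Phi h ψ z) * Phi h ψ ((ModularGroup.T ^ p.1 * γ * ModularGroup.T ^ p.2) • z) =
      ∫ z, ((ind1 (z.re - p.2) * ind1 ((γ • z).re + p.1) : ℝ) : ℂ) * (conj (Pt h ψ z) * Pt h ψ (γ • z)) := by
    intro p
    rw [← integral_smul_eq_self (μ := (volume : Measure ℍ)) (fun z => conj (Phi h ψ z) * Phi h ψ ((ModularGroup.T ^ p.1 * γ * ModularGroup.T ^ p.2) • z)) (g := ModularGroup.T ^ (-p.2))]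
    congr 1; ext z
    have : (ModularGroup.T ^ p.1 * γ * ModularGroup.T ^ p.2) • ModularGroup.T ^ (-p.2) • z = ModularGroup.T ^ p.1 • (γ • z) := by
      rw [smul_smul, mul_assoc, ← zpow_add, add_neg_cancel, zpow_zero, mul_one, mul_smul]
    rw [this]
    unfold Phi
    rw [Pt_T, Pt_T, T_re, T_re, map_mul, Complex.conj_ofReal]
    push_cast
    rw [← sub_eq_add_neg]
    ring
  simp only [e]
  have hW := (W_int h ψ y0 hy0 hm hψ1 hsup γ hc).1
  refine hasSum_integral_of_dominated_convergence (fun p z => (ind1 (z.re - p.2) * ind1 ((γ • z).re + p.1)) * ‖conj (Pt h ψ z) * Pt h ψ (γ • z)‖) (fun p => ?_) (fun p => ?_) ?_ ?_ ?_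
  · refine Measurable.aestronglyMeasurable (Measurable.mul (Complex.measurable_ofReal.comp (Measurable.mul ?_ ?_)) hWm)
    · exact ind1_meas.comp (meas_re.sub_const _)
    · exact ind1_meas.comp ((meas_re.comp (measurable_const_smul γ)).add_const _)
  · refine Filter.Eventually.of_forall fun z => ?_
    rw [norm_mul, Complex.norm_real, Real.norm_of_nonneg]
    exact mul_nonneg (Set.indicator_nonneg (fun _ _ => zero_le_one) _) (Set.indicator_nonneg (fun _ _ => zero_le_one) _)
  · exact Filter.Eventually.of_forall fun z => (ind1_sum _ _ _).2.summable
  · refine hW.norm.congr (Filter.Eventually.of_forall fun z => ?_)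
    exact ((ind1_sum _ _ _).2.tsum_eq).symm
  · exact Filter.Eventually.of_forall fun z => (ind1_sum _ _ _).1
end

open MeasureTheory UpperHalfPlane ComplexConjugate
open scoped MatrixGroups

/-- the archimedean integral. -/
noncomputable def IC (h : ℤ) (ψ : ℝ → ℝ) (C : ℝ) : ℂ :=
  ∫ z : ℍ, Complex.exp (2 * Real.pi * Complex.I * h * ((z.re + (1 / ((C:ℂ)^2 * z)).re : ℝ) : ℂ)) * ψ z.im * ψ (z.im / ((C * z.re)^2 + (C * z.im)^2))

lemma shift_int (t : ℝ) (f : ℍ → ℂ) : ∫ z : ℍ, f (t +ᵥ z) = ∫ z, f z := by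
  have hg : ∃ g : GL (Fin 2) ℝ, ∀ z : ℍ, g • z = t +ᵥ z := by
    refine ⟨Matrix.SpecialLinearGroup.toGL (⟨!![1, t; 0, 1], by simp⟩ : SL(2, ℝ)), fun z => ?_⟩
    ext1
    have := UpperHalfPlane.coe_specialLinearGroup_apply (⟨!![1, t; 0, 1], by simp⟩ : SL(2, ℝ)) z
    refine Eq.trans this ?_
    simp [add_comm]
  obtain ⟨g, hg⟩ := hg
  simp only [← hg]
  exact integral_smul_eq_self f

lemma W_phase (h : ℤ) (ψ : ℝ → ℝ) (γ : SL(2, ℤ)) (hc : γ 1 0 ≠ 0) :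
    ∫ z, conj (Pt h ψ z) * Pt h ψ (γ • z) = Complex.exp (-(2 * Real.pi * Complex.I * h * ((γ 0 0 : ℂ) + γ 1 1) / γ 1 0)) * IC h ψ (γ 1 0) := by
  have hC : ((γ 1 0 : ℝ)) ≠ 0 := by exact_mod_cast hc
  have hC' : ((γ 1 0 : ℂ)) ≠ 0 := by exact_mod_cast hc
  unfold IC
  rw [← shift_int (-(γ 1 1 / γ 1 0 : ℝ)) (fun z => conj (Pt h ψ z) * Pt h ψ (γ • z)), ← integral_const_mul]
  congr 1; ext w
  set z : ℍ := (-(γ 1 1 / γ 1 0 : ℝ)) +ᵥ w with hz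
  have zre : z.re = w.re - γ 1 1 / γ 1 0 := by rw [hz, vadd_re]; ring
  have zim : z.im = w.im := by rw [hz, vadd_im]
  have zc : (z : ℂ) = w - γ 1 1 / γ 1 0 := by rw [hz, coe_vadd]; push_cast; ring
  have hw : (w : ℂ) ≠ 0 := w.ne_zero
  have hg : ((γ • z : ℍ) : ℂ) = γ 0 0 / γ 1 0 - 1 / ((γ 1 0 : ℂ)^2 * w) := by
    rw [sl_coe, zc]
    have hdet := congrArg (Int.cast : ℤ → ℂ) (sl_det γ)
    push_cast at hdet
    have : (γ 1 0 : ℂ) * (w - γ 1 1 / γ 1 0) + γ 1 1 = γ 1 0 * w := by field_simp; ring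
    rw [this]
    field_simp
    linear_combination -hdet
  have him : (γ • z).im = w.im / ((γ 1 0 * w.re)^2 + (γ 1 0 * w.im)^2) := by
    rw [sl_im, zim, zre]
    congr 3
    field_simp; ring
  have hre : (γ • z).re = γ 0 0 / γ 1 0 - (1 / (((γ 1 0 : ℝ) : ℂ)^2 * w)).re := by
    have := congrArg Complex.re hg
    rw [Complex.sub_re] at this
    rw [← UpperHalfPlane.coe_re, this]
    congr 1
    rw [show ((γ 0 0 : ℂ) / γ 1 0) = ((γ 0 0 / γ 1 0 : ℝ) : ℂ) by push_cast; rfl, Complex.ofReal_re]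
  unfold Pt
  rw [him, hre, zim, zre, map_mul, Complex.conj_ofReal, ← Complex.exp_conj]
  have : ∀ a b c d e : ℂ, a * b * (c * d) = (a * c) * b * d := by intros; ring
  rw [this _ _ _ _ 0, ← Complex.exp_add, ← mul_assoc, ← mul_assoc, ← Complex.exp_add]
  congr 3
  simp only [map_neg, map_mul, Complex.conj_ofReal, Complex.conj_I, map_intCast, map_ofNat]
  push_cast
  ring

lemma fiber_rep (C : ℤ) (hC : C ≠ 0) (A D : ℤ) (h : C ∣ A * D - 1) : ∃ γ : SL(2, ℤ), γ 0 0 = A ∧ γ 1 0 = C ∧ γ 1 1 = D := by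
  obtain ⟨b, hb⟩ := h
  exact ⟨⟨!![A, b; C, D], by rw [Matrix.det_fin_two_of]; linarith⟩, rfl, rfl, rfl⟩

lemma sl_ext (γ δ : SL(2, ℤ)) (hC : γ 1 0 ≠ 0) (h1 : γ 0 0 = δ 0 0) (h2 : γ 1 0 = δ 1 0) (h3 : γ 1 1 = δ 1 1) : γ = δ := by
  have a := sl_det γ
  have b := sl_det δ
  have h4 : γ 0 1 = δ 0 1 := by
    rw [← h1, ← h2, ← h3] at b
    have : γ 0 1 * γ 1 0 = δ 0 1 * γ 1 0 := by linarith
    exact mul_right_cancel₀ hC this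
  ext i j
  fin_cases i <;> fin_cases j <;> assumption

lemma TgT (γ : SL(2, ℤ)) (l l' : ℤ) : (ModularGroup.T ^ l * γ * ModularGroup.T ^ l') 0 0 = γ 0 0 + l * γ 1 0 ∧
    (ModularGroup.T ^ l * γ * ModularGroup.T ^ l') 1 0 = γ 1 0 ∧ (ModularGroup.T ^ l * γ * ModularGroup.T ^ l') 1 1 = γ 1 1 + l' * γ 1 0 := by
  simp only [sl_mul, ModularGroup.coe_T_zpow]
  refine ⟨?_, ?_, ?_⟩ <;> simp; ring

section
variable (h : ℤ) (ψ : ℝ → ℝ) (y0 : ℝ) (hy0 : 0 < y0) (hm : Measurable ψ) (hψ1 : ∀ y, |ψ y| ≤ 1) (hsup : ∀ y, ψ y ≠ 0 → y0 ≤ y ∧ y ≤ 2 * y0)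
include hy0 hsup hm hψ1

/-- sum over one double coset. -/
lemma J_coset (S : Finset SL(2, ℤ)) (hS : ∀ γ ∉ S, ∫ z, conj (Phi h ψ z) * Phi h ψ (γ • z) = 0) (γ0 : SL(2, ℤ)) (hc : γ0 1 0 ≠ 0) :
    ∑ γ ∈ S with (γ 1 0 = γ0 1 0 ∧ γ0 1 0 ∣ γ 1 1 - γ0 1 1), ∫ z, conj (Phi h ψ z) * Phi h ψ (γ • z) =
      Complex.exp (-(2 * Real.pi * Complex.I * h * ((γ0 0 0 : ℂ) + γ0 1 1) / γ0 1 0)) * IC h ψ (γ0 1 0) := by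
  classical
  rw [← W_phase h ψ γ0 hc]
  have hs := J_fiber h ψ y0 hy0 hm hψ1 hsup γ0 hc
  set J : SL(2, ℤ) → ℂ := fun γ => ∫ z, conj (Phi h ψ z) * Phi h ψ (γ • z) with hJ
  set J' : SL(2, ℤ) → ℂ := fun γ => if γ 1 0 = γ0 1 0 ∧ γ0 1 0 ∣ γ 1 1 - γ0 1 1 then J γ else 0 with hJ'
  set ι : ℤ × ℤ → SL(2, ℤ) := fun p => ModularGroup.T ^ p.1 * γ0 * ModularGroup.T ^ p.2 with hι
  have hcomp : (fun p : ℤ × ℤ => J (ι p)) = J' ∘ ι := by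
    ext p
    simp only [hJ', Function.comp, hι, TgT]
    rw [if_pos ⟨trivial, by simp⟩]
  have hinj : Function.Injective ι := by
    rintro ⟨l, l'⟩ ⟨m, m'⟩ he
    have h1 := (TgT γ0 l l').1
    have h2 := (TgT γ0 l l').2.2
    simp only [hι] at he
    rw [he, (TgT γ0 m m').1] at h1
    rw [he, (TgT γ0 m m').2.2] at h2
    have e1 : m = l := mul_right_cancel₀ hc (by linarith)
    have e2 : m' = l' := mul_right_cancel₀ hc (by linarith)
    rw [e1, e2]
  have hs' : HasSum (J' ∘ ι) (∫ z, conj (Pt h ψ z) * Pt h ψ (γ0 • z)) := by rw [← hcomp]; exact hs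
  rw [hinj.hasSum_iff] at hs'
  · have h2 : HasSum J' (∑ γ ∈ S, J' γ) := hasSum_sum_of_ne_finset_zero (fun γ hγ => by
      simp only [hJ']; split_ifs
      · exact hS γ hγ
      · rfl)
    rw [hs'.unique h2, Finset.sum_filter]
  · intro γ hγ
    simp only [hJ']
    rw [if_neg]
    rintro ⟨a1, l', hl'⟩
    apply hγ
    have d1 := sl_det γ
    have d0 := sl_det γ0
    have hcop : IsCoprime (γ0 1 0) (γ0 1 1) := ⟨-γ0 0 1, γ0 0 0, by linarith⟩
    have : γ0 1 0 ∣ γ 0 0 - γ0 0 0 := by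
      apply hcop.dvd_of_dvd_mul_right
      refine ⟨γ 0 1 - γ0 0 1 - γ 0 0 * l', ?_⟩
      rw [a1] at d1
      linear_combination d1 - d0 - γ 0 0 * hl'
    obtain ⟨l, hl⟩ := this
    refine ⟨(l, l'), ?_⟩
    apply sl_ext
    · rw [(TgT γ0 l l').2.1]; exact hc
    · rw [(TgT γ0 l l').1]; linarith
    · rw [(TgT γ0 l l').2.1, a1]
    · rw [(TgT γ0 l l').2.2]; linarith
end

open MeasureTheory UpperHalfPlane ComplexConjugate
open scoped MatrixGroups

section
variable (h : ℤ) (ψ : ℝ → ℝ) (y0 : ℝ) (hy0 : 0 < y0) (hm : Measurable ψ) (hψ1 : ∀ y, |ψ y| ≤ 1) (hsup : ∀ y, ψ y ≠ 0 → y0 ≤ y ∧ y ≤ 2 * y0)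
include hy0 hsup hm hψ1

lemma J_C (S : Finset SL(2, ℤ)) (hS : ∀ γ ∉ S, ∫ z, conj (Phi h ψ z) * Phi h ψ (γ • z) = 0) (d c : ℕ) (hdc : d ∣ c) (hc : c ≠ 0)
    (s : ℤ) (hs : s = 1 ∨ s = -1) :
    ‖∑ γ ∈ S with (γ 1 0 = s * c ∧ (d : ℤ) ∣ γ 1 1 - 1), ∫ z, conj (Phi h ψ z) * Phi h ψ (γ • z)‖ ≤ 3 / y0 * (klN d (-s * h) c / c) := by
  classical
  have : NeZero c := ⟨hc⟩
  have hss : s * s = 1 := by rcases hs with rfl | rfl <;> rfl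
  have hs0 : s ≠ 0 := by rcases hs with rfl | rfl <;> norm_num
  have hsc : s * (c:ℤ) ≠ 0 := mul_ne_zero hs0 (by exact_mod_cast hc)
  have hdvd : ∀ x : ℤ, s * (c:ℤ) ∣ x ↔ (x : ZMod c) = 0 := by
    intro x
    rw [ZMod.intCast_zmod_eq_zero_iff_dvd]
    rcases hs with rfl | rfl <;> simp
  set J : SL(2, ℤ) → ℂ := fun γ => ∫ z, conj (Phi h ψ z) * Phi h ψ (γ • z) with hJ
  have hun : ∀ γ : SL(2, ℤ), γ 1 0 = s * c → (γ 1 1 : ZMod c) * (γ 0 0 : ZMod c) = 1 := by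
    intro γ hγ
    have := congrArg (Int.cast : ℤ → ZMod c) (sl_det γ)
    rw [hγ] at this
    push_cast at this
    rw [ZMod.natCast_self] at this
    linear_combination this
  set f : SL(2, ℤ) → (ZMod c)ˣ := fun γ => if hh : γ 1 0 = s * c then ⟨(γ 1 1 : ZMod c), (γ 0 0 : ZMod c), hun γ hh, by rw [mul_comm]; exact hun γ hh⟩ else 1 with hf
  have hfv : ∀ γ : SL(2, ℤ), γ 1 0 = s * c → ((f γ : (ZMod c)ˣ) : ZMod c) = (γ 1 1 : ZMod c) := by
    intro γ hγ; simp only [hf, dif_pos hγ]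
  have key : ∑ γ ∈ S with (γ 1 0 = s * c ∧ (d : ℤ) ∣ γ 1 1 - 1), J γ = IC h ψ (s * c) * Kl d (-s * h) c := by
    rw [← Finset.sum_fiberwise (g := f)]
    unfold Kl
    rw [Finset.mul_sum]
    refine Finset.sum_congr (by ext; simp) fun u _ => ?_
    rw [Finset.filter_filter]
    obtain ⟨γ0, g1, g2, g3⟩ := fiber_rep (s * c) hsc ((((u⁻¹ : (ZMod c)ˣ) : ZMod c)).val : ℤ) (((u : ZMod c)).val : ℤ) (by
      rw [hdvd]; push_cast; simp)
    have hcond : ∀ γ : SL(2, ℤ), γ 1 0 = s * c → (f γ = u ↔ s * (c:ℤ) ∣ γ 1 1 - γ0 1 1) := by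
      intro γ hγ
      rw [hdvd, g3, Units.ext_iff, hfv γ hγ]
      push_cast
      rw [ZMod.natCast_zmod_val, sub_eq_zero]
    have hcast : ∀ γ : SL(2, ℤ), γ 1 0 = s * c → f γ = u → ((d : ℤ) ∣ γ 1 1 - 1 ↔ (ZMod.cast (u : ZMod c) : ZMod d) = 1) := by
      intro γ hγ hu
      rw [← hu, hfv γ hγ, ZMod.cast_intCast hdc, ← ZMod.intCast_zmod_eq_zero_iff_dvd]
      push_cast
      rw [sub_eq_zero]
    split_ifs with hu
    · have e1 : S.filter (fun γ => (γ 1 0 = s * c ∧ (d : ℤ) ∣ γ 1 1 - 1) ∧ f γ = u) = S.filter (fun γ => γ 1 0 = γ0 1 0 ∧ γ0 1 0 ∣ γ 1 1 - γ0 1 1) := by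
        apply Finset.filter_congr
        intro γ _
        rw [g2]
        constructor
        · rintro ⟨⟨a1, a2⟩, a3⟩
          exact ⟨a1, (hcond γ a1).mp a3⟩
        · rintro ⟨a1, a2⟩
          have a3 := (hcond γ a1).mpr a2
          exact ⟨⟨a1, (hcast γ a1 a3).mpr hu⟩, a3⟩
      rw [e1, J_coset h ψ y0 hy0 hm hψ1 hsup S hS γ0 (by rw [g2]; exact hsc), g2, mul_comm]
      congr 1
      · push_cast; rfl
      · have e2 : (((-s * h : ℤ) : ZMod c)) * ((u : ZMod c) + ((u⁻¹ : (ZMod c)ˣ) : ZMod c)) = ((-s * h * (γ0 0 0 + γ0 1 1) : ℤ) : ZMod c) := by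
          rw [g1, g3]; push_cast; rw [ZMod.natCast_zmod_val, ZMod.natCast_zmod_val]; ring
        rw [e2, ZMod.stdAddChar_coe]
        congr 1
        have hc' : (c:ℂ) ≠ 0 := by exact_mod_cast hc
        have hsC : (s:ℂ) * s = 1 := by exact_mod_cast hss
        have hsC0 : (s:ℂ) ≠ 0 := by exact_mod_cast hs0
        push_cast
        field_simp
        linear_combination (h * (γ0 0 0 + γ0 1 1)) * hsC
    · rw [mul_zero]
      apply Finset.sum_eq_zero
      intro γ hγ
      simp only [Finset.mem_filter] at hγ
      exact absurd ((hcast γ hγ.2.1.1 hγ.2.2).mp hγ.2.1.2) hu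
  obtain ⟨γ1, k1, k2, k3⟩ := fiber_rep (s * c) hsc 1 1 (by simp)
  have hW := (W_int h ψ y0 hy0 hm hψ1 hsup γ1 (by rw [k2]; exact hsc)).2
  rw [W_phase h ψ γ1 (by rw [k2]; exact hsc), norm_mul, Complex.norm_exp, k2] at hW
  have hre : (-(2 * Real.pi * Complex.I * h * ((γ1 0 0 : ℂ) + γ1 1 1) / ((s * c : ℤ) : ℂ)) : ℂ).re = 0 := by
    rw [k1, k3]
    have : (-(2 * Real.pi * Complex.I * h * (((1:ℤ) : ℂ) + ((1:ℤ):ℂ)) / ((s * c : ℤ) : ℂ)) : ℂ) = ((-(4 * Real.pi * h / (s * c)) : ℝ) : ℂ) * Complex.I := by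
      push_cast; ring
    rw [this, Complex.re_ofReal_mul, Complex.I_re, mul_zero]
  rw [hre, Real.exp_zero, one_mul] at hW
  rw [key, norm_mul]
  have hkl : ‖Kl d (-s * h) c‖ = klN d (-s * h) c := by
    unfold klN; rw [dif_pos hc]
  rw [hkl]
  have hnn : 0 ≤ klN d (-s * h) c := by rw [← hkl]; positivity
  have habs : |((s * c : ℤ) : ℝ)| = c := by
    rcases hs with rfl | rfl <;> push_cast <;> simp
  rw [habs] at hW
  have hcp : (0:ℝ) < c := by exact_mod_cast Nat.pos_of_ne_zero hc
  push_cast at hW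
  calc _ ≤ 3 / (c * y0) * klN d (-s * h) c := by gcongr
    _ = _ := by field_simp

lemma J_zero (γ : SL(2, ℤ)) (h0 : γ 1 0 = 0) : ‖∫ z, conj (Phi h ψ z) * Phi h ψ (γ • z)‖ ≤ if (γ = 1 ∨ γ = -1) then 1 / y0 else 0 := by
  set R : Set ℍ := {z : ℍ | (0 ≤ z.re ∧ z.re ≤ 1) ∧ (y0 ≤ z.im ∧ z.im ≤ 2*y0)} with hR
  have hRm : MeasurableSet R :=
    ((measurableSet_le measurable_const meas_re).inter (measurableSet_le meas_re measurable_const)).inter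
      ((measurableSet_le measurable_const meas_im).inter (measurableSet_le meas_im measurable_const))
  have hvol : volume R ≤ ENNReal.ofReal (1 / y0) := by
    refine (vol_rect 0 1 y0 (2*y0) hy0 (by linarith) (by linarith)).trans (le_of_eq ?_)
    congr 1; field_simp; ring
  have hI : Integrable (R.indicator (1 : ℍ → ℝ)) volume := (integrable_indicator_iff hRm).mpr (integrableOn_const (hvol.trans_lt ENNReal.ofReal_lt_top).ne)
  have hi1 : ∀ x, |ind1 x| ≤ 1 := by
    intro x; unfold ind1; rw [Set.indicator_apply]; split_ifs <;> simp
  have hi0 : ∀ x, ind1 x ≠ 0 → 0 ≤ x ∧ x < 1 := by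
    intro x hx; unfold ind1 at hx
    exact Set.mem_Ico.mp (Set.mem_of_indicator_ne_zero (s := Set.Ico (0:ℝ) 1) hx)
  have hP : ∀ z, ‖Phi h ψ z‖ ≤ R.indicator (1 : ℍ → ℝ) z := by
    intro z
    unfold Phi
    rw [norm_mul, Pt_norm, Complex.norm_real, Real.norm_eq_abs]
    by_cases hz : z ∈ R
    · rw [Set.indicator_of_mem hz]
      exact mul_le_one₀ (hi1 _) (abs_nonneg _) (hψ1 _)
    · rw [Set.indicator_of_notMem hz]
      apply le_of_eq
      by_contra hne
      apply hz
      have a1 : ind1 z.re ≠ 0 := by intro hh; rw [hh] at hne; simp at hne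
      have a2 : ψ z.im ≠ 0 := by intro hh; rw [hh] at hne; simp at hne
      exact ⟨⟨(hi0 _ a1).1, (hi0 _ a1).2.le⟩, hsup _ a2⟩
  have hP1 : ∀ z, ‖Phi h ψ z‖ ≤ 1 := fun z => (hP z).trans (Set.indicator_le_self' (fun _ _ => zero_le_one) z)
  split_ifs with hγ
  · refine (norm_integral_le_of_norm_le hI (Filter.Eventually.of_forall fun z => ?_)).trans ?_
    · rw [norm_mul, RCLike.norm_conj]
      exact (mul_le_of_le_one_right (norm_nonneg _) (hP1 _)).trans (hP z)
    · rw [integral_indicator_one hRm]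
      exact ENNReal.toReal_le_of_le_ofReal (by positivity) hvol
  · rw [integral_eq_zero_of_ae, norm_zero]
    refine Filter.Eventually.of_forall fun z => ?_
    by_contra hne
    apply hγ
    have hn1 : ind1 z.re ≠ 0 := by intro hh; apply hne; simp [Phi, hh]
    have hn2 : ind1 (γ • z).re ≠ 0 := by
      intro hh; apply hne
      show conj (Phi h ψ z) * Phi h ψ (γ • z) = 0
      unfold Phi; rw [hh]; simp
    have b1 := hi0 _ hn1
    have b2 := hi0 _ hn2
    have e := congrArg Complex.re (sl_coe γ z)
    have hdet := sl_det γ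
    rw [h0] at e hdet
    have hAD : γ 0 0 * γ 1 1 = 1 := by linarith
    have fin : ∀ B : ℤ, (B:ℝ) < 1 → -1 < (B:ℝ) → B = 0 := by
      intro B h1 h2
      have : B < 1 := by exact_mod_cast h1
      have : -1 < B := by exact_mod_cast h2
      omega
    rw [UpperHalfPlane.coe_re] at e
    rcases Int.mul_eq_one_iff_eq_one_or_neg_one.mp hAD with ⟨ha, hd⟩ | ⟨ha, hd⟩
    · left
      rw [ha, hd] at e
      have e' : (γ • z).re = z.re + γ 0 1 := by rw [e]; simp
      have hB : γ 0 1 = 0 := fin _ (by linarith) (by linarith)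
      ext i j; fin_cases i <;> fin_cases j <;> simp [ha, hd, hB, h0]
    · right
      rw [ha, hd] at e
      have e' : (γ • z).re = z.re - γ 0 1 := by rw [e]; simp [div_neg]; ring
      have hB : γ 0 1 = 0 := fin _ (by linarith) (by linarith)
      ext i j; fin_cases i <;> fin_cases j <;> simp [ha, hd, hB, h0]
end

open MeasureTheory UpperHalfPlane ComplexConjugate
open scoped MatrixGroups

section
variable (h : ℤ) (ψ : ℝ → ℝ) (y0 : ℝ) (hy0 : 0 < y0) (hm : Measurable ψ) (hψ1 : ∀ y, |ψ y| ≤ 1) (hsup : ∀ y, ψ y ≠ 0 → y0 ≤ y ∧ y ≤ 2 * y0)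
include hy0 hsup hm hψ1

lemma unf_bound (d Q : ℕ) (hd : d ∣ Q) (hQ : Q ≠ 0) (V : ℍ → ℂ) (hVm : Measurable V) (hV : ∀ γ ∈ GQ d Q hd, ∀ z, V (γ • z) = V z)
    (B : ℝ) (hB0 : 0 ≤ B) (hB : ∀ z, ‖V z‖ ≤ B) :
    ‖∫ z, V z * Phi h ψ z‖ ^ 2 ≤ B ^ 2 * (4 * (Q * d * Q.divisors.card)) * (2 / y0 + 3 / y0 * ∑ c ∈ (Finset.Icc 1 ⌊3 / (2 * y0)⌋₊).filter (Q ∣ ·), (klN d h c / c + klN d (-h) c / c)) := by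
  classical
  set C0 := ⌊3 / (2 * y0)⌋₊ with hC0
  have hi0 : ∀ x, ind1 x ≠ 0 → 0 ≤ x ∧ x < 1 := by
    intro x hx; unfold ind1 at hx
    exact Set.mem_Ico.mp (Set.mem_of_indicator_ne_zero (s := Set.Ico (0:ℝ) 1) hx)
  have hi1 : ∀ x, |ind1 x| ≤ 1 := by
    intro x; unfold ind1; rw [Set.indicator_apply]; split_ifs <;> simp
  have hP : ∀ z, Phi h ψ z ≠ 0 → (0 ≤ z.re ∧ z.re < 1) ∧ ψ z.im ≠ 0 := by
    intro z hz
    refine ⟨hi0 _ fun hh => hz ?_, fun hh => hz ?_⟩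
    · simp [Phi, hh]
    · simp [Phi, Pt, hh]
  have hP1 : ∀ z, ‖Phi h ψ z‖ ≤ 1 := by
    intro z
    unfold Phi
    rw [norm_mul, Pt_norm, Complex.norm_real, Real.norm_eq_abs]
    exact mul_le_one₀ (hi1 _) (abs_nonneg _) (hψ1 _)
  have hfin := fin_SL y0 1 hy0
  have hre : ∀ z : ℍ, Phi h ψ z ≠ 0 → |z.re| ≤ 1 ∧ y0 ≤ z.im := by
    intro z hz
    obtain ⟨⟨a, b⟩, c⟩ := hP z hz
    exact ⟨abs_le.mpr ⟨by linarith, b.le⟩, (hsup _ c).1⟩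
  have hfin2 : Set.Finite {γ : SL(2, ℤ) | ∃ z, Phi h ψ z ≠ 0 ∧ Phi h ψ (γ • z) ≠ 0} := by
    refine hfin.subset ?_
    rintro γ ⟨z, h1, h2⟩
    exact ⟨z, (hre z h1).1, (hre z h1).2, (hre _ h2).1, (hre _ h2).2⟩
  set S := hfin2.toFinset with hSd
  have hSm : ∀ γ : SL(2, ℤ), γ ∈ S ↔ ∃ z, Phi h ψ z ≠ 0 ∧ Phi h ψ (γ • z) ≠ 0 := by
    intro γ; rw [hSd, Set.Finite.mem_toFinset]; rfl
  have hS0 : ∀ γ ∉ S, ∫ z, conj (Phi h ψ z) * Phi h ψ (γ • z) = 0 := by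
    intro γ hγ
    refine integral_eq_zero_of_ae (Filter.Eventually.of_forall fun z => ?_)
    by_contra hne
    apply hγ
    rw [hSm]
    refine ⟨z, fun hh => hne ?_, fun hh => hne ?_⟩
    · show conj (Phi h ψ z) * Phi h ψ (γ • z) = 0
      rw [hh, map_zero, zero_mul]
    · show conj (Phi h ψ z) * Phi h ψ (γ • z) = 0
      rw [hh, mul_zero]
  have hSc : ∀ γ ∈ S, (γ 1 0).natAbs ∈ Finset.range (C0 + 1) := by
    intro γ hγ
    obtain ⟨z, h1, h2⟩ := (hSm γ).mp hγ
    have := supp_bd' ψ y0 hy0 hsup γ z (hP z h1).2 (hP _ h2).2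
    rw [Finset.mem_range, Nat.lt_succ_iff, hC0, Nat.le_floor_iff (by positivity), le_div_iff₀ (by positivity), Nat.cast_natAbs, Int.cast_abs]
    linarith
  obtain ⟨w, w1, w2, w3, w4, w5⟩ := by
    have := (GQ_index d Q hd hQ).1
    exact w_exists (GQ d Q hd)
  set J : SL(2, ℤ) → ℂ := fun γ => ∫ z, conj (Phi h ψ z) * Phi h ψ (γ • z) with hJ
  have hΦI : Integrable (Phi h ψ) volume := by
    set R : Set ℍ := {z : ℍ | (0 ≤ z.re ∧ z.re ≤ 1) ∧ (y0 ≤ z.im ∧ z.im ≤ 2*y0)} with hR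
    have hRm : MeasurableSet R :=
      ((measurableSet_le measurable_const meas_re).inter (measurableSet_le meas_re measurable_const)).inter
        ((measurableSet_le measurable_const meas_im).inter (measurableSet_le meas_im measurable_const))
    have hvol : volume R < ⊤ := 
      (vol_rect 0 1 y0 (2*y0) hy0 (by linarith) (by linarith)).trans_lt ENNReal.ofReal_lt_top
    have hI : Integrable (R.indicator (1 : ℍ → ℝ)) volume := (integrable_indicator_iff hRm).mpr (integrableOn_const hvol.ne)
    refine hI.mono' (Phi_meas h ψ hm).aestronglyMeasurable (Filter.Eventually.of_forall fun z => ?_)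
    by_cases hz : z ∈ R
    · rw [Set.indicator_of_mem hz]; exact hP1 z
    · rw [Set.indicator_of_notMem hz]
      by_contra hne
      apply hz
      have := hP z (fun hh => hne (by rw [hh, norm_zero]))
      exact ⟨⟨this.1.1, this.1.2.le⟩, hsup _ this.2⟩
  have main := unf_CS (G := GQ d Q hd) volume w w1 w2 w3 w4 V hVm (fun g z => hV g.1 g.2 z) B hB0 hB (Phi h ψ) (Phi_meas h ψ hm) hΦI hP1
    (S.subtype (· ∈ GQ d Q hd)) (fun g z h1 h2 => by
      rw [Finset.mem_subtype, hSm]; exact ⟨z, h1, h2⟩)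
  refine main.trans ?_
  have hw0 : 0 ≤ ∫ z, w z := integral_nonneg w2
  have e1 : (∑ g ∈ S.subtype (· ∈ GQ d Q hd), ∫ z, conj (Phi h ψ z) * Phi h ψ (g • z)) = ∑ γ ∈ S with γ ∈ GQ d Q hd, J γ :=
    Finset.sum_subtype_eq_sum_filter (f := J) (p := (· ∈ GQ d Q hd))
  rw [e1]
  have hidx : ∫ z, w z ≤ 4 * (Q * d * Q.divisors.card) := by
    refine w5.trans ?_
    have := (GQ_index d Q hd hQ).2
    have : ((GQ d Q hd).index : ℝ) ≤ Q * d * Q.divisors.card := by exact_mod_cast this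
    linarith
  have hk : ‖∑ γ ∈ S with γ ∈ GQ d Q hd, J γ‖ ≤ 2 / y0 + 3 / y0 * ∑ c ∈ (Finset.Icc 1 C0).filter (Q ∣ ·), (klN d h c / c + klN d (-h) c / c) := by
    rw [← Finset.sum_fiberwise_of_maps_to (s := S.filter (· ∈ GQ d Q hd)) (t := Finset.range (C0 + 1)) (g := fun γ => (γ 1 0).natAbs) (fun γ hγ => hSc γ (Finset.mem_filter.mp hγ).1)]
    rw [Finset.range_eq_Ico, Finset.sum_eq_sum_Ico_succ_bot (by omega)]
    refine (norm_add_le _ _).trans (add_le_add ?_ ?_)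
    · refine (norm_sum_le _ _).trans ?_
      have : ∀ γ ∈ (S.filter (· ∈ GQ d Q hd)).filter (fun γ => (γ 1 0).natAbs = 0), ‖J γ‖ ≤ if γ ∈ ({1, -1} : Finset SL(2, ℤ)) then 1 / y0 else 0 := by
        intro γ hγ
        have := J_zero h ψ y0 hy0 hm hψ1 hsup γ (Int.natAbs_eq_zero.mp (Finset.mem_filter.mp hγ).2)
        simp only [Finset.mem_insert, Finset.mem_singleton]; exact this
      refine (Finset.sum_le_sum this).trans ?_
      rw [← Finset.sum_filter, Finset.sum_const, nsmul_eq_mul]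
      have hcard : ((((S.filter (· ∈ GQ d Q hd)).filter (fun γ => (γ 1 0).natAbs = 0)).filter (· ∈ ({1, -1} : Finset SL(2, ℤ)))).card : ℝ) ≤ 2 := by
        have : _ ≤ ({1, -1} : Finset SL(2, ℤ)).card := Finset.card_le_card (s := (((S.filter (· ∈ GQ d Q hd)).filter (fun γ => (γ 1 0).natAbs = 0)).filter (· ∈ ({1, -1} : Finset SL(2, ℤ))))) (fun x hx => (Finset.mem_filter.mp hx).2)
        exact_mod_cast this.trans Finset.card_le_two
      calc _ ≤ 2 * (1 / y0) := by gcongr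
        _ = _ := by ring
    · rw [show Finset.Ico (0 + 1) (C0 + 1) = Finset.Icc 1 C0 by ext; simp [Nat.lt_succ_iff], Finset.mul_sum, Finset.sum_filter]
      refine (norm_sum_le _ _).trans (Finset.sum_le_sum fun c hc => ?_)
      have hc1 : 1 ≤ c := (Finset.mem_Icc.mp hc).1
      have es : (S.filter (· ∈ GQ d Q hd)).filter (fun γ => (γ 1 0).natAbs = c) = if Q ∣ c then S.filter (fun γ => γ 1 0 = 1 * (c:ℤ) ∧ (d : ℤ) ∣ γ 1 1 - 1) ∪ S.filter (fun γ => γ 1 0 = -1 * (c:ℤ) ∧ (d : ℤ) ∣ γ 1 1 - 1) else ∅ := by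
        ext γ
        split_ifs with hQc
        · simp only [Finset.mem_filter, Finset.mem_union, GQ_mem]
          constructor
          · rintro ⟨⟨a1, a2, a3⟩, a4⟩
            rcases Int.natAbs_eq (γ 1 0) with h1 | h1
            · left; exact ⟨a1, by rw [h1, a4, one_mul], a3⟩
            · right; exact ⟨a1, by rw [h1, a4]; ring, a3⟩
          · rintro (⟨a1, a2, a3⟩ | ⟨a1, a2, a3⟩)
            · refine ⟨⟨a1, ?_, a3⟩, by rw [a2]; simp⟩
              rw [a2, one_mul]; exact_mod_cast hQc
            · refine ⟨⟨a1, ?_, a3⟩, by rw [a2]; simp⟩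
              rw [a2]; exact Dvd.dvd.mul_left (by exact_mod_cast hQc) _
        · simp only [Finset.mem_filter, GQ_mem, Finset.notMem_empty, iff_false]
          rintro ⟨⟨a1, a2, a3⟩, a4⟩
          apply hQc
          rw [← a4]
          exact Int.natCast_dvd.mp a2
      rw [es]
      split_ifs with hQc
      · rw [Finset.sum_union]
        · refine (norm_add_le _ _).trans ?_
          have b1 := J_C h ψ y0 hy0 hm hψ1 hsup S hS0 d c (hd.trans hQc) (by omega) 1 (Or.inl rfl)
          have b2 := J_C h ψ y0 hy0 hm hψ1 hsup S hS0 d c (hd.trans hQc) (by omega) (-1) (Or.inr rfl)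
          rw [show (-1 * h : ℤ) = -h by ring] at b1
          rw [show (- -1 * h : ℤ) = h by ring] at b2
          calc _ ≤ _ := add_le_add b1 b2
            _ = _ := by ring
        · rw [Finset.disjoint_left]
          intro γ h1 h2
          have a1 := (Finset.mem_filter.mp h1).2.1
          have a2 := (Finset.mem_filter.mp h2).2.1
          omega
      · simp
  exact mul_le_mul (mul_le_mul_of_nonneg_left hidx (by positivity)) hk (norm_nonneg _) (by positivity)
end

open MeasureTheory UpperHalfPlane ComplexConjugate
open scoped MatrixGroups

lemma ofc_im (p : ℕ) (hp : 1 ≤ p) (z : ℍ) (t : ℝ) : 0 < ((p:ℂ) * z + t).im ∧ ((p:ℂ) * z + t).im = p * z.im := by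
  have h0 : (0:ℝ) < p := by exact_mod_cast hp
  have : ((p:ℂ) * z + t).im = p * z.im := by simp
  exact ⟨by rw [this]; exact mul_pos h0 z.im_pos, this⟩

lemma ed_conj {j a F B} (E : ED j a F B) (p d Q : ℕ) (hd : d ∣ Q) (hp : 1 ≤ p) (hd0 : 1 ≤ d) (hpQ : d ^ 2 * p ∣ Q) (w : ℤ) (γ : SL(2, ℤ)) (hγ : γ ∈ GQ d Q hd) (z : ℍ) :
    F (ofComplex ((p:ℂ) * (γ • z : ℍ) + ((w / d : ℝ) : ℂ))) = ((γ 1 0 : ℂ) * z + γ 1 1) ^ (2 * j) * F (ofComplex ((p:ℂ) * z + ((w / d : ℝ) : ℂ))) := by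
  obtain ⟨h1, h2⟩ := (GQ_mem d Q hd γ).mp hγ
  obtain ⟨_, h3⟩ := (GQ_mem' d Q hd γ).mp hγ
  obtain ⟨c, hc⟩ : ((d:ℤ) ^ 2 * p) ∣ γ 1 0 := dvd_trans (by exact_mod_cast hpQ) h1
  obtain ⟨x, hx⟩ : (d:ℤ) ∣ γ 1 1 - γ 0 0 := by
    have := dvd_sub h2 h3
    rwa [show γ 1 1 - 1 - (γ 0 0 - 1) = γ 1 1 - γ 0 0 by ring] at this
  have hdet := sl_det γ
  set δ : SL(2, ℤ) := ⟨!![γ 0 0 + w * d * c, p * γ 0 1 + w * x - w ^ 2 * c; d ^ 2 * c, γ 1 1 - w * d * c], by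
    rw [Matrix.det_fin_two_of]
    rw [hc] at hdet
    linear_combination hdet + (d * c * w) * hx⟩ with hδ
  have d00 : δ 0 0 = γ 0 0 + w * d * c := rfl
  have d01 : δ 0 1 = p * γ 0 1 + w * x - w ^ 2 * c := rfl
  have d10 : δ 1 0 = d ^ 2 * c := rfl
  have d11 : δ 1 1 = γ 1 1 - w * d * c := rfl
  have him := (ofc_im p hp z (w / d : ℝ)).1
  set W : ℍ := ofComplex ((p:ℂ) * z + ((w / d : ℝ) : ℂ)) with hW
  have hWc : (W : ℂ) = (p:ℂ) * z + ((w / d : ℝ) : ℂ) := by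
    rw [hW, ofComplex_apply_of_im_pos him]
  have hdC : (d:ℂ) ≠ 0 := by exact_mod_cast (by omega : d ≠ 0)
  have hcC := congrArg (Int.cast : ℤ → ℂ) hc
  have hxC := congrArg (Int.cast : ℤ → ℂ) hx
  push_cast at hcC hxC
  have hden : ((δ 1 0 : ℂ) * W + δ 1 1) = (γ 1 0 : ℂ) * z + γ 1 1 := by
    rw [hWc, d10, d11]; push_cast; rw [hcC]; field_simp; ring
  have hne : (γ 1 0 : ℂ) * z + γ 1 1 ≠ 0 := by
    have := denom_ne_zero (γ : GL (Fin 2) ℝ) z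
    rw [ModularGroup.denom_apply] at this
    exact this
  have hsm : δ • W = ofComplex ((p:ℂ) * (γ • z : ℍ) + ((w / d : ℝ) : ℂ)) := by
    ext1
    rw [ofComplex_apply_of_im_pos (ofc_im p hp (γ • z) (w / d : ℝ)).1]
    rw [sl_coe, hden]
    show _ = (p:ℂ) * (γ • z : ℍ) + ((w / d : ℝ) : ℂ)
    rw [sl_coe, div_eq_iff hne, add_mul, mul_assoc, div_mul_cancel₀ _ hne, hWc, d00, d01, hcC]
    push_cast
    field_simp
    linear_combination -(w : ℂ) * hxC
  rw [← hsm, E.modu, ModularGroup.denom_apply, hden]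

/-- the product of two forms. -/
noncomputable def Vb (j : ℕ) (F : ℍ → ℂ) (p q : ℕ) (s t : ℝ) (z : ℍ) : ℂ :=
  ((z.im ^ (2 * j) * ((p:ℝ) * q) ^ j : ℝ) : ℂ) * (F (ofComplex ((p:ℂ) * z + (s:ℂ))) * conj (F (ofComplex ((q:ℂ) * z + (t:ℂ)))))

lemma Vb_bd {j a F B} (E : ED j a F B) (p q : ℕ) (hp : 1 ≤ p) (hq : 1 ≤ q) (s t : ℝ) (z : ℍ) : ‖Vb j F p q s t z‖ ≤ B ^ 2 := by
  have h1 := (ed_ofc E _ (ofc_im p hp z s).1).2.2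
  have h2 := (ed_ofc E _ (ofc_im q hq z t).1).2.2
  rw [(ofc_im p hp z s).2] at h1
  rw [(ofc_im q hq z t).2] at h2
  have hz := z.im_pos
  unfold Vb
  rw [norm_mul, norm_mul, RCLike.norm_conj, Complex.norm_real, Real.norm_of_nonneg (by positivity)]
  calc _ = (‖F (ofComplex ((p:ℂ) * z + (s:ℂ)))‖ * (p * z.im) ^ j) * (‖F (ofComplex ((q:ℂ) * z + (t:ℂ)))‖ * (q * z.im) ^ j) := by
        rw [mul_pow, mul_pow, mul_pow, pow_mul', sq]; ring
    _ ≤ B * B := mul_le_mul h1 h2 (by positivity) E.Bpos.le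
    _ = _ := by ring

lemma Vb_meas {j a F B} (E : ED j a F B) (p q : ℕ) (hp : 1 ≤ p) (hq : 1 ≤ q) (s t : ℝ) : Measurable (Vb j F p q s t) := by
  have key : ∀ (p : ℕ) (hp : 1 ≤ p) (s : ℝ), Continuous fun z : ℍ => F (ofComplex ((p:ℂ) * z + (s:ℂ))) := by
    intro p hp s
    have : (fun z : ℍ => F (ofComplex ((p:ℂ) * z + (s:ℂ)))) = fun z : ℍ => F ⟨(p:ℂ) * z + (s:ℂ), (ofc_im p hp z s).1⟩ := by
      ext z; rw [ofComplex_apply_of_im_pos (ofc_im p hp z s).1]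
    rw [this]
    refine E.cont.comp ?_
    rw [UpperHalfPlane.isEmbedding_coe.continuous_iff]
    show Continuous fun z : ℍ => (p:ℂ) * z + (s:ℂ)
    fun_prop
  refine Continuous.measurable ?_
  unfold Vb
  exact (Complex.continuous_ofReal.comp ((UpperHalfPlane.continuous_im.pow _).mul continuous_const)).mul ((key p hp s).mul (Complex.continuous_conj.comp (key q hq t)))

lemma Vb_inv {j a F B} (E : ED j a F B) (p q d Q : ℕ) (hd : d ∣ Q) (hp : 1 ≤ p) (hq : 1 ≤ q) (hd0 : 1 ≤ d) (hpQ : d ^ 2 * p ∣ Q) (hqQ : d ^ 2 * q ∣ Q) (w w' : ℤ) (γ : SL(2, ℤ)) (hγ : γ ∈ GQ d Q hd) (z : ℍ) :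
    Vb j F p q (w / d) (w' / d) (γ • z) = Vb j F p q (w / d) (w' / d) z := by
  have e1 := ed_conj E p d Q hd hp hd0 hpQ w γ hγ z
  have e2 := ed_conj E q d Q hd hq hd0 hqQ w' γ hγ z
  unfold Vb
  rw [e1, e2, sl_im]
  have hne : (γ 1 0 : ℂ) * z + γ 1 1 ≠ 0 := by
    have := denom_ne_zero (γ : GL (Fin 2) ℝ) z
    rw [ModularGroup.denom_apply] at this
    exact this
  set D : ℂ := (γ 1 0 : ℂ) * z + γ 1 1 with hD
  have hn : (((γ 1 0 : ℝ) * z.re + γ 1 1) ^ 2 + ((γ 1 0 : ℝ) * z.im) ^ 2 : ℝ) = Complex.normSq D := by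
    rw [hD, Complex.normSq_apply]; simp; ring
  rw [hn, map_mul, map_pow]
  have hne2 : conj D ≠ 0 := by simpa using hne
  push_cast
  rw [Complex.normSq_eq_conj_mul_self, div_pow, mul_pow]
  field_simp

open MeasureTheory UpperHalfPlane ComplexConjugate
open scoped MatrixGroups

lemma ofc_meas : Measurable (fun w : ℂ => ofComplex w) := by
  have hs : MeasurableSet {w : ℂ | 0 < w.im} := measurableSet_lt measurable_const Complex.measurable_im
  refine measurable_of_restrict_of_restrict_compl hs ?_ ?_
  · have : ({w : ℂ | 0 < w.im}.domRestrict fun w : ℂ => ofComplex w) = fun w => (⟨w.1, w.2⟩ : ℍ) := by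
      ext w
      rw [Set.domRestrict_apply, ofComplex_apply_of_im_pos w.2]
    rw [this]
    refine Continuous.measurable ?_
    rw [UpperHalfPlane.isEmbedding_coe.continuous_iff]
    exact continuous_subtype_val
  · have : ({w : ℂ | 0 < w.im}ᶜ.domRestrict fun w : ℂ => ofComplex w) = fun w => ofComplex 0 := by
      ext w
      rw [Set.domRestrict_apply, ofComplex_apply_of_im_nonpos (not_lt.mp w.2), ofComplex_apply_of_im_nonpos (by simp)]
    rw [this]
    exact measurable_const

lemma int_strip (V : ℍ → ℂ) (hVm : Measurable V) (B : ℝ) (hB : ∀ z, ‖V z‖ ≤ B) (h : ℤ) (ψ : ℝ → ℝ) (y0 : ℝ) (hy0 : 0 < y0) (hm : Measurable ψ) (hψ1 : ∀ y, |ψ y| ≤ 1)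
    (hsup : ∀ y, ψ y ≠ 0 → y0 ≤ y ∧ y ≤ 2 * y0) :
    ∫ z, V z * Phi h ψ z = ∫ y in Set.Icc y0 (2 * y0), ((ψ y / y ^ 2 : ℝ) : ℂ) * ∫ x in (0:ℝ)..1, V (ofComplex (x + y * Complex.I)) * Complex.exp (-(2 * Real.pi * Complex.I * h * x)) := by
  have hB0 : 0 ≤ B := (norm_nonneg _).trans (hB UpperHalfPlane.I)
  set f : ℝ × ℝ → ℂ := fun p => V (ofComplex (p.1 + p.2 * Complex.I)) * (ind1 p.1 * (Complex.exp (-(2 * Real.pi * Complex.I * h * p.1)) * ψ p.2)) with hf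
  have hVm' : Measurable fun p : ℝ × ℝ => V (ofComplex (p.1 + p.2 * Complex.I)) := hVm.comp (ofc_meas.comp (by fun_prop))
  have hfm : Measurable f := by
    have := ind1_meas
    refine hVm'.mul (Measurable.mul ?_ (Measurable.mul ?_ ?_)) <;> fun_prop
  have e1 : ∫ z, V z * Phi h ψ z = ∫ z : ℍ, f (z.re, z.im) := by
    congr 1; ext z
    simp only [hf]
    have : ((z.re : ℂ) + z.im * Complex.I) = z := by
      rw [← UpperHalfPlane.coe_re, ← UpperHalfPlane.coe_im]; exact Complex.re_add_im _
    rw [this, ofComplex_apply]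
    rfl
  rw [e1, int_H f hfm]
  set H : ℝ × ℝ → ℂ := fun p => ((ψ p.2 / p.2 ^ 2 : ℝ) : ℂ) * (V (ofComplex (p.1 + p.2 * Complex.I)) * Complex.exp (-(2 * Real.pi * Complex.I * h * p.1))) with hH
  have hHm : Measurable H := by
    refine Measurable.mul ?_ (hVm'.mul ?_) <;> fun_prop
  have e2 : ∫ p in {p : ℝ × ℝ | 0 < p.2}, ((1 / p.2 ^ 2 : ℝ) : ℂ) * f p = ∫ p in Set.Ico (0:ℝ) 1 ×ˢ Set.Icc y0 (2 * y0), H p := by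
    have hms : MeasurableSet (Set.Ico (0:ℝ) 1 ×ˢ Set.Icc y0 (2 * y0)) := measurableSet_Ico.prod measurableSet_Icc
    rw [setIntegral_eq_of_subset_of_forall_diff_eq_zero (s := Set.Ico (0:ℝ) 1 ×ˢ Set.Icc y0 (2 * y0)) (measurableSet_lt measurable_const measurable_snd)]
    · refine setIntegral_congr_fun hms ?_
      rintro ⟨x, y⟩ ⟨hx, hy⟩
      simp only [hf, hH]
      rw [show ind1 x = 1 from Set.indicator_of_mem hx _]
      push_cast
      ring
    · rintro ⟨x, y⟩ ⟨hx, hy⟩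
      exact lt_of_lt_of_le hy0 hy.1
    · rintro ⟨x, y⟩ ⟨_, hn⟩
      simp only [hf]
      by_cases hx : x ∈ Set.Ico (0:ℝ) 1
      · have : ψ y = 0 := by
          by_contra hne
          exact hn ⟨hx, hsup y hne⟩
        rw [this]; simp
      · rw [show ind1 x = 0 from Set.indicator_of_notMem hx _]; simp
  rw [e2]
  have hHI : IntegrableOn H (Set.Ico (0:ℝ) 1 ×ˢ Set.Icc y0 (2 * y0)) := by
    refine IntegrableOn.of_bound (C := 1 / y0 ^ 2 * (B * 1)) ?_ hHm.aestronglyMeasurable ?_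
    · rw [Measure.volume_eq_prod, Measure.prod_prod]
      exact ENNReal.mul_lt_top (by simp) (by simp)
    · refine (ae_restrict_iff' (measurableSet_Ico.prod measurableSet_Icc)).mpr (Filter.Eventually.of_forall ?_)
      rintro ⟨x, y⟩ ⟨_, hy⟩
      have hy' : y0 ≤ y := hy.1
      simp only [hH]
      rw [norm_mul, norm_mul, Complex.norm_real, Real.norm_eq_abs, abs_div, abs_of_nonneg (sq_nonneg y)]
      have : ‖Complex.exp (-(2 * Real.pi * Complex.I * h * x))‖ = 1 := by
        rw [show (-(2 * Real.pi * Complex.I * h * x) : ℂ) = ((-(2 * Real.pi * h * x) : ℝ) : ℂ) * Complex.I by push_cast; ring]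
        exact Complex.norm_exp_ofReal_mul_I _
      rw [this]
      gcongr
      · exact hψ1 y
      · exact hB _
  rw [Measure.volume_eq_prod, ← setIntegral_prod_swap, setIntegral_prod]
  · refine setIntegral_congr_fun measurableSet_Icc fun y hy => ?_
    simp only [hH, Prod.fst_swap, Prod.snd_swap]
    rw [integral_const_mul, intervalIntegral.integral_of_le zero_le_one, integral_Ico_eq_integral_Ioc]
  · rw [Measure.volume_eq_prod] at hHI
    exact hHI.swap

open MeasureTheory UpperHalfPlane ComplexConjugate
open scoped MatrixGroups

/-- coefficients extended by zero. -/
def av (a : ℕ → ℂ) (x : ℤ) : ℂ := if 1 ≤ x then a x.toNat else 0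

/-- weighted coefficient. -/
noncomputable def ct (a : ℕ → ℂ) (f : ℤ) (Y : ℝ) (m : ℕ) (n : ℤ) : ℂ :=
  av a (m * n + f) * (Real.exp (-(2 * Real.pi * Y * ((m * n + f : ℤ) / m))) : ℝ)

lemma char_avg (d : ℕ) (hd : 1 ≤ d) (x : ℤ) :
    (1 / (d:ℂ)) * ∑ b ∈ Finset.range d, Complex.exp (2 * Real.pi * Complex.I * x * b / d) = if (d:ℤ) ∣ x then 1 else 0 := by
  have hdC : (d:ℂ) ≠ 0 := by exact_mod_cast (by omega : d ≠ 0)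
  set ζ := Complex.exp (2 * Real.pi * Complex.I * x / d) with hζ
  have e : ∀ b : ℕ, Complex.exp (2 * Real.pi * Complex.I * x * b / d) = ζ ^ b := by
    intro b; rw [hζ, ← Complex.exp_nat_mul]; congr 1; ring
  simp only [e]
  have h1 : ζ = 1 ↔ (d:ℤ) ∣ x := by
    rw [hζ, Complex.exp_eq_one_iff]
    constructor
    · rintro ⟨n, hn⟩
      refine ⟨n, ?_⟩
      have h2 : (2 * Real.pi * Complex.I : ℂ) ≠ 0 := Complex.two_pi_I_ne_zero
      have : (x:ℂ) = d * n := by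
        field_simp at hn
        exact hn
      exact_mod_cast this
    · rintro ⟨n, rfl⟩
      refine ⟨n, ?_⟩
      push_cast; field_simp
  split_ifs with h
  · rw [h1.mpr h]; simp [hdC]
  · have hz : ζ - 1 ≠ 0 := fun hh => h (h1.mp (sub_eq_zero.mp hh))
    have hp : ζ ^ d = 1 := by
      rw [← e, Complex.exp_eq_one_iff]
      exact ⟨x, by field_simp⟩
    have := geom_sum_mul ζ d
    rw [hp, sub_self] at this
    rw [(mul_eq_zero.mp this).resolve_right hz, mul_zero]

lemma inner_eval {j a F B} (E : ED j a F B) (p q d : ℕ) (hp : 1 ≤ p) (hq : 1 ≤ q) (hd : 1 ≤ d) (u v f : ℤ) (huv : u * p + v * q = 1) (y : ℝ) (hy : 0 < y) :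
    (1 / (d:ℂ)) * ∑ b ∈ Finset.range d, Complex.exp (-(2 * Real.pi * Complex.I * ((u + v) * f) * b / d)) *
      (∫ x in (0:ℝ)..1, F (ofComplex (q * (x + y * Complex.I) + (((u * b : ℤ) / d : ℝ)))) * conj (F (ofComplex (p * (x + y * Complex.I) + (((-v * b : ℤ) / d : ℝ)))))
        * Complex.exp (-(2 * Real.pi * Complex.I * ((((q:ℤ) - p) * f : ℤ)) * x))) =
    ∑' n : ℤ, ct a f ((d * p * q : ℕ) * y) (d * p) n * conj (ct a f ((d * p * q : ℕ) * y) (d * q) n) := by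
  have hdC : (d:ℂ) ≠ 0 := by exact_mod_cast (by omega : d ≠ 0)
  have hS := (ed_mix E q p hq hp 0 0 0 y hy).1
  set h : ℤ := ((q:ℤ) - p) * f with hh
  set Z : ℕ × ℕ → ℂ := fun i => if (q:ℤ) * (i.1+1) - p * (i.2+1) - h = 0 then
          a (i.1+1) * conj (a (i.2+1)) * Real.exp (-(2*Real.pi*y*(q*(i.1+1) + p*(i.2+1)))) else 0 with hZ
  have hZn : ∀ i, ‖Z i‖ ≤ ‖a (i.1+1)‖ * ‖a (i.2+1)‖ * Real.exp (-(2*Real.pi*y*(q*(i.1+1) + p*(i.2+1)))) := by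
    intro i
    simp only [hZ]
    split_ifs
    · rw [norm_mul, norm_mul, RCLike.norm_conj, Complex.norm_real, Real.norm_of_nonneg (Real.exp_pos _).le]
    · rw [norm_zero]; positivity
  have hZs : Summable fun i => ‖Z i‖ := Summable.of_nonneg_of_le (fun _ => norm_nonneg _) hZn hS
  have ek : ∀ i : ℕ × ℕ, ∀ b : ℕ, Complex.exp (-(2 * Real.pi * Complex.I * ((u + v) * f) * b / d)) * Complex.exp (2 * Real.pi * Complex.I * ((i.1+1) * (((u * b : ℤ) / d : ℝ) : ℂ) - (i.2+1) * (((-v * b : ℤ) / d : ℝ) : ℂ)))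
      = Complex.exp (2 * Real.pi * Complex.I * ((u * (i.1+1) + v * (i.2+1) - (u + v) * f : ℤ)) * b / d) := by
    intro i b
    rw [← Complex.exp_add]
    congr 1
    push_cast
    field_simp
    ring
  have e1 : ∀ b ∈ Finset.range d, Complex.exp (-(2 * Real.pi * Complex.I * ((u + v) * f) * b / d)) *
      (∫ x in (0:ℝ)..1, F (ofComplex (q * (x + y * Complex.I) + (((u * b : ℤ) / d : ℝ)))) * conj (F (ofComplex (p * (x + y * Complex.I) + (((-v * b : ℤ) / d : ℝ)))))
        * Complex.exp (-(2 * Real.pi * Complex.I * h * x))) = ∑' i, Z i * Complex.exp (2 * Real.pi * Complex.I * ((u * (i.1+1) + v * (i.2+1) - (u + v) * f : ℤ)) * b / d) := by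
    intro b _
    rw [(ed_mix E q p hq hp _ _ h y hy).2, ← tsum_mul_left]
    congr 1; ext i
    rw [← ek i b]
    simp only [hZ]
    split_ifs
    · ring
    · simp
  rw [Finset.sum_congr rfl e1, ← Summable.tsum_finsetSum, ← tsum_mul_left]
  · have e2 : ∀ i : ℕ × ℕ, (1 / (d:ℂ)) * ∑ b ∈ Finset.range d, Z i * Complex.exp (2 * Real.pi * Complex.I * ((u * (i.1+1) + v * (i.2+1) - (u + v) * f : ℤ)) * b / d)
        = Z i * if (d:ℤ) ∣ (u * (i.1+1) + v * (i.2+1) - (u + v) * f : ℤ) then 1 else 0 := by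
      intro i
      rw [← char_avg d hd, ← Finset.mul_sum]; ring
    simp only [e2]
    have hav : ∀ x : ℤ, av a x ≠ 0 → 1 ≤ x := by
      intro x hx; by_contra hn; exact hx (if_neg hn)
    refine tsum_eq_tsum_of_ne_zero_bij (fun n => (((d * p : ℕ) * n.1 + f).toNat - 1, ((d * q : ℕ) * n.1 + f).toNat - 1)) ?_ ?_ ?_
    · rintro ⟨n, hn⟩ ⟨n', hn'⟩ hnn
      have k1 : ∀ n : ℤ, ct a f ((d * p * q : ℕ) * y) (d * p) n * conj (ct a f ((d * p * q : ℕ) * y) (d * q) n) ≠ 0 → 1 ≤ ((d * p : ℕ) * n + f) := by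
        intro n hn; apply hav; intro h0; apply hn; unfold ct; rw [h0]; simp
      have a1 := k1 n hn
      have a2 := k1 n' hn'
      simp only [Prod.mk.injEq] at hnn
      have : ((d * p : ℕ) : ℤ) * n = (d * p : ℕ) * n' := by omega
      have h0 : ((d * p : ℕ) : ℤ) ≠ 0 := by
        have : d * p ≠ 0 := Nat.mul_ne_zero (by omega) (by omega)
        exact_mod_cast this
      exact Subtype.ext (mul_left_cancel₀ h0 this)
    · rintro ⟨r, s⟩ hi
      rw [Function.mem_support] at hi
      have c1 : (q:ℤ) * (r+1) - p * (s+1) - h = 0 := by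
        by_contra hn; apply hi; simp only [hZ]; rw [if_neg hn, zero_mul]
      have c2 : (d:ℤ) ∣ (u * (r+1) + v * (s+1) - (u + v) * f : ℤ) := by
        by_contra hn; apply hi; simp only []; rw [if_neg hn, mul_zero]
      obtain ⟨n, hn⟩ := c2
      have r1 : ((d * p : ℕ) : ℤ) * n + f = r + 1 := by
        push_cast
        rw [hh] at c1
        linear_combination (-p : ℤ) * hn - v * c1 + (r + 1 - f : ℤ) * huv
      have s1 : ((d * q : ℕ) : ℤ) * n + f = s + 1 := by
        push_cast
        rw [hh] at c1
        linear_combination (-q : ℤ) * hn + u * c1 + (s + 1 - f : ℤ) * huv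
      rw [Set.mem_range]
      refine ⟨⟨n, ?_⟩, ?_⟩
      · rw [Function.mem_support]
        have hZ0 : Z (r, s) ≠ 0 := fun h0 => hi (by simp only [h0, zero_mul])
        simp only [hZ] at hZ0
        rw [if_pos c1] at hZ0
        unfold ct av
        rw [r1, s1, if_pos (by omega), if_pos (by omega)]
        have t1 : ((r:ℤ) + 1).toNat = r + 1 := by omega
        have t2 : ((s:ℤ) + 1).toNat = s + 1 := by omega
        rw [t1, t2]
        have b1 : a (r + 1) ≠ 0 := fun h0 => hZ0 (by rw [h0]; simp)
        have b2 : a (s + 1) ≠ 0 := fun h0 => hZ0 (by rw [h0]; simp)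
        have hE : ∀ x : ℝ, ((Real.exp x : ℝ) : ℂ) ≠ 0 := fun x => by exact_mod_cast (Real.exp_pos x).ne'
        exact mul_ne_zero (mul_ne_zero b1 (hE _)) ((map_ne_zero _).mpr (mul_ne_zero b2 (hE _)))
      · simp only [r1, s1]
        ext <;> simp <;> omega
    · rintro ⟨n, hn⟩
      rw [Function.mem_support] at hn
      have a1 : 1 ≤ ((d * p : ℕ) * n + f) := by
        apply hav; intro h0; apply hn; unfold ct; rw [h0]; simp
      have a2 : 1 ≤ ((d * q : ℕ) * n + f) := by
        apply hav; intro h0; apply hn; unfold ct; rw [h0]; simp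
      obtain ⟨r, hr⟩ : ∃ r : ℕ, ((d * p : ℕ) * n + f) = r + 1 := ⟨((d * p : ℕ) * n + f).toNat - 1, by omega⟩
      obtain ⟨s, hs⟩ : ∃ r : ℕ, ((d * q : ℕ) * n + f) = r + 1 := ⟨((d * q : ℕ) * n + f).toNat - 1, by omega⟩
      have t1 : ((r:ℤ) + 1).toNat = r + 1 := by omega
      have t2 : ((s:ℤ) + 1).toNat = s + 1 := by omega
      simp only [hr, hs, t1, t2, Nat.add_sub_cancel, hZ]
      have hr' := hr
      have hs' := hs
      push_cast at hr' hs'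
      rw [if_pos (by rw [hh]; linear_combination (-q:ℤ) * hr' + p * hs'), if_pos ⟨n, by linear_combination (-u) * hr' - v * hs' + d * n * huv⟩]
      unfold ct av
      rw [hr, hs, if_pos (by omega), if_pos (by omega), t1, t2, map_mul, Complex.conj_ofReal, mul_one]
      have : Real.exp (-(2*Real.pi*y*(q*(r+1) + p*(s+1)))) = Real.exp (-(2 * Real.pi * ((d * p * q : ℕ) * y) * (((r + 1 : ℤ)) / (d * p : ℕ)))) * Real.exp (-(2 * Real.pi * ((d * p * q : ℕ) * y) * (((s + 1 : ℤ)) / (d * q : ℕ)))) := by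
        rw [← Real.exp_add]; congr 1
        have h1 : (d:ℝ) ≠ 0 := by exact_mod_cast (by omega : d ≠ 0)
        have h2 : (p:ℝ) ≠ 0 := by exact_mod_cast (by omega : p ≠ 0)
        have h3 : (q:ℝ) ≠ 0 := by exact_mod_cast (by omega : q ≠ 0)
        push_cast
        field_simp
        ring
      rw [this]; push_cast; ring
  · intro b _
    refine Summable.of_norm ?_
    refine hZs.congr fun i => ?_
    rw [norm_mul]
    have : ∀ x : ℤ, ‖Complex.exp (2 * Real.pi * Complex.I * x * b / d)‖ = 1 := by
      intro x
      rw [show (2 * Real.pi * Complex.I * x * b / d : ℂ) = ((2 * Real.pi * x * b / d : ℝ) : ℂ) * Complex.I by push_cast; ring]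
      exact Complex.norm_exp_ofReal_mul_I _
    rw [this, mul_one]

open MeasureTheory UpperHalfPlane ComplexConjugate
open scoped MatrixGroups

/-- correlation sum. -/
noncomputable def TT (a : ℕ → ℂ) (f : ℤ) (m1 m2 : ℕ) (Y : ℝ) : ℂ := ∑' n : ℤ, ct a f Y m1 n * conj (ct a f Y m2 n)

lemma pair_core {j a F B} (E : ED j a F B) (p q d : ℕ) (hp : 1 ≤ p) (hq : 1 ≤ q) (hd : 1 ≤ d) (hpq : p.Coprime q) (f : ℤ) (Y L : ℝ) (hL : 0 < L) (hLY : L ≤ Y) :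
    ‖∫ y in Y..Y+L, TT a f (d * p) (d * q) y‖ ^ 2 ≤ Y ^ 3 / Y ^ (4 * j) * ((d * p : ℕ) * (d * q : ℕ) : ℝ) ^ (2 * j) * B ^ 4 * (4 * d ^ 2 * (d ^ 2 * (p * q)).divisors.card *
      (2 + 3 * ∑ c ∈ (Finset.Icc 1 ⌊3 * (d * p * q : ℕ) / (2 * Y)⌋₊).filter (d ^ 2 * (p * q) ∣ ·), (klN d (((q:ℤ) - p) * f) c / c + klN d (-(((q:ℤ) - p) * f)) c / c))) := by
  have hY : 0 < Y := lt_of_lt_of_le hL hLY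
  set ℓ : ℕ := d * p * q with hℓ
  have hℓ0 : (0:ℝ) < ℓ := by
    rw [hℓ]; exact_mod_cast Nat.mul_pos (Nat.mul_pos (by omega) (by omega)) (by omega)
  have hj := E.hj
  obtain ⟨u, v, huv⟩ : ∃ u v : ℤ, u * p + v * q = 1 := by
    have := (Nat.isCoprime_iff_coprime.mpr hpq)
    obtain ⟨u, v, h⟩ := this
    exact ⟨u, v, h⟩
  set h : ℤ := ((q:ℤ) - p) * f with hh
  set Q : ℕ := d ^ 2 * (p * q) with hQ
  have hQ0 : Q ≠ 0 := by
    rw [hQ]; exact Nat.mul_ne_zero (pow_ne_zero _ (by omega)) (Nat.mul_ne_zero (by omega) (by omega))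
  have hdQ : d ∣ Q := ⟨d * (p * q), by rw [hQ]; ring⟩
  have hdC : (d:ℂ) ≠ 0 := by exact_mod_cast (by omega : d ≠ 0)
  set y0 := Y / ℓ with hy0d
  set L' := L / ℓ with hL'd
  have hy0 : 0 < y0 := by positivity
  have hL' : 0 < L' := by positivity
  have hLy : L' ≤ y0 := by rw [hL'd, hy0d]; gcongr
  set ψ : ℝ → ℝ := (Set.Icc y0 (y0 + L')).indicator (fun y => (y0 / y) ^ (2 * j - 2)) with hψ
  have hψm : Measurable ψ := Measurable.indicator (by fun_prop) measurableSet_Icc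
  have hsup : ∀ y, ψ y ≠ 0 → y0 ≤ y ∧ y ≤ 2 * y0 := by
    intro y hy
    have := Set.mem_Icc.mp (Set.mem_of_indicator_ne_zero hy)
    exact ⟨this.1, by linarith [this.2]⟩
  have hψ1 : ∀ y, |ψ y| ≤ 1 := by
    intro y
    rw [hψ, Set.indicator_apply]
    split_ifs with hy
    · have hy1 : y0 ≤ y := hy.1
      have : 0 < y := by linarith
      rw [abs_of_nonneg (by positivity)]
      exact pow_le_one₀ (by positivity) ((div_le_one this).mpr hy1)
    · simp
  set e : ℕ → ℂ := fun b => Complex.exp (-(2 * Real.pi * Complex.I * ((u + v) * f) * b / d)) with he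
  have hen : ∀ b, ‖e b‖ = 1 := by
    intro b
    simp only [he]
    rw [show (-(2 * Real.pi * Complex.I * ((u + v) * f) * b / d) : ℂ) = ((-(2 * Real.pi * ((u + v) * f) * b / d) : ℝ) : ℂ) * Complex.I by push_cast; ring]
    exact Complex.norm_exp_ofReal_mul_I _
  set W : ℕ → ℍ → ℂ := fun b => Vb j F q p ((u * b : ℤ) / d) ((-v * b : ℤ) / d) with hW
  have hWm : ∀ b, Measurable (W b) := fun b => Vb_meas E q p hq hp _ _
  have hWb : ∀ b z, ‖W b z‖ ≤ B ^ 2 := fun b z => Vb_bd E q p hq hp _ _ z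
  set V : ℍ → ℂ := fun z => (1 / (d:ℂ)) * ∑ b ∈ Finset.range d, e b * W b z with hV
  have hVm : Measurable V := by
    refine Measurable.const_mul (Finset.measurable_fun_sum _ fun b _ => (hWm b).const_mul _) _
  have hVb : ∀ z, ‖V z‖ ≤ B ^ 2 := by
    intro z
    simp only [hV]
    rw [norm_mul, norm_div, norm_one, Complex.norm_natCast]
    have : ‖∑ b ∈ Finset.range d, e b * W b z‖ ≤ d * B ^ 2 := by
      refine (norm_sum_le_of_le _ (fun b _ => ?_)).trans (le_of_eq (by rw [Finset.sum_const, Finset.card_range, nsmul_eq_mul]))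
      rw [norm_mul, hen, one_mul]; exact hWb b z
    calc _ ≤ 1 / (d:ℝ) * (d * B ^ 2) := by gcongr
      _ = _ := by have : (d:ℝ) ≠ 0 := by exact_mod_cast (by omega : d ≠ 0)
                  field_simp
  have hVi : ∀ γ ∈ GQ d Q hdQ, ∀ z, V (γ • z) = V z := by
    intro γ hγ z
    simp only [hV, hW]
    congr 1
    refine Finset.sum_congr rfl fun b _ => ?_
    rw [Vb_inv E q p d Q hdQ hq hp hd ⟨p, by rw [hQ]; ring⟩ ⟨q, by rw [hQ]; ring⟩ _ _ γ hγ z]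
  have hmain := unf_bound h ψ y0 hy0 hψm hψ1 hsup d Q hdQ hQ0 V hVm hVi (B ^ 2) (by positivity) hVb
  have hint : ∫ z, V z * Phi h ψ z = ((y0 ^ (2 * j - 2) * ((p:ℝ) * q) ^ j / ℓ : ℝ) : ℂ) * ∫ y in Y..Y+L, TT a f (d * p) (d * q) y := by
    rw [int_strip V hVm (B ^ 2) hVb h ψ y0 hy0 hψm hψ1 hsup]
    have inn : ∀ y : ℝ, 0 < y → ∫ x in (0:ℝ)..1, V (ofComplex (x + y * Complex.I)) * Complex.exp (-(2 * Real.pi * Complex.I * h * x)) =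
        ((y ^ (2 * j) * ((p:ℝ) * q) ^ j : ℝ) : ℂ) * TT a f (d * p) (d * q) (ℓ * y) := by
      intro y hy
      unfold TT
      rw [← inner_eval E p q d hp hq hd u v f huv y hy]
      have hz : ∀ x : ℝ, ((ofComplex (x + y * Complex.I) : ℍ) : ℂ) = x + y * Complex.I := by
        intro x; rw [ofComplex_apply_of_im_pos (by simpa using hy)]
      have hzi : ∀ x : ℝ, (ofComplex (x + y * Complex.I) : ℍ).im = y := by
        intro x; rw [← UpperHalfPlane.coe_im, hz]; simp
      have hWv : ∀ b (x : ℝ), W b (ofComplex (x + y * Complex.I)) * Complex.exp (-(2 * Real.pi * Complex.I * h * x)) = ((y ^ (2 * j) * ((p:ℝ) * q) ^ j : ℝ) : ℂ) *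
        (F (ofComplex (q * (x + y * Complex.I) + (((u * b : ℤ) / d : ℝ)))) * conj (F (ofComplex (p * (x + y * Complex.I) + (((-v * b : ℤ) / d : ℝ)))))
        * Complex.exp (-(2 * Real.pi * Complex.I * h * x))) := by
        intro b x
        simp only [hW]
        unfold Vb
        rw [hz, hzi, mul_comm (q:ℝ) p]
        ring
      have hsum : ∀ x : ℝ, V (ofComplex (x + y * Complex.I)) * Complex.exp (-(2 * Real.pi * Complex.I * h * x)) =
          ∑ b ∈ Finset.range d, (1 / (d:ℂ)) * e b * (W b (ofComplex (x + y * Complex.I)) * Complex.exp (-(2 * Real.pi * Complex.I * h * x))) := by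
        intro x
        simp only [hV]
        rw [mul_assoc, Finset.sum_mul, Finset.mul_sum]
        refine Finset.sum_congr rfl fun b _ => by ring
      simp only [hsum]
      rw [intervalIntegral.integral_finset_sum]
      · rw [Finset.mul_sum, Finset.mul_sum]
        refine Finset.sum_congr rfl fun b _ => ?_
        rw [intervalIntegral.integral_const_mul]
        simp only [hWv]
        rw [intervalIntegral.integral_const_mul]
        simp only [he]
        ring
      · intro b _
        refine IntervalIntegrable.const_mul ?_ _
        rw [intervalIntegrable_iff]
        refine IntegrableOn.of_bound (C := B ^ 2 * 1) (by simp) ?_ (Filter.Eventually.of_forall fun x => ?_)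
        · refine Measurable.aestronglyMeasurable (((hWm b).comp (ofc_meas.comp (by fun_prop))).mul (by fun_prop))
        · rw [norm_mul]
          have : ‖Complex.exp (-(2 * Real.pi * Complex.I * h * x))‖ = 1 := by
            rw [show (-(2 * Real.pi * Complex.I * h * x) : ℂ) = ((-(2 * Real.pi * h * x) : ℝ) : ℂ) * Complex.I by push_cast; ring]
            exact Complex.norm_exp_ofReal_mul_I _
          rw [this]
          gcongr
          exact hWb b _
    have e3 : ∫ y in Set.Icc y0 (2 * y0), ((ψ y / y ^ 2 : ℝ) : ℂ) * ∫ x in (0:ℝ)..1, V (ofComplex (x + y * Complex.I)) * Complex.exp (-(2 * Real.pi * Complex.I * h * x))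
        = ∫ y in Set.Icc y0 (y0 + L'), ((y0 ^ (2 * j - 2) * ((p:ℝ) * q) ^ j : ℝ) : ℂ) * TT a f (d * p) (d * q) (ℓ * y) := by
      rw [setIntegral_eq_of_subset_of_forall_diff_eq_zero (s := Set.Icc y0 (y0 + L')) measurableSet_Icc]
      · refine setIntegral_congr_fun measurableSet_Icc fun y hy => ?_
        have hyp : 0 < y := lt_of_lt_of_le hy0 hy.1
        rw [inn y hyp, ← mul_assoc, ← Complex.ofReal_mul]
        congr 2
        rw [hψ, Set.indicator_of_mem hy]
        obtain ⟨i, rfl⟩ : ∃ i, j = i + 1 := ⟨j - 1, by omega⟩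
        rw [show 2 * (i + 1) - 2 = 2 * i by omega, show 2 * (i + 1) = 2 * i + 2 by ring, div_pow]
        field_simp
        ring
      · intro y hy; exact ⟨hy.1, by linarith [hy.2]⟩
      · intro y hy
        rw [hψ, Set.indicator_of_notMem hy.2]; simp
    rw [e3, integral_const_mul, integral_Icc_eq_integral_Ioc, ← intervalIntegral.integral_of_le (by linarith), intervalIntegral.integral_comp_mul_left _ hℓ0.ne']
    rw [show (ℓ:ℝ) * y0 = Y by rw [hy0d]; field_simp, show (ℓ:ℝ) * (y0 + L') = Y + L by rw [hy0d, hL'd]; field_simp]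
    rw [Complex.real_smul, ← mul_assoc, ← Complex.ofReal_mul]
    congr 2
  rw [hint, norm_mul, Complex.norm_real, mul_pow, Real.norm_of_nonneg (by positivity)] at hmain
  have hp' : (0:ℝ) < p := by exact_mod_cast hp
  have hq' : (0:ℝ) < q := by exact_mod_cast hq
  have hd' : (0:ℝ) < d := by exact_mod_cast hd
  have hK : 0 < (y0 ^ (2 * j - 2) * ((p:ℝ) * q) ^ j / ℓ) ^ 2 := by positivity
  rw [mul_comm, ← le_div_iff₀ hK] at hmain
  refine hmain.trans (le_of_eq ?_)
  rw [show 3 / (2 * y0) = 3 * (ℓ:ℝ) / (2 * Y) by rw [hy0d]; field_simp]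
  set SS := ∑ c ∈ (Finset.Icc 1 ⌊3 * (ℓ:ℝ) / (2 * Y)⌋₊).filter (Q ∣ ·), (klN d h c / c + klN d (-h) c / c) with hSS
  rw [show (2 / y0 + 3 / y0 * SS) = (2 + 3 * SS) / y0 by field_simp]
  obtain ⟨i, rfl⟩ : ∃ i, j = i + 1 := ⟨j - 1, by omega⟩
  rw [show 2 * (i + 1) - 2 = 2 * i by omega]
  have hQc : (Q:ℝ) = d ^ 2 * (p * q) := by rw [hQ]; push_cast; ring
  have hlc : (ℓ:ℝ) = d * p * q := by rw [hℓ]; push_cast; ring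
  rw [hQc, hy0d, hlc]
  push_cast
  rw [show 2 * (i + 1) = 2 * i + 2 by ring, show 4 * (i + 1) = 4 * i + 4 by ring]
  simp only [div_pow, mul_pow, pow_add, ← pow_mul]
  field_simp
  ring_nf

open MeasureTheory UpperHalfPlane ComplexConjugate

lemma pair_aux (C0 l Q Y : ℝ) (hY : 0 < Y) (hQ0 : 0 < Q) (hl : l ≤ Q) (hC : C0 ≤ 3 * l / (2 * Y)) : √C0 / Q ≤ (5 / 4) / (√Y * √Q) := by
  have hc : √C0 ≤ (5 / 4) * √Q / √Y := by
    rw [← Real.sqrt_sq (show (0:ℝ) ≤ 5 / 4 * √Q / √Y by positivity)]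
    apply Real.sqrt_le_sqrt
    rw [div_pow, mul_pow, Real.sq_sqrt hQ0.le, Real.sq_sqrt hY.le]
    refine hC.trans ?_
    rw [div_le_div_iff₀ (by positivity) hY]
    nlinarith [mul_pos hQ0 hY, mul_le_mul_of_nonneg_right hl hY.le]
  have hsQ : 0 < √Q := Real.sqrt_pos.mpr hQ0
  have hsY : 0 < √Y := Real.sqrt_pos.mpr hY
  calc √C0 / Q ≤ (5 / 4) * √Q / √Y / Q := by gcongr
    _ = _ := by
      nth_rewrite 2 [← Real.mul_self_sqrt hQ0.le]
      field_simp

set_option maxHeartbeats 800000 in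
lemma pair_bound {j a F B} (E : ED j a F B) (m1 m2 : ℕ) (h1 : Squarefree m1) (h2 : Squarefree m2) (hne : m1 ≠ m2) (f : ℤ) (hf : f ≠ 0) (Y L N T : ℝ) (hL : 0 < L) (hLY : L ≤ Y)
    (hT : ∀ n : ℕ, 1 ≤ n → (n:ℝ) ≤ N → (n.divisors.card : ℝ) ≤ T) (hN1 : (m1:ℝ) * m2 ≤ N) (hN2 : 2 * (m1 * m2) / Y ≤ N) (hN3 : (m1 + m2) * |(f:ℝ)| ≤ N) (hTl : 1 + Real.log N ≤ T) :
    ‖∫ y in Y..Y+L, TT a f m1 m2 y‖ ^ 2 ≤ Y ^ 3 / Y ^ (4 * j) * ((m1:ℝ) * m2) ^ (2 * j) * B ^ 4 * ((Nat.gcd m1 m2 : ℝ) ^ 2 * (60 * T ^ 6 *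
      (1 + √(Nat.gcd f.natAbs m1) * √(Nat.gcd f.natAbs m2) / (√Y * √(m1 * m2))))) := by
  have hY : 0 < Y := lt_of_lt_of_le hL hLY
  have hm1 : 0 < m1 := Nat.pos_of_ne_zero h1.ne_zero
  have hm2 : 0 < m2 := Nat.pos_of_ne_zero h2.ne_zero
  obtain ⟨d, p, q, hd, hpq, rfl, rfl⟩ : ∃ d p q : ℕ, 0 < d ∧ p.Coprime q ∧ m1 = d * p ∧ m2 = d * q := by
    obtain ⟨g, p, q, hg, hc, a1, a2⟩ := Nat.exists_coprime' (m := m1) (n := m2) (Nat.gcd_pos_of_pos_left _ hm1)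
    exact ⟨_, p, q, hg, hc, by rw [a1]; ring, by rw [a2]; ring⟩
  have hp : 1 ≤ p := Nat.pos_of_mul_pos_left hm1
  have hq : 1 ≤ q := Nat.pos_of_mul_pos_left hm2
  have hgcd : Nat.gcd (d * p) (d * q) = d := by rw [Nat.gcd_mul_left, hpq.gcd_eq_one, mul_one]
  obtain ⟨c1, sd, sp⟩ := Nat.squarefree_mul_iff.mp h1
  obtain ⟨c2, _, sq⟩ := Nat.squarefree_mul_iff.mp h2
  have hpqs : Squarefree (p * q) := Nat.squarefree_mul_iff.mpr ⟨hpq, sp, sq⟩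
  have hdpq : d.Coprime (p * q) := Nat.Coprime.mul_right c1 c2
  have hqp : (q:ℤ) - p ≠ 0 := by
    intro h0; apply hne; congr 1; omega
  set h : ℤ := ((q:ℤ) - p) * f with hh
  have hh0 : h ≠ 0 := mul_ne_zero hqp hf
  have hcore := pair_core E p q d hp hq hd hpq f Y L hL hLY
  rw [← hh] at hcore
  refine hcore.trans ?_
  rw [hgcd]
  have hN : 1 ≤ N := by
    refine le_trans ?_ hN1
    exact_mod_cast Nat.mul_pos hm1 hm2
  have hT1 : 1 ≤ T := by linarith [Real.log_nonneg hN]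
  have hd' : (1:ℝ) ≤ d := by exact_mod_cast hd
  have hp' : (1:ℝ) ≤ p := by exact_mod_cast hp
  have hq' : (1:ℝ) ≤ q := by exact_mod_cast hq
  have hdpq0 : (0:ℝ) ≤ d * p * q := by positivity
  have hdp1 : (d:ℝ) * p * q ≤ d * p * (d * q) := by
    rw [show (d:ℝ) * p * (d * q) = d * p * q * d by ring]; exact le_mul_of_one_le_right hdpq0 hd'
  have hdp2 : (p:ℝ) * q ≤ d * p * q := by
    rw [mul_assoc]; exact le_mul_of_one_le_left (by positivity) hd'
  have habs : |(q:ℝ) - p| ≤ d * p + d * q := by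
    have := le_mul_of_one_le_left (show (0:ℝ) ≤ p by positivity) hd'
    have := le_mul_of_one_le_left (show (0:ℝ) ≤ q by positivity) hd'
    rw [abs_le]; constructor <;> linarith
  set C0 := ⌊3 * (d * p * q : ℕ) / (2 * Y)⌋₊ with hC0
  have hC0le : (C0:ℝ) ≤ 3 * (d * p * q : ℕ) / (2 * Y) := Nat.floor_le (by positivity)
  have hC0N : (C0:ℝ) ≤ N := by
    refine hC0le.trans (le_trans ?_ hN2)
    rw [div_le_div_iff₀ (by positivity) (by positivity)]
    push_cast
    have h3 : 3 * (d * p * q : ℝ) ≤ 2 * (d * p * (d * q)) * 2 := by linarith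
    calc _ ≤ 2 * (d * p * (d * q)) * 2 * Y := mul_le_mul_of_nonneg_right h3 hY.le
      _ = _ := by ring
  set g := √(Nat.gcd f.natAbs (d * p) : ℝ) * √(Nat.gcd f.natAbs (d * q) : ℝ) with hg
  have hgb : √(Int.gcd h (p * q : ℕ) : ℝ) ≤ g := by
    rw [hg, ← Real.sqrt_mul (by positivity)]
    apply Real.sqrt_le_sqrt
    have e1 : Int.gcd h (p * q : ℕ) = Nat.gcd f.natAbs (p * q) := by
      rw [Int.gcd, hh, Int.natAbs_mul, Int.natAbs_natCast]
      apply Nat.Coprime.gcd_mul_left_cancel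
      have : IsCoprime ((q:ℤ) - p) ((p * q : ℕ) : ℤ) := by
        push_cast
        have hc : IsCoprime (p:ℤ) q := Nat.isCoprime_iff_coprime.mpr hpq
        refine IsCoprime.mul_right ?_ ?_
        · obtain ⟨x, y, hxy⟩ := hc
          exact ⟨y, x + y, by linear_combination hxy⟩
        · obtain ⟨x, y, hxy⟩ := hc
          exact ⟨-x, x + y, by linear_combination hxy⟩
      have := Int.isCoprime_iff_gcd_eq_one.mp this
      rwa [Int.gcd, Int.natAbs_natCast] at this
    rw [e1]
    have hf0 : 0 < f.natAbs := Int.natAbs_pos.mpr hf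
    have : Nat.gcd f.natAbs (p * q) ≤ Nat.gcd f.natAbs (d * p) * Nat.gcd f.natAbs (d * q) := by
      refine (Nat.le_of_dvd (Nat.mul_pos (Nat.gcd_pos_of_pos_left _ hf0) (Nat.gcd_pos_of_pos_left _ hf0)) (Nat.gcd_mul_right_dvd_mul_gcd _ _ _)).trans ?_
      exact Nat.mul_le_mul (Nat.le_of_dvd (Nat.gcd_pos_of_pos_left _ hf0) (Nat.gcd_dvd_gcd_of_dvd_right _ (Nat.dvd_mul_left _ _))) (Nat.le_of_dvd (Nat.gcd_pos_of_pos_left _ hf0) (Nat.gcd_dvd_gcd_of_dvd_right _ (Nat.dvd_mul_left _ _)))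
    exact_mod_cast this
  have hlog : 1 + Real.log C0 ≤ T := by
    rcases Nat.eq_zero_or_pos C0 with h0 | h0
    · rw [h0]; simpa using hT1
    · have : Real.log C0 ≤ Real.log N := Real.log_le_log (by exact_mod_cast h0) hC0N
      linarith
  have hlog0 : 0 ≤ 1 + Real.log C0 := by
    have := Real.log_natCast_nonneg C0; linarith
  have htpq : ((p * q).divisors.card : ℝ) ≤ T := by
    apply hT _ (Nat.mul_pos hp hq)
    refine le_trans ?_ hN1
    push_cast
    exact hdp2.trans hdp1
  have hthn : ((h.natAbs).divisors.card : ℝ) ≤ T := by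
    apply hT _ (Int.natAbs_pos.mpr hh0)
    refine le_trans ?_ hN3
    rw [Nat.cast_natAbs, Int.cast_abs, hh]
    push_cast
    rw [abs_mul]
    exact mul_le_mul_of_nonneg_right habs (abs_nonneg _)
  have htQ : ((d ^ 2 * (p * q)).divisors.card : ℝ) ≤ T := by
    apply hT _ (Nat.mul_pos (by positivity) (Nat.mul_pos hp hq))
    refine le_trans (le_of_eq ?_) hN1
    push_cast; ring
  set x := g / (√Y * √((d * p : ℕ) * (d * q : ℕ))) with hx
  have hx0 : 0 ≤ x := by positivity
  have hsq : √(C0:ℝ) / (d ^ 2 * (p * q : ℕ) : ℝ) ≤ (5 / 4) / (√Y * √((d * p : ℕ) * (d * q : ℕ))) := by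
    have e0 : ((d * p : ℕ) * (d * q : ℕ) : ℝ) = d ^ 2 * (p * q : ℕ) := by push_cast; ring
    rw [e0]
    refine pair_aux _ _ _ _ hY (by push_cast; positivity) ?_ hC0le
    push_cast
    linarith [hdp1, show (d:ℝ) ^ 2 * (p * q) = d * p * (d * q) by ring]
  have kl : ∀ h' : ℤ, h' ≠ 0 → h'.natAbs = h.natAbs → ∑ c ∈ (Finset.Icc 1 C0).filter (d ^ 2 * (p * q) ∣ ·), klN d h' c / c ≤ 5 / 2 * T ^ 5 * x := by
    intro h' h0 hab
    have hT' : ∀ n : ℕ, 1 ≤ n → n ≤ C0 → (n.divisors.card : ℝ) ≤ T := fun n a1 a2 => hT n a1 (le_trans (by exact_mod_cast a2) hC0N)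
    refine (kl_sum_aux T (by linarith) d (p * q) C0 h' hT' sd hpqs hdpq h0).trans ?_
    have hgg : √(Int.gcd h' (p * q : ℕ) : ℝ) ≤ g := by
      have : Int.gcd h' (p * q : ℕ) = Int.gcd h (p * q : ℕ) := by rw [Int.gcd, Int.gcd, hab]
      rw [this]; exact hgb
    rw [hab]
    calc _ ≤ 2 * T ^ 2 * T * T * T * g * (√(C0:ℝ) / (d ^ 2 * (p * q : ℕ) : ℝ)) := by
          rw [← mul_div_assoc]
          gcongr
      _ ≤ 2 * T ^ 2 * T * T * T * g * ((5 / 4) / (√Y * √((d * p : ℕ) * (d * q : ℕ)))) := by gcongr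
      _ = _ := by rw [hx]; ring
  rw [Finset.sum_add_distrib]
  have k1 := kl h hh0 rfl
  have k2 := kl (-h) (by simpa using hh0) (Int.natAbs_neg h)
  have hfin : (4 * (d:ℝ) ^ 2 * (d ^ 2 * (p * q)).divisors.card * (2 + 3 * (∑ c ∈ (Finset.Icc 1 C0).filter (d ^ 2 * (p * q) ∣ ·), klN d h c / c + ∑ c ∈ (Finset.Icc 1 C0).filter (d ^ 2 * (p * q) ∣ ·), klN d (-h) c / c)))
      ≤ (d:ℝ) ^ 2 * (60 * T ^ 6 * (1 + x)) := by
    calc _ ≤ 4 * (d:ℝ) ^ 2 * T * (2 + 3 * (5 / 2 * T ^ 5 * x + 5 / 2 * T ^ 5 * x)) := by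
          gcongr
          rw [mul_comm]
          have hkn : ∀ h' : ℤ, ∀ c : ℕ, 0 ≤ klN d h' c / c := by
            intro h' c; unfold klN; split_ifs <;> positivity
          have := Finset.sum_nonneg (s := (Finset.Icc 1 C0).filter (d ^ 2 * (p * q) ∣ ·)) fun c _ => hkn h c
          have := Finset.sum_nonneg (s := (Finset.Icc 1 C0).filter (d ^ 2 * (p * q) ∣ ·)) fun c _ => hkn (-h) c
          linarith
      _ = (d:ℝ) ^ 2 * (8 * T + 60 * T ^ 6 * x) := by ring
      _ ≤ (d:ℝ) ^ 2 * (60 * T ^ 6 * (1 + x)) := by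
          have : T ≤ T ^ 6 := le_self_pow₀ hT1 (by norm_num)
          apply mul_le_mul_of_nonneg_left _ (sq_nonneg _)
          linarith
  gcongr

open MeasureTheory UpperHalfPlane ComplexConjugate

lemma av_parseval {j a F B} (E : ED j a F B) (y : ℝ) (hy : 0 < y) :
    (Summable fun x : ℤ => ‖av a x‖ ^ 2 * Real.exp (-(4 * Real.pi * y * x))) ∧
    ∑' x : ℤ, ‖av a x‖ ^ 2 * Real.exp (-(4 * Real.pi * y * x)) ≤ B ^ 2 / y ^ (2 * j) := by
  obtain ⟨h1, h2⟩ := ed_parseval E y hy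
  set ι : ℕ → ℤ := fun n => (n:ℤ) + 1 with hι
  have hinj : Function.Injective ι := fun x y h => by simpa [hι] using h
  have hz : ∀ x ∉ Set.range ι, ‖av a x‖ ^ 2 * Real.exp (-(4 * Real.pi * y * x)) = 0 := by
    intro x hx
    rw [av, if_neg]
    · simp
    · intro h; exact hx ⟨(x - 1).toNat, by simp only [hι]; omega⟩
  have he : (fun x : ℤ => ‖av a x‖ ^ 2 * Real.exp (-(4 * Real.pi * y * x))) ∘ ι = fun n : ℕ => ‖a (n+1)‖^2 * Real.exp (-(4*Real.pi*y*(n+1))) := by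
    funext n
    simp only [Function.comp, hι, av]
    rw [if_pos (by omega), show ((n:ℤ) + 1).toNat = n + 1 by omega]
    push_cast; rfl
  refine ⟨(hinj.summable_iff hz).mp (by rw [he]; exact h1), ?_⟩
  rw [← hinj.tsum_eq (fun x hx => by
    by_contra h; exact hx (hz x h))]
  have : (fun c => ‖av a (ι c)‖ ^ 2 * Real.exp (-(4 * Real.pi * y * (ι c)))) = fun n : ℕ => ‖a (n+1)‖^2 * Real.exp (-(4*Real.pi*y*(n+1))) := he
  rw [this]; exact h2

lemma ct_sq (a : ℕ → ℂ) (f : ℤ) (Y : ℝ) (m : ℕ) (n : ℤ) :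
    ‖ct a f Y m n‖ ^ 2 = ‖av a (m * n + f)‖ ^ 2 * Real.exp (-(4 * Real.pi * (Y / m) * (m * n + f : ℤ))) := by
  rw [ct, norm_mul, Complex.norm_real, mul_pow, Real.norm_of_nonneg (Real.exp_nonneg _), ← Real.exp_nat_mul]
  congr 2; push_cast; ring

lemma ct_inj (f : ℤ) (m : ℕ) (hm : 1 ≤ m) : Function.Injective fun n : ℤ => (m:ℤ) * n + f := by
  intro x y h
  simp only [add_left_inj] at h
  exact mul_left_cancel₀ (by omega) h

lemma ct_sum {j a F B} (E : ED j a F B) (f : ℤ) (Y : ℝ) (hY : 0 < Y) (m : ℕ) (hm : 1 ≤ m) : Summable fun n : ℤ => ‖ct a f Y m n‖ ^ 2 := by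
  have h := (av_parseval E (Y / m) (div_pos hY (by exact_mod_cast hm))).1.comp_injective (ct_inj f m hm)
  refine h.congr fun n => ?_
  rw [ct_sq]; rfl

lemma ct_anti (a : ℕ → ℂ) (f : ℤ) (Y y : ℝ) (h : y ≤ Y) (m : ℕ) (n : ℤ) : ‖ct a f Y m n‖ ≤ ‖ct a f y m n‖ := by
  rw [ct, ct, norm_mul, norm_mul, Complex.norm_real, Complex.norm_real, Real.norm_of_nonneg (Real.exp_nonneg _), Real.norm_of_nonneg (Real.exp_nonneg _)]
  by_cases hx : 1 ≤ (m:ℤ) * n + f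
  · have : (0:ℝ) ≤ ((m * n + f : ℤ) : ℝ) / m := div_nonneg (by exact_mod_cast (by omega : (0:ℤ) ≤ m * n + f)) (Nat.cast_nonneg _)
    gcongr
  · rw [av, if_neg hx]; simp

lemma ct_prod_le (z w : ℂ) : ‖z * conj w‖ ≤ ‖z‖ ^ 2 + ‖w‖ ^ 2 := by
  rw [norm_mul, RCLike.norm_conj]
  nlinarith [sq_nonneg (‖z‖ - ‖w‖), norm_nonneg z, norm_nonneg w, sq_nonneg (‖z‖ + ‖w‖)]

lemma TT_sum {j a F B} (E : ED j a F B) (f : ℤ) (Y : ℝ) (hY : 0 < Y) (m1 m2 : ℕ) (h1 : 1 ≤ m1) (h2 : 1 ≤ m2) :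
    HasSum (fun n : ℤ => ct a f Y m1 n * conj (ct a f Y m2 n)) (TT a f m1 m2 Y) :=
  (Summable.of_norm_bounded ((ct_sum E f Y hY m1 h1).add (ct_sum E f Y hY m2 h2)) fun _ => ct_prod_le _ _).hasSum

lemma TT_cont {j a F B} (E : ED j a F B) (f : ℤ) (y : ℝ) (hy : 0 < y) (m1 m2 : ℕ) (h1 : 1 ≤ m1) (h2 : 1 ≤ m2) :
    ContinuousOn (TT a f m1 m2) (Set.Ici y) := by
  refine continuousOn_tsum (fun n => ?_) ((ct_sum E f y hy m1 h1).add (ct_sum E f y hy m2 h2)) fun n Y hY => ?_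
  · unfold ct
    fun_prop
  · refine (ct_prod_le _ _).trans ?_
    have := ct_anti a f Y y hY m1 n
    have := ct_anti a f Y y hY m2 n
    gcongr

lemma diag_bound {j a F B} (E : ED j a F B) (f : ℤ) (I : Finset ℕ) (mb : ℕ) (hI : ∀ m ∈ I, 1 ≤ m ∧ m ≤ mb) (Y r0 T N : ℝ) (hY : 0 < Y) (hr0 : 0 < r0)
    (hT : ∀ n : ℕ, 1 ≤ n → (n.divisors.card : ℝ) ≤ T * (1 + n / N)) (hT0 : 0 ≤ T) (hN : r0 ≤ N) (hf : |(f:ℝ)| ≤ N) (hy : 0 < Y / mb - 1 / (4 * Real.pi * r0)) :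
    ∑ m ∈ I, ∑' n : ℤ, (if n = 0 then 0 else ‖ct a f Y m n‖ ^ 2) ≤ 2 * T * (B ^ 2 / (Y / mb - 1 / (4 * Real.pi * r0)) ^ (2 * j)) := by
  set y := Y / mb - 1 / (4 * Real.pi * r0) with hyd
  obtain ⟨hs, hb⟩ := av_parseval E y hy
  set P : ℕ → ℤ → ℝ := fun m x => if (m:ℤ) ∣ x - f ∧ x ≠ f then ‖av a x‖ ^ 2 * Real.exp (-(4 * Real.pi * (Y / m) * x)) else 0 with hP
  have key : ∀ m ∈ I, Summable (P m) ∧ ∑' n : ℤ, (if n = 0 then 0 else ‖ct a f Y m n‖ ^ 2) = ∑' x, P m x := by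
    intro m hm
    have hm1 := (hI m hm).1
    constructor
    · refine Summable.of_nonneg_of_le (fun x => ?_) (fun x => ?_) (av_parseval E (Y / m) (div_pos hY (by exact_mod_cast hm1))).1
      · simp only [hP]; split_ifs <;> positivity
      · simp only [hP]; split_ifs
        · exact le_rfl
        · positivity
    · rw [← (ct_inj f m hm1).tsum_eq (f := P m)]
      · refine tsum_congr fun n => ?_
        simp only [hP, add_sub_cancel_right, dvd_mul_right, true_and, ct_sq]
        have : ((m:ℤ) * n + f ≠ f) ↔ ¬ n = 0 := by
          simp; omega
        by_cases h0 : n = 0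
        · rw [if_pos h0, if_neg (by rw [this]; simpa using h0)]
        · rw [if_neg h0, if_pos (this.mpr h0)]
      · intro x hx
        rw [Function.mem_support] at hx
        by_contra h
        apply hx
        simp only [hP]
        rw [if_neg]
        rintro ⟨⟨c, hc⟩, -⟩
        exact h ⟨c, by simp only []; omega⟩
  rw [Finset.sum_congr rfl fun m hm => (key m hm).2, ← Summable.tsum_finsetSum fun m hm => (key m hm).1]
  calc _ ≤ ∑' x : ℤ, (2 * T) * (‖av a x‖ ^ 2 * Real.exp (-(4 * Real.pi * y * x))) := by
        refine Summable.tsum_le_tsum (fun x => ?_) (summable_sum fun m hm => (key m hm).1) (hs.mul_left _)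
        by_cases hx : 1 ≤ x
        swap
        · simp [hP, av, if_neg hx]
        by_cases hxf : x = f
        · simp only [hP, hxf]; simp; positivity
        have hx0 : (0:ℝ) < x := by exact_mod_cast hx
        have hd0 : (x - f).natAbs ≠ 0 := by omega
        calc ∑ m ∈ I, P m x ≤ ∑ m ∈ (x - f).natAbs.divisors, ‖av a x‖ ^ 2 * Real.exp (-(4 * Real.pi * (Y / mb) * x)) := by
              rw [← Finset.sum_filter_add_sum_filter_not I (fun m : ℕ => (m:ℤ) ∣ x - f)]
              have z : ∑ m ∈ I.filter (fun m : ℕ => ¬ (m:ℤ) ∣ x - f), P m x = 0 := by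
                refine Finset.sum_eq_zero fun m hm => ?_
                simp only [hP]; rw [if_neg]; rintro ⟨h, -⟩; exact (Finset.mem_filter.mp hm).2 h
              rw [z, add_zero]
              refine (Finset.sum_le_sum (g := fun _ => ‖av a x‖ ^ 2 * Real.exp (-(4 * Real.pi * (Y / mb) * x))) fun m hm => ?_).trans (Finset.sum_le_sum_of_subset_of_nonneg ?_ fun _ _ _ => by positivity)
              · have := hI m (Finset.mem_filter.mp hm).1
                have h1 : (0:ℝ) < m := by exact_mod_cast this.1
                have h2 : (m:ℝ) ≤ mb := by exact_mod_cast this.2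
                simp only [hP]; rw [if_pos ⟨(Finset.mem_filter.mp hm).2, hxf⟩]
                gcongr
              · intro m hm
                rw [Nat.mem_divisors]
                exact ⟨Int.natCast_dvd.mp (Finset.mem_filter.mp hm).2, hd0⟩
          _ = (x - f).natAbs.divisors.card * (‖av a x‖ ^ 2 * Real.exp (-(4 * Real.pi * (Y / mb) * x))) := by
              rw [Finset.sum_const, nsmul_eq_mul]
          _ ≤ (2 * T * Real.exp (x / r0)) * (‖av a x‖ ^ 2 * Real.exp (-(4 * Real.pi * (Y / mb) * x))) := by
              refine mul_le_mul_of_nonneg_right ((hT _ (by omega)).trans ?_) (by positivity)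
              have hN0 : 0 < N := by linarith
              have e1 : ((x - f).natAbs : ℝ) / N ≤ x / r0 + 1 := by
                rw [Nat.cast_natAbs, Int.cast_abs]
                push_cast
                calc _ ≤ (|(x:ℝ)| + |(f:ℝ)|) / N := by gcongr; exact abs_sub _ _
                  _ = x / N + |(f:ℝ)| / N := by rw [abs_of_pos hx0, add_div]
                  _ ≤ _ := by gcongr; exact div_le_one_of_le₀ hf hN0.le
              have e2 := Real.add_one_le_exp ((x:ℝ) / r0)
              have e3 : 0 ≤ (x:ℝ) / r0 := by positivity
              rw [mul_comm 2 T, mul_assoc]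
              apply mul_le_mul_of_nonneg_left _ hT0
              linarith
          _ = _ := by
              have : Real.exp (-(4 * Real.pi * y * x)) = Real.exp (x / r0) * Real.exp (-(4 * Real.pi * (Y / mb) * x)) := by
                rw [← Real.exp_add]; congr 1; rw [hyd]; field_simp; ring
              rw [this]; ring
    _ ≤ _ := by rw [tsum_mul_left]; gcongr

open MeasureTheory UpperHalfPlane ComplexConjugate

/-- index set of shifts. -/
def SS : Finset ℤ := {-1, 0, 1}
/-- shift weights. -/
def om (s : ℤ) : ℝ := if s = 0 then -2 else 1
/-- correction factors. -/
noncomputable def es (f : ℤ) (δ : ℝ) (s : ℤ) (m : ℕ) : ℝ := Real.exp (-(2 * Real.pi * s * δ * (f / m)))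
/-- weights in `n`. -/
noncomputable def wn (δ : ℝ) (n : ℤ) : ℝ := (Real.exp (2 * Real.pi * δ * n) - Real.exp (-(2 * Real.pi * δ * n))) ^ 2
/-- pair terms. -/
noncomputable def tq (a : ℕ → ℂ) (f : ℤ) (δ : ℝ) (α : ℕ → ℂ) (m1 m2 : ℕ) (Y : ℝ) : ℂ :=
  α m1 * conj (α m2) * ∑ s ∈ SS, ((om s * es f δ s m1 * es f δ s m2 : ℝ) : ℂ) * TT a f m1 m2 (Y - s * δ)
/-- quadratic form. -/
noncomputable def QQ (a : ℕ → ℂ) (f : ℤ) (δ : ℝ) (α : ℕ → ℂ) (I : Finset ℕ) (Y : ℝ) : ℂ := ∑ m1 ∈ I, ∑ m2 ∈ I, tq a f δ α m1 m2 Y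

lemma wn_eq (δ : ℝ) (n : ℤ) : wn δ n = ∑ s ∈ SS, om s * Real.exp (2 * Real.pi * s * δ * n) ^ 2 := by
  have h : Real.exp (2 * Real.pi * δ * n) * Real.exp (-(2 * Real.pi * δ * n)) = 1 := by rw [← Real.exp_add]; simp
  simp only [SS, om, wn]
  rw [Finset.sum_insert (by decide), Finset.sum_insert (by decide), Finset.sum_singleton]
  simp only [Int.cast_neg, Int.cast_one, Int.cast_zero]
  norm_num
  linear_combination (-2) * h

lemma es_ct (a : ℕ → ℂ) (f : ℤ) (δ Y : ℝ) (s : ℤ) (m : ℕ) (hm : 1 ≤ m) (n : ℤ) :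
    (es f δ s m : ℂ) * ct a f (Y - s * δ) m n = (Real.exp (2 * Real.pi * s * δ * n) : ℝ) * ct a f Y m n := by
  have hm' : (m:ℝ) ≠ 0 := by positivity
  rw [ct, ct, es, mul_left_comm, mul_left_comm ((Real.exp _ : ℝ) : ℂ), ← Complex.ofReal_mul, ← Complex.ofReal_mul, ← Real.exp_add, ← Real.exp_add]
  congr 3
  push_cast
  field_simp
  ring

lemma tq_sum {j a F B} (E : ED j a F B) (f : ℤ) (δ Y : ℝ) (hδ : 0 ≤ δ) (hY : δ < Y) (α : ℕ → ℂ) (m1 m2 : ℕ) (h1 : 1 ≤ m1) (h2 : 1 ≤ m2) :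
    HasSum (fun n : ℤ => (wn δ n : ℂ) * ((α m1 * ct a f Y m1 n) * conj (α m2 * ct a f Y m2 n))) (tq a f δ α m1 m2 Y) := by
  have hs : ∀ s ∈ SS, 0 < Y - s * δ := by
    intro s hs
    simp only [SS, Finset.mem_insert, Finset.mem_singleton] at hs
    rcases hs with rfl | rfl | rfl <;> push_cast <;> linarith
  have h := (hasSum_sum fun s hs' => (TT_sum E f _ (hs s hs') m1 m2 h1 h2).mul_left ((om s * es f δ s m1 * es f δ s m2 : ℝ) : ℂ)).mul_left (α m1 * conj (α m2))
  refine h.congr_fun ?_ |> fun h' => h'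
  intro n
  rw [wn_eq, Complex.ofReal_sum, Finset.sum_mul, Finset.mul_sum]
  refine Finset.sum_congr rfl fun s _ => ?_
  have e1 := es_ct a f δ Y s m1 h1 n
  have e2 := congrArg conj (es_ct a f δ Y s m2 h2 n)
  simp only [map_mul, Complex.conj_ofReal] at e2
  push_cast
  simp only [map_mul]
  calc _ = (om s : ℂ) * α m1 * conj (α m2) * (((Real.exp (2 * Real.pi * s * δ * n) : ℝ) : ℂ) * ct a f Y m1 n) * (((Real.exp (2 * Real.pi * s * δ * n) : ℝ) : ℂ) * conj (ct a f Y m2 n)) := by push_cast; ring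
    _ = _ := by rw [← e1, ← e2]; ring

lemma QQ_sum {j a F B} (E : ED j a F B) (f : ℤ) (δ Y : ℝ) (hδ : 0 ≤ δ) (hY : δ < Y) (α : ℕ → ℂ) (I : Finset ℕ) (hI : ∀ m ∈ I, 1 ≤ m) :
    HasSum (fun n : ℤ => wn δ n * ‖∑ m ∈ I, α m * ct a f Y m n‖ ^ 2) (QQ a f δ α I Y).re := by
  have h := hasSum_sum fun m1 (h1 : m1 ∈ I) => hasSum_sum fun m2 (h2 : m2 ∈ I) => tq_sum E f δ Y hδ hY α m1 m2 (hI m1 h1) (hI m2 h2)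
  have h' := Complex.hasSum_re h
  refine h'.congr_fun ?_ |> fun h' => h'
  intro n
  rw [← Finset.sum_congr rfl fun m1 _ => Finset.mul_sum I _ _, ← Finset.mul_sum, ← Finset.sum_congr rfl fun m1 _ => Finset.mul_sum I _ _, ← Finset.sum_mul, ← map_sum, Complex.mul_conj, ← Complex.ofReal_mul, Complex.ofReal_re, Complex.normSq_eq_norm_sq]

lemma tq_cont {j a F B} (E : ED j a F B) (f : ℤ) (δ Y0 L : ℝ) (hδ : 0 ≤ δ) (hY : δ < Y0) (α : ℕ → ℂ) (m1 m2 : ℕ) (h1 : 1 ≤ m1) (h2 : 1 ≤ m2) (s : ℤ) (hs : s ∈ SS) :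
    ContinuousOn (fun Y => TT a f m1 m2 (Y - s * δ)) (Set.Icc Y0 (Y0 + L)) := by
  refine (TT_cont E f (Y0 - δ) (by linarith) m1 m2 h1 h2).comp (by fun_prop) fun Y hY' => ?_
  have := hY'.1
  simp only [SS, Finset.mem_insert, Finset.mem_singleton] at hs
  rw [Set.mem_Ici]
  rcases hs with rfl | rfl | rfl <;> push_cast <;> linarith

lemma QQ_int {j a F B} (E : ED j a F B) (f : ℤ) (δ Y0 L D : ℝ) (hδ : 0 ≤ δ) (hY : δ < Y0) (hL : 0 ≤ L) (α : ℕ → ℂ) (hα : ∀ m, ‖α m‖ ≤ 1) (I : Finset ℕ) (hI : ∀ m ∈ I, 1 ≤ m)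
    (he : ∀ s ∈ SS, ∀ m ∈ I, es f δ s m ≤ 2)
    (hD : ∀ s ∈ SS, ∀ Y ∈ Set.Icc Y0 (Y0 + L), ∑ m ∈ I, ∑' n : ℤ, (if n = 0 then 0 else ‖ct a f (Y - s * δ) m n‖ ^ 2) ≤ D)
    (P : ℕ → ℕ → ℝ) (hP0 : ∀ m1 m2, 0 ≤ P m1 m2)
    (hP : ∀ s ∈ SS, ∀ m1 ∈ I, ∀ m2 ∈ I, m1 ≠ m2 → α m1 ≠ 0 → α m2 ≠ 0 → ‖∫ y in (Y0 - s * δ)..(Y0 - s * δ + L), TT a f m1 m2 y‖ ≤ P m1 m2) :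
    (∀ m1 ∈ I, ∀ m2 ∈ I, ContinuousOn (tq a f δ α m1 m2) (Set.Icc Y0 (Y0 + L))) ∧
    (∫ y in Y0..(Y0 + L), (QQ a f δ α I y).re) ≤ 8 * D * L + 16 * ∑ m1 ∈ I, ∑ m2 ∈ I, P m1 m2 := by
  have hc : ∀ m1 ∈ I, ∀ m2 ∈ I, ContinuousOn (tq a f δ α m1 m2) (Set.Icc Y0 (Y0 + L)) := by
    intro m1 h1 m2 h2
    refine ContinuousOn.mul continuousOn_const (continuousOn_finset_sum _ fun s hs => continuousOn_const.mul (tq_cont E f δ Y0 L hδ hY α m1 m2 (hI _ h1) (hI _ h2) s hs))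
  refine ⟨hc, ?_⟩
  have hii : ∀ m1 ∈ I, ∀ m2 ∈ I, IntervalIntegrable (fun y => (tq a f δ α m1 m2 y).re) volume Y0 (Y0 + L) := by
    intro m1 h1 m2 h2
    apply ContinuousOn.intervalIntegrable
    rw [Set.uIcc_of_le (by linarith)]
    exact Complex.continuous_re.comp_continuousOn (hc m1 h1 m2 h2)
  have hcs : ∀ m1 ∈ I, ∀ m2 ∈ I, IntervalIntegrable (fun y => tq a f δ α m1 m2 y) volume Y0 (Y0 + L) := by
    intro m1 h1 m2 h2
    apply ContinuousOn.intervalIntegrable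
    rw [Set.uIcc_of_le (by linarith)]
    exact hc m1 h1 m2 h2
  have hsplit : ∀ y, (QQ a f δ α I y).re = ∑ m ∈ I, (tq a f δ α m m y).re + ∑ m1 ∈ I, ∑ m2 ∈ I, (if m1 = m2 then 0 else (tq a f δ α m1 m2 y).re) := by
    intro y
    rw [QQ, Complex.re_sum, ← Finset.sum_add_distrib]
    refine Finset.sum_congr rfl fun m1 h1 => ?_
    rw [Complex.re_sum, ← Finset.add_sum_erase _ _ h1, ← Finset.add_sum_erase I (fun m2 => if m1 = m2 then 0 else (tq a f δ α m1 m2 y).re) h1, if_pos rfl, zero_add]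
    congr 1
    refine Finset.sum_congr rfl fun m2 h2 => ?_
    rw [if_neg (Finset.ne_of_mem_erase h2).symm]
  have hi2 : ∀ m1 ∈ I, ∀ m2 ∈ I, IntervalIntegrable (fun y => (if m1 = m2 then 0 else (tq a f δ α m1 m2 y).re)) volume Y0 (Y0 + L) := by
    intro m1 h1 m2 h2
    split_ifs
    · exact intervalIntegrable_const
    · exact hii m1 h1 m2 h2
  have hid : IntervalIntegrable (fun y => ∑ m ∈ I, (tq a f δ α m m y).re) volume Y0 (Y0 + L) := by
    have := IntervalIntegrable.sum I (f := fun m y => (tq a f δ α m m y).re) fun m hm => hii m hm m hm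
    simpa only [Finset.sum_fn] using this
  have hio1 : ∀ m1 ∈ I, IntervalIntegrable (fun y => ∑ m2 ∈ I, (if m1 = m2 then 0 else (tq a f δ α m1 m2 y).re)) volume Y0 (Y0 + L) := by
    intro m1 h1
    have := IntervalIntegrable.sum I (f := fun m2 y => (if m1 = m2 then 0 else (tq a f δ α m1 m2 y).re)) fun m hm => hi2 m1 h1 m hm
    simpa only [Finset.sum_fn] using this
  have hio : IntervalIntegrable (fun y => ∑ m1 ∈ I, ∑ m2 ∈ I, (if m1 = m2 then 0 else (tq a f δ α m1 m2 y).re)) volume Y0 (Y0 + L) := by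
    have := IntervalIntegrable.sum I (f := fun m1 y => ∑ m2 ∈ I, (if m1 = m2 then 0 else (tq a f δ α m1 m2 y).re)) hio1
    simpa only [Finset.sum_fn] using this
  simp_rw [hsplit]
  rw [intervalIntegral.integral_add hid hio]
  refine add_le_add ?_ ?_
  · calc _ ≤ ∫ y in Y0..(Y0 + L), 8 * D := by
          refine intervalIntegral.integral_mono_on (by linarith) hid intervalIntegrable_const fun Y hYm => ?_
          have hYd : δ < Y := lt_of_lt_of_le hY hYm.1
          have hm1 := hD (-1) (by decide) Y hYm
          have hp1 := hD 1 (by decide) Y hYm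
          have : ∀ m ∈ I, (tq a f δ α m m Y).re ≤ 4 * ∑' n : ℤ, (if n = 0 then 0 else ‖ct a f (Y - (-1:ℤ) * δ) m n‖ ^ 2) + 4 * ∑' n : ℤ, (if n = 0 then 0 else ‖ct a f (Y - (1:ℤ) * δ) m n‖ ^ 2) := by
            intro m hm
            have h := Complex.hasSum_re (tq_sum E f δ Y hδ hYd α m m (hI m hm) (hI m hm))
            have hsm : ∀ s ∈ SS, Summable fun n : ℤ => (if n = 0 then 0 else ‖ct a f (Y - s * δ) m n‖ ^ 2) := by
              intro s hs
              have hp : 0 < Y - s * δ := by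
                simp only [SS, Finset.mem_insert, Finset.mem_singleton] at hs
                rcases hs with rfl | rfl | rfl <;> push_cast <;> linarith
              refine Summable.of_nonneg_of_le (fun n => ?_) (fun n => ?_) (ct_sum E f _ hp m (hI m hm))
              · split_ifs <;> positivity
              · split_ifs
                · positivity
                · exact le_rfl
            have h2 := ((hsm (-1) (by decide)).mul_left 4).hasSum.add ((hsm 1 (by decide)).mul_left 4).hasSum
            rw [tsum_mul_left, tsum_mul_left] at h2
            refine hasSum_le (fun n => ?_) h h2
            rw [Complex.mul_conj, ← Complex.ofReal_mul, Complex.ofReal_re, Complex.normSq_eq_norm_sq, norm_mul]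
            by_cases hn : n = 0
            · simp [hn, wn]
            · rw [if_neg hn, if_neg hn]
              have e : ∀ s ∈ SS, (Real.exp (2 * Real.pi * s * δ * n) * ‖ct a f Y m n‖) ^ 2 ≤ 4 * ‖ct a f (Y - s * δ) m n‖ ^ 2 := by
                intro s hs
                have := congrArg norm (es_ct a f δ Y s m (hI m hm) n)
                rw [norm_mul, norm_mul, Complex.norm_real, Complex.norm_real, Real.norm_of_nonneg (Real.exp_nonneg _), Real.norm_of_nonneg (by unfold es; positivity)] at this
                rw [← this, mul_pow]
                have h2 := he s hs m hm
                have h0 : 0 ≤ es f δ s m := by unfold es; positivity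
                have : es f δ s m ^ 2 ≤ 4 := by nlinarith
                gcongr
              have e1 := e (-1) (by decide)
              have e2 := e 1 (by decide)
              have hw : wn δ n ≤ Real.exp (2 * Real.pi * (-1:ℤ) * δ * n) ^ 2 + Real.exp (2 * Real.pi * (1:ℤ) * δ * n) ^ 2 := by
                rw [wn_eq, SS, Finset.sum_insert (by decide), Finset.sum_insert (by decide), Finset.sum_singleton]
                simp only [om]; norm_num
              calc wn δ n * (‖α m‖ * ‖ct a f Y m n‖) ^ 2 ≤ (Real.exp (2 * Real.pi * (-1:ℤ) * δ * n) ^ 2 + Real.exp (2 * Real.pi * (1:ℤ) * δ * n) ^ 2) * (1 * ‖ct a f Y m n‖) ^ 2 := by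
                    gcongr; exact hα m
                _ = (Real.exp (2 * Real.pi * (-1:ℤ) * δ * n) * ‖ct a f Y m n‖) ^ 2 + (Real.exp (2 * Real.pi * (1:ℤ) * δ * n) * ‖ct a f Y m n‖) ^ 2 := by ring
                _ ≤ _ := add_le_add e1 e2
          refine (Finset.sum_le_sum this).trans ?_
          rw [Finset.sum_add_distrib, ← Finset.mul_sum, ← Finset.mul_sum]
          linarith
      _ = _ := by rw [intervalIntegral.integral_const, smul_eq_mul]; ring
  · rw [intervalIntegral.integral_finset_sum hio1, Finset.mul_sum]
    refine Finset.sum_le_sum fun m1 h1 => ?_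
    rw [intervalIntegral.integral_finset_sum (hi2 m1 h1), Finset.mul_sum]
    refine Finset.sum_le_sum fun m2 h2 => ?_
    by_cases h12 : m1 = m2
    · simp only [h12, if_true]; simp; exact hP0 _ _
    simp only [if_neg h12]
    by_cases ha1 : α m1 = 0
    · simp only [tq, ha1]; simp; exact hP0 _ _
    by_cases ha2 : α m2 = 0
    · simp only [tq, ha2]; simp; exact hP0 _ _
    have e0 : ∫ y in Y0..(Y0 + L), (tq a f δ α m1 m2 y).re = (∫ y in Y0..(Y0 + L), tq a f δ α m1 m2 y).re := by
      exact Complex.reCLM.intervalIntegral_comp_comm (hcs m1 h1 m2 h2)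
    rw [e0]
    refine (Complex.re_le_norm _).trans ?_
    simp only [tq]
    rw [intervalIntegral.integral_const_mul, intervalIntegral.integral_finset_sum, norm_mul, norm_mul, RCLike.norm_conj]
    swap
    · intro s hs
      apply ContinuousOn.intervalIntegrable
      rw [Set.uIcc_of_le (by linarith)]
      exact continuousOn_const.mul (tq_cont E f δ Y0 L hδ hY α m1 m2 (hI _ h1) (hI _ h2) s hs)
    have hsb : ∀ s ∈ SS, ‖∫ y in Y0..(Y0 + L), ((om s * es f δ s m1 * es f δ s m2 : ℝ) : ℂ) * TT a f m1 m2 (y - s * δ)‖ ≤ |om s| * 4 * P m1 m2 := by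
      intro s hs
      rw [intervalIntegral.integral_const_mul, intervalIntegral.integral_comp_sub_right, norm_mul, Complex.norm_real, Real.norm_eq_abs, abs_mul, abs_mul]
      have h := hP s hs m1 h1 m2 h2 h12 ha1 ha2
      rw [show Y0 + L - s * δ = Y0 - s * δ + L by ring]
      have g1 : |es f δ s m1| ≤ 2 := by rw [abs_of_nonneg (by unfold es; positivity)]; exact he s hs m1 h1
      have g2 : |es f δ s m2| ≤ 2 := by rw [abs_of_nonneg (by unfold es; positivity)]; exact he s hs m2 h2
      calc _ ≤ |om s| * 2 * 2 * P m1 m2 := by gcongr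
        _ = _ := by ring
    calc _ ≤ 1 * 1 * ∑ s ∈ SS, |om s| * 4 * P m1 m2 := by
          gcongr
          · exact hα m1
          · exact hα m2
          · exact norm_sum_le_of_le _ hsb
      _ = _ := by
          rw [SS, Finset.sum_insert (by decide), Finset.sum_insert (by decide), Finset.sum_singleton]
          simp only [om]; norm_num; ring

open MeasureTheory UpperHalfPlane ComplexConjugate

lemma one_sub_pow_ge (x : ℝ) (n : ℕ) (h0 : 0 ≤ x) (h1 : x ≤ 1 / 4) : Real.exp (-(4 / 3 * x * n)) ≤ (1 - x) ^ n := by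
  have h : Real.exp (-(4 / 3 * x)) ≤ 1 - x := by
    rw [Real.exp_neg, inv_le_comm₀ (Real.exp_pos _) (by linarith)]
    refine le_trans ?_ (Real.add_one_le_exp _)
    rw [inv_le_iff_one_le_mul₀ (by linarith)]
    nlinarith
  calc _ = Real.exp (-(4 / 3 * x)) ^ n := by rw [← Real.exp_nat_mul]; congr 1; ring
    _ ≤ _ := by gcongr

lemma one_add_pow_le (x : ℝ) (n : ℕ) (h0 : 0 ≤ x) : (1 + x) ^ n ≤ Real.exp (x * n) := by
  calc (1 + x) ^ n ≤ Real.exp x ^ n := by gcongr; linarith [Real.add_one_le_exp x]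
    _ = _ := by rw [← Real.exp_nat_mul]; congr 1; ring

lemma exp_4_le : Real.exp 4 ≤ 64 := by
  have h := Real.exp_one_lt_d9
  have : Real.exp 4 = Real.exp 1 ^ 4 := by rw [← Real.exp_nat_mul]; norm_num
  rw [this]
  calc Real.exp 1 ^ 4 ≤ 2.7182818286 ^ 4 := by gcongr
    _ ≤ 64 := by norm_num

lemma gcd_sum_le (q n : ℕ) (hq : q ≠ 0) : ∑ s ∈ Finset.Icc 1 n, (Nat.gcd q s : ℝ) ≤ n * (q.divisors.card * (1 + Real.log n)) := by
  refine le_trans ?_ (mul_le_mul_of_nonneg_left (sum_gcd_inv q n hq) (Nat.cast_nonneg _))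
  rw [Finset.mul_sum]
  refine Finset.sum_le_sum fun s hs => ?_
  obtain ⟨h1, h2⟩ := Finset.mem_Icc.mp hs
  have h1' : (0:ℝ) < s := by exact_mod_cast h1
  have h2' : (s:ℝ) ≤ n := by exact_mod_cast h2
  rw [mul_left_comm, mul_one_div]
  exact le_mul_of_one_le_right (by positivity) ((one_le_div h1').mpr h2')

lemma gcd_pairs (f ma mb : ℕ) (hma : 1 ≤ ma) (hf : f ≠ 0) (T v : ℝ) (hv : 0 ≤ v) (hT1 : 1 ≤ T) (hm : ∀ m : ℕ, 1 ≤ m → m ≤ mb → (m.divisors.card : ℝ) ≤ 2 * T) (hfT : (f.divisors.card : ℝ) ≤ 2 * T) (hl : 1 + Real.log mb ≤ T) :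
    ∑ m1 ∈ Finset.Icc ma mb, ∑ m2 ∈ Finset.Icc ma mb, (Nat.gcd m1 m2 : ℝ) * (1 + ((Nat.gcd f m1 : ℝ) + Nat.gcd f m2) * v) ≤ 8 * T ^ 4 * mb ^ 2 * (1 + v) := by
  have hlog : 0 ≤ 1 + Real.log mb := by linarith [Real.log_natCast_nonneg mb]
  have s1 : ∀ m1 ∈ Finset.Icc ma mb, ∑ m2 ∈ Finset.Icc ma mb, (Nat.gcd m1 m2 : ℝ) ≤ 2 * T ^ 2 * mb := by
    intro m1 h1
    obtain ⟨h1, h2⟩ := Finset.mem_Icc.mp h1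
    calc _ ≤ ∑ m2 ∈ Finset.Icc 1 mb, (Nat.gcd m1 m2 : ℝ) := Finset.sum_le_sum_of_subset_of_nonneg (Finset.Icc_subset_Icc_left hma) fun _ _ _ => by positivity
      _ ≤ mb * (m1.divisors.card * (1 + Real.log mb)) := gcd_sum_le _ _ (by omega)
      _ ≤ mb * (2 * T * T) := by gcongr; exact hm m1 (by omega) h2
      _ = _ := by ring
  have s2 : ∑ m ∈ Finset.Icc ma mb, (Nat.gcd f m : ℝ) ≤ 2 * T ^ 2 * mb := by
    calc _ ≤ ∑ m2 ∈ Finset.Icc 1 mb, (Nat.gcd f m2 : ℝ) := Finset.sum_le_sum_of_subset_of_nonneg (Finset.Icc_subset_Icc_left hma) fun _ _ _ => by positivity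
      _ ≤ mb * (f.divisors.card * (1 + Real.log mb)) := gcd_sum_le _ _ hf
      _ ≤ mb * (2 * T * T) := by gcongr
      _ = _ := by ring
  have e1 : ∑ m1 ∈ Finset.Icc ma mb, ∑ m2 ∈ Finset.Icc ma mb, (Nat.gcd m1 m2 : ℝ) * Nat.gcd f m1 ≤ 4 * T ^ 4 * mb ^ 2 := by
    calc _ = ∑ m1 ∈ Finset.Icc ma mb, (∑ m2 ∈ Finset.Icc ma mb, (Nat.gcd m1 m2 : ℝ)) * Nat.gcd f m1 := by simp_rw [Finset.sum_mul]
      _ ≤ ∑ m1 ∈ Finset.Icc ma mb, (2 * T ^ 2 * mb) * Nat.gcd f m1 := Finset.sum_le_sum fun m1 h1 => mul_le_mul_of_nonneg_right (s1 m1 h1) (by positivity)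
      _ ≤ (2 * T ^ 2 * mb) * (2 * T ^ 2 * mb) := by rw [← Finset.mul_sum]; gcongr
      _ = _ := by ring
  have e2 : ∑ m1 ∈ Finset.Icc ma mb, ∑ m2 ∈ Finset.Icc ma mb, (Nat.gcd m1 m2 : ℝ) * Nat.gcd f m2 ≤ 4 * T ^ 4 * mb ^ 2 := by
    rw [Finset.sum_comm]
    refine le_trans (le_of_eq ?_) e1
    refine Finset.sum_congr rfl fun x _ => Finset.sum_congr rfl fun y _ => ?_
    rw [Nat.gcd_comm]
  have e0 : ∑ m1 ∈ Finset.Icc ma mb, ∑ m2 ∈ Finset.Icc ma mb, (Nat.gcd m1 m2 : ℝ) ≤ 4 * T ^ 4 * mb ^ 2 := by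
    refine le_trans (Finset.sum_le_sum fun m1 h1 => Finset.sum_le_sum fun m2 h2 => ?_) e1
    refine le_mul_of_one_le_right (by positivity) ?_
    exact_mod_cast Nat.gcd_pos_of_pos_left _ (Nat.pos_of_ne_zero hf)
  calc _ = ∑ m1 ∈ Finset.Icc ma mb, ∑ m2 ∈ Finset.Icc ma mb, (Nat.gcd m1 m2 : ℝ) + v * (∑ m1 ∈ Finset.Icc ma mb, ∑ m2 ∈ Finset.Icc ma mb, (Nat.gcd m1 m2 : ℝ) * Nat.gcd f m1 + ∑ m1 ∈ Finset.Icc ma mb, ∑ m2 ∈ Finset.Icc ma mb, (Nat.gcd m1 m2 : ℝ) * Nat.gcd f m2) := by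
        rw [← Finset.sum_add_distrib, Finset.mul_sum, ← Finset.sum_add_distrib]
        refine Finset.sum_congr rfl fun x _ => ?_
        rw [← Finset.sum_add_distrib, Finset.mul_sum, ← Finset.sum_add_distrib]
        refine Finset.sum_congr rfl fun y _ => ?_
        ring
    _ ≤ 4 * T ^ 4 * mb ^ 2 + v * (4 * T ^ 4 * mb ^ 2 + 4 * T ^ 4 * mb ^ 2) := by gcongr
    _ ≤ _ := by
        have : 0 ≤ T ^ 4 * (mb:ℝ) ^ 2 := by positivity
        linarith

lemma sq_le_aux (Y0 x : ℝ) (hY : 0 < Y0) (g1 g2 m : ℝ) (h1 : 1 ≤ g1) (h2 : 1 ≤ g2) (hm : 1 ≤ m) (hx : x ≤ 2 * (√g1 * √g2 / (√Y0 * m))) :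
    1 + x ≤ (1 + (g1 + g2) * (1 / (√√Y0 * √m))) ^ 2 := by
  have a1 : √√Y0 ^ 2 = √Y0 := Real.sq_sqrt (Real.sqrt_nonneg _)
  have a2 : √m ^ 2 = m := Real.sq_sqrt (by linarith)
  have b : √g1 * √g2 ≤ g1 * g2 := by
    have := Real.sqrt_le_iff.mpr ⟨by linarith, (by nlinarith : g1 ≤ g1 ^ 2)⟩
    have := Real.sqrt_le_iff.mpr ⟨by linarith, (by nlinarith : g2 ≤ g2 ^ 2)⟩
    gcongr
  have h3 : (1 / (√√Y0 * √m)) ^ 2 = 1 / (√Y0 * m) := by rw [div_pow, mul_pow, a1, a2, one_pow]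
  set w := 1 / (√√Y0 * √m) with hw
  have hw0 : 0 ≤ w := by positivity
  have : 2 * (√g1 * √g2 / (√Y0 * m)) ≤ ((g1 + g2) * w) ^ 2 := by
    rw [mul_pow, h3, mul_one_div, ← mul_div_assoc]
    gcongr
    nlinarith
  have : 0 ≤ (g1 + g2) * w := by positivity
  nlinarith

open MeasureTheory UpperHalfPlane ComplexConjugate

lemma box_pair {j a F B} (E : ED j a F B) (f : ℤ) (hf : f ≠ 0) (ma m1 m2 : ℕ) (hma : 1 ≤ ma) (Y0 Y1 L N T : ℝ) (hY0 : 0 < Y0) (hL : L = Y0 / (2 * j))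
    (hY1 : Y0 * (1 - 1 / (2 * j)) ≤ Y1) (hY2 : Y1 ≤ Y0 * (1 + 1 / (2 * j)))
    (h1 : ma ≤ m1) (h1' : (m1:ℝ) ≤ ma * (1 + 1 / (32 * j))) (h2 : ma ≤ m2) (h2' : (m2:ℝ) ≤ ma * (1 + 1 / (32 * j)))
    (s1 : Squarefree m1) (s2 : Squarefree m2) (hne : m1 ≠ m2)
    (hT : ∀ n : ℕ, 1 ≤ n → (n.divisors.card : ℝ) ≤ T * (1 + n / N)) (hT1 : 1 ≤ T)
    (hN1 : (m1:ℝ) * m2 ≤ N) (hN2 : 2 * (m1 * m2) / Y1 ≤ N) (hN3 : (m1 + m2) * |(f:ℝ)| ≤ N) (hTl : 1 + Real.log N ≤ T) :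
    ‖∫ y in Y1..Y1+L, TT a f m1 m2 y‖ ≤ 1024 * (Y0 * √Y0) * ((ma / Y0) ^ (2 * j) * B ^ 2) * T ^ 3 * ((Nat.gcd m1 m2 : ℝ) * (1 + ((Nat.gcd f.natAbs m1 : ℝ) + Nat.gcd f.natAbs m2) * (1 / (√√Y0 * √ma)))) := by
  have hj : (6:ℝ) ≤ j := by exact_mod_cast E.hj
  have hma' : (1:ℝ) ≤ ma := by exact_mod_cast hma
  have hx0 : 0 ≤ 1 / (2 * (j:ℝ)) := by positivity
  have hx1 : 1 / (2 * (j:ℝ)) ≤ 1 / 12 := by gcongr; linarith only [hj]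
  have hY1p : 11 / 12 * Y0 ≤ Y1 := by linarith [mul_le_mul_of_nonneg_left hx1 hY0.le]
  have hY1q : Y1 ≤ 13 / 12 * Y0 := by linarith [mul_le_mul_of_nonneg_left hx1 hY0.le]
  have hY10 : 0 < Y1 := by linarith only [hY0, hY1p]
  have hN0 : 0 < N := lt_of_lt_of_le (mul_pos (by exact_mod_cast (by omega : 0 < m1)) (by exact_mod_cast (by omega : 0 < m2))) hN1
  have hLY : L ≤ Y1 := by rw [hL, div_eq_mul_one_div]; linarith [mul_le_mul_of_nonneg_left hx1 hY0.le]
  have hL0 : 0 < L := by rw [hL]; positivity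
  have hm1r : (ma:ℝ) ≤ m1 := by exact_mod_cast h1
  have hm2r : (ma:ℝ) ≤ m2 := by exact_mod_cast h2
  have hm10 : (0:ℝ) < m1 := by linarith only [hma', hm1r]
  have hm20 : (0:ℝ) < m2 := by linarith only [hma', hm2r]
  have main := pair_bound E m1 m2 s1 s2 hne f hf Y1 L N (2 * T) hL0 hLY (fun n hn hnN => (hT n hn).trans (by
    have : (n:ℝ) / N ≤ 1 := div_le_one_of_le₀ hnN hN0.le
    calc T * (1 + n / N) ≤ T * (1 + 1) := by gcongr
      _ = 2 * T := by ring)) hN1 hN2 hN3 (by linarith only [hT1, hTl])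
  have hgp : ∀ m, (1:ℝ) ≤ (Nat.gcd f.natAbs m : ℝ) := fun m => by exact_mod_cast Nat.gcd_pos_of_pos_left _ (Int.natAbs_pos.mpr hf)
  set g1 : ℝ := (Nat.gcd f.natAbs m1 : ℝ)
  set g2 : ℝ := (Nat.gcd f.natAbs m2 : ℝ)
  set d : ℝ := (Nat.gcd m1 m2 : ℝ)
  have hg1 : 1 ≤ g1 := hgp m1
  have hg2 : 1 ≤ g2 := hgp m2
  have hd0 : 0 ≤ d := Nat.cast_nonneg _
  have hB := E.Bpos
  clear_value g1 g2 d
  -- x bound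
  have hx : √g1 * √g2 / (√Y1 * √(m1 * m2)) ≤ 2 * (√g1 * √g2 / (√Y0 * ma)) := by
    have a1 : √Y0 ≤ 2 * √Y1 := by
      rw [← Real.sqrt_sq (show (0:ℝ) ≤ 2 by norm_num), ← Real.sqrt_mul (by norm_num)]
      apply Real.sqrt_le_sqrt; linarith only [hY1p, hY1q]
    have a2 : (ma:ℝ) ≤ √(m1 * m2) := by
      apply Real.le_sqrt_of_sq_le; rw [sq]; gcongr
    have a3 : 0 < √Y1 := Real.sqrt_pos.mpr hY10
    have a4 : 0 < √Y0 := Real.sqrt_pos.mpr hY0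
    rw [← mul_div_assoc, div_le_div_iff₀ (by positivity) (by positivity)]
    calc √g1 * √g2 * (√Y0 * ma) ≤ √g1 * √g2 * ((2 * √Y1) * √(m1 * m2)) := by gcongr
      _ = _ := by ring
  have hs := sq_le_aux Y0 _ hY0 g1 g2 ma hg1 hg2 hma' hx
  -- powers
  have p1 : Y1 ^ 3 ≤ 2 * Y0 ^ 3 := by
    calc Y1 ^ 3 ≤ (13 / 12 * Y0) ^ 3 := by gcongr
      _ = (13 / 12) ^ 3 * Y0 ^ 3 := by ring
      _ ≤ _ := by gcongr; norm_num
  have p2 : Y0 ^ (4 * j) ≤ 64 * Y1 ^ (4 * j) := by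
    have := one_sub_pow_ge (1 / (2 * (j:ℝ))) (4 * j) hx0 (by linarith only [hx1])
    have e : -(4 / 3 * (1 / (2 * (j:ℝ))) * ((4 * j : ℕ) : ℝ)) = - (8 / 3) := by push_cast; field_simp; norm_num
    rw [e] at this
    have h4 : (1:ℝ) ≤ 64 * Real.exp (-(8/3)) := by
      have := exp_4_le
      have h5 : Real.exp (-4) ≤ Real.exp (-(8/3)) := by gcongr; norm_num
      have h6 : Real.exp 4 * Real.exp (-4) = 1 := by rw [← Real.exp_add]; simp
      calc (1:ℝ) = Real.exp 4 * Real.exp (-4) := h6.symm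
        _ ≤ 64 * Real.exp (-(8/3)) := by gcongr
    calc Y0 ^ (4 * j) = 1 * Y0 ^ (4 * j) := by ring
      _ ≤ (64 * (1 - 1 / (2 * (j:ℝ))) ^ (4 * j)) * Y0 ^ (4 * j) := by gcongr; linarith only [this, h4]
      _ = 64 * (Y0 * (1 - 1 / (2 * (j:ℝ)))) ^ (4 * j) := by rw [mul_pow]; ring
      _ ≤ _ := by
        have : 0 ≤ Y0 * (1 - 1 / (2 * (j:ℝ))) := mul_nonneg hY0.le (by linarith only [hx1])
        gcongr
  have p3 : ((m1:ℝ) * m2) ^ (2 * j) ≤ 2 * (ma:ℝ) ^ (4 * j) := by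
    have := one_add_pow_le (1 / (32 * (j:ℝ))) (4 * j) (by positivity)
    have e : (1 / (32 * (j:ℝ))) * ((4 * j : ℕ) : ℝ) = 1 / 8 := by push_cast; field_simp; norm_num
    rw [e] at this
    have h4 : Real.exp (1/8) ≤ 2 := by
      have := Real.exp_bound_div_one_sub_of_interval (x := 1/8) (by norm_num) (by norm_num)
      exact this.trans (by norm_num)
    calc ((m1:ℝ) * m2) ^ (2 * j) ≤ ((ma * (1 + 1 / (32 * j))) * (ma * (1 + 1 / (32 * j)))) ^ (2 * j) := by gcongr
      _ = (1 + 1 / (32 * (j:ℝ))) ^ (4 * j) * (ma:ℝ) ^ (4 * j) := by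
        rw [← mul_pow, ← sq, ← pow_mul]; ring_nf
      _ ≤ _ := by gcongr; linarith only [this, h4]
  apply le_of_sq_le_sq _ (by positivity)
  refine main.trans ?_
  have q1 : Y1 ^ 3 / Y1 ^ (4 * j) ≤ 2 * Y0 ^ 3 * 64 / Y0 ^ (4 * j) := by
    rw [div_le_div_iff₀ (by positivity) (by positivity)]
    calc Y1 ^ 3 * Y0 ^ (4 * j) ≤ (2 * Y0 ^ 3) * (64 * Y1 ^ (4 * j)) := by gcongr
      _ = _ := by ring
  set u := 1 + (g1 + g2) * (1 / (√√Y0 * √ma)) with hu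
  set x := √g1 * √g2 / (√Y1 * √(m1 * m2)) with hxd
  have hx00 : 0 ≤ x := by positivity
  calc _ ≤ (2 * Y0 ^ 3 * 64 / Y0 ^ (4 * j)) * (2 * (ma:ℝ) ^ (4 * j)) * B ^ 4 * (d ^ 2 * (60 * (2 * T) ^ 6 * u ^ 2)) := by gcongr
    _ = 983040 * (Y0 ^ 3 * (ma:ℝ) ^ (4 * j) / Y0 ^ (4 * j) * B ^ 4 * d ^ 2 * T ^ 6 * u ^ 2) := by ring
    _ ≤ 1048576 * (Y0 ^ 3 * (ma:ℝ) ^ (4 * j) / Y0 ^ (4 * j) * B ^ 4 * d ^ 2 * T ^ 6 * u ^ 2) := by gcongr; norm_num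
    _ = _ := by
      rw [div_pow]
      have e : (Y0 * √Y0) ^ 2 = Y0 ^ 3 := by rw [mul_pow, Real.sq_sqrt hY0.le]; ring
      rw [show 4 * j = 2 * j * 2 by ring, pow_mul, pow_mul, ← e]
      ring

lemma box_int {j a F B} (E : ED j a F B) (f : ℤ) (hf : f ≠ 0) (ma mb : ℕ) (hma : 1 ≤ ma) (hmb : (mb:ℝ) ≤ ma * (1 + 1 / (32 * j))) (r0 Y0 L δ N T : ℝ) (hr0 : 0 < r0)
    (hY0 : Y0 = j * ma / (2 * Real.pi * r0)) (hL : L = Y0 / (2 * j)) (hδ : 0 ≤ δ) (hδL : δ ≤ L) (hδf : 2 * Real.pi * δ * (|(f:ℝ)| / ma) ≤ 1 / 2)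
    (hT : ∀ n : ℕ, 1 ≤ n → (n.divisors.card : ℝ) ≤ T * (1 + n / N)) (hT1 : 1 ≤ T) (hTl : 1 + Real.log N ≤ T)
    (hN0 : r0 ≤ N) (hNm : (mb:ℝ) ^ 2 ≤ N) (hNY : 4 * mb ^ 2 / Y0 ≤ N) (hNf : 2 * mb * |(f:ℝ)| ≤ N)
    (α : ℕ → ℂ) (hα : ∀ m, ‖α m‖ ≤ 1) (hα2 : ∀ m, ¬ Squarefree m → α m = 0) (hmab : ma ≤ mb) :
    (∀ s ∈ SS, ∀ Y ∈ Set.Icc Y0 (Y0 + L), ∑ m ∈ Finset.Icc ma mb, ∑' n : ℤ, (if n = 0 then 0 else ‖ct a f (Y - s * δ) m n‖ ^ 2) ≤ 128 * T * ((ma / Y0) ^ (2 * j) * B ^ 2)) ∧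
    IntervalIntegrable (fun y => (QQ a f δ α (Finset.Icc ma mb) y).re) volume Y0 (Y0 + L) ∧
    ∫ y in Y0..(Y0 + L), (QQ a f δ α (Finset.Icc ma mb) y).re ≤ L * (2 ^ 20 * T ^ 7 * ((ma / Y0) ^ (2 * j) * B ^ 2) * (1 + j * √Y0 * ma ^ 2 * (1 + 1 / (√√Y0 * √ma)))) := by
  have hj : (6:ℝ) ≤ j := by exact_mod_cast E.hj
  have hma' : (1:ℝ) ≤ ma := by exact_mod_cast hma
  have hpi := Real.pi_pos
  have hY00 : 0 < Y0 := by rw [hY0]; positivity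
  have hx0 : 0 ≤ 1 / (2 * (j:ℝ)) := by positivity
  have hx1 : 1 / (2 * (j:ℝ)) ≤ 1 / 12 := by gcongr; linarith only [hj]
  have hLx : L = Y0 * (1 / (2 * j)) := by rw [hL]; ring
  have hL0 : 0 < L := by rw [hL]; positivity
  have hLY : L ≤ Y0 / 12 := by rw [hLx]; linarith [mul_le_mul_of_nonneg_left hx1 hY00.le]
  have hB := E.Bpos
  have hmb1 : (1:ℝ) ≤ mb := by exact_mod_cast hma.trans hmab
  have hN1 : 1 ≤ N := (one_le_pow₀ hmb1).trans hNm
  have habs : ∀ s ∈ SS, |(s:ℝ)| ≤ 1 := by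
    intro s hs
    simp only [SS, Finset.mem_insert, Finset.mem_singleton] at hs
    rcases hs with rfl | rfl | rfl <;> norm_num
  have hsδ : ∀ s ∈ SS, |s * δ| ≤ L := by
    intro s hs
    rw [abs_mul, abs_of_nonneg hδ]
    calc _ ≤ 1 * δ := by gcongr; exact habs s hs
      _ ≤ L := by linarith only [hδL]
  have hfN : |(f:ℝ)| ≤ N := by
    refine le_trans ?_ hNf
    have := abs_nonneg (f:ℝ)
    calc |(f:ℝ)| = 1 * |(f:ℝ)| := by ring
      _ ≤ _ := by gcongr; linarith only [hmb1]
  set A0 := (ma / Y0) ^ (2 * j) * B ^ 2 with hA0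
  have hA00 : 0 ≤ A0 := by positivity
  have hD : ∀ s ∈ SS, ∀ Y ∈ Set.Icc Y0 (Y0 + L), ∑ m ∈ Finset.Icc ma mb, ∑' n : ℤ, (if n = 0 then 0 else ‖ct a f (Y - s * δ) m n‖ ^ 2) ≤ 128 * T * A0 := by
    intro s hs Y hY
    have hYs : Y0 * (1 - 1 / (2 * j)) ≤ Y - s * δ := by
      have := (abs_le.mp (hsδ s hs)).2
      have := hY.1
      linarith
    have hYp : 0 < Y - s * δ := lt_of_lt_of_le (mul_pos hY00 (by linarith only [hx1])) hYs
    have hy : Y0 / ma * (1 - 3 / (2 * j)) ≤ (Y - s * δ) / mb - 1 / (4 * Real.pi * r0) := by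
      have e1 : 1 / (4 * Real.pi * r0) = Y0 / ma * (1 / (2 * j)) := by rw [hY0]; field_simp; norm_num
      rw [e1]
      have e2 : Y0 / ma * (1 - 2 / (2 * j)) ≤ (Y - s * δ) / mb := by
        rw [le_div_iff₀ (by linarith only [hmb1])]
        refine le_trans ?_ hYs
        calc Y0 / ma * (1 - 2 / (2 * j)) * mb ≤ Y0 / ma * (1 - 2 / (2 * j)) * (ma * (1 + 1 / (32 * j))) := by
              have : 0 ≤ 1 - 2 / (2 * (j:ℝ)) := by
                have : 2 / (2 * (j:ℝ)) = 2 * (1 / (2 * (j:ℝ))) := by ring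
                linarith only [hx1, this]
              gcongr
          _ = Y0 * ((1 - 2 * (1 / (2 * j))) * (1 + 1 / (2 * j) / 16)) := by field_simp; ring
          _ ≤ _ := by
              apply mul_le_mul_of_nonneg_left _ hY00.le
              have : (0:ℝ) ≤ 1 / (2 * j) := by positivity
              nlinarith only [this]
      calc _ = Y0 / ma * (1 - 2 / (2 * j)) - Y0 / ma * (1 / (2 * j)) := by ring
        _ ≤ _ := by linarith only [e2]
    have hx3 : 3 / (2 * (j:ℝ)) = 3 * (1 / (2 * (j:ℝ))) := by ring
    have hyp : 0 < Y0 / ma * (1 - 3 / (2 * j)) := mul_pos (by positivity) (by linarith only [hx1, hx3])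
    refine (diag_bound E f _ mb (fun m hm => ⟨hma.trans (Finset.mem_Icc.mp hm).1, (Finset.mem_Icc.mp hm).2⟩) _ r0 T N hYp hr0 hT (by linarith only [hT1]) hN0 hfN (lt_of_lt_of_le hyp hy)).trans ?_
    have hp := one_sub_pow_ge (3 / (2 * (j:ℝ))) (2 * j) (by positivity) (by linarith only [hx1, hx3])
    have e : -(4 / 3 * (3 / (2 * (j:ℝ))) * ((2 * j : ℕ) : ℝ)) = - 4 := by push_cast; field_simp
    rw [e] at hp
    have h6 : Real.exp 4 * Real.exp (-4) = 1 := by rw [← Real.exp_add]; simp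
    have h7 : 1 ≤ 64 * (1 - 3 / (2 * (j:ℝ))) ^ (2 * j) := by
      calc (1:ℝ) = Real.exp 4 * Real.exp (-4) := h6.symm
        _ ≤ 64 * _ := by gcongr; exact exp_4_le
    calc _ ≤ 2 * T * (B ^ 2 / (Y0 / ma * (1 - 3 / (2 * j))) ^ (2 * j)) := by gcongr
      _ ≤ 2 * T * (64 * A0) := by
          gcongr
          rw [div_le_iff₀ (by positivity), mul_pow, hA0, div_pow, div_pow]
          calc B ^ 2 = B ^ 2 * 1 := by ring
            _ ≤ B ^ 2 * (64 * (1 - 3 / (2 * (j:ℝ))) ^ (2 * j)) := by gcongr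
            _ = _ := by field_simp
      _ = _ := by ring
  refine ⟨hD, ?_⟩
  set v := 1 / (√√Y0 * √ma) with hv
  have hv0 : 0 ≤ v := by positivity
  obtain ⟨hc, hi⟩ := QQ_int E f δ Y0 L (128 * T * A0) hδ (by linarith only [hδL, hL0, hLY]) hL0.le α hα (Finset.Icc ma mb) (fun m hm => hma.trans (Finset.mem_Icc.mp hm).1) (fun s hs m hm => by
      have h1 : (ma:ℝ) ≤ m := by exact_mod_cast (Finset.mem_Icc.mp hm).1
      have h2 : -(2 * Real.pi * s * δ * (f / m)) ≤ 1 / 2 := by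
        refine (neg_le_abs _).trans (le_trans ?_ hδf)
        rw [abs_mul, abs_mul, abs_mul, abs_div, abs_of_pos (show (0:ℝ) < m by linarith only [hma', h1]), abs_of_pos (show 0 < 2 * Real.pi by positivity), abs_of_nonneg hδ]
        calc _ ≤ 2 * Real.pi * 1 * δ * (|(f:ℝ)| / ma) := by gcongr; exact habs s hs
          _ = _ := by ring
      have h3 : Real.exp (1/2) ≤ 2 := by
        have := Real.exp_bound_div_one_sub_of_interval (x := 1/2) (by norm_num) (by norm_num)
        exact this.trans (by norm_num)
      unfold es
      exact (Real.exp_le_exp.mpr h2).trans h3) hD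
    (fun m1 m2 => 1024 * (Y0 * √Y0) * A0 * T ^ 3 * ((Nat.gcd m1 m2 : ℝ) * (1 + ((Nat.gcd f.natAbs m1 : ℝ) + Nat.gcd f.natAbs m2) * v)))
    (fun m1 m2 => by positivity) (fun s hs m1 h1 m2 h2 hne a1 a2 => by
      obtain ⟨h1a, h1b⟩ := Finset.mem_Icc.mp h1
      obtain ⟨h2a, h2b⟩ := Finset.mem_Icc.mp h2
      have k1 : (m1:ℝ) ≤ mb := by exact_mod_cast h1b
      have k2 : (m2:ℝ) ≤ mb := by exact_mod_cast h2b
      have hab := abs_le.mp (hsδ s hs)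
      have g1 : Y0 * (1 - 1 / (2 * j)) ≤ Y0 - s * δ := by linarith
      have g2 : Y0 - s * δ ≤ Y0 * (1 + 1 / (2 * j)) := by linarith
      have g3 : Y0 / 2 ≤ Y0 - s * δ := by linarith only [hLx, hL0, hLY, g1]
      have hmm : (m1:ℝ) * m2 ≤ mb ^ 2 := by rw [sq]; gcongr
      refine box_pair E f hf ma m1 m2 hma Y0 _ L N T hY00 hL g1 g2 h1a (k1.trans hmb) h2a (k2.trans hmb) (by_contra fun h => a1 (hα2 _ h)) (by_contra fun h => a2 (hα2 _ h)) hne hT hT1 (hmm.trans hNm) (le_trans ?_ hNY) (le_trans ?_ hNf) hTl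
      · calc 2 * (m1 * m2) / (Y0 - s * δ) ≤ 2 * (mb:ℝ) ^ 2 / (Y0 / 2) := by gcongr
          _ = _ := by field_simp; norm_num
      · gcongr; linarith only [k1, k2])
  constructor
  · apply ContinuousOn.intervalIntegrable
    rw [Set.uIcc_of_le (by linarith only [hL0])]
    refine Complex.continuous_re.comp_continuousOn (continuousOn_finset_sum _ fun m1 h1 => continuousOn_finset_sum _ fun m2 h2 => hc m1 h1 m2 h2)
  refine hi.trans ?_
  have hτ : ∀ n : ℕ, 1 ≤ n → (n:ℝ) ≤ N → (n.divisors.card : ℝ) ≤ 2 * T := by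
    intro n hn hnN
    refine (hT n hn).trans ?_
    have : (n:ℝ) / N ≤ 1 := div_le_one_of_le₀ hnN (by linarith only [hnN])
    calc T * (1 + n / N) ≤ T * (1 + 1) := by gcongr
      _ = 2 * T := by ring
  have hmbN : (mb:ℝ) ≤ N := (le_self_pow₀ hmb1 (by norm_num)).trans hNm
  have hg := gcd_pairs f.natAbs ma mb hma (by simpa using hf) T v hv0 hT1 (fun m h1 h2 => hτ m h1 (le_trans (by exact_mod_cast h2) hmbN)) (hτ _ (Int.natAbs_pos.mpr hf) (by rw [Nat.cast_natAbs, Int.cast_abs]; exact hfN)) (by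
    have := Real.log_le_log (by linarith only [hmb1]) hmbN
    linarith only [hTl, this])
  simp_rw [← Finset.mul_sum]
  have hmb2 : (mb:ℝ) ^ 2 ≤ 2 * (ma:ℝ) ^ 2 := by
    have h32 : 1 / (32 * (j:ℝ)) ≤ 1 / 4 := by gcongr; linarith only [hj]
    calc (mb:ℝ) ^ 2 ≤ ((ma:ℝ) * (1 + 1 / 4)) ^ 2 := by
          gcongr
          refine hmb.trans ?_
          gcongr
      _ = (25/16) * (ma:ℝ) ^ 2 := by ring
      _ ≤ _ := by gcongr; norm_num
  have hYL : Y0 = L * (2 * j) := by rw [hL]; field_simp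
  calc _ ≤ 8 * (128 * T * A0) * L + 16 * (1024 * (Y0 * √Y0) * A0 * T ^ 3 * (8 * T ^ 4 * (2 * ma ^ 2) * (1 + v))) := by gcongr; exact hg.trans (by gcongr)
    _ = L * (A0 * (1024 * T + 524288 * T ^ 7 * (j * √Y0 * ma ^ 2 * (1 + v)))) := by
        set q := √Y0
        rw [hYL]; ring
    _ ≤ L * (A0 * (2 ^ 20 * T ^ 7 + 2 ^ 20 * T ^ 7 * (j * √Y0 * ma ^ 2 * (1 + v)))) := by
        have : T ≤ T ^ 7 := le_self_pow₀ hT1 (by norm_num)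
        gcongr
        · linarith only []
        · norm_num
    _ = _ := by ring

open MeasureTheory UpperHalfPlane ComplexConjugate

lemma abel (x W : ℕ → ℂ) (ma mb : ℕ) (h : ma ≤ mb) :
    ∑ m ∈ Finset.Icc ma mb, x m * W m = (∑ m ∈ Finset.Icc ma mb, x m) * W mb + ∑ t ∈ Finset.Ico ma mb, (∑ m ∈ Finset.Icc ma t, x m) * (W t - W (t + 1)) := by
  induction mb, h using Nat.le_induction with
  | base => simp
  | succ n hn ih =>
    rw [Finset.sum_Icc_succ_top (by omega), ih, Finset.sum_Icc_succ_top (by omega), Finset.sum_Ico_succ_top hn]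
    ring

lemma box_abs {j a F B} (E : ED j a F B) (f : ℤ) (ma mb : ℕ) (hma : 1 ≤ ma) (hmab : ma ≤ mb) (J : Finset ℕ) (hJ : J.Nonempty) (σ : ℤ) (hσ : σ = 1 ∨ σ = -1)
    (Y0 L δ Q w U0 U1 : ℝ) (hL : 0 < L) (hδ : 0 ≤ δ) (hδY : δ < Y0) (hQ : 0 < Q) (hw : 0 < w) (hU0 : 0 ≤ U0) (hU1 : 0 ≤ U1)
    (hwn : ∀ n ∈ J, w ≤ wn δ (σ * n)) (α β : ℕ → ℂ) (hα : ∀ m, ‖α m‖ ≤ 1) (hβ : ∀ m, ‖β m‖ ≤ 1) (hα2 : ∀ m, ¬ Squarefree m → α m = 0)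
    (hQQ : ∀ α' : ℕ → ℂ, (∀ m, ‖α' m‖ ≤ 1) → (∀ m, ¬ Squarefree m → α' m = 0) → IntervalIntegrable (fun y => (QQ a f δ α' (Finset.Icc ma mb) y).re) volume Y0 (Y0 + L) ∧
      ∫ y in Y0..(Y0 + L), (QQ a f δ α' (Finset.Icc ma mb) y).re ≤ L * Q)
    (z : ℕ → ℕ → ℂ) (W : ℝ → ℕ → ℕ → ℂ) (hz : ∀ Y ∈ Set.Icc Y0 (Y0 + L), ∀ m ∈ Finset.Icc ma mb, ∀ n ∈ J, z m n = ct a f Y m (σ * n) * W Y m n)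
    (hW0 : ∀ Y ∈ Set.Icc Y0 (Y0 + L), ∀ m ∈ Finset.Icc ma mb, ∀ n ∈ J, ‖W Y m n‖ ≤ U0)
    (hW1 : ∀ Y ∈ Set.Icc Y0 (Y0 + L), ∀ m ∈ Finset.Ico ma mb, ∀ n ∈ J, ‖W Y m n - W Y (m + 1) n‖ ≤ U1) :
    ‖∑ m ∈ Finset.Icc ma mb, ∑ n ∈ J, α m * β n * z m n‖ ≤ (U0 + ((mb:ℝ) - ma) * U1) * √(J.card * Q / w) := by
  set S := ∑ m ∈ Finset.Icc ma mb, ∑ n ∈ J, α m * β n * z m n with hS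
  set H := √(J.card * Q / w) with hH
  have hJc : (0:ℝ) < J.card := by exact_mod_cast Finset.card_pos.mpr hJ
  have hH0 : 0 < H := Real.sqrt_pos.mpr (by positivity)
  have hHsq : H ^ 2 = J.card * Q / w := Real.sq_sqrt (by positivity)
  set αt : ℕ → ℕ → ℂ := fun t m => if m ≤ t then α m else 0 with hαt
  have ht1 : ∀ t m, ‖αt t m‖ ≤ 1 := by
    intro t m; simp only [hαt]; split_ifs
    · exact hα m
    · simp
  have ht2 : ∀ t m, ¬ Squarefree m → αt t m = 0 := by
    intro t m h; simp only [hαt]; split_ifs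
    · exact hα2 m h
    · rfl
  set D : ℕ → ℝ → ℝ := fun t Y => ∑ n ∈ J, ‖∑ m ∈ Finset.Icc ma mb, αt t m * ct a f Y m (σ * n)‖ with hD
  set h : ℕ → ℝ → ℝ := fun t Y => ((J.card / (w * H)) * (QQ a f δ (αt t) (Finset.Icc ma mb) Y).re + H) / 2 with hh
  have hDh : ∀ t, ∀ Y ∈ Set.Icc Y0 (Y0 + L), D t Y ≤ h t Y := by
    intro t Y hY
    have hs := QQ_sum E f δ Y hδ (lt_of_lt_of_le hδY hY.1) (αt t) (Finset.Icc ma mb) (fun m hm => hma.trans (Finset.mem_Icc.mp hm).1)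
    have hinj : Set.InjOn (fun n : ℕ => σ * (n:ℤ)) J := by
      intro x _ y _ hxy
      simp only at hxy
      rcases hσ with rfl | rfl <;> omega
    have h1 : w * ∑ n ∈ J, ‖∑ m ∈ Finset.Icc ma mb, αt t m * ct a f Y m (σ * n)‖ ^ 2 ≤ (QQ a f δ (αt t) (Finset.Icc ma mb) Y).re := by
      have h2 := sum_le_hasSum (J.image fun n : ℕ => σ * (n:ℤ)) (fun n _ => mul_nonneg (sq_nonneg _) (sq_nonneg _)) hs
      rw [Finset.sum_image hinj] at h2
      refine le_trans ?_ h2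
      rw [Finset.mul_sum]
      exact Finset.sum_le_sum fun n hn => mul_le_mul_of_nonneg_right (hwn n hn) (sq_nonneg _)
    have h2 : D t Y ^ 2 ≤ J.card * ∑ n ∈ J, ‖∑ m ∈ Finset.Icc ma mb, αt t m * ct a f Y m (σ * n)‖ ^ 2 := sq_sum_le_card_mul_sum_sq
    set R := (QQ a f δ (αt t) (Finset.Icc ma mb) Y).re
    have h3 : D t Y ^ 2 ≤ J.card / w * R := by
      refine h2.trans ?_
      rw [div_mul_eq_mul_div, mul_div_assoc]
      gcongr
      rw [le_div_iff₀ hw, mul_comm]; exact h1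
    have h4 : 2 * D t Y ≤ D t Y ^ 2 / H + H := by
      rw [← sub_nonneg, show D t Y ^ 2 / H + H - 2 * D t Y = (D t Y - H) ^ 2 / H by field_simp; ring]
      positivity
    have h5 : D t Y ^ 2 / H ≤ J.card / (w * H) * R := by
      calc D t Y ^ 2 / H ≤ J.card / w * R / H := by gcongr
        _ = _ := by field_simp
    simp only [hh]
    linarith
  have hint : ∀ t, IntervalIntegrable (h t) volume Y0 (Y0 + L) ∧ ∫ y in Y0..(Y0 + L), h t y ≤ L * H := by
    intro t
    obtain ⟨i1, i2⟩ := hQQ (αt t) (ht1 t) (ht2 t)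
    have i3 := (i1.const_mul (J.card / (w * H)))
    refine ⟨(i3.add intervalIntegrable_const).div_const 2, ?_⟩
    simp only [hh]
    rw [intervalIntegral.integral_div, intervalIntegral.integral_add i3 intervalIntegrable_const, intervalIntegral.integral_const_mul, intervalIntegral.integral_const, smul_eq_mul]
    have e : J.card / (w * H) * (L * Q) = L * H := by
      have : J.card * Q = H ^ 2 * w := by rw [hHsq]; field_simp
      field_simp
      linear_combination this
    have : J.card / (w * H) * ∫ y in Y0..(Y0 + L), (QQ a f δ (αt t) (Finset.Icc ma mb) y).re ≤ J.card / (w * H) * (L * Q) := by gcongr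
    rw [e] at this
    linarith
  have hpt : ∀ Y ∈ Set.Icc Y0 (Y0 + L), ‖S‖ ≤ U0 * h mb Y + U1 * ∑ t ∈ Finset.Ico ma mb, h t Y := by
    intro Y hY
    have hP : ∀ t, t ≤ mb → ∀ n : ℕ, ∑ m ∈ Finset.Icc ma t, α m * ct a f Y m (σ * n) = ∑ m ∈ Finset.Icc ma mb, αt t m * ct a f Y m (σ * n) := by
      intro t ht n
      rw [← Finset.sum_subset (Finset.Icc_subset_Icc_right ht)]
      · refine Finset.sum_congr rfl fun m hm => ?_
        simp only [hαt]; rw [if_pos (Finset.mem_Icc.mp hm).2]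
      · intro m hm hm'
        simp only [hαt]; rw [if_neg, zero_mul]
        intro hle; exact hm' (Finset.mem_Icc.mpr ⟨(Finset.mem_Icc.mp hm).1, hle⟩)
    have e1 : S = ∑ n ∈ J, β n * ∑ m ∈ Finset.Icc ma mb, (α m * ct a f Y m (σ * n)) * W Y m n := by
      rw [hS, Finset.sum_comm]
      refine Finset.sum_congr rfl fun n hn => ?_
      rw [Finset.mul_sum]
      refine Finset.sum_congr rfl fun m hm => ?_
      rw [hz Y hY m hm n hn]; ring
    have e2 : ‖S‖ ≤ ∑ n ∈ J, (U0 * ‖∑ m ∈ Finset.Icc ma mb, αt mb m * ct a f Y m (σ * n)‖ + U1 * ∑ t ∈ Finset.Ico ma mb, ‖∑ m ∈ Finset.Icc ma mb, αt t m * ct a f Y m (σ * n)‖) := by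
      rw [e1]
      refine norm_sum_le_of_le _ fun n hn => ?_
      rw [norm_mul, abel _ _ _ _ hmab]
      refine (mul_le_of_le_one_left (norm_nonneg _) (hβ n)).trans ((norm_add_le _ _).trans (add_le_add ?_ ?_))
      · rw [norm_mul, mul_comm, hP mb le_rfl]
        exact mul_le_mul_of_nonneg_right (hW0 Y hY mb (Finset.right_mem_Icc.mpr hmab) n hn) (norm_nonneg _)
      · rw [Finset.mul_sum]
        refine norm_sum_le_of_le _ fun t ht => ?_
        rw [norm_mul, mul_comm, hP t (Finset.mem_Ico.mp ht).2.le]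
        exact mul_le_mul_of_nonneg_right (hW1 Y hY t ht n hn) (norm_nonneg _)
    refine e2.trans ?_
    rw [Finset.sum_add_distrib, ← Finset.mul_sum, ← Finset.mul_sum, Finset.sum_comm]
    refine add_le_add (mul_le_mul_of_nonneg_left (hDh mb Y hY) hU0) (mul_le_mul_of_nonneg_left (Finset.sum_le_sum fun t _ => hDh t Y hY) hU1)
  have hsum : IntervalIntegrable (fun Y => ∑ t ∈ Finset.Ico ma mb, h t Y) volume Y0 (Y0 + L) := by
    have := IntervalIntegrable.sum (Finset.Ico ma mb) (f := h) fun t _ => (hint t).1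
    simpa only [Finset.sum_fn] using this
  have hfin : ∫ y in Y0..(Y0 + L), ‖S‖ ≤ ∫ y in Y0..(Y0 + L), (U0 * h mb y + U1 * ∑ t ∈ Finset.Ico ma mb, h t y) :=
    intervalIntegral.integral_mono_on (by linarith) intervalIntegrable_const (((hint mb).1.const_mul _).add (hsum.const_mul _)) hpt
  rw [intervalIntegral.integral_const, intervalIntegral.integral_add ((hint mb).1.const_mul _) (hsum.const_mul _), intervalIntegral.integral_const_mul, intervalIntegral.integral_const_mul, intervalIntegral.integral_finset_sum (fun t _ => (hint t).1), smul_eq_mul, add_sub_cancel_left] at hfin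
  have h1 : ∑ t ∈ Finset.Ico ma mb, ∫ y in Y0..(Y0 + L), h t y ≤ ((mb:ℝ) - ma) * (L * H) := by
    refine (Finset.sum_le_card_nsmul _ _ _ fun t _ => (hint t).2).trans ?_
    rw [Nat.card_Ico, nsmul_eq_mul, Nat.cast_sub hmab]
  have h2 : L * ‖S‖ ≤ L * ((U0 + ((mb:ℝ) - ma) * U1) * H) := by
    calc L * ‖S‖ ≤ _ := hfin
      _ ≤ U0 * (L * H) + U1 * (((mb:ℝ) - ma) * (L * H)) := by gcongr; exact (hint mb).2
      _ = _ := by ring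
  exact le_of_mul_le_mul_left h2 hL

lemma box_triv {j a F B} (E : ED j a F B) (f : ℤ) (ma mb : ℕ) (hma : 1 ≤ ma) (J : Finset ℕ) (hJ1 : ∀ n ∈ J, 1 ≤ n) (σ : ℤ) (hσ : σ = 1 ∨ σ = -1)
    (Y D U0 : ℝ) (hY : 0 < Y) (hU0 : 0 ≤ U0) (α β : ℕ → ℂ) (hα : ∀ m, ‖α m‖ ≤ 1) (hβ : ∀ m, ‖β m‖ ≤ 1)
    (hD : ∑ m ∈ Finset.Icc ma mb, ∑' n : ℤ, (if n = 0 then 0 else ‖ct a f Y m n‖ ^ 2) ≤ D)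
    (z W : ℕ → ℕ → ℂ) (hz : ∀ m ∈ Finset.Icc ma mb, ∀ n ∈ J, z m n = ct a f Y m (σ * n) * W m n)
    (hW0 : ∀ m ∈ Finset.Icc ma mb, ∀ n ∈ J, ‖W m n‖ ≤ U0) :
    ‖∑ m ∈ Finset.Icc ma mb, ∑ n ∈ J, α m * β n * z m n‖ ≤ U0 * √((Finset.Icc ma mb).card * J.card * D) := by
  have h1 : ‖∑ m ∈ Finset.Icc ma mb, ∑ n ∈ J, α m * β n * z m n‖ ≤ U0 * ∑ m ∈ Finset.Icc ma mb, ∑ n ∈ J, ‖ct a f Y m (σ * n)‖ := by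
    simp_rw [Finset.mul_sum]
    refine norm_sum_le_of_le _ fun m hm => norm_sum_le_of_le _ fun n hn => ?_
    rw [hz m hm n hn, norm_mul, norm_mul, norm_mul]
    calc _ ≤ 1 * 1 * (‖ct a f Y m (σ * n)‖ * U0) := by
          gcongr
          · exact hα m
          · exact hβ n
          · exact hW0 m hm n hn
      _ = _ := by ring
  refine h1.trans (mul_le_mul_of_nonneg_left ?_ hU0)
  apply Real.le_sqrt_of_sq_le
  rw [← Finset.sum_product']
  refine sq_sum_le_card_mul_sum_sq.trans ?_
  rw [Finset.card_product, Nat.cast_mul]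
  refine mul_le_mul_of_nonneg_left (le_trans ?_ hD) (by positivity)
  rw [Finset.sum_product]
  refine Finset.sum_le_sum fun m hm => ?_
  have hinj : Set.InjOn (fun n : ℕ => σ * (n:ℤ)) J := by
    intro x _ y _ hxy
    simp only at hxy
    rcases hσ with rfl | rfl <;> omega
  have hsm : Summable fun n : ℤ => (if n = 0 then 0 else ‖ct a f Y m n‖ ^ 2) := by
    refine Summable.of_nonneg_of_le (fun n => ?_) (fun n => ?_) (ct_sum E f Y hY m (hma.trans (Finset.mem_Icc.mp hm).1))
    · split_ifs <;> positivity
    · split_ifs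
      · positivity
      · exact le_rfl
  have := hsm.sum_le_tsum (J.image fun n : ℕ => σ * (n:ℤ)) (fun n _ => by split_ifs <;> positivity)
  rw [Finset.sum_image hinj] at this
  refine le_trans (le_of_eq (Finset.sum_congr rfl fun n hn => ?_)) this
  have := hJ1 n hn
  rw [if_neg]
  rcases hσ with rfl | rfl <;> omega

open MeasureTheory UpperHalfPlane ComplexConjugate

lemma box_r {m m0 n n0 η : ℝ} (hm : 0 < m) (hm0 : 0 < m0) (hn : 0 < n) (hn0 : 0 < n0) (hη : 0 ≤ η) (hη1 : η ≤ 1 / 100)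
    (h1 : m ≤ m0 * (1 + η)) (h2 : m0 ≤ m * (1 + η)) (h3 : n ≤ n0 * (1 + η)) (h4 : n0 ≤ n * (1 + η)) : |m * n - m0 * n0| ≤ 3 * η * (m0 * n0) := by
  have a1 : m * n ≤ m0 * (1 + η) * (n0 * (1 + η)) := by gcongr
  have a2 : m0 * n0 ≤ m * (1 + η) * (n * (1 + η)) := by gcongr
  have p := mul_pos hm0 hn0
  have q := mul_pos hm hn
  have a3 : m0 * n0 * (1 - 3 * η) ≤ m * (1 + η) * (n * (1 + η)) * (1 - 3 * η) := mul_le_mul_of_nonneg_right a2 (by linarith)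
  have a4 : m * (1 + η) * (n * (1 + η)) * (1 - 3 * η) = m * n * (1 - η - 5 * η ^ 2 - 3 * η ^ 3) := by ring
  have a5 : m * n * (1 - η - 5 * η ^ 2 - 3 * η ^ 3) ≤ m * n * 1 := by
    gcongr; have := pow_nonneg hη 2; have := pow_nonneg hη 3; linarith
  have a6 : η * η ≤ η * 1 := by gcongr; linarith
  have a7 := mul_le_mul_of_nonneg_right a6 p.le
  rw [abs_le]; constructor
  · linarith
  · linarith

lemma vv_bd {j : ℕ} (hj : 6 ≤ j) {r r0 m ma Y : ℝ} (hr0 : 0 < r0) (hr : |r - r0| ≤ r0 / (16 * j)) (hma : 0 < ma) (hm : ma ≤ m)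
    (hY : 2 * Real.pi * Y ≤ (j + 1 / 2) * ma / r0) (hY0 : 0 ≤ Y) :
    2 * Real.pi * Y * (r / m) - (j - 1 / 2) * Real.log r ≤ j + 2 - (j - 1 / 2) * Real.log r0 := by
  have hj' : (6:ℝ) ≤ j := by exact_mod_cast hj
  have hx : r0 / (16 * j) ≤ r0 / 96 := by gcongr; linarith
  obtain ⟨hr1, hr2⟩ := abs_le.mp hr
  have rp : 0 < r := by linarith
  have e1 : 2 * Real.pi * Y * (r / m) ≤ (j + 1 / 2) * ma / r0 * ((r0 + r0 / (16 * j)) / ma) := by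
    have : r / m ≤ (r0 + r0 / (16 * j)) / ma := by gcongr; linarith
    have : 0 ≤ r / m := div_nonneg rp.le (by linarith)
    gcongr
  have e2 : (j + 1 / 2) * ma / r0 * ((r0 + r0 / (16 * j)) / ma) = j + 1 / 2 + 1 / 16 + 1 / (32 * j) := by
    field_simp; ring
  have e3 : 1 / (32 * (j:ℝ)) ≤ 1 / 32 := by gcongr; linarith
  have e4 : Real.log (r0 / r) ≤ r0 / r - 1 := Real.log_le_sub_one_of_pos (by positivity)
  rw [Real.log_div hr0.ne' rp.ne'] at e4
  have e5 : r0 / r - 1 ≤ 1 / (15 * j) := by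
    rw [div_sub_one rp.ne', div_le_div_iff₀ rp (by positivity)]
    have : r0 / (16 * j) * (16 * j) = r0 := by field_simp
    have h7 : (r0 - r) * (16 * j) ≤ r0 / (16 * j) * (16 * j) := by gcongr; linarith
    have h8 : r0 - r ≤ r0 / 96 := by linarith
    linarith
  have e6 : (j - 1 / 2) * (Real.log r0 - Real.log r) ≤ (j:ℝ) * (1 / (15 * j)) := by
    calc (j - 1 / 2) * (Real.log r0 - Real.log r) ≤ ((j:ℝ) - 1 / 2) * (1 / (15 * j)) := by gcongr <;> linarith
      _ ≤ _ := by gcongr; linarith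
  have e7 : (j:ℝ) * (1 / (15 * j)) = 1 / 15 := by field_simp
  linarith

lemma exp_diff (u v M : ℝ) (hu : u ≤ M) (hv : v ≤ M) : |Real.exp u - Real.exp v| ≤ Real.exp M * |u - v| := by
  wlog h : v ≤ u generalizing u v
  · rw [abs_sub_comm, abs_sub_comm u]; exact this v u hv hu (by linarith)
  rw [abs_of_nonneg (by have := Real.exp_le_exp.mpr h; linarith), abs_of_nonneg (by linarith)]
  have h1 := Real.add_one_le_exp (v - u)
  have h2 : Real.exp v = Real.exp u * Real.exp (v - u) := by rw [← Real.exp_add]; congr 1; ring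
  have h3 : Real.exp u * (v - u + 1) ≤ Real.exp u * Real.exp (v - u) := by gcongr
  have h4 : Real.exp u * (u - v) ≤ Real.exp M * (u - v) := by gcongr
  linarith

lemma log_diff {r s c : ℝ} (hc : 0 < c) (hr : c ≤ r) (hs : c ≤ s) : |Real.log r - Real.log s| ≤ |r - s| / c := by
  wlog h : s ≤ r generalizing r s
  · rw [abs_sub_comm, abs_sub_comm r]; exact this hs hr (by linarith)
  have sp : 0 < s := by linarith
  have rp : 0 < r := by linarith
  rw [abs_of_nonneg (by have := Real.log_le_log sp h; linarith), abs_of_nonneg (by linarith)]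
  have e4 : Real.log (r / s) ≤ r / s - 1 := Real.log_le_sub_one_of_pos (by positivity)
  rw [Real.log_div rp.ne' sp.ne', div_sub_one sp.ne'] at e4
  refine e4.trans ?_
  gcongr

/-- the smooth weight. -/
noncomputable def Wf (g : ℝ → ℂ) (σ f : ℤ) (j : ℕ) (Y : ℝ) (m n : ℕ) : ℂ :=
  g (m * n) * (Real.exp (2 * Real.pi * Y * (((m * (σ * n) + f : ℤ) : ℝ) / m) - (j - 1 / 2) * Real.log ((m * (σ * n) + f : ℤ) : ℝ)) : ℝ)

lemma Wf_eq (g : ℝ → ℂ) (σ f : ℤ) (j : ℕ) (a : ℕ → ℂ) (Y : ℝ) (m n : ℕ) (h : 0 < (m * (σ * n) + f : ℤ)) :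
    g (m * n) * heckeLambda (2 * j) a (σ * m * n + f) = ct a f Y m (σ * n) * Wf g σ f j Y m n := by
  have e : σ * m * n + f = m * (σ * n) + f := by ring
  rw [heckeLambda, e, if_pos h, ct, av, if_pos (by omega), Wf]
  set r : ℤ := m * (σ * n) + f
  have e1 : ((r.toNat : ℕ) : ℝ) = r := by
    have : ((r.toNat : ℕ) : ℤ) = r := Int.toNat_of_nonneg h.le
    exact_mod_cast this
  have rp : (0:ℝ) < r := by exact_mod_cast h
  have e2 : (r:ℝ) ^ (-((((2 * j : ℕ) : ℝ) - 1) / 2)) = Real.exp (-(2 * Real.pi * Y * (r / m))) * Real.exp (2 * Real.pi * Y * ((r : ℝ) / m) - (j - 1 / 2) * Real.log r) := by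
    rw [← Real.exp_add, Real.rpow_def_of_pos rp]; congr 1; push_cast; ring
  rw [e1, e2]; push_cast; ring

lemma Wf_bd {g : ℝ → ℂ} {σ f : ℤ} {j : ℕ} (hj : 6 ≤ j) {Y X Z κs r0 : ℝ} {ma m : ℕ} (n : ℕ) (hκ : 0 ≤ κs) (hg0 : ∀ x, ‖g x‖ ≤ κs)
    (hr0 : 0 < r0) (hr : |((m * (σ * n) + f : ℤ) : ℝ) - r0| ≤ r0 / (16 * j)) (hma : 1 ≤ ma) (hm : ma ≤ m)
    (hY : 2 * Real.pi * Y ≤ (j + 1 / 2) * ma / r0) (hY0 : 0 ≤ Y) :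
    ‖Wf g σ f j Y m n‖ ≤ κs * Real.exp (j + 2 - (j - 1 / 2) * Real.log r0) := by
  rw [Wf, norm_mul, Complex.norm_real, Real.norm_eq_abs, Real.abs_exp]
  have hm' : (ma:ℝ) ≤ m := by exact_mod_cast hm
  have h := vv_bd hj hr0 hr (by exact_mod_cast hma) hm' hY hY0
  exact mul_le_mul (hg0 _) (Real.exp_le_exp.mpr h) (Real.exp_nonneg _) hκ

lemma Wf_diff {g : ℝ → ℂ} {σ f : ℤ} (hσ : σ = 1 ∨ σ = -1) {j : ℕ} (hj : 6 ≤ j) {Y X Z κs r0 : ℝ} {ma m n : ℕ} (hX : 1 ≤ X) (hZ : 1 ≤ Z) (hκ : 0 ≤ κs) (hg0 : ∀ x, ‖g x‖ ≤ κs)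
    (hg1 : ∀ x y, ‖g x - g y‖ ≤ κs * (Z / X) * |x - y|) (hrX : X / (100 * Z) ≤ r0)
    (hr : |((m * (σ * n) + f : ℤ) : ℝ) - r0| ≤ r0 / (16 * j)) (hr' : |(((m + 1 : ℕ) * (σ * n) + f : ℤ) : ℝ) - r0| ≤ r0 / (16 * j)) (hma : 1 ≤ ma) (hm : ma ≤ m)
    (hY : 2 * Real.pi * Y ≤ (j + 1 / 2) * ma / r0) (hY0 : 0 ≤ Y) (hn : (n:ℝ) ≤ 3 * X / ma) :
    ‖Wf g σ f j Y m n - Wf g σ f j Y (m + 1) n‖ ≤ κs * Real.exp (j + 2 - (j - 1 / 2) * Real.log r0) * (700 * j * Z * (1 + |(f:ℝ)| / X) / ma) := by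
  have hXp : 0 < X := by linarith
  have hr0 : 0 < r0 := lt_of_lt_of_le (by positivity) hrX
  have hma' : (1:ℝ) ≤ ma := by exact_mod_cast hma
  have hmm : (ma:ℝ) ≤ m := by exact_mod_cast hm
  have hj' : (6:ℝ) ≤ j := by exact_mod_cast hj
  have hx : r0 / (16 * j) ≤ r0 / 96 := by gcongr; linarith
  set M := j + 2 - (j - 1 / 2) * Real.log r0 with hM
  set r : ℝ := ((m * (σ * n) + f : ℤ) : ℝ) with hrd
  set s : ℝ := (((m + 1 : ℕ) * (σ * n) + f : ℤ) : ℝ) with hsd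
  have v1 := vv_bd hj hr0 hr (by linarith) hmm hY hY0
  have v2 := vv_bd hj hr0 hr' (by linarith) (m := ((m + 1 : ℕ) : ℝ)) (by push_cast; linarith) hY hY0
  rw [Wf, Wf]
  rw [← hrd, ← hsd]
  set u := 2 * Real.pi * Y * (r / m) - (j - 1 / 2) * Real.log r with hu
  set v := 2 * Real.pi * Y * (s / (m + 1 : ℕ)) - (j - 1 / 2) * Real.log s with hv
  have ee := exp_diff u v M v1 v2
  have hsr : |r - s| = n := by
    have : r - s = -(σ * n) := by rw [hrd, hsd]; push_cast; ring
    rw [this, abs_neg, abs_mul]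
    rcases hσ with h | h <;> simp [h]
  have hl := log_diff (c := r0 / 2) (by linarith) (r := r) (s := s) (by linarith [(abs_le.mp hr).1]) (by linarith [(abs_le.mp hr').1])
  rw [hsr] at hl
  have huv : |u - v| ≤ 2 * j * |(f:ℝ)| / (ma * r0) + j * (3 * X / ma / (r0 / 2)) := by
    have e1 : u - v = 2 * Real.pi * Y * (f * (1 / (m * (m + 1)))) - (j - 1 / 2) * (Real.log r - Real.log s) := by
      rw [hu, hv, hrd, hsd]; push_cast
      have : (m:ℝ) ≠ 0 := by linarith
      have : (m:ℝ) + 1 ≠ 0 := by linarith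
      field_simp; ring
    rw [e1]
    refine (abs_sub _ _).trans ?_
    have p1 : |2 * Real.pi * Y * ((f:ℝ) * (1 / (m * (m + 1))))| ≤ (j + 1 / 2) * ma / r0 * (|(f:ℝ)| * (1 / (ma * ma))) := by
      rw [abs_mul, abs_of_nonneg (by positivity : 0 ≤ 2 * Real.pi * Y), abs_mul, abs_of_nonneg (by positivity : (0:ℝ) ≤ 1 / (m * (m + 1)))]
      gcongr; linarith
    have p2 : |((j:ℝ) - 1 / 2) * (Real.log r - Real.log s)| ≤ j * (3 * X / ma / (r0 / 2)) := by
      rw [abs_mul, abs_of_nonneg (by linarith : (0:ℝ) ≤ j - 1 / 2)]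
      gcongr
      · linarith
      · refine hl.trans ?_; gcongr
    refine add_le_add (p1.trans ?_) p2
    rw [show ((j:ℝ) + 1 / 2) * ma / r0 * (|(f:ℝ)| * (1 / (ma * ma))) = (j + 1 / 2) * |(f:ℝ)| / (ma * r0) by field_simp]
    gcongr; linarith
  have t0 : 0 ≤ |(f:ℝ)| / X := by positivity
  have huv2 : |u - v| ≤ 600 * (j * Z * (1 + |(f:ℝ)| / X) / ma) := by
    refine huv.trans ?_
    have q : 1 / r0 ≤ 100 * Z / X := by rw [div_le_div_iff₀ hr0 hXp, mul_comm, mul_one, ← div_le_iff₀' (by positivity)]; linarith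
    calc 2 * j * |(f:ℝ)| / (ma * r0) + j * (3 * X / ma / (r0 / 2)) = (2 * j * |(f:ℝ)| / ma + 6 * j * X / ma) * (1 / r0) := by field_simp; ring
      _ ≤ (2 * j * |(f:ℝ)| / ma + 6 * j * X / ma) * (100 * Z / X) := by gcongr
      _ = 200 * (j * Z * (|(f:ℝ)| / X) / ma) + 600 * (j * Z / ma) := by field_simp; ring
      _ ≤ _ := ?_
    have t1 : 0 ≤ j * Z * (|(f:ℝ)| / X) / ma := by positivity
    have t3 : j * Z * (1 + |(f:ℝ)| / X) / ma = j * Z * (|(f:ℝ)| / X) / ma + j * Z / ma := by ring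
    linarith
  have hg2 : ‖g (m * n) - g ((m + 1 : ℕ) * n)‖ ≤ κs * (3 * (j * Z * (1 + |(f:ℝ)| / X) / ma)) := by
    refine (hg1 _ _).trans ?_
    rw [show (m:ℝ) * n - (m + 1 : ℕ) * n = -n by push_cast; ring, abs_neg, Nat.abs_cast]
    calc κs * (Z / X) * n ≤ κs * (Z / X) * (3 * X / ma) := by gcongr
      _ = κs * (3 * (1 * Z * 1 / ma)) := by field_simp
      _ ≤ _ := by gcongr <;> linarith
  have key : ∀ (p q : ℂ) (x y : ℝ), p * (x:ℂ) - q * (y:ℂ) = (p - q) * (x:ℂ) + q * ((x - y : ℝ) : ℂ) := by intro p q x y; push_cast; ring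
  rw [key]
  refine (norm_add_le _ _).trans ?_
  rw [norm_mul, norm_mul, Complex.norm_real, Complex.norm_real, Real.norm_eq_abs, Real.norm_eq_abs, Real.abs_exp]
  set t := j * Z * (1 + |(f:ℝ)| / X) / ma with ht
  have ht0 : 0 ≤ t := by positivity
  calc _ ≤ κs * (3 * t) * Real.exp M + κs * (Real.exp M * (600 * t)) := by
        refine add_le_add (mul_le_mul hg2 (Real.exp_le_exp.mpr v1) (Real.exp_nonneg _) (by positivity)) (mul_le_mul (hg0 _) (ee.trans ?_) (abs_nonneg _) hκ)
        gcongr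
    _ = κs * Real.exp M * (603 * t) := by ring
    _ ≤ κs * Real.exp M * (700 * t) := by gcongr; norm_num
    _ = _ := by rw [ht]; ring

open MeasureTheory UpperHalfPlane ComplexConjugate

/-- the data of a box. -/
structure Bx (j : ℕ) (f σ : ℤ) (X Z r0 : ℝ) (ma mb : ℕ) (J : Finset ℕ) (m0 n0 : ℕ) : Prop where
  hj : 6 ≤ j
  hf : f ≠ 0
  hσ : σ = 1 ∨ σ = -1
  hX : 1 ≤ X
  hZ : 1 ≤ Z
  hma : 1 ≤ ma
  hmb : (mb:ℝ) ≤ ma * (1 + 1 / (10000 * Z * j))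
  hJ1 : ∀ n ∈ J, 1 ≤ n
  hJ2 : ∀ n ∈ J, ∀ n' ∈ J, (n:ℝ) ≤ n' * (1 + 1 / (10000 * Z * j))
  hm0 : m0 ∈ Finset.Icc ma mb
  hn0 : n0 ∈ J
  h1 : X ≤ m0 * n0
  h2 : m0 * n0 ≤ 2 * X
  hr0 : r0 = σ * m0 * n0 + f
  h3 : X / (100 * Z) ≤ r0
  h4 : r0 ≤ 200 * (X + |(f:ℝ)|)

section
variable {j : ℕ} {f σ : ℤ} {X Z r0 : ℝ} {ma mb : ℕ} {J : Finset ℕ} {m0 n0 : ℕ} (b : Bx j f σ X Z r0 ma mb J m0 n0)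
include b

lemma Bx.eta : 0 < 1 / (10000 * Z * j) ∧ 1 / (10000 * Z * j) ≤ 1 / (60000:ℝ) ∧ 1 / (10000 * Z * j) ≤ 1 / (32 * j:ℝ) := by
  have hj' : (6:ℝ) ≤ j := by exact_mod_cast b.hj
  have hZ := b.hZ
  have hz : (j:ℝ) ≤ Z * j := le_mul_of_one_le_left (by linarith) hZ
  refine ⟨by positivity, ?_, ?_⟩ <;> gcongr <;> linarith

lemma Bx.near {m n : ℕ} (hm : m ∈ Finset.Icc ma mb) (hn : n ∈ J) : |(m:ℝ) * n - m0 * n0| ≤ 6 * (1 / (10000 * Z * j)) * X := by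
  obtain ⟨e1, e2, -⟩ := b.eta
  set η := 1 / (10000 * Z * j)
  have hmb : (mb:ℝ) ≤ ma * (1 + η) := b.hmb
  have A : ∀ m ∈ Finset.Icc ma mb, ∀ m' ∈ Finset.Icc ma mb, (m:ℝ) ≤ m' * (1 + η) := by
    intro m hm m' hm'
    rw [Finset.mem_Icc] at hm hm'
    calc (m:ℝ) ≤ mb := by exact_mod_cast hm.2
      _ ≤ ma * (1 + η) := hmb
      _ ≤ _ := by gcongr; exact hm'.1
  have P : ∀ m ∈ Finset.Icc ma mb, (0:ℝ) < m := fun m hm => by exact_mod_cast b.hma.trans (Finset.mem_Icc.mp hm).1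
  have Q : ∀ n ∈ J, (0:ℝ) < n := fun n hn => by exact_mod_cast b.hJ1 n hn
  have h := box_r (P m hm) (P m0 b.hm0) (Q n hn) (Q n0 b.hn0) e1.le (by linarith only [e2]) (A m hm m0 b.hm0) (A m0 b.hm0 m hm) (b.hJ2 n hn n0 b.hn0) (b.hJ2 n0 b.hn0 n hn)
  have h2 : 3 * η * (m0 * n0) ≤ 3 * η * (2 * X) := mul_le_mul_of_nonneg_left b.h2 (by positivity)
  linarith only [h, h2]

lemma Bx.r0pos : 0 < r0 := by
  have := b.hX; have := b.hZ
  exact lt_of_lt_of_le (by positivity) b.h3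

lemma Bx.rn {m n : ℕ} (hm : m ∈ Finset.Icc ma mb) (hn : n ∈ J) : |((m * (σ * n) + f : ℤ) : ℝ) - r0| ≤ r0 / (16 * j) := by
  have hj' : (6:ℝ) ≤ j := by exact_mod_cast b.hj
  have hZ : 0 < Z := by linarith [b.hZ]
  have e : ((m * (σ * n) + f : ℤ) : ℝ) - r0 = σ * (m * n - m0 * n0) := by rw [b.hr0]; push_cast; ring
  have hs : |(σ:ℝ)| = 1 := by rcases b.hσ with h | h <;> simp [h]
  rw [e, abs_mul, hs, one_mul]
  refine (b.near hm hn).trans ?_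
  have h3 := b.h3
  calc 6 * (1 / (10000 * Z * j)) * X = (X / (100 * Z)) * (6 / 100) / j := by field_simp; ring
    _ ≤ r0 * (6 / 100) / j := by gcongr
    _ ≤ r0 * (1 / 16) / j := by have := b.r0pos; have : (6:ℝ) / 100 ≤ 1 / 16 := by norm_num
                                gcongr
    _ = _ := by field_simp

lemma Bx.rpos {m n : ℕ} (hm : m ∈ Finset.Icc ma mb) (hn : n ∈ J) : 0 < (m * (σ * n) + f : ℤ) := by
  have hj' : (6:ℝ) ≤ j := by exact_mod_cast b.hj
  have h := (abs_le.mp (b.rn hm hn)).1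
  have hr := b.r0pos
  have : r0 / (16 * j) ≤ r0 / 96 := by gcongr; linarith only [hj']
  have : (0:ℝ) < (m * (σ * n) + f : ℤ) := by linarith only [h, hr, this]
  exact_mod_cast this

lemma Bx.mn {n : ℕ} (hn : n ∈ J) : X / 2 ≤ ma * n ∧ (n:ℝ) ≤ 3 * X / ma := by
  obtain ⟨e1, e2, -⟩ := b.eta
  have hX := b.hX
  have hma : (0:ℝ) < ma := by exact_mod_cast b.hma
  have hm : ma ∈ Finset.Icc ma mb := by
    have := Finset.mem_Icc.mp b.hm0
    exact Finset.mem_Icc.mpr ⟨le_rfl, this.1.trans this.2⟩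
  have h := abs_le.mp (b.near hm hn)
  have h1 := b.h1
  have h2 := b.h2
  have : 6 * (1 / (10000 * Z * j)) * X ≤ 6 * (1 / 60000) * X := by gcongr
  refine ⟨by linarith only [h.1, h1, this, hX], ?_⟩
  rw [le_div_iff₀ hma]
  linarith only [h.2, h2, this, hX]

lemma Bx.mX : (ma:ℝ) ≤ 2 * X ∧ (mb:ℝ) ≤ 2 * ma ∧ ma ≤ mb ∧ (1:ℝ) ≤ ma := by
  obtain ⟨e1, e2, -⟩ := b.eta
  have h := Finset.mem_Icc.mp b.hm0
  have hma : (1:ℝ) ≤ ma := by exact_mod_cast b.hma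
  refine ⟨?_, ?_, h.1.trans h.2, hma⟩
  · have hn : (1:ℝ) ≤ n0 := by exact_mod_cast b.hJ1 n0 b.hn0
    calc (ma:ℝ) ≤ m0 := by exact_mod_cast h.1
      _ ≤ m0 * n0 := le_mul_of_one_le_right (by positivity) hn
      _ ≤ _ := b.h2
  · refine b.hmb.trans ?_
    have : (ma:ℝ) * (1 + 1 / (10000 * Z * j)) ≤ ma * 2 := by gcongr; linarith only [e2]
    linarith only [this]

lemma Bx.cardJ : (J.card:ℝ) ≤ 3 * X / ma := by
  have h : J ⊆ Finset.Icc 1 ⌊3 * X / ma⌋₊ := fun n hn => Finset.mem_Icc.mpr ⟨b.hJ1 n hn, Nat.le_floor (b.mn hn).2⟩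
  have h2 := Finset.card_le_card h
  rw [Nat.card_Icc, Nat.add_sub_cancel] at h2
  have hX := b.hX
  exact (Nat.cast_le.mpr h2).trans (Nat.floor_le (by positivity))

lemma Bx.wnb {n : ℕ} (hn : n ∈ J) : 1 / (500 * (1 + |(f:ℝ)| / X)) ^ 2 ≤ wn (ma / (2600 * (X + |(f:ℝ)|))) (σ * n) := by
  have hX : 0 < X := by linarith [b.hX]
  have hp : 0 < X + |(f:ℝ)| := by positivity
  set δ := ma / (2600 * (X + |(f:ℝ)|)) with hδ
  have h := (b.mn hn).1
  have e1 : 1 / (500 * (1 + |(f:ℝ)| / X)) ≤ 2 * (2 * Real.pi * δ * n) := by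
    have e2 : 1 / (500 * (1 + |(f:ℝ)| / X)) = (X / 500) / (X + |(f:ℝ)|) := by field_simp
    have e3 : 2 * (2 * Real.pi * δ * n) = (4 * Real.pi * (ma * n) / 2600) / (X + |(f:ℝ)|) := by rw [hδ]; field_simp; ring
    rw [e2, e3]
    refine div_le_div_of_nonneg_right ?_ hp.le
    have : 3 * (ma * n:ℝ) ≤ Real.pi * (ma * n) := by gcongr; exact Real.pi_gt_three.le
    linarith only [this, h, hX]
  have hx : 0 ≤ 2 * Real.pi * δ * n := by positivity
  have hs := Real.self_le_sinh_iff.mpr hx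
  rw [Real.sinh_eq] at hs
  have e4 : wn δ (σ * n) = (Real.exp (2 * Real.pi * δ * n) - Real.exp (-(2 * Real.pi * δ * n))) ^ 2 := by
    rw [wn]; rcases b.hσ with h | h <;> rw [h]
    · push_cast; rw [one_mul]
    · push_cast; rw [show 2 * Real.pi * δ * (-1 * (n:ℝ)) = -(2 * Real.pi * δ * n) by ring, neg_neg]; ring
  rw [e4, one_div, ← inv_pow, ← one_div]
  gcongr
  linarith only [hs, e1]

lemma Bx.Yb {Y0 L Y : ℝ} (hY0 : Y0 = j * ma / (2 * Real.pi * r0)) (hL : L = Y0 / (2 * j)) (hY : Y ∈ Set.Icc Y0 (Y0 + L)) : 2 * Real.pi * Y ≤ (j + 1 / 2) * ma / r0 ∧ 0 ≤ Y := by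
  have hr := b.r0pos
  have hj : (0:ℝ) < j := by exact_mod_cast (by have := b.hj; omega : 0 < j)
  have hY0p : 0 ≤ Y0 := by rw [hY0]; positivity
  refine ⟨?_, hY0p.trans hY.1⟩
  calc 2 * Real.pi * Y ≤ 2 * Real.pi * (Y0 + L) := by gcongr; exact hY.2
    _ = _ := by rw [hL, hY0]; field_simp

end

lemma VA {j a F B} (E : ED j a F B) {r0 : ℝ} (hr : 0 < r0) : Real.exp (j + 2 - (j - 1 / 2) * Real.log r0) ^ 2 * ((2 * Real.pi * r0 / j) ^ (2 * j) * B ^ 2) ≤ 2 ^ 20 * (j:ℝ) ^ 6 * r0 := by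
  have hj : (0:ℝ) < j := by exact_mod_cast (by have := E.hj; omega : 0 < j)
  have hO := Om_pos (j := j) (by have := E.hj; omega)
  have h := ed_sup E
  have h0 : 0 ≤ B / Om j := div_nonneg E.Bpos.le hO.le
  have e1 : Real.exp (j + 2 - (j - 1 / 2) * Real.log r0) ^ 2 = Real.exp 4 * r0 * (Real.exp 1 / r0) ^ (2 * j) := by
    rw [div_pow, ← Real.exp_nat_mul, ← Real.exp_nat_mul]
    have : r0 ^ (2 * j) = Real.exp (2 * j * Real.log r0) := by
      rw [show (2 * j * Real.log r0 : ℝ) = ((2 * j : ℕ) : ℝ) * Real.log r0 by push_cast; ring, Real.exp_nat_mul, Real.exp_log hr]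
    rw [this, ← Real.exp_sub]
    nth_rw 2 [← Real.exp_log hr]
    rw [← Real.exp_add, ← Real.exp_add]
    congr 1; push_cast; ring
  have e2 : Real.exp 4 * r0 * (Real.exp 1 / r0) ^ (2 * j) * ((2 * Real.pi * r0 / j) ^ (2 * j) * B ^ 2) = Real.exp 4 * r0 * (B / Om j) ^ 2 := by
    have : (B / Om j) ^ 2 = ((Real.exp 1 / r0) * (2 * Real.pi * r0 / j)) ^ (2 * j) * B ^ 2 := by
      rw [Om, div_pow, ← pow_mul, mul_comm j 2, div_eq_mul_inv, ← inv_pow, mul_comm]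
      congr 2; field_simp
    rw [this, mul_pow]; ring
  rw [e1, e2]
  calc Real.exp 4 * r0 * (B / Om j) ^ 2 ≤ 64 * r0 * (128 * (j:ℝ) ^ 3) ^ 2 := by gcongr; exact exp_4_le
    _ = _ := by ring

open MeasureTheory UpperHalfPlane ComplexConjugate

lemma rP {j r0 ma Y0 x Φ : ℝ} (hj : 1 ≤ j) (hr : 0 < r0) (hma : 0 < ma) (hY : 0 < Y0) (hYr : Y0 * r0 ≤ j * ma) (hx : 0 ≤ x) (hΦ : 1 ≤ Φ) (hrx : r0 ≤ Φ * x ^ 4) :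
    r0 * (1 + j * √Y0 * ma ^ 2 * (1 + 1 / (√(√Y0) * √ma))) ≤ Φ * j ^ 2 * (x ^ 4 + x ^ 2 * √√ma ^ 10 + x ^ 3 * √√ma ^ 7) := by
  set y := √√ma with hy
  set q := √√Y0 with hq
  set ρ := √√r0 with hρ
  have four : ∀ t : ℝ, 0 < t → √√t ^ 4 = t ∧ √t = √√t ^ 2 ∧ 0 < √√t := by
    intro t ht
    have h2 : √√t ^ 2 = √t := Real.sq_sqrt (Real.sqrt_nonneg _)
    refine ⟨?_, h2.symm, Real.sqrt_pos.mpr (Real.sqrt_pos.mpr ht)⟩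
    rw [show √√t ^ 4 = (√√t ^ 2) ^ 2 by ring, h2, Real.sq_sqrt ht.le]
  obtain ⟨a1, a2, a3⟩ := four ma hma
  obtain ⟨b1, b2, b3⟩ := four Y0 hY
  obtain ⟨c1, -, c3⟩ := four r0 hr
  rw [← hy] at a1 a2 a3
  rw [← hq] at b1 b2 b3
  rw [← hρ] at c1 c3
  have h4 : (q * ρ) ^ 4 ≤ (j * y) ^ 4 := by
    rw [mul_pow, mul_pow, a1, b1, c1]
    refine hYr.trans ?_
    gcongr; exact le_self_pow₀ hj (by norm_num)
  have hj2 : (q * ρ) ^ 4 ≤ j * y ^ 4 := by rw [mul_pow, a1, b1, c1]; exact hYr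
  have i1 : q * ρ ≤ j * y := by
    refine le_of_not_gt fun h => ?_
    have := pow_lt_pow_left₀ h (by positivity) (n := 4) (by norm_num)
    linarith only [this, h4]
  have i2 : (q * ρ) ^ 2 ≤ j * y ^ 2 := by
    refine le_of_not_gt fun h => ?_
    have := pow_lt_pow_left₀ h (by positivity) (n := 2) (by norm_num)
    have h5 : j * y ^ 4 ≤ (j * y ^ 2) ^ 2 := by
      rw [mul_pow, ← pow_mul]; gcongr; exact le_self_pow₀ hj (by norm_num)
    have h6 : ((q * ρ) ^ 2) ^ 2 = (q * ρ) ^ 4 := by ring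
    linarith only [this, h5, h6, hj2]
  have d : ∀ k : ℕ, 1 ≤ k → k ≤ 4 → ρ ^ k ≤ Φ * x ^ k := by
    intro k hk hk4
    refine le_of_not_gt fun h => ?_
    have h1 := pow_lt_pow_left₀ h (by positivity) (n := 4) (by norm_num)
    have h2 : (ρ ^ k) ^ 4 = r0 ^ k := by rw [← c1]; ring
    have h3 : r0 ^ k ≤ (Φ * x ^ 4) ^ k := by gcongr
    have h4 : (Φ * x ^ 4) ^ k ≤ (Φ * x ^ k) ^ 4 := by
      rw [mul_pow, mul_pow, ← pow_mul, ← pow_mul, mul_comm 4 k]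
      gcongr
    linarith only [h1, h2, h3, h4]
  have e : r0 * (1 + j * √Y0 * ma ^ 2 * (1 + 1 / (q * √ma))) = ρ ^ 4 + j * (q * ρ) ^ 2 * ρ ^ 2 * y ^ 8 + j * (q * ρ) * ρ ^ 3 * y ^ 6 := by
    rw [a2, b2, ← a1, ← c1]; field_simp; ring
  have hj2' : 1 ≤ j ^ 2 := one_le_pow₀ hj
  rw [e]
  calc _ ≤ 1 * (Φ * x ^ 4) + j * (j * y ^ 2) * (Φ * x ^ 2) * y ^ 8 + j * (j * y) * (Φ * x ^ 3) * y ^ 6 := by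
        rw [one_mul]; gcongr <;> (apply d <;> norm_num)
    _ ≤ j ^ 2 * (Φ * x ^ 4) + j * (j * y ^ 2) * (Φ * x ^ 2) * y ^ 8 + j * (j * y) * (Φ * x ^ 3) * y ^ 6 := by gcongr
    _ = _ := by ring

lemma calcB {κs V T A0 X ma cI cJ H r0 j : ℝ} (hκ : 0 ≤ κs) (hT : 1 ≤ T) (hX : 0 < X) (hma : 0 < ma) (hA : 0 ≤ A0) (hj : 0 ≤ j) (hH : 0 ≤ H) (hcI0 : 0 ≤ cI) (hcI : cI ≤ 2 * ma) (hcJ0 : 0 ≤ cJ) (hcJ : cJ ≤ 3 * X / ma)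
    (hVA : V ^ 2 * A0 ≤ 2 ^ 20 * j ^ 6 * r0) (h4 : r0 ≤ 200 * H) : (κs * V * √(cI * cJ * (128 * T * A0))) ^ 2 ≤ 2 ^ 40 * κs ^ 2 * T * j ^ 6 * H * X := by
  rw [mul_pow, Real.sq_sqrt (by positivity)]
  calc (κs * V) ^ 2 * (cI * cJ * (128 * T * A0)) ≤ (κs * V) ^ 2 * (2 * ma * (3 * X / ma) * (128 * T * A0)) := by gcongr
    _ = 768 * κs ^ 2 * X * T * (V ^ 2 * A0) := by field_simp; ring
    _ ≤ 768 * κs ^ 2 * X * T * (2 ^ 20 * j ^ 6 * (200 * H)) := by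
      refine mul_le_mul_of_nonneg_left (hVA.trans ?_) (by positivity)
      gcongr
    _ = 768 * 2 ^ 20 * 200 * (κs ^ 2 * T * j ^ 6 * H * X) := by ring
    _ ≤ 2 ^ 40 * (κs ^ 2 * T * j ^ 6 * H * X) := by gcongr; norm_num
    _ = _ := by ring

lemma uu {κs V φ ma mb U1 Z j : ℝ} (hκ : 0 ≤ κs) (hV : 0 ≤ V) (hφ : 1 ≤ φ) (hZ : 0 < Z) (hj : 0 < j) (hma : 0 < ma) (hm : ma ≤ mb) (hmb : mb ≤ ma * (1 + 1 / (10000 * Z * j))) (hU1 : U1 = κs * V * (700 * j * Z * φ / ma)) :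
    κs * V + (mb - ma) * U1 ≤ 2 * κs * V * φ ∧ 0 ≤ κs * V + (mb - ma) * U1 := by
  have hU : 0 ≤ U1 := by rw [hU1]; positivity
  have u1 : (mb - ma) * U1 ≤ (ma * (1 / (10000 * Z * j))) * U1 := mul_le_mul_of_nonneg_right (by linarith only [hmb]) hU
  have u2 : (ma * (1 / (10000 * Z * j))) * U1 = 7 / 100 * (κs * V * φ) := by rw [hU1]; field_simp; ring
  have u3 : κs * V * 1 ≤ κs * V * φ := by gcongr
  have u4 : 0 ≤ κs * V := by positivity
  exact ⟨by linarith only [u1, u2, u3, u4], add_nonneg u4 (mul_nonneg (sub_nonneg.mpr hm) hU)⟩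

lemma calcA {u κs V T A0 X ma cJ r0 j φ P G : ℝ} (hu0 : 0 ≤ u) (hu : u ≤ 2 * κs * V * φ) (hκ : 0 ≤ κs) (hT : 1 ≤ T) (hX : 0 < X) (hma : 0 < ma) (hφ : 1 ≤ φ) (hA : 0 ≤ A0) (hj : 0 ≤ j) (hP : 0 ≤ P) (hcJ0 : 0 ≤ cJ) (hcJ : cJ ≤ 3 * X / ma)
    (hVA : V ^ 2 * A0 ≤ 2 ^ 20 * j ^ 6 * r0) (hrP : r0 * P ≤ 200 * φ * j ^ 2 * G) (hG : 0 ≤ G) :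
    (u * √(cJ * (2 ^ 20 * T ^ 7 * A0 * P) / (1 / (500 * φ) ^ 2))) ^ 2 ≤ 2 ^ 70 * κs ^ 2 * T ^ 7 * j ^ 8 * φ ^ 5 * (X / ma * G) := by
  rw [mul_pow, Real.sq_sqrt (by positivity)]
  calc _ ≤ (2 * κs * V * φ) ^ 2 * ((3 * X / ma) * (2 ^ 20 * T ^ 7 * A0 * P) / (1 / (500 * φ) ^ 2)) := by gcongr
    _ = 3000000 * 2 ^ 20 * (κs ^ 2 * T ^ 7 * φ ^ 4 * (X / ma) * P) * (V ^ 2 * A0) := by field_simp; ring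
    _ ≤ 3000000 * 2 ^ 20 * (κs ^ 2 * T ^ 7 * φ ^ 4 * (X / ma) * P) * (2 ^ 20 * j ^ 6 * r0) := by gcongr
    _ = 3000000 * 2 ^ 40 * (κs ^ 2 * T ^ 7 * φ ^ 4 * (X / ma) * j ^ 6) * (r0 * P) := by ring
    _ ≤ 3000000 * 2 ^ 40 * (κs ^ 2 * T ^ 7 * φ ^ 4 * (X / ma) * j ^ 6) * (200 * φ * j ^ 2 * G) := by gcongr
    _ = 3000000 * 2 ^ 40 * 200 * (κs ^ 2 * T ^ 7 * j ^ 8 * φ ^ 5 * (X / ma * G)) := by ring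
    _ ≤ 2 ^ 70 * (κs ^ 2 * T ^ 7 * j ^ 8 * φ ^ 5 * (X / ma * G)) := by gcongr; norm_num
    _ = _ := by ring

lemma nums {j r0 H X fa ma mb Y0 L δ N : ℝ} (hj : 6 ≤ j) (hr : 0 < r0) (h4 : r0 ≤ 200 * H) (hX : 1 ≤ X) (hp1 : X ≤ H) (hp2 : fa ≤ H) (hfa : 0 ≤ fa) (m1 : ma ≤ 2 * X) (m2 : mb ≤ 2 * ma) (m4 : 1 ≤ ma) (hmb0 : 0 ≤ mb)
    (hY0 : Y0 = j * ma / (2 * Real.pi * r0)) (hL : L = Y0 / (2 * j)) (hδ : δ = ma / (2600 * H)) (hN : N = 10 ^ 5 * H ^ 2) :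
    0 < Y0 ∧ 0 < L ∧ 0 < δ ∧ δ ≤ L ∧ L < Y0 ∧ 2 * Real.pi * δ * (fa / ma) ≤ 1 / 2 ∧ mb ^ 2 ≤ N ∧ 4 * mb ^ 2 / Y0 ≤ N ∧ 2 * mb * fa ≤ N ∧ r0 ≤ N := by
  have hp : 0 < H := by linarith only [hX, hp1]
  have hH2 : H ≤ H ^ 2 := le_self_pow₀ (by linarith only [hX, hp1]) (by norm_num)
  have hY0p : 0 < Y0 := by rw [hY0]; positivity
  have hLp : 0 < L := by rw [hL]; positivity
  have hδp : 0 < δ := by rw [hδ]; positivity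
  have hδL : δ ≤ L := by
    have : L = ma / (4 * Real.pi * r0) := by rw [hL, hY0]; field_simp; ring
    rw [this, hδ]
    refine div_le_div_of_nonneg_left (by positivity) (by positivity) ?_
    calc 4 * Real.pi * r0 ≤ 4 * 3.15 * (200 * H) := by gcongr; exact Real.pi_lt_d2.le
      _ ≤ _ := by linarith only [hp]
  have hLY : L < Y0 := by
    rw [hL]; exact div_lt_self hY0p (by linarith only [hj])
  have hδf : 2 * Real.pi * δ * (fa / ma) ≤ 1 / 2 := by
    rw [show 2 * Real.pi * δ * (fa / ma) = 2 * Real.pi / 2600 * (fa / H) by rw [hδ]; field_simp]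
    calc 2 * Real.pi / 2600 * (fa / H) ≤ 2 * 4 / 2600 * 1 := by gcongr; exacts [Real.pi_lt_four.le, (div_le_one hp).mpr hp2]
      _ ≤ _ := by norm_num
  have mbX : mb ≤ 4 * H := by linarith only [m1, m2, hp1]
  have maX : ma ≤ 2 * H := by linarith only [m1, hp1]
  have hHH : 0 ≤ H * H := by positivity
  have hNm : mb ^ 2 ≤ N := by
    calc mb ^ 2 ≤ (4 * H) ^ 2 := by gcongr
      _ ≤ _ := by rw [hN]; linarith only [hHH]
  have hNY : 4 * mb ^ 2 / Y0 ≤ N := by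
    rw [div_le_iff₀ hY0p]
    have : N * Y0 = 10 ^ 5 * H ^ 2 * j * ma / (2 * Real.pi * r0) := by rw [hN, hY0]; ring
    rw [this, le_div_iff₀ (by positivity)]
    calc 4 * mb ^ 2 * (2 * Real.pi * r0) ≤ 4 * (2 * ma) ^ 2 * (2 * 4 * (200 * H)) := by gcongr; exact Real.pi_lt_four.le
      _ = 25600 * H * ma * ma := by ring
      _ ≤ 25600 * H * (2 * H) * ma := by gcongr
      _ ≤ 10 ^ 5 * H ^ 2 * 6 * ma := by
        have : 0 ≤ H ^ 2 * ma := by positivity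
        linarith only [this]
      _ ≤ _ := by gcongr
  have hNf : 2 * mb * fa ≤ N := by
    calc 2 * mb * fa ≤ 2 * (4 * H) * H := by gcongr
      _ ≤ _ := by rw [hN]; linarith only [hHH]
  have hN0 : r0 ≤ N := by rw [hN]; linarith only [h4, hH2, hp]
  exact ⟨hY0p, hLp, hδp, hδL, hLY, hδf, hNm, hNY, hNf, hN0⟩

section
variable {j : ℕ} {a : ℕ → ℂ} {F : ℍ → ℂ} {B : ℝ} (E : ED j a F B) {f σ : ℤ} {X Z r0 : ℝ} {ma mb : ℕ} {J : Finset ℕ} {m0 n0 : ℕ} (b : Bx j f σ X Z r0 ma mb J m0 n0)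
  {κs T N : ℝ} {g : ℝ → ℂ} (hκ : 0 ≤ κs) (hg0 : ∀ x, ‖g x‖ ≤ κs) (hg1 : ∀ x y, ‖g x - g y‖ ≤ κs * (Z / X) * |x - y|)
  (hN : N = 10 ^ 5 * (X + |(f:ℝ)|) ^ 2) (hT : ∀ n : ℕ, 1 ≤ n → (n.divisors.card : ℝ) ≤ T * (1 + n / N)) (hT1 : 1 ≤ T) (hTl : 1 + Real.log N ≤ T)
  {α β : ℕ → ℂ} (hα : ∀ m, ‖α m‖ ≤ 1) (hβ : ∀ m, ‖β m‖ ≤ 1) (hα2 : ∀ m, ¬ Squarefree m → α m = 0)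
include E b hκ hg0 hN hT hT1 hTl hα hβ hα2

lemma box_both : ‖∑ m ∈ Finset.Icc ma mb, ∑ n ∈ J, α m * β n * (g (m * n) * heckeLambda (2 * j) a (σ * m * n + f))‖ ^ 2 ≤ 2 ^ 40 * κs ^ 2 * T * (j:ℝ) ^ 6 * (X + |(f:ℝ)|) * X ∧
    ((∀ x y, ‖g x - g y‖ ≤ κs * (Z / X) * |x - y|) → ∀ ξ : ℝ, 0 ≤ ξ → ξ ^ 8 = X → ‖∑ m ∈ Finset.Icc ma mb, ∑ n ∈ J, α m * β n * (g (m * n) * heckeLambda (2 * j) a (σ * m * n + f))‖ ^ 2 ≤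
      2 ^ 70 * κs ^ 2 * T ^ 7 * (j:ℝ) ^ 8 * (1 + |(f:ℝ)| / X) ^ 5 * (X / ma * ((ξ ^ 2) ^ 4 + (ξ ^ 2) ^ 2 * √√ma ^ 10 + (ξ ^ 2) ^ 3 * √√ma ^ 7))) := by
  have hr := b.r0pos
  have hX := b.hX
  have hZ := b.hZ
  have h4 := b.h4
  have hj : (6:ℝ) ≤ j := by exact_mod_cast b.hj
  obtain ⟨m1, m2, m3, m4⟩ := b.mX
  have pi3 := Real.pi_gt_three
  have hp : 0 < X + |(f:ℝ)| := by positivity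
  have hp1 : X ≤ X + |(f:ℝ)| := le_add_of_nonneg_right (abs_nonneg _)
  have hp2 : |(f:ℝ)| ≤ X + |(f:ℝ)| := le_add_of_nonneg_left (by linarith only [hX])
  obtain ⟨e1, e2, e3⟩ := b.eta
  set H := X + |(f:ℝ)| with hH
  obtain ⟨Y0, hY0⟩ : ∃ y, y = j * ma / (2 * Real.pi * r0) := ⟨_, rfl⟩
  obtain ⟨L, hL⟩ : ∃ y, y = Y0 / (2 * j) := ⟨_, rfl⟩
  obtain ⟨δ, hδ⟩ : ∃ y, y = ma / (2600 * H) := ⟨_, rfl⟩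
  have hwn : ∀ n ∈ J, 1 / (500 * (1 + |(f:ℝ)| / X)) ^ 2 ≤ wn δ (σ * n) := fun n hn => by rw [hδ]; exact b.wnb hn
  clear_value H
  obtain ⟨hY0p, hLp, hδp, hδL, hLY, hδf, hNm, hNY, hNf, hN0⟩ := nums hj hr h4 hX hp1 hp2 (abs_nonneg _) m1 m2 m4 mb.cast_nonneg hY0 hL hδ hN
  have hmb : (mb:ℝ) ≤ ma * (1 + 1 / (32 * j)) := b.hmb.trans (by gcongr)
  have BI : ∀ α' : ℕ → ℂ, (∀ m, ‖α' m‖ ≤ 1) → (∀ m, ¬ Squarefree m → α' m = 0) → _ := fun α' h1 h2 =>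
    box_int E f b.hf ma mb b.hma hmb r0 Y0 L δ N T hr hY0 hL hδp.le hδL hδf hT hT1 hTl hN0 hNm hNY hNf α' h1 h2 m3
  have hmY : (ma:ℝ) / Y0 = 2 * Real.pi * r0 / j := by rw [hY0]; field_simp
  rw [hmY] at BI
  have hVA := VA E hr
  set V := Real.exp (j + 2 - (j - 1 / 2) * Real.log r0) with hV
  set A0 := (2 * Real.pi * r0 / j) ^ (2 * j) * B ^ 2 with hA0
  have hA0p : 0 < A0 := by have := E.Bpos; positivity
  have hVp : 0 < V := Real.exp_pos _
  have hz : ∀ Y ∈ Set.Icc Y0 (Y0 + L), ∀ m ∈ Finset.Icc ma mb, ∀ n ∈ J, g (m * n) * heckeLambda (2 * j) a (σ * m * n + f) = ct a f Y m (σ * n) * Wf g σ f j Y m n :=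
    fun Y _ m hm n hn => Wf_eq g σ f j a Y m n (b.rpos hm hn)
  have hW0 : ∀ Y ∈ Set.Icc Y0 (Y0 + L), ∀ m ∈ Finset.Icc ma mb, ∀ n ∈ J, ‖Wf g σ f j Y m n‖ ≤ κs * V :=
    fun Y hY m hm n hn => Wf_bd b.hj (X := X) (Z := Z) n hκ hg0 hr (b.rn hm hn) b.hma (Finset.mem_Icc.mp hm).1 (b.Yb hY0 hL hY).1 (b.Yb hY0 hL hY).2
  have hW1 : (∀ x y, ‖g x - g y‖ ≤ κs * (Z / X) * |x - y|) → ∀ Y ∈ Set.Icc Y0 (Y0 + L), ∀ m ∈ Finset.Ico ma mb, ∀ n ∈ J, ‖Wf g σ f j Y m n - Wf g σ f j Y (m + 1) n‖ ≤ κs * V * (700 * j * Z * (1 + |(f:ℝ)| / X) / ma) := by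
    intro hg1 Y hY m hm n hn
    have hm1 := Finset.mem_Ico.mp hm
    exact Wf_diff b.hσ b.hj hX hZ hκ hg0 hg1 b.h3 (b.rn (Finset.mem_Icc.mpr ⟨hm1.1, hm1.2.le⟩) hn) (b.rn (Finset.mem_Icc.mpr ⟨by omega, hm1.2⟩) hn) b.hma hm1.1 (b.Yb hY0 hL hY).1 (b.Yb hY0 hL hY).2 (b.mn hn).2
  clear_value V A0
  have hcJ := b.cardJ
  have hYm : Y0 ∈ Set.Icc Y0 (Y0 + L) := ⟨le_rfl, by linarith only [hLp]⟩
  constructor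
  · have hD := (BI α hα hα2).1 0 (by simp [SS]) Y0 hYm
    simp only [Int.cast_zero, zero_mul, sub_zero] at hD
    have h := box_triv E f ma mb b.hma J b.hJ1 σ b.hσ Y0 (128 * T * A0) (κs * V) hY0p (by positivity) α β hα hβ hD _ _ (hz Y0 hYm) (hW0 Y0 hYm)
    have h2 := pow_le_pow_left₀ (norm_nonneg _) h 2
    refine h2.trans ?_
    have hcI : ((Finset.Icc ma mb).card : ℝ) ≤ 2 * ma := by
      refine le_trans ?_ m2
      have : (Finset.Icc ma mb).card ≤ mb := by rw [Nat.card_Icc]; have := b.hma; omega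
      exact_mod_cast this
    exact calcB hκ hT1 (by linarith only [hX]) (by linarith only [m4]) hA0p.le j.cast_nonneg hp.le (Nat.cast_nonneg _) hcI (Nat.cast_nonneg _) hcJ hVA h4
  · intro hg1 ξ hξ hξX
    replace hW1 := hW1 hg1
    set φ := 1 + |(f:ℝ)| / X with hφ
    have hφ1 : 1 ≤ φ := by rw [hφ]; exact le_add_of_nonneg_right (by positivity)
    have hHφ : H = φ * X := by rw [hφ, hH]; field_simp
    set P := 1 + j * √Y0 * (ma:ℝ) ^ 2 * (1 + 1 / (√√Y0 * √ma)) with hP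
    have hPp : 0 < P := by positivity
    set U1 := κs * V * (700 * j * Z * φ / ma) with hU1
    have hU0 : 0 ≤ κs * V := by positivity
    have hU1p : 0 ≤ U1 := by positivity
    clear_value P U1 φ
    have h := box_abs E f ma mb b.hma m3 J ⟨n0, b.hn0⟩ σ b.hσ Y0 L δ (2 ^ 20 * T ^ 7 * A0 * P) (1 / (500 * φ) ^ 2) (κs * V) U1 hLp hδp.le (by linarith only [hδL, hLY]) (by positivity) (by positivity) hU0 hU1p
      hwn α β hα hβ hα2 (fun α' h1 h2 => (BI α' h1 h2).2) _ _ hz hW0 hW1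
    have h2 := pow_le_pow_left₀ (norm_nonneg _) h 2
    refine h2.trans ?_
    have hrP := rP (j := j) (r0 := r0) (ma := ma) (Y0 := Y0) (x := ξ ^ 2) (Φ := 200 * φ) (by linarith only [hj]) hr (by linarith only [m4]) hY0p
      (by rw [hY0]
          rw [show (j:ℝ) * ma / (2 * Real.pi * r0) * r0 = j * ma / (2 * Real.pi) by field_simp]
          exact div_le_self (by positivity) (by linarith only [pi3])) (by positivity) (by linarith only [hφ1])
      (by rw [← pow_mul, hξX, mul_assoc, ← hHφ]; exact h4)
    rw [← hP] at hrP
    set G := (ξ ^ 2) ^ 4 + (ξ ^ 2) ^ 2 * √√(ma:ℝ) ^ 10 + (ξ ^ 2) ^ 3 * √√(ma:ℝ) ^ 7 with hG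
    have hG0 : 0 ≤ G := by positivity
    obtain ⟨hu, hum⟩ := uu hκ hVp.le hφ1 (by linarith only [hZ]) (by linarith only [hj]) (by linarith only [m4]) (Nat.cast_le.mpr m3) b.hmb hU1
    exact calcA hum hu hκ hT1 (by linarith only [hX]) (by linarith only [m4]) hφ1 hA0p.le j.cast_nonneg hPp.le (Nat.cast_nonneg _) hcJ hVA hrP hG0

end

open MeasureTheory UpperHalfPlane ComplexConjugate

lemma comb {S κs T j φ X H ma ξ μ ν : ℝ} (hκ : 0 ≤ κs) (hT : 1 ≤ T) (hj : 1 ≤ j) (hφ : 1 ≤ φ) (hX : 0 < X) (hH : H = φ * X) (hma : 0 < ma) (hξ : 0 ≤ ξ) (hξX : ξ ^ 8 = X) (hμ : 0 ≤ μ) (hμm : ma ≤ μ ^ 8) (hν : 0 ≤ ν) (hνm : X ^ 2 / ma ≤ ν ^ 2)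
    (hB : S ^ 2 ≤ 2 ^ 40 * κs ^ 2 * T * j ^ 6 * H * X)
    (hA : S ^ 2 ≤ 2 ^ 70 * κs ^ 2 * T ^ 7 * j ^ 8 * φ ^ 5 * (X / ma * ((ξ ^ 2) ^ 4 + (ξ ^ 2) ^ 2 * √√ma ^ 10 + (ξ ^ 2) ^ 3 * √√ma ^ 7))) :
    S ≤ 2 ^ 40 * κs * φ ^ 3 * T ^ 4 * j ^ 4 * (ν + μ ^ 3 * ξ ^ 7) := by
  set R := ν + μ ^ 3 * ξ ^ 7 with hR
  have hR0 : 0 ≤ R := by positivity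
  have hR1 : μ ^ 3 * ξ ^ 7 ≤ R := le_add_of_nonneg_left hν
  have hR2 : ν ≤ R := le_add_of_nonneg_right (by positivity)
  refine le_of_sq_le_sq ?_ (by positivity)
  have main : ∀ G, 0 ≤ G → G ≤ 3 * R ^ 2 → S ^ 2 ≤ 2 ^ 70 * κs ^ 2 * T ^ 7 * j ^ 8 * φ ^ 5 * G → S ^ 2 ≤ (2 ^ 40 * κs * φ ^ 3 * T ^ 4 * j ^ 4 * R) ^ 2 := by
    intro G hG0 hG h
    calc S ^ 2 ≤ 2 ^ 70 * κs ^ 2 * T ^ 7 * j ^ 8 * φ ^ 5 * G := h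
      _ = 2 ^ 70 * (κs ^ 2 * j ^ 8 * (T ^ 7 * (φ ^ 5 * G))) := by ring
      _ ≤ 2 ^ 70 * (κs ^ 2 * j ^ 8 * (T ^ 8 * (φ ^ 6 * (3 * R ^ 2)))) := by
        refine mul_le_mul_of_nonneg_left ?_ (by positivity)
        have := pow_le_pow_right₀ hT (by norm_num : 7 ≤ 8)
        have := pow_le_pow_right₀ hφ (by norm_num : 5 ≤ 6)
        gcongr
      _ = 3 * 2 ^ 70 * (κs ^ 2 * T ^ 8 * j ^ 8 * φ ^ 6 * R ^ 2) := by ring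
      _ ≤ 2 ^ 80 * (κs ^ 2 * T ^ 8 * j ^ 8 * φ ^ 6 * R ^ 2) := by gcongr; norm_num
      _ = _ := by ring
  rcases le_total (μ ^ 3) ξ with h | h
  · refine main _ (by positivity) ?_ hA
    set y := √√ma with hy
    have hy0 : 0 < y := Real.sqrt_pos.mpr (Real.sqrt_pos.mpr hma)
    have hy4 : y ^ 4 = ma := by
      rw [show y ^ 4 = (y ^ 2) ^ 2 by ring, hy, Real.sq_sqrt (Real.sqrt_nonneg _), Real.sq_sqrt hma.le]
    have hyμ : y ≤ μ ^ 2 := by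
      refine le_of_not_gt fun h => ?_
      have := pow_lt_pow_left₀ h (by positivity) (n := 4) (by norm_num)
      rw [hy4, ← pow_mul] at this
      exact absurd hμm (not_le.mpr this)
    have e : X / ma * ((ξ ^ 2) ^ 4 + (ξ ^ 2) ^ 2 * y ^ 10 + (ξ ^ 2) ^ 3 * y ^ 7) = X ^ 2 / ma + (ξ ^ 12 * y ^ 6 + ξ ^ 14 * y ^ 3) := by
      rw [← hy4, ← hξX]; field_simp; ring
    rw [e]
    have hr : (μ ^ 3 * ξ ^ 7) ^ 2 ≤ R ^ 2 := by gcongr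
    have a1 : ξ ^ 12 * y ^ 6 ≤ R ^ 2 := by
      calc ξ ^ 12 * y ^ 6 ≤ ξ ^ 12 * (μ ^ 2) ^ 6 := by gcongr
        _ = ξ ^ 12 * μ ^ 6 * (μ ^ 3) ^ 2 := by ring
        _ ≤ ξ ^ 12 * μ ^ 6 * ξ ^ 2 := by gcongr
        _ = (μ ^ 3 * ξ ^ 7) ^ 2 := by ring
        _ ≤ _ := hr
    have a2 : ξ ^ 14 * y ^ 3 ≤ R ^ 2 := by
      calc ξ ^ 14 * y ^ 3 ≤ ξ ^ 14 * (μ ^ 2) ^ 3 := by gcongr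
        _ = (μ ^ 3 * ξ ^ 7) ^ 2 := by ring
        _ ≤ _ := hr
    have a3 : ν ^ 2 ≤ R ^ 2 := by gcongr
    linarith only [a1, a2, a3, hνm]
  · have hXR : X ≤ R := by
      calc X = ξ * ξ ^ 7 := by rw [← hξX]; ring
        _ ≤ μ ^ 3 * ξ ^ 7 := by gcongr
        _ ≤ R := hR1
    refine main (X ^ 2) (by positivity) ?_ (hB.trans ?_)
    · have : X ^ 2 ≤ R ^ 2 := by gcongr
      have : 0 ≤ R ^ 2 := by positivity
      linarith only [this, ‹X ^ 2 ≤ R ^ 2›]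
    · rw [hH]
      have t1 := pow_le_pow_right₀ hT (by norm_num : 1 ≤ 7)
      have t2 := pow_le_pow_right₀ hφ (by norm_num : 1 ≤ 5)
      have t3 := pow_le_pow_right₀ hj (by norm_num : 6 ≤ 8)
      calc 2 ^ 40 * κs ^ 2 * T * j ^ 6 * (φ * X) * X = 2 ^ 40 * (κs ^ 2 * X ^ 2 * (T ^ 1 * (j ^ 6 * φ ^ 1))) := by ring
        _ ≤ 2 ^ 70 * (κs ^ 2 * X ^ 2 * (T ^ 7 * (j ^ 8 * φ ^ 5))) := by
          refine mul_le_mul (by norm_num) ?_ (by positivity) (by positivity)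
          gcongr
        _ = _ := by ring

/-- the block sums: dyadic style keys. -/
noncomputable def ky (η : ℝ) (n : ℕ) : ℕ := ⌊Real.log n / η⌋₊

lemma ky_close {η : ℝ} (hη : 0 < η) (hη1 : η ≤ 1 / 2) {m n : ℕ} (hm : 1 ≤ m) (hn : 1 ≤ n) (h : ky η m = ky η n) : (m:ℝ) ≤ n * (1 + 2 * η) := by
  have hm' : (0:ℝ) < m := by exact_mod_cast hm
  have hn' : (1:ℝ) ≤ n := by exact_mod_cast hn
  have h1 := Nat.lt_floor_add_one (Real.log m / η)
  have h2 := Nat.floor_le (div_nonneg (Real.log_nonneg hn') hη.le)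
  rw [ky, ky] at h
  rw [h] at h1
  have h3 : Real.log m / η < Real.log n / η + 1 := by linarith only [h1, h2]
  have h4 : Real.log m < Real.log n + η := by
    have := mul_lt_mul_of_pos_right h3 hη
    rwa [add_mul, div_mul_cancel₀ _ hη.ne', div_mul_cancel₀ _ hη.ne', one_mul] at this
  have h5 : (m:ℝ) ≤ n * Real.exp η := by
    rw [← Real.exp_log hm', ← Real.exp_log (by linarith only [hn'] : (0:ℝ) < n), ← Real.exp_add]
    exact Real.exp_le_exp.mpr h4.le
  refine h5.trans ?_
  gcongr
  have := Real.exp_bound_div_one_sub_of_interval hη.le (by linarith only [hη1])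
  refine this.trans ?_
  rw [div_le_iff₀ (by linarith only [hη1])]
  have : η * η ≤ η * (1 / 2) := by gcongr
  linarith only [this]

lemma ky_mono {η : ℝ} (hη : 0 < η) {m n : ℕ} (hm : 1 ≤ m) (h : m ≤ n) : ky η m ≤ ky η n := by
  have hm' : (0:ℝ) < m := by exact_mod_cast hm
  exact Nat.floor_mono (div_le_div_of_nonneg_right (Real.log_le_log hm' (by exact_mod_cast h)) hη.le)

lemma T_exists (e : ℝ) (he : 0 < e) (he1 : e ≤ 1) : ∃ C : ℝ, 1 ≤ C ∧ ∀ X fa : ℝ, 1 ≤ X → 1 ≤ fa →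
    (∀ n : ℕ, 1 ≤ n → (n.divisors.card : ℝ) ≤ C * (X * fa) ^ e * (1 + n / (10 ^ 5 * (X + fa) ^ 2))) ∧ 1 ≤ C * (X * fa) ^ e ∧ 1 + Real.log (10 ^ 5 * (X + fa) ^ 2) ≤ C * (X * fa) ^ e := by
  obtain ⟨C1, hC1, hτ⟩ := tau_bound (e / 2) (by positivity)
  refine ⟨4 * 10 ^ 5 * (C1 + 1 / (e / 2) + 1), by have : 0 < 1 / (e / 2) := by positivity
                                                  linarith, ?_⟩
  intro X fa hX hfa
  set P := X * fa with hP
  have hP1 : 1 ≤ P := one_le_mul_of_one_le_of_one_le hX hfa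
  set N := 10 ^ 5 * (X + fa) ^ 2 with hN
  have hNp : 0 < N := by positivity
  have hXP : X ≤ P := le_mul_of_one_le_right (by linarith) hfa
  have hfP : fa ≤ P := le_mul_of_one_le_left (by linarith) hX
  have hNP : N ≤ 4 * 10 ^ 5 * P ^ 2 := by
    calc N ≤ 10 ^ 5 * (P + P) ^ 2 := by rw [hN]; gcongr
      _ = _ := by ring
  have hNe : N ^ (e / 2) ≤ 4 * 10 ^ 5 * P ^ e := by
    calc N ^ (e / 2) ≤ (4 * 10 ^ 5 * P ^ 2) ^ (e / 2) := by gcongr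
      _ = (4 * 10 ^ 5 : ℝ) ^ (e / 2) * P ^ e := by
        rw [Real.mul_rpow (by positivity) (by positivity), ← Real.rpow_natCast P 2, ← Real.rpow_mul (by linarith)]
        congr 2; push_cast; ring
      _ ≤ (4 * 10 ^ 5 : ℝ) ^ (1:ℝ) * P ^ e := by
        gcongr
        · norm_num
        · linarith
      _ = _ := by rw [Real.rpow_one]
  have hPe : 1 ≤ P ^ e := Real.one_le_rpow hP1 he.le
  have hi : 0 < 1 / (e / 2) := by positivity
  have hT1 : 1 ≤ 4 * 10 ^ 5 * P ^ e := by linarith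
  have e0 : 4 * 10 ^ 5 * (C1 + 1 / (e / 2) + 1) * P ^ e = (C1 + 1 / (e / 2) + 1) * (4 * 10 ^ 5 * P ^ e) := by ring
  rw [e0]
  set D := 4 * 10 ^ 5 * P ^ e with hD
  refine ⟨fun n hn => ?_, ?_, ?_⟩
  · have hn0 : (0:ℝ) ≤ n / N := by positivity
    have h1 : (n:ℝ) ^ (e / 2) = N ^ (e / 2) * (n / N) ^ (e / 2) := by
      rw [← Real.mul_rpow hNp.le hn0]; congr 1; field_simp
    have h2 : ((n:ℝ) / N) ^ (e / 2) ≤ 1 + n / N := by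
      rcases le_total ((n:ℝ) / N) 1 with h | h
      · have := Real.rpow_le_one hn0 h (by positivity : 0 ≤ e / 2)
        linarith
      · have := Real.rpow_le_rpow_of_exponent_le h (by linarith : e / 2 ≤ 1)
        rw [Real.rpow_one] at this
        linarith
    calc (n.divisors.card : ℝ) ≤ C1 * (n:ℝ) ^ (e / 2) := hτ n (by omega)
      _ ≤ C1 * (D * (1 + n / N)) := by rw [h1]; gcongr
      _ = C1 * D * (1 + n / N) := by ring
      _ ≤ _ := by gcongr; linarith
  · have : 1 * 1 ≤ (C1 + 1 / (e / 2) + 1) * D := by gcongr; linarith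
    linarith
  · have h := Real.log_le_rpow_div hNp.le (by positivity : 0 < e / 2)
    have h2 : N ^ (e / 2) / (e / 2) ≤ 1 / (e / 2) * D := by rw [div_eq_mul_one_div, mul_comm]; gcongr
    have h3 : 0 ≤ C1 * D := by positivity
    linarith

lemma box_sum {j : ℕ} {a : ℕ → ℂ} {F : ℍ → ℂ} {B : ℝ} (E : ED j a F B) {f σ : ℤ} {M₁ M₂ X Z Ξ : ℝ} (hf : f ≠ 0) (hσ : σ = 1 ∨ σ = -1) (hM : 1 ≤ M₁) (hM2 : 1 ≤ M₂) (hX : 1 ≤ X) (hZ : 1 ≤ Z)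
  {κs T N : ℝ} {g : ℝ → ℂ} (hκ : 0 ≤ κs) (hg0 : ∀ x, ‖g x‖ ≤ κs) (hg1 : ∀ x y, ‖g x - g y‖ ≤ κs * (Z / X) * |x - y|)
  (hgs : ∀ x : ℝ, g x ≠ 0 → X ≤ x ∧ x ≤ 2 * X) (hΞ : X / (100 * Z) ≤ Ξ) (hΞ2 : Ξ ≤ 100 * (X + |(f : ℝ)|))
  (hgΞ : ∀ x : ℝ, ¬(Ξ ≤ (σ : ℝ) * x + (f : ℝ) ∧ (σ : ℝ) * x + (f : ℝ) ≤ 2 * Ξ) → g x = 0)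
  (hN : N = 10 ^ 5 * (X + |(f:ℝ)|) ^ 2) (hT : ∀ n : ℕ, 1 ≤ n → (n.divisors.card : ℝ) ≤ T * (1 + n / N)) (hT1 : 1 ≤ T) (hTl : 1 + Real.log N ≤ T)
  {α β : ℕ → ℂ} (hα : ∀ m, ‖α m‖ ≤ 1) (hβ : ∀ m, ‖β m‖ ≤ 1) (hα2 : ∀ m, ¬ Squarefree m → α m = 0) (η : ℝ) (hη : η = 1 / (20000 * Z * j)) (A A' : Finset ℕ) (hA : A = Finset.Icc 1 ⌊2 * X⌋₊) (hA' : A' = A.filter fun m : ℕ => M₁ ≤ m ∧ (m:ℝ) ≤ M₂) (p q : ℕ) :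
    ‖∑ m ∈ A' with ky η m = p, ∑ n ∈ A with ky η n = q, α m * β n * (g (m * n) * heckeLambda (2 * j) a (σ * m * n + f))‖ ≤
      2 ^ 40 * κs * (1 + |(f:ℝ)| / X) ^ 3 * T ^ 4 * (j:ℝ) ^ 4 * (M₁ ^ (-(1 : ℝ) / 2) * X + M₂ ^ ((3 : ℝ) / 8) * X ^ ((7 : ℝ) / 8)) := by
  by_cases hne : ∃ m ∈ A'.filter (ky η · = p), ∃ n ∈ A.filter (ky η · = q), g (m * n) ≠ 0
  swap
  · push Not at hne
    rw [Finset.sum_eq_zero fun m hm => Finset.sum_eq_zero fun n hn => by rw [hne m hm n hn]; ring, norm_zero]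
    positivity
  obtain ⟨m0, hm0, n0, hn0, hg⟩ := hne
  have hj : (6:ℝ) ≤ j := by exact_mod_cast E.hj
  have hηp : 0 < η := by rw [hη]; positivity
  have hηZ : η ≤ 1 / 2 := by
    rw [hη]; gcongr
    have : 1 * 6 ≤ Z * j := by gcongr
    linarith only [this]
  have h2η : 1 + 2 * η = 1 + 1 / (10000 * Z * j) := by rw [hη]; field_simp; ring
  have memA : ∀ m ∈ A'.filter (ky η · = p), (1 ≤ m ∧ m ≤ ⌊2 * X⌋₊) ∧ (M₁ ≤ m ∧ (m:ℝ) ≤ M₂) ∧ ky η m = p := by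
    intro m hm
    simp only [hA', hA, Finset.mem_filter, Finset.mem_Icc] at hm
    exact ⟨hm.1.1, hm.1.2, hm.2⟩
  have memJ : ∀ n ∈ A.filter (ky η · = q), 1 ≤ n ∧ ky η n = q := by
    intro n hn
    simp only [hA, Finset.mem_filter, Finset.mem_Icc] at hn
    exact ⟨hn.1.1, hn.2⟩
  set I := A'.filter (ky η · = p) with hI
  set J := A.filter (ky η · = q) with hJ
  have hIne : I.Nonempty := ⟨m0, hm0⟩
  obtain ⟨ma, hma⟩ : ∃ ma, ma = I.min' hIne := ⟨_, rfl⟩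
  obtain ⟨mb, hmb⟩ : ∃ mb, mb = I.max' hIne := ⟨_, rfl⟩
  have ha := memA ma (hma ▸ I.min'_mem hIne)
  have hb := memA mb (hmb ▸ I.max'_mem hIne)
  have hIcc : I = Finset.Icc ma mb := by
    ext m
    constructor
    · intro hm; rw [hma, hmb]; exact Finset.mem_Icc.mpr ⟨I.min'_le m hm, I.le_max' m hm⟩
    · intro hm
      obtain ⟨h1, h2⟩ := Finset.mem_Icc.mp hm
      have h1' : (ma:ℝ) ≤ m := by exact_mod_cast h1
      have h2' : (m:ℝ) ≤ mb := by exact_mod_cast h2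
      simp only [hI, hA', hA, Finset.mem_filter, Finset.mem_Icc]
      exact ⟨⟨⟨ha.1.1.trans h1, h2.trans hb.1.2⟩, ha.2.1.1.trans h1', h2'.trans hb.2.1.2⟩, le_antisymm ((ky_mono hηp (ha.1.1.trans h1) h2).trans hb.2.2.le) (ha.2.2.ge.trans (ky_mono hηp ha.1.1 h1))⟩
  obtain ⟨g1, g2⟩ := hgs _ hg
  have hr : Ξ ≤ (σ : ℝ) * (m0 * n0) + f ∧ (σ : ℝ) * (m0 * n0) + (f : ℝ) ≤ 2 * Ξ := by
    by_contra h; exact hg (hgΞ _ h)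
  have b : Bx j f σ X Z (σ * m0 * n0 + f) ma mb J m0 n0 :=
    { hj := E.hj, hf := hf, hσ := hσ, hX := hX, hZ := hZ, hma := ha.1.1
      hmb := by rw [← h2η]; exact ky_close hηp hηZ hb.1.1 ha.1.1 (hb.2.2.trans ha.2.2.symm)
      hJ1 := fun n hn => (memJ n hn).1
      hJ2 := fun n hn n' hn' => by rw [← h2η]; exact ky_close hηp hηZ (memJ n hn).1 (memJ n' hn').1 ((memJ n hn).2.trans (memJ n' hn').2.symm)
      hm0 := hIcc ▸ hm0, hn0 := hn0, h1 := g1, h2 := g2, hr0 := rfl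
      h3 := by linarith only [hr.1, hΞ]
      h4 := by linarith only [hr.2, hΞ2] }
  have hX0 : 0 < X := by linarith only [hX]
  have hma1 : (1:ℝ) ≤ ma := by exact_mod_cast ha.1.1
  have e1 : ∀ (x : ℝ) (n : ℕ), 0 ≤ x → (x ^ ((1:ℝ) / 8)) ^ n = x ^ ((n:ℝ) / 8) := by
    intro x n hx; rw [← Real.rpow_natCast, ← Real.rpow_mul hx]; congr 1; ring
  have hξ : (X ^ ((1:ℝ) / 8)) ^ 8 = X := by rw [e1 _ _ hX0.le]; norm_num
  obtain ⟨bB, bA⟩ := box_both E b hκ hg0 hN hT hT1 hTl hα hβ hα2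
  rw [hIcc]
  have hM8 : (M₂ ^ ((1:ℝ) / 8)) ^ 8 = M₂ := by rw [e1 _ _ (by linarith only [hM2])]; norm_num
  have hν : (M₁ ^ (-(1:ℝ) / 2)) ^ 2 = M₁⁻¹ := by
    rw [← Real.rpow_natCast, ← Real.rpow_mul (by linarith only [hM]), show -(1:ℝ) / 2 * ((2:ℕ):ℝ) = -1 by norm_num, Real.rpow_neg_one]
  have h := comb hκ hT1 (by linarith only [hj]) (φ := 1 + |(f:ℝ)| / X) (le_add_of_nonneg_right (by positivity)) hX0 (by field_simp) (by linarith only [hma1] : (0:ℝ) < ma) (by positivity) hξ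
    (by positivity : 0 ≤ M₂ ^ ((1:ℝ) / 8)) (by rw [hM8]; exact ha.2.1.2) (by positivity : 0 ≤ M₁ ^ (-(1:ℝ) / 2) * X) (by
      rw [mul_pow, hν, div_eq_inv_mul]
      gcongr; exact ha.2.1.1) bB (bA hg1 _ (by positivity) hξ)
  rw [e1 _ _ hX0.le, e1 _ _ (by linarith only [hM2])] at h
  exact_mod_cast h

open MeasureTheory UpperHalfPlane ComplexConjugate

lemma parts_sum (A A' : Finset ℕ) (κ : ℕ → ℕ) (K0 : ℕ) (h1 : ∀ m ∈ A, κ m < K0) (h2 : ∀ m ∈ A', κ m < K0) (t : ℕ → ℕ → ℂ) (b : ℝ)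
    (hb : ∀ p q, ‖∑ m ∈ A' with κ m = p, ∑ n ∈ A with κ n = q, t m n‖ ≤ b) : ‖∑ m ∈ A', ∑ n ∈ A, t m n‖ ≤ (K0:ℝ) ^ 2 * b := by
  have e : ∑ m ∈ A', ∑ n ∈ A, t m n = ∑ p ∈ Finset.range K0, ∑ q ∈ Finset.range K0, ∑ m ∈ A' with κ m = p, ∑ n ∈ A with κ n = q, t m n := by
    rw [← Finset.sum_fiberwise_of_maps_to (fun m hm => Finset.mem_range.mpr (h2 m hm))]
    refine Finset.sum_congr rfl fun p _ => ?_
    rw [Finset.sum_comm (s := Finset.range K0)]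
    refine Finset.sum_congr rfl fun m _ => ?_
    rw [← Finset.sum_fiberwise_of_maps_to (fun m hm => Finset.mem_range.mpr (h1 m hm))]
  rw [e]
  calc _ ≤ ∑ p ∈ Finset.range K0, ∑ q ∈ Finset.range K0, b := (norm_sum_le _ _).trans (Finset.sum_le_sum fun p _ => (norm_sum_le _ _).trans (Finset.sum_le_sum fun q _ => hb p q))
    _ = _ := by simp only [Finset.sum_const, Finset.card_range, nsmul_eq_mul]; ring

lemma tsum_fin (A A' : Finset ℕ) (P : ℕ → Prop) [DecidablePred P] (hA' : A' = A.filter P) (t : ℕ → ℕ → ℂ) (h : ∀ m n, t m n ≠ 0 → m ∈ A ∧ n ∈ A) :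
    ∑' (m : ℕ) (n : ℕ), (if P m then t m n else 0) = ∑ m ∈ A', ∑ n ∈ A, t m n := by
  have e1 : ∀ m, ∑' n : ℕ, (if P m then t m n else 0) = if P m then ∑ n ∈ A, t m n else 0 := by
    intro m
    split_ifs
    · exact tsum_eq_sum fun n hn => by_contra fun hh => hn (h m n hh).2
    · simp
  simp_rw [e1]
  rw [tsum_eq_sum (s := A), hA', Finset.sum_filter]
  intro m hm
  split_ifs
  · exact Finset.sum_eq_zero fun n _ => by_contra fun hh => hm (h m n hh).1
  · rfl

lemma fin_arith {κs φ T j R Z K0 η C Y k S : ℝ} (hκ : 0 ≤ κs) (hφ : 1 ≤ φ) (hT : 1 ≤ T) (hj : 6 ≤ j) (hR : 0 ≤ R) (hZ : 1 ≤ Z) (hη : η = 1 / (20000 * Z * j)) (h0 : 0 ≤ K0) (hK : K0 ≤ T / η + 1) (hk : k = 2 * j) (hC : 0 ≤ C)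
    (hT6 : T ^ 6 ≤ C ^ 6 * Y) (hS : S ≤ K0 ^ 2 * (2 ^ 40 * κs * φ ^ 3 * T ^ 4 * j ^ 4 * R)) :
    S ≤ 2 ^ 70 * κs * C ^ 6 * Y * k ^ 10 * Z ^ 5 * φ ^ 5 * R := by
  have hT0 : 0 < T := by linarith
  have hK2 : K0 ≤ 2 ^ 15 * Z * j * T := by
    have e : T / η = 20000 * (Z * j * T) := by rw [hη]; field_simp
    have : 1 * 1 * 1 ≤ Z * j * T := by gcongr; linarith
    linarith
  have hk1 : j ^ 6 ≤ k ^ 10 := by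
    calc j ^ 6 ≤ k ^ 6 := by gcongr; linarith
      _ ≤ _ := pow_le_pow_right₀ (by linarith) (by norm_num)
  have hz := pow_le_pow_right₀ hZ (by norm_num : 2 ≤ 5)
  have hp := pow_le_pow_right₀ hφ (by norm_num : 3 ≤ 5)
  have hY : 0 ≤ C ^ 6 * Y := le_trans (by positivity) hT6
  calc S ≤ _ := hS
    _ ≤ (2 ^ 15 * Z * j * T) ^ 2 * (2 ^ 40 * κs * φ ^ 3 * T ^ 4 * j ^ 4 * R) := by gcongr
    _ = 2 ^ 70 * κs * T ^ 6 * j ^ 6 * Z ^ 2 * φ ^ 3 * R := by ring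
    _ ≤ 2 ^ 70 * κs * (C ^ 6 * Y) * k ^ 10 * Z ^ 5 * φ ^ 5 * R := by gcongr
    _ = _ := by ring

lemma T6 {ε e C X fa k : ℝ} (he : 6 * e ≤ ε) (hε : 0 < ε) (hC : 0 ≤ C) (hX : 1 ≤ X) (hf : 1 ≤ fa) (hk : 1 ≤ k) : (C * (X * fa) ^ e) ^ 6 ≤ C ^ 6 * (k * X * fa) ^ ε := by
  have h1 : 1 * 1 ≤ X * fa := by gcongr
  have h2 : 1 * (X * fa) ≤ k * (X * fa) := by gcongr
  rw [mul_pow, ← Real.rpow_natCast ((X * fa) ^ e), ← Real.rpow_mul (by linarith)]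
  gcongr
  calc (X * fa) ^ (e * (6:ℕ)) ≤ (X * fa) ^ ε := Real.rpow_le_rpow_of_exponent_le (by linarith) (by push_cast; linarith)
    _ ≤ _ := Real.rpow_le_rpow (by linarith) (by linarith) hε.le

lemma g_bds {κ : ℕ → ℝ} {X Z : ℝ} {g : ℝ → ℂ} (hX : 1 ≤ X) (hZ : 1 ≤ Z) (hg : ContDiff ℝ (⊤ : ℕ∞) g) (h : ∀ ν : ℕ, ∀ x : ℝ, ‖iteratedDeriv ν g x‖ ≤ κ ν * (X / Z) ^ (-(ν : ℝ))) :
    (∀ x, ‖g x‖ ≤ |κ 0| + |κ 1|) ∧ ∀ x y, ‖g x - g y‖ ≤ (|κ 0| + |κ 1|) * (Z / X) * |x - y| := by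
  constructor
  · intro x
    have := h 0 x
    rw [iteratedDeriv_zero, Nat.cast_zero, neg_zero, Real.rpow_zero, mul_one] at this
    linarith [le_abs_self (κ 0), abs_nonneg (κ 1)]
  · intro x y
    have hd : ∀ x ∈ Set.univ, ‖deriv g x‖ ≤ (|κ 0| + |κ 1|) * (Z / X) := by
      intro x _
      have := h 1 x
      rw [iteratedDeriv_one, Nat.cast_one, Real.rpow_neg_one, inv_div] at this
      refine this.trans ?_
      gcongr
      linarith [le_abs_self (κ 1), abs_nonneg (κ 0)]
    have := convex_univ.norm_image_sub_le_of_norm_deriv_le (fun x _ => (hg.differentiable (by simp)).differentiableAt) hd (Set.mem_univ y) (Set.mem_univ x)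
    rwa [Real.norm_eq_abs] at this

/-- **Bilinear forms in shifted Hecke eigenvalues with a smooth weight**
(Corollary 8.4, level 1). -/
theorem bilinear_shifted_hecke_smooth :
    ∀ ε : ℝ, 0 < ε → ∀ κ : ℕ → ℝ, ∃ K : ℝ,
      ∀ (k : ℕ) (a : ℕ → ℂ), IsNormalizedHeckeEigenform k a →
        ∀ (M₁ M₂ X Z Ξ : ℝ) (f σ : ℤ) (α β : ℕ → ℂ) (g : ℝ → ℂ),
          1 ≤ M₁ → 1 ≤ M₂ → 1 ≤ X → 1 ≤ Z → f ≠ 0 → (σ = 1 ∨ σ = -1) →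
          (∀ m : ℕ, ‖α m‖ ≤ 1) → (∀ n : ℕ, ‖β n‖ ≤ 1) →
          (∀ m : ℕ, ¬Squarefree m → α m = 0) →
          ContDiff ℝ (⊤ : ℕ∞) g →
          (∀ x : ℝ, g x ≠ 0 → X ≤ x ∧ x ≤ 2 * X) →
          (∀ ν : ℕ, ∀ x : ℝ, ‖iteratedDeriv ν g x‖ ≤ κ ν * (X / Z) ^ (-(ν : ℝ))) →
          X / (100 * Z) ≤ Ξ → Ξ ≤ 100 * (X + |(f : ℝ)|) →
          (∀ x : ℝ, ¬(Ξ ≤ (σ : ℝ) * x + (f : ℝ) ∧ (σ : ℝ) * x + (f : ℝ) ≤ 2 * Ξ) →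
            g x = 0) →
          ‖∑' (m : ℕ) (n : ℕ), if M₁ ≤ (m : ℝ) ∧ (m : ℝ) ≤ M₂ then
              α m * β n * g ((m : ℝ) * (n : ℝ)) * heckeLambda k a (σ * m * n + f)
            else 0‖ ≤
            K * ((k : ℝ) * X * |(f : ℝ)|) ^ ε * (k : ℝ) ^ (10 : ℕ) * Z ^ (5 : ℕ) *
              (1 + |(f : ℝ)| / X) ^ (5 : ℕ) *
              (M₁ ^ (-(1 : ℝ) / 2) * X + M₂ ^ ((3 : ℝ) / 8) * X ^ ((7 : ℝ) / 8)) := by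
  intro ε hε κ
  have he : 0 < min ε 1 / 6 := by positivity
  have he6 : 6 * (min ε 1 / 6) ≤ ε := by linarith [min_le_left ε 1]
  obtain ⟨C, hC1, hC⟩ := T_exists (min ε 1 / 6) he (by linarith [min_le_right ε 1])
  set e := min ε 1 / 6
  refine ⟨2 ^ 70 * (|κ 0| + |κ 1|) * C ^ 6, ?_⟩
  intro k a hka M₁ M₂ X Z Ξ f σ α β g hM hM2 hX hZ hf hσ hα hβ hα2 hg hgs hgd hΞ hΞ2 hgΞ
  obtain ⟨j, F, B, rfl, E⟩ := ed_exists k a hka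
  obtain ⟨hg0, hg1⟩ := g_bds hX hZ hg hgd
  have hf1 : (1:ℝ) ≤ |(f:ℝ)| := by exact_mod_cast Int.one_le_abs hf
  obtain ⟨hT, hT1, hTl⟩ := hC X _ hX hf1
  have hj : (6:ℝ) ≤ j := by exact_mod_cast E.hj
  obtain ⟨η, hη⟩ : ∃ η : ℝ, η = 1 / (20000 * Z * j) := ⟨_, rfl⟩
  have hη0 : 0 < η := by rw [hη]; positivity
  have h6 := T6 he6 hε (by linarith only [hC1] : 0 ≤ C) hX hf1 (by push_cast; linarith only [hj] : (1:ℝ) ≤ ((2 * j : ℕ):ℝ))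
  set T := C * (X * |(f:ℝ)|) ^ e with hTdef
  obtain ⟨A, hA⟩ : ∃ A, A = Finset.Icc 1 ⌊2 * X⌋₊ := ⟨_, rfl⟩
  obtain ⟨A', hA'⟩ : ∃ A', A' = A.filter fun m : ℕ => M₁ ≤ m ∧ (m:ℝ) ≤ M₂ := ⟨_, rfl⟩
  have hkey : ∀ m ∈ A, ky η m < ⌊T / η⌋₊ + 1 := by
    intro m hm
    rw [hA, Finset.mem_Icc] at hm
    have hm1 : (1:ℝ) ≤ m := by exact_mod_cast hm.1
    have hm2 : (m:ℝ) ≤ 2 * X := (Nat.cast_le.mpr hm.2).trans (Nat.floor_le (by linarith only [hX]))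
    have : Real.log m ≤ Real.log (10 ^ 5 * (X + |(f:ℝ)|) ^ 2) := Real.log_le_log (by linarith only [hm1]) (by nlinarith only [hm2, hX, hf1])
    exact Nat.lt_succ_of_le (Nat.floor_mono (div_le_div_of_nonneg_right (by linarith only [this, hTl]) hη0.le))
  rw [tsum_fin A A' _ hA' (fun m n => α m * β n * g ((m : ℝ) * (n : ℝ)) * heckeLambda (2 * j) a (σ * m * n + f))]
  · refine fin_arith (add_nonneg (abs_nonneg _) (abs_nonneg _)) (le_add_of_nonneg_right (by positivity)) hT1 hj (by positivity) hZ hη (Nat.cast_nonneg (⌊T / η⌋₊ + 1)) ?_ (by push_cast; rfl) (by linarith only [hC1]) h6 (parts_sum A A' (ky η) _ hkey (fun m hm => hkey m ?_) _ _ fun p q => ?_)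
    · push_cast
      have := Nat.floor_le (by positivity : 0 ≤ T / η)
      linarith only [this]
    · rw [hA'] at hm; exact Finset.mem_of_mem_filter _ hm
    · have := box_sum E hf hσ hM hM2 hX hZ (add_nonneg (abs_nonneg _) (abs_nonneg _)) hg0 hg1 hgs hΞ hΞ2 hgΞ rfl hT hT1 hTl hα hβ hα2 η hη A A' hA hA' p q
      simp only [← mul_assoc] at this ⊢
      exact this
  · intro m n hmn
    have hgn : g ((m:ℝ) * n) ≠ 0 := fun h => hmn (by rw [h]; ring)
    obtain ⟨h1, h2⟩ := hgs _ hgn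
    have hm : 1 ≤ m := by by_contra h; rw [show m = 0 by omega] at h1; norm_num at h1; linarith only [h1, hX]
    have hn : 1 ≤ n := by by_contra h; rw [show n = 0 by omega] at h1; norm_num at h1; linarith only [h1, hX]
    have hmn2 : m * n ≤ ⌊2 * X⌋₊ := Nat.le_floor (by push_cast; exact h2)
    rw [hA, Finset.mem_Icc, Finset.mem_Icc]
    exact ⟨⟨hm, (Nat.le_mul_of_pos_right m hn).trans hmn2⟩, hn, (Nat.le_mul_of_pos_left n hm).trans hmn2⟩
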